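/- There exists 0 < G* < ∞ such that for every G > G* the following holds. Let S⁺ = {(r₀, ξ₀) ∈ (0,∞) × ℝ/2πℤ : G²/r₀³ − r₀·(r₀² + ρ(ξ₀)²/4)^{−3/2} > 0} (the section {y = 0, ẏ > 0}), and let ψ be the Poincaré return map on S⁺: for (r₀, ξ₀) ∈ S⁺ and any representative t₀ ∈ ℝ of ξ₀, ψ(r₀, ξ₀) = (r(t₁), t₁ mod 2π), where r is the maximal solution of the REI3BP with r(t₀) = r₀, r'(t₀) = 0, and t₁ is the smallest time > t₀ with r'(t₁) = 0 and r''(t₁) > 0, ψ being defined on the set of points for which such t₁ exists (this is independent of the representative t₀ by 2π-periodicity of ρ). Then there exists a set S contained in the domain of ψ with ψ(S) = S and a homeomorphism χ : ℕ^ℤ → S (ℕ^ℤ carrying the product topology, S the subspace topology of (0,∞) × ℝ/2πℤ) such that ψ ∘ χ = χ ∘ σ, where σ : ℕ^ℤ → ℕ^ℤ is the shift σ({aₙ}ₙ) = {aₙ₋₁}ₙ. In other words, ψ has a Smale horseshoe with infinitely many symbols. -/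

import Mathlib

open Real Filter

/-- The inverse of Kepler's equation `u ↦ u - sin u`. -/
noncomputable def keplerE : ℝ → ℝ := Function.invFun (fun u : ℝ => u - Real.sin u)

/-- The regularized degenerate Keplerian collision orbit of the primaries. -/
noncomputable def primRho (t : ℝ) : ℝ := 1 - Real.cos (keplerE t)

/-- `r` is a solution of the REI3BP with angular momentum `G` on the set `s`. -/
def IsSolutionOn (G : ℝ) (r : ℝ → ℝ) (s : Set ℝ) : Prop :=
  ∀ t ∈ s, 0 < r t ∧ ContDiffAt ℝ 2 r t ∧
    deriv (deriv r) t =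
      G ^ 2 / r t ^ 3 - r t * (r t ^ 2 + primRho t ^ 2 / 4) ^ (-(3 : ℝ) / 2)

/-- The section `S⁺ = {y = 0, ẏ > 0}` in coordinates `(r₀, ξ₀) ∈ (0,∞) × ℝ/2πℤ`. -/
def SectionPlus (G : ℝ) : Set (ℝ × AddCircle (2 * Real.pi)) :=
  {p | 0 < p.1 ∧ ∀ t : ℝ, (t : AddCircle (2 * Real.pi)) = p.2 →
    0 < G ^ 2 / p.1 ^ 3 - p.1 * (p.1 ^ 2 + primRho t ^ 2 / 4) ^ (-(3 : ℝ) / 2)}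

/-- The graph of the Poincaré return map `ψ` on the section `S⁺`:
`PoincareReturn G p q` holds iff, for a representative `t₀` of the angle of `p`,
the solution of the REI3BP with `r(t₀) = p.1`, `r'(t₀) = 0` returns for the first
time at `t₁ > t₀` to the section `{r' = 0, r'' > 0}` and `q = (r t₁, t₁ mod 2π)`. -/
def PoincareReturn (G : ℝ) (p q : ℝ × AddCircle (2 * Real.pi)) : Prop :=
  ∃ t₀ t₁ : ℝ, ∃ r : ℝ → ℝ,
    (t₀ : AddCircle (2 * Real.pi)) = p.2 ∧ t₀ < t₁ ∧
    (∃ a b : ℝ, a < t₀ ∧ t₁ < b ∧ IsSolutionOn G r (Set.Ioo a b)) ∧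
    r t₀ = p.1 ∧ deriv r t₀ = 0 ∧
    deriv r t₁ = 0 ∧ 0 < deriv (deriv r) t₁ ∧
    (∀ t ∈ Set.Ioo t₀ t₁, ¬(deriv r t = 0 ∧ 0 < deriv (deriv r) t)) ∧
    q = (r t₁, (t₁ : AddCircle (2 * Real.pi)))

open Real Filter

lemma kep_strictMono : StrictMono (fun u : ℝ => u - Real.sin u) := by
  have hmono : Monotone (fun u : ℝ => u - Real.sin u) := by
    apply monotone_of_deriv_nonneg (by fun_prop)
    intro x
    have : HasDerivAt (fun u : ℝ => u - Real.sin u) (1 - Real.cos x) x :=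
      (hasDerivAt_id x).sub (Real.hasDerivAt_sin x)
    rw [this.deriv]; linarith [Real.cos_le_one x]
  intro a b hab
  rcases (hmono hab.le).lt_or_eq with h | h
  · exact h
  · exfalso
    simp only at h
    have h2 : Real.sin b - Real.sin a = b - a := by linarith
    rw [Real.sin_sub_sin] at h2
    have h3 : Real.sin ((b - a) / 2) < (b - a) / 2 := Real.sin_lt (by linarith)
    have h5 : -((b - a) / 2) < Real.sin ((b - a) / 2) := by
      rcases le_total ((b-a)/2) π with hp | hp
      · linarith [Real.sin_nonneg_of_nonneg_of_le_pi (x := (b-a)/2) (by linarith) hp]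
      · linarith [Real.neg_one_le_sin ((b-a)/2), Real.pi_gt_three]
    have h4 := Real.abs_cos_le_one ((b + a) / 2)
    have : |2 * Real.sin ((b - a) / 2) * Real.cos ((b + a) / 2)| < b - a := by
      rw [abs_mul, abs_mul]
      have : |Real.sin ((b - a) / 2)| < (b - a)/2 := abs_lt.2 ⟨h5, h3⟩
      norm_num
      nlinarith [abs_nonneg (Real.sin ((b - a) / 2)), abs_nonneg (Real.cos ((b + a) / 2))]
    rw [h2, abs_of_pos (by linarith)] at this
    exact lt_irrefl _ this

lemma kep_surj : Function.Surjective (fun u : ℝ => u - Real.sin u) := by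
  apply Continuous.surjective (by fun_prop)
  · apply tendsto_atTop_mono (f := fun u : ℝ => u - 1)
    · intro u; linarith [Real.sin_le_one u]
    · exact tendsto_atTop_add_const_right _ _ tendsto_id
  · apply tendsto_atBot_mono (f := fun u : ℝ => u + 1)
    · intro u; linarith [Real.neg_one_le_sin u]
    · exact tendsto_atBot_add_const_right _ _ tendsto_id

lemma kep_spec (t : ℝ) : keplerE t - Real.sin (keplerE t) = t :=
  Function.rightInverse_invFun kep_surj t

lemma kep_eq {u t : ℝ} (h : u - Real.sin u = t) : keplerE t = u :=
  kep_strictMono.injective (by show _ - _ = _ - _; rw [kep_spec, h])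

lemma kepE_strictMono : StrictMono keplerE := by
  intro a b hab
  rw [← kep_strictMono.lt_iff_lt]; simpa [kep_spec] using hab

lemma kepE_cont : Continuous keplerE := by
  have hs : Function.Surjective keplerE := fun u => ⟨_, kep_eq rfl⟩
  exact (kepE_strictMono.orderIsoOfSurjective _ hs).continuous

lemma kepE_neg (t : ℝ) : keplerE (-t) = - keplerE t :=
  kep_eq (by rw [Real.sin_neg]; linarith [kep_spec t])

lemma kepE_per (t : ℝ) : keplerE (t + 2 * π) = keplerE t + 2 * π :=
  kep_eq (by rw [Real.sin_add_two_pi]; linarith [kep_spec t])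

/-- `q = ρ²/4` -/
noncomputable def qq (t : ℝ) : ℝ := primRho t ^ 2 / 4

lemma rho_cont : Continuous primRho := by
  unfold primRho; have := kepE_cont; fun_prop

lemma qq_cont : Continuous qq := by
  unfold qq; have := rho_cont; fun_prop

lemma qq_nonneg (t : ℝ) : 0 ≤ qq t := by unfold qq; positivity

lemma qq_le_one (t : ℝ) : qq t ≤ 1 := by
  unfold qq primRho
  nlinarith [Real.neg_one_le_cos (keplerE t), Real.cos_le_one (keplerE t)]

lemma rho_neg (t : ℝ) : primRho (-t) = primRho t := by
  unfold primRho; rw [kepE_neg, Real.cos_neg]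
lemma rho_per (t : ℝ) : primRho (t + 2 * π) = primRho t := by
  unfold primRho; rw [kepE_per, Real.cos_add_two_pi]
lemma qq_neg (t : ℝ) : qq (-t) = qq t := by unfold qq; rw [rho_neg]
lemma qq_per (t : ℝ) : qq (t + 2 * π) = qq t := by unfold qq; rw [rho_per]
lemma qq_periodic : Function.Periodic qq (2 * π) := qq_per

lemma qq_mono {a b : ℝ} (ha : 0 ≤ a) (hab : a < b) (hb : b ≤ π) : qq a < qq b := by
  have e0 : keplerE 0 = 0 := kep_eq (by simp)
  have e1 : keplerE π = π := kep_eq (by simp)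
  have h0 : 0 ≤ keplerE a := e0 ▸ kepE_strictMono.monotone ha
  have h1 : keplerE b ≤ π := by
    calc keplerE b ≤ keplerE π := kepE_strictMono.monotone hb
      _ = π := e1
  have h := Real.cos_lt_cos_of_nonneg_of_le_pi h0 h1 (kepE_strictMono hab)
  unfold qq primRho
  nlinarith [Real.cos_le_one (keplerE a)]

lemma qq_coef_neg : ∫ s in (-π)..π, qq s * Real.cos s < 0 := by
  have hc : Continuous fun s => qq s * Real.cos s := qq_cont.mul Real.continuous_cos
  have hi : ∀ a b, IntervalIntegrable (fun s => qq s * Real.cos s) MeasureTheory.volume a b :=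
    fun a b => hc.intervalIntegrable a b
  have s1 : ∫ s in (-π)..0, qq s * Real.cos s = ∫ s in (0:ℝ)..π, qq s * Real.cos s := by
    have := intervalIntegral.integral_comp_neg (a := 0) (b := π) (fun s => qq s * Real.cos s)
    simp only [qq_neg, Real.cos_neg, neg_zero] at this
    exact this.symm
  have s2 : ∫ s in (π/2)..π, qq s * Real.cos s
      = ∫ s in (0:ℝ)..(π/2), - (qq (π - s) * Real.cos s) := by
    have := intervalIntegral.integral_comp_sub_left (a := 0) (b := π/2)
      (fun s => qq s * Real.cos s) π
    simp only [Real.cos_pi_sub, sub_zero, mul_neg] at this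
    rw [this]; congr 1; ring
  have hc2 : Continuous fun s => - (qq (π - s) * Real.cos s) := by
    have := qq_cont; fun_prop
  have s3 : ∫ s in (0:ℝ)..π, qq s * Real.cos s
      = ∫ s in (0:ℝ)..(π/2), (qq s * Real.cos s - qq (π - s) * Real.cos s) := by
    rw [← intervalIntegral.integral_add_adjacent_intervals (hi 0 (π/2)) (hi (π/2) π), s2,
      ← intervalIntegral.integral_add (hi _ _) (hc2.intervalIntegrable _ _)]
    congr 1
  have hpos : 0 < ∫ s in (0:ℝ)..(π/2), (qq (π - s) * Real.cos s - qq s * Real.cos s) := by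
    apply intervalIntegral.intervalIntegral_pos_of_pos_on
    · apply Continuous.intervalIntegrable; have := qq_cont; fun_prop
    · intro x hx
      have := qq_mono (a := x) (b := π - x) hx.1.le (by linarith [hx.2]) (by linarith [hx.1])
      have hcx : 0 < Real.cos x := Real.cos_pos_of_mem_Ioo ⟨by linarith [hx.1, Real.pi_pos], hx.2⟩
      nlinarith
    · linarith [Real.pi_pos]
  have hneg : ∫ s in (0:ℝ)..(π/2), (qq s * Real.cos s - qq (π - s) * Real.cos s)
      = - ∫ s in (0:ℝ)..(π/2), (qq (π - s) * Real.cos s - qq s * Real.cos s) := by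
    rw [← intervalIntegral.integral_neg]; congr 1; ext s; ring
  rw [← intervalIntegral.integral_add_adjacent_intervals (hi (-π) 0) (hi 0 π), s1, s3, hneg]
  linarith

open Real Filter

noncomputable def tauA (z : ℂ) : ℂ := z + Complex.exp (Complex.log (1 + z ^ 2) / 2)
noncomputable def tau (z : ℂ) : ℂ :=
  Complex.exp (Complex.log (tauA z) / 3) - Complex.exp (-(Complex.log (tauA z) / 3))

lemma tau_slit {z : ℂ} (hz : |z.im| < 1) : 1 + z ^ 2 ∈ Complex.slitPlane := by
  left
  have : (1 + z ^ 2).re = 1 + z.re ^ 2 - z.im ^ 2 := by simp [pow_two]; ring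
  rw [this]; nlinarith [sq_nonneg z.re, (sq_lt_one_iff_abs_lt_one z.im).2 hz]

lemma tauA_inv {z : ℂ} (hz : |z.im| < 1) :
    0 < (tauA z).re ∧ (tauA z)⁻¹ = tauA z - 2 * z := by
  set S := Complex.exp (Complex.log (1 + z ^ 2) / 2) with hS
  have hS2 : S ^ 2 = 1 + z ^ 2 := by
    rw [hS, ← Complex.exp_nat_mul, show ((2:ℕ):ℂ) * (Complex.log (1 + z ^ 2) / 2)
      = Complex.log (1 + z ^ 2) by push_cast; ring,
      Complex.exp_log (Complex.slitPlane_ne_zero (tau_slit hz))]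
  have hSre : 0 < S.re := by
    rw [hS, Complex.exp_re]
    apply mul_pos (Real.exp_pos _)
    have him : (Complex.log (1 + z ^ 2) / 2).im = (1 + z ^ 2).arg / 2 := by
      rw [show (2:ℂ) = ((2:ℝ):ℂ) by simp, Complex.div_ofReal_im, Complex.log_im]
    rw [him]
    have h1 := Complex.neg_pi_lt_arg (1 + z ^ 2)
    have h2 := (Complex.mem_slitPlane_iff_arg.1 (tau_slit hz)).1
    have h3 := lt_of_le_of_ne (Complex.arg_le_pi (1 + z ^ 2)) h2
    apply Real.cos_pos_of_mem_Ioo; constructor <;> linarith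
  have hA : tauA z = z + S := rfl
  have hm : tauA z * (S - z) = 1 := by rw [hA]; linear_combination hS2
  have hne : tauA z ≠ 0 := left_ne_zero_of_mul_eq_one hm
  have hinv : (tauA z)⁻¹ = S - z := inv_eq_of_mul_eq_one_right hm
  refine ⟨?_, by rw [hinv, hA]; ring⟩
  have h1 : (tauA z).re + ((tauA z)⁻¹).re = 2 * S.re := by
    rw [hinv, hA]; simp; ring
  rw [Complex.inv_re] at h1
  have hn : 0 < Complex.normSq (tauA z) := Complex.normSq_pos.2 hne
  by_contra! hcon
  have : (tauA z).re / Complex.normSq (tauA z) ≤ 0 := div_nonpos_of_nonpos_of_nonneg hcon hn.le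
  linarith

lemma tau_cubic {z : ℂ} (hz : |z.im| < 1) : tau z ^ 3 + 3 * tau z = 2 * z := by
  obtain ⟨h1, h2⟩ := tauA_inv hz
  have hne : tauA z ≠ 0 := by rintro h; rw [h] at h1; simp at h1
  set E := Complex.exp (Complex.log (tauA z) / 3) with hE
  have hE3 : E ^ 3 = tauA z := by
    rw [hE, ← Complex.exp_nat_mul, show ((3:ℕ):ℂ) * (Complex.log (tauA z) / 3)
      = Complex.log (tauA z) by push_cast; ring, Complex.exp_log hne]
  have hE0 : E ≠ 0 := Complex.exp_ne_zero _
  have ht : tau z = E - E⁻¹ := by rw [tau, Complex.exp_neg]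
  have h3 : (E⁻¹) ^ 3 = tauA z - 2 * z := by rw [← h2, ← hE3, inv_pow]
  have h4 : E * E⁻¹ = 1 := mul_inv_cancel₀ hE0
  rw [ht]
  linear_combination hE3 - h3 - 3 * (E - E⁻¹) * h4

lemma tau_im {z : ℂ} (hz : |z.im| < 1) : |(tau z).im| < 1 := by
  obtain ⟨h1, h2⟩ := tauA_inv hz
  have hcub := tau_cubic hz
  set l := (Complex.log (tauA z) / 3).re with hl
  set θ := (Complex.log (tauA z) / 3).im with hθ
  have hLe : Complex.log (tauA z) / 3 = l + θ * Complex.I := (Complex.re_add_im _).symm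
  have hθ' : θ = (tauA z).arg / 3 := by
    rw [hθ, show (3:ℂ) = ((3:ℝ):ℂ) by simp, Complex.div_ofReal_im, Complex.log_im]
  have hb := abs_lt.1 (Complex.abs_arg_lt_pi_div_two_iff.2 (Or.inl h1))
  have hs : Real.sin θ ^ 2 < 1/4 := by
    have e : Real.sin (π/6) = 1/2 := Real.sin_pi_div_six
    have a1 : Real.sin θ < Real.sin (π/6) := by
      apply Real.sin_lt_sin_of_lt_of_le_pi_div_two <;> linarith [Real.pi_pos]
    have a2 : Real.sin (-(π/6)) < Real.sin θ := by
      apply Real.sin_lt_sin_of_lt_of_le_pi_div_two <;> linarith [Real.pi_pos]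
    rw [Real.sin_neg] at a2
    nlinarith
  have hre : (tau z).re = 2 * Real.sinh l * Real.cos θ := by
    rw [tau, Complex.sub_re, Complex.exp_re, Complex.exp_re, Complex.neg_re, Complex.neg_im,
      Real.cos_neg, Real.sinh_eq]; ring
  have him : (tau z).im = 2 * Real.cosh l * Real.sin θ := by
    rw [tau, Complex.sub_im, Complex.exp_im, Complex.exp_im, Complex.neg_re, Complex.neg_im,
      Real.sin_neg, Real.cosh_eq]; ring
  have hz2 : (tau z).im * (3 * (tau z).re ^ 2 + 3 - (tau z).im ^ 2) = 2 * z.im := by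
    have := congrArg Complex.im hcub
    simp [pow_succ] at this
    linarith
  have hc := Real.cosh_sq l
  have hcs := Real.sin_sq_add_cos_sq θ
  set a := (tau z).re; set b := (tau z).im
  set c := Real.cosh l ^ 2
  set s := Real.sin θ ^ 2
  have hb2 : b ^ 2 = 4 * c * s := by rw [him]; ring
  have ha2 : a ^ 2 = 4 * (c - 1) * (1 - s) := by
    rw [hre]
    have : Real.sinh l ^ 2 = c - 1 := by linarith
    have : Real.cos θ ^ 2 = 1 - s := by linarith
    calc _ = 4 * Real.sinh l ^ 2 * Real.cos θ ^ 2 := by ring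
      _ = _ := by rw [‹Real.sinh l ^ 2 = c - 1›, ‹Real.cos θ ^ 2 = 1 - s›]
  by_contra! hcon
  have hb1 : 1 ≤ b ^ 2 := by rw [← sq_abs]; nlinarith
  have hs0 : 0 < s := by
    rcases (sq_nonneg (Real.sin θ)).lt_or_eq with h | h
    · exact h
    · exfalso; have : s = 0 := h.symm
      rw [hb2, this] at hb1; linarith
  have hq : 2 ≤ 3 * a ^ 2 + 3 - b ^ 2 := by
    rw [ha2, hb2]; nlinarith
  have : |b| * (3 * a ^ 2 + 3 - b ^ 2) = 2 * |z.im| := by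
    rw [← abs_of_pos (show 0 < 3 * a ^ 2 + 3 - b ^ 2 by linarith), ← abs_mul, hz2, abs_mul]; norm_num
  nlinarith

lemma cubic_inj {x y : ℂ} (hx : |x.im| < 1) (hy : |y.im| < 1)
    (h : x ^ 3 + 3 * x = y ^ 3 + 3 * y) : x = y := by
  have h1 : (x - y) * (x ^ 2 + x * y + y ^ 2 + 3) = 0 := by linear_combination h
  rcases mul_eq_zero.1 h1 with h2 | h2
  · exact sub_eq_zero.1 h2
  · exfalso
    have h3 := congrArg Complex.re h2
    simp [pow_two] at h3
    have a := abs_lt.1 hx; have b := abs_lt.1 hy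
    nlinarith [sq_nonneg (x.re + y.re), sq_nonneg x.re, sq_nonneg y.re, mul_pos (sub_pos.2 a.2) (sub_pos.2 b.2)]

lemma tau_unique {z t : ℂ} (hz : |z.im| < 1) (ht : |t.im| < 1) (h : t ^ 3 + 3 * t = 2 * z) :
    tau z = t := cubic_inj (tau_im hz) ht (by rw [tau_cubic hz, h])

lemma one_add_sq_ne {t : ℂ} (ht : |t.im| < 1) : 1 + t ^ 2 ≠ 0 := by
  intro h
  have h3 := congrArg Complex.re h
  simp [pow_two] at h3
  have a := abs_lt.1 ht
  nlinarith [sq_nonneg t.re]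

lemma tau_diff {z : ℂ} (hz : |z.im| < 1) : DifferentiableAt ℂ tau z := by
  have h1 : DifferentiableAt ℂ tauA z := by
    unfold tauA
    have : DifferentiableAt ℂ (fun z : ℂ => Complex.log (1 + z ^ 2)) z :=
      (by fun_prop : DifferentiableAt ℂ (fun z : ℂ => 1 + z ^ 2) z).clog (tau_slit hz)
    fun_prop
  have h2 : DifferentiableAt ℂ (fun z => Complex.log (tauA z)) z :=
    h1.clog (Or.inl (tauA_inv hz).1)
  unfold tau
  fun_prop

lemma im_nhds {z : ℂ} {g : ℝ} (hz : |z.im| < g) : ∀ᶠ y : ℂ in nhds z, |y.im| < g :=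
  (Complex.continuous_im.abs.isOpen_preimage _ isOpen_Iio).mem_nhds hz

lemma tau_deriv {z : ℂ} (hz : |z.im| < 1) : HasDerivAt tau (2 / (3 * (1 + tau z ^ 2))) z := by
  have h := (tau_diff hz).hasDerivAt
  have h1 : HasDerivAt (fun z => tau z ^ 3 + 3 * tau z)
      (3 * tau z ^ 2 * deriv tau z + 3 * deriv tau z) z := by
    exact ((h.pow 3).add (h.const_mul 3)).congr_deriv (by norm_num)
  have h2 : HasDerivAt (fun z : ℂ => 2 * z) 2 z := by simpa using (hasDerivAt_id z).const_mul (2:ℂ)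
  have h3 : (fun z => tau z ^ 3 + 3 * tau z) =ᶠ[nhds z] fun z => 2 * z := by
    filter_upwards [im_nhds hz] with y hy using tau_cubic hy
  have h4 := h1.unique (h2.congr_of_eventuallyEq h3)
  have h5 := one_add_sq_ne (tau_im hz)
  have : deriv tau z = 2 / (3 * (1 + tau z ^ 2)) := by
    rw [eq_div_iff (by simpa using h5)]; linear_combination h4
  rwa [this] at h

lemma tau_neg {z : ℂ} (hz : |z.im| < 1) : tau (-z) = - tau z :=
  tau_unique (by simpa) (by simpa using tau_im hz) (by linear_combination -tau_cubic hz)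

lemma tau_conj {z : ℂ} (hz : |z.im| < 1) : tau (starRingEnd ℂ z) = starRingEnd ℂ (tau z) := by
  refine tau_unique (by simpa) (by simpa using tau_im hz) ?_
  have := congrArg (starRingEnd ℂ) (tau_cubic hz)
  simpa [Complex.conj_ofNat] using this

lemma tau_sgn {z : ℂ} (hz : |z.im| < 1) (h0 : 0 ≤ z.im) : 0 ≤ (tau z).im := by
  have := congrArg Complex.im (tau_cubic hz)
  have h2 := abs_lt.1 (tau_im hz)
  simp [pow_succ] at this
  by_contra! h
  nlinarith [sq_nonneg (tau z).re, mul_pos_of_neg_of_neg h h, mul_nonneg (sq_nonneg (tau z).re) (neg_pos.2 h).le]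

/-- main metric facts in upper half strip; `d = |τ - i|`, `h=|τ+2i|` -/
lemma tau_metric {z : ℂ} (hz : |z.im| < 1) (h0 : 0 ≤ z.im) :
    ‖tau z - Complex.I‖ ^ 2 * ‖tau z + 2 * Complex.I‖ = 2 * ‖z - Complex.I‖ ∧
    2 ≤ ‖tau z + 2 * Complex.I‖ ∧ ‖tau z - Complex.I‖ ≤ ‖tau z + 2 * Complex.I‖ ∧
    ‖tau z + 2 * Complex.I‖ ≤ ‖tau z - Complex.I‖ + 3 ∧
    ‖tau z + Complex.I‖ ≤ ‖tau z + 2 * Complex.I‖ ∧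
    ‖tau z + 2 * Complex.I‖ ≤ 2 * ‖tau z + Complex.I‖ ∧
    ‖tau z‖ ≤ ‖tau z + Complex.I‖ ∧ 0 < ‖tau z - Complex.I‖ := by
  have hc := tau_cubic hz
  have hs := tau_sgn hz h0
  have hi := tau_im hz
  set t := tau z
  have hn : ∀ c : ℝ, ‖t + c * Complex.I‖ ^ 2 = t.re ^ 2 + (t.im + c) ^ 2 := by
    intro c; rw [← Complex.normSq_eq_norm_sq, Complex.normSq_apply]; simp; ring
  have n1 := hn 1; have n2 := hn 2; have nm := hn (-1); have n0 := hn 0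
  push_cast at n1 n2 nm n0
  have e1 : t + (1:ℂ) * Complex.I = t + Complex.I := by ring
  have em : t + (-1:ℂ) * Complex.I = t - Complex.I := by ring
  have e0 : t + (0:ℂ) * Complex.I = t := by ring
  rw [e1] at n1; rw [em] at nm; rw [e0] at n0
  have hlt := abs_lt.1 hi
  refine ⟨?_, ?_, ?_, ?_, ?_, ?_, ?_, ?_⟩
  · rw [← norm_pow, ← norm_mul]
    have : (t - Complex.I) ^ 2 * (t + 2 * Complex.I) = 2 * (z - Complex.I) := by
      linear_combination hc + (-3 * t + 2 * Complex.I) * Complex.I_sq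
    rw [this, norm_mul]; norm_num
  · apply le_of_sq_le_sq _ (norm_nonneg _); rw [n2]; nlinarith [sq_nonneg t.re]
  · apply le_of_sq_le_sq _ (norm_nonneg _); rw [n2, nm]; nlinarith
  · calc ‖t + 2 * Complex.I‖ = ‖(t - Complex.I) + 3 * Complex.I‖ := by ring_nf
      _ ≤ ‖t - Complex.I‖ + ‖3 * Complex.I‖ := norm_add_le _ _
      _ = _ := by simp
  · apply le_of_sq_le_sq _ (norm_nonneg _); rw [n2, n1]; nlinarith
  · apply le_of_sq_le_sq _ (by positivity); rw [mul_pow, n2, n1]; nlinarith [sq_nonneg t.re]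
  · apply le_of_sq_le_sq _ (norm_nonneg _); rw [n0, n1]; nlinarith
  · rw [norm_pos_iff]; intro h
    have := congrArg Complex.im h; simp at this; linarith

open Real Filter

noncomputable def Tt (G : ℝ) (v : ℂ) : ℂ := tau (3 * v / G ^ 3)
noncomputable def rh (G : ℝ) (v : ℂ) : ℂ := G ^ 2 * (1 + Tt G v ^ 2) / 2
noncomputable def e1 (G : ℝ) (v : ℂ) : ℂ := 2 / G * (Tt G v / (1 + Tt G v ^ 2))
noncomputable def ph (G : ℝ) (v : ℂ) : ℂ := 4 / G ^ 4 * ((1 - Tt G v ^ 2) / (1 + Tt G v ^ 2) ^ 3)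
noncomputable def nn (t : ℂ) : ℂ := -1 + 3 * t ^ 2 + t ^ 4 + t ^ 6 / 5
noncomputable def kk (t : ℂ) : ℂ :=
  (8 * t + 4 * t ^ 3 + 16 / 5 * t ^ 5 + 4 / 5 * t ^ 7) / (1 - t ^ 2)
noncomputable def zt (G : ℝ) (v u : ℂ) : ℂ :=
  G ^ 4 / 4 * ((nn (Tt G u) - kk (Tt G v) * Tt G u) / (1 + Tt G u ^ 2))
noncomputable def zt1 (G : ℝ) (v u : ℂ) : ℂ :=
  G / 2 * ((8 * Tt G u + 4 * Tt G u ^ 3 + 16 / 5 * Tt G u ^ 5 + 4 / 5 * Tt G u ^ 7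
    - kk (Tt G v) * (1 - Tt G u ^ 2)) / (1 + Tt G u ^ 2) ^ 3)
noncomputable def F0 (G : ℝ) (r : ℂ) : ℂ := G ^ 2 / r ^ 3 - 1 / r ^ 2
noncomputable def F0' (G : ℝ) (r : ℂ) : ℂ := -3 * G ^ 2 / r ^ 4 + 2 / r ^ 3

section
variable {G : ℝ} {u v : ℂ}

lemma zim (hG : 0 < G) (hu : |u.im| < G ^ 3 / 3) : |(3 * u / (G:ℂ) ^ 3).im| < 1 := by
  have : (3 * u / (G:ℂ) ^ 3).im = 3 * u.im / G ^ 3 := by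
    rw [← Complex.ofReal_pow, Complex.div_ofReal_im]; simp
  have h3 : 0 < G ^ 3 := by positivity
  rw [this, abs_div, abs_mul, abs_of_pos h3, div_lt_one h3]; norm_num; linarith

lemma Tt_im (hG : 0 < G) (hu : |u.im| < G ^ 3 / 3) : |(Tt G u).im| < 1 := tau_im (zim hG hu)
lemma Tt_ne (hG : 0 < G) (hu : |u.im| < G ^ 3 / 3) : 1 + Tt G u ^ 2 ≠ 0 :=
  one_add_sq_ne (Tt_im hG hu)

lemma Tt_deriv (hG : 0 < G) (hu : |u.im| < G ^ 3 / 3) :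
    HasDerivAt (Tt G) (2 / (G ^ 3 * (1 + Tt G u ^ 2))) u := by
  have h1 : HasDerivAt (fun u : ℂ => 3 * u / (G:ℂ) ^ 3) (3 / (G:ℂ) ^ 3) u := by
    simpa using ((hasDerivAt_id u).const_mul (3:ℂ)).div_const ((G:ℂ) ^ 3)
  have h2 := (tau_deriv (zim hG hu)).comp u h1
  have hGc : (G:ℂ) ≠ 0 := by exact_mod_cast hG.ne'
  have hne := Tt_ne hG hu
  refine h2.congr_deriv ?_
  change 2 / (3 * (1 + Tt G u ^ 2)) * (3 / (G:ℂ) ^ 3) = _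
  field_simp

lemma rh_ne (hG : 0 < G) (hu : |u.im| < G ^ 3 / 3) : rh G u ≠ 0 := by
  have hGc : (G:ℂ) ≠ 0 := by exact_mod_cast hG.ne'
  unfold rh; simp [hGc, Tt_ne hG hu]

lemma rh_deriv (hG : 0 < G) (hu : |u.im| < G ^ 3 / 3) : HasDerivAt (rh G) (e1 G u) u := by
  have h := Tt_deriv hG hu
  have h2 := (((h.pow 2).const_add 1).const_mul ((G:ℂ) ^ 2)).div_const 2
  have hGc : (G:ℂ) ≠ 0 := by exact_mod_cast hG.ne'
  have hne := Tt_ne hG hu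
  refine h2.congr_deriv ?_
  unfold e1; field_simp; norm_num

lemma e1_deriv (hG : 0 < G) (hu : |u.im| < G ^ 3 / 3) : HasDerivAt (e1 G) (ph G u) u := by
  have h := Tt_deriv hG hu
  have hne := Tt_ne hG hu
  have h2 := ((h.div ((h.pow 2).const_add 1) hne)).const_mul (2 / (G:ℂ))
  have hGc : (G:ℂ) ≠ 0 := by exact_mod_cast hG.ne'
  refine h2.congr_deriv ?_
  unfold ph; simp; field_simp; ring

lemma ph_eq (hG : 0 < G) (hu : |u.im| < G ^ 3 / 3) : ph G u = F0 G (rh G u) := by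
  have hne := Tt_ne hG hu
  have hGc : (G:ℂ) ≠ 0 := by exact_mod_cast hG.ne'
  unfold ph F0 rh; field_simp; ring

lemma F0_deriv {r : ℂ} (hr : r ≠ 0) : HasDerivAt (F0 G) (F0' G r) r := by
  have h3 := ((hasDerivAt_id r).pow 3).fun_inv (pow_ne_zero 3 hr)
  have h2 := ((hasDerivAt_id r).pow 2).fun_inv (pow_ne_zero 2 hr)
  have := (h3.const_mul ((G:ℂ) ^ 2)).sub h2
  have h4 : F0 G = (fun r => (G:ℂ) ^ 2 * (r ^ 3)⁻¹) - fun r => (r ^ 2)⁻¹ := by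
    ext r; simp [F0, div_eq_mul_inv]
  rw [h4]
  refine this.congr_deriv ?_
  unfold F0'; simp; field_simp; ring

lemma ph_deriv (hG : 0 < G) (hu : |u.im| < G ^ 3 / 3) :
    HasDerivAt (ph G) (F0' G (rh G u) * e1 G u) u := by
  have h := (F0_deriv (G := G) (rh_ne hG hu)).comp u (rh_deriv hG hu)
  refine h.congr_of_eventuallyEq ?_
  filter_upwards [im_nhds hu] with y hy using ph_eq hG hy

lemma zt_deriv (hG : 0 < G) (hu : |u.im| < G ^ 3 / 3) : HasDerivAt (zt G v) (zt1 G v u) u := by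
  have h := Tt_deriv hG hu
  have hne := Tt_ne hG hu
  have hGc : (G:ℂ) ≠ 0 := by exact_mod_cast hG.ne'
  have hn : HasDerivAt (fun u => nn (Tt G u)) _ u :=
    (((h.pow 2).const_mul 3).const_add (-1)).add (h.pow 4) |>.add ((h.pow 6).div_const 5)
  have h2 := ((hn.sub (h.const_mul (kk (Tt G v)))).div ((h.pow 2).const_add 1) hne).const_mul
    ((G:ℂ) ^ 4 / 4)
  refine h2.congr_deriv ?_
  unfold zt1 nn; simp; field_simp; ring

lemma zt1_deriv (hG : 0 < G) (hu : |u.im| < G ^ 3 / 3) :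
    HasDerivAt (zt1 G v) (F0' G (rh G u) * zt G v u) u := by
  have h := Tt_deriv hG hu
  have hne := Tt_ne hG hu
  have hGc : (G:ℂ) ≠ 0 := by exact_mod_cast hG.ne'
  have hn : HasDerivAt (fun u => 8 * Tt G u + 4 * Tt G u ^ 3 + 16 / 5 * Tt G u ^ 5
     + 4 / 5 * Tt G u ^ 7 - kk (Tt G v) * (1 - Tt G u ^ 2)) _ u :=
    ((((h.const_mul 8).add ((h.pow 3).const_mul 4)).add ((h.pow 5).const_mul (16/5))).add
      ((h.pow 7).const_mul (4/5))).sub (((h.pow 2).const_sub 1).const_mul (kk (Tt G v)))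
  have h2 := (hn.div (((h.pow 2).const_add 1).pow 3) (pow_ne_zero 3 hne)).const_mul ((G:ℂ) / 2)
  refine h2.congr_deriv ?_
  unfold F0' rh zt nn; simp; field_simp; ring

lemma wronsk (hG : 0 < G) (hu : |u.im| < G ^ 3 / 3) :
    e1 G u * zt1 G v u - ph G u * zt G v u = 1 := by
  have hne := Tt_ne hG hu
  have hGc : (G:ℂ) ≠ 0 := by exact_mod_cast hG.ne'
  unfold e1 zt1 ph zt nn; field_simp; ring

lemma zt1_self (h1 : 1 - Tt G v ^ 2 ≠ 0) : zt1 G v v = 0 := by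
  unfold zt1 kk; field_simp; ring

end

open Real Filter

/-- complex domain -/
def Dom (G : ℝ) : Set ℂ := {v | |v.re| < 12 ∧ |v.im| < G ^ 3 / 3 - 1}
noncomputable def y0 (G : ℝ) (v : ℂ) : ℝ := G ^ 3 / 3 - |v.im|

@[elab_as_elim] lemma conj_cases (P : ℂ → Prop) (h1 : ∀ v, 0 ≤ v.im → P v)
    (h2 : ∀ v, P (starRingEnd ℂ v) → P v) (v : ℂ) : P v := by
  rcases le_total 0 v.im with h | h
  · exact h1 v h
  · exact h2 v (h1 _ (by simpa using h))

section
variable {G : ℝ} {u v : ℂ}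

lemma Dom_im (hv : v ∈ Dom G) : |v.im| < G ^ 3 / 3 := by have := hv.2; linarith
lemma Dom_y0 (hv : v ∈ Dom G) : 1 < y0 G v := by have := hv.2; unfold y0; linarith
lemma Dom_open : IsOpen (Dom G) :=
  (isOpen_lt (f := fun v : ℂ => |v.re|) (Complex.continuous_re.abs) continuous_const).inter
    (isOpen_lt (f := fun v : ℂ => |v.im|) (Complex.continuous_im.abs) continuous_const)
lemma Dom_add (hv : v ∈ Dom G) (s : ℝ) : |(v + s).im| < G ^ 3 / 3 := by
  simpa using Dom_im hv
lemma Dom_conj (hv : v ∈ Dom G) : starRingEnd ℂ v ∈ Dom G := by simpa [Dom] using hv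
lemma y0_conj : y0 G (starRingEnd ℂ v) = y0 G v := by simp [y0]
lemma y0_le : y0 G v ≤ G ^ 3 / 3 := by unfold y0; linarith [abs_nonneg v.im]

lemma Tt_conj (hG : 0 < G) (hu : |u.im| < G ^ 3 / 3) :
    Tt G (starRingEnd ℂ u) = starRingEnd ℂ (Tt G u) := by
  unfold Tt; rw [← tau_conj (zim hG hu)]; simp [Complex.conj_ofNat]
lemma Tt_neg (hG : 0 < G) (hu : |u.im| < G ^ 3 / 3) : Tt G (-u) = - Tt G u := by
  unfold Tt; rw [← tau_neg (zim hG hu)]; congr 1; ring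
lemma rh_conj (hG : 0 < G) (hu : |u.im| < G ^ 3 / 3) :
    rh G (starRingEnd ℂ u) = starRingEnd ℂ (rh G u) := by
  unfold rh; rw [Tt_conj hG hu]; simp [Complex.conj_ofNat]
lemma e1_conj (hG : 0 < G) (hu : |u.im| < G ^ 3 / 3) :
    e1 G (starRingEnd ℂ u) = starRingEnd ℂ (e1 G u) := by
  unfold e1; rw [Tt_conj hG hu]; simp [Complex.conj_ofNat]
lemma ph_conj (hG : 0 < G) (hu : |u.im| < G ^ 3 / 3) :
    ph G (starRingEnd ℂ u) = starRingEnd ℂ (ph G u) := by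
  unfold ph; rw [Tt_conj hG hu]; simp [Complex.conj_ofNat]
lemma zt_conj (hG : 0 < G) (hv : |v.im| < G ^ 3 / 3) (hu : |u.im| < G ^ 3 / 3) :
    zt G (starRingEnd ℂ v) (starRingEnd ℂ u) = starRingEnd ℂ (zt G v u) := by
  unfold zt nn kk; rw [Tt_conj hG hu, Tt_conj hG hv]; simp [Complex.conj_ofNat]
lemma rh_neg (hG : 0 < G) (hu : |u.im| < G ^ 3 / 3) : rh G (-u) = rh G u := by
  unfold rh; rw [Tt_neg hG hu]; ring
lemma e1_neg (hG : 0 < G) (hu : |u.im| < G ^ 3 / 3) : e1 G (-u) = - e1 G u := by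
  unfold e1; rw [Tt_neg hG hu]; ring
lemma ph_neg (hG : 0 < G) (hu : |u.im| < G ^ 3 / 3) : ph G (-u) = ph G u := by
  unfold ph; rw [Tt_neg hG hu]; ring

/-- distance to the singularity, dimensionless -/
noncomputable def mm (G : ℝ) (u : ℂ) : ℝ := ‖3 * u / (G:ℂ) ^ 3 - Complex.I‖

lemma mm_bounds (hG : 0 < G) (hv : v ∈ Dom G) (h0 : 0 ≤ v.im) {s : ℝ} (hs : 0 ≤ s) :
    (y0 G v + s) / 9 ≤ G ^ 3 * mm G (v + s) ∧ G ^ 3 * mm G (v + s) ≤ 39 * (y0 G v + s) := by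
  have hGc : (G:ℂ) ≠ 0 := by exact_mod_cast hG.ne'
  have h3 : (0:ℝ) < G ^ 3 := by positivity
  have e : G ^ 3 * mm G (v + s) = 3 * ‖(v + s) - (G ^ 3 / 3 : ℝ) * Complex.I‖ := by
    unfold mm
    have : (3 * (v + s) / (G:ℂ) ^ 3 - Complex.I)
       = (3 / (G:ℂ) ^ 3) * ((v + s) - (G ^ 3 / 3 : ℝ) * Complex.I) := by
      push_cast; field_simp
    rw [this, norm_mul, norm_div, norm_pow, Complex.norm_real, Real.norm_of_nonneg hG.le]
    field_simp; norm_num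
  rw [e]
  set k := (v + s) - (G ^ 3 / 3 : ℝ) * Complex.I with hk
  have kre : k.re = v.re + s := by simp [hk, -Complex.ofReal_div, -Complex.ofReal_pow]
  have kim : k.im = v.im - G ^ 3 / 3 := by simp [hk, -Complex.ofReal_div, -Complex.ofReal_pow]
  have hy := Dom_y0 hv
  have hyv : y0 G v = -k.im := by rw [kim, y0, abs_of_nonneg h0]; ring
  have a1 := Complex.abs_re_le_norm k
  have a2 := Complex.abs_im_le_norm k
  have a3 := Complex.norm_le_abs_re_add_abs_im k
  have a4 : |k.im| = y0 G v := by rw [hyv, abs_of_neg (by linarith)]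
  rw [a4] at a2 a3
  have hx := abs_lt.1 hv.1
  have a5 := abs_le.1 a1
  have a6 : |k.re| ≤ 12 + s := by rw [kre]; exact abs_le.2 ⟨by linarith, by linarith⟩
  rw [kre] at a5
  constructor <;> linarith

/-- comparison of `d`'s -/
lemma d_comp {d h d' h' m m' : ℝ} (e : d ^ 2 * h = 2 * m) (e' : d' ^ 2 * h' = 2 * m')
    (h1 : 2 ≤ h) (h2 : d ≤ h) (h3 : h' ≤ d' + 3) (hd' : 0 < d') (hd : 0 < d)
    (hm : m ≤ 351 * m') : d ≤ 30 * d' := by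
  by_contra! hcon
  have a : d' ^ 2 * h' ≤ (d/30) ^ 2 * (d/30 + 3) := by
    have : d' ≤ d / 30 := by linarith
    have h5 : 0 ≤ h' := by
      by_contra! hh
      nlinarith [mul_pos (pow_pos hd 2) (by linarith : 0 < h), mul_neg_of_pos_of_neg (pow_pos hd' 2) hh]
    gcongr
    linarith
  have hd2 : 0 < d ^ 2 := by positivity
  nlinarith [mul_le_mul_of_nonneg_left h1 hd2.le, mul_le_mul_of_nonneg_left h2 hd2.le]

/-- package of metric facts -/
lemma Tt_metric (hG : 0 < G) (hu : |u.im| < G ^ 3 / 3) (h0 : 0 ≤ u.im) :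
    ∃ d h : ℝ, d = ‖Tt G u - Complex.I‖ ∧ h = ‖Tt G u + 2 * Complex.I‖ ∧ d ^ 2 * h = 2 * mm G u ∧
     2 ≤ h ∧ d ≤ h ∧ h ≤ d + 3 ∧ 0 < d ∧ ‖Tt G u‖ ≤ h ∧
     d * h / 2 ≤ ‖1 + Tt G u ^ 2‖ ∧ ‖1 + Tt G u ^ 2‖ ≤ d * h ∧ ‖Tt G u‖ * d ≤ ‖1 + Tt G u ^ 2‖ := by
  have hz : 0 ≤ (3 * u / (G:ℂ) ^ 3).im := by
    rw [← Complex.ofReal_pow, Complex.div_ofReal_im]; simp; positivity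
  obtain ⟨m1, m2, m3, m4, m5, m6, m7, m8⟩ := tau_metric (zim hG hu) hz
  have e : ‖1 + Tt G u ^ 2‖ = ‖Tt G u - Complex.I‖ * ‖Tt G u + Complex.I‖ := by
    rw [← norm_mul]; congr 1; linear_combination Complex.I_sq
  refine ⟨_, _, rfl, rfl, m1, m2, m3, m4, m8, m7.trans m5, ?_, ?_, ?_⟩ <;> rw [e] <;>
    simp only [Tt] at * <;> nlinarith

lemma rh_norm (_ : 0 < G) : ‖rh G u‖ = G ^ 2 * ‖1 + Tt G u ^ 2‖ / 2 := by
  unfold rh; simp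

lemma K1 (hG : 0 < G) (hv : v ∈ Dom G) {s : ℝ} (hs : 0 ≤ s) :
    G * (y0 G v + s) / 40 ≤ ‖rh G (v + s)‖ ^ 2 := by
  revert hv; refine conj_cases _ ?_ ?_ v
  · intro v h0 hv
    obtain ⟨d, h, -, -, e, h1, h2, h3, h4, h5, h6, h7, h8⟩ :=
      Tt_metric hG (Dom_add hv s) (by simpa using h0)
    have hm := (mm_bounds hG hv h0 hs).1
    rw [rh_norm hG]
    have : d ^ 2 * h ^ 2 / 4 ≤ ‖1 + Tt G (v + s) ^ 2‖ ^ 2 := by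
      calc d ^ 2 * h ^ 2 / 4 = (d * h / 2) ^ 2 := by ring
        _ ≤ _ := by gcongr
    have h9 : mm G (v + s) ≤ d ^ 2 * h ^ 2 / 4 := by
      nlinarith [mul_le_mul_of_nonneg_left h1 (by positivity : 0 ≤ d ^ 2 * h)]
    calc G * (y0 G v + s) / 40 ≤ G * (G ^ 3 * mm G (v + s)) / 4 := by
          have : 0 < G := hG
          have : 0 ≤ y0 G v + s := by linarith [Dom_y0 hv]
          nlinarith
      _ ≤ G * (G ^ 3 * ‖1 + Tt G (v + s) ^ 2‖ ^ 2) / 4 := by gcongr; linarith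
      _ = _ := by ring
  · intro v h hv
    have := h (Dom_conj hv)
    rw [y0_conj] at this
    rwa [show (starRingEnd ℂ v + (s:ℂ)) = starRingEnd ℂ (v + s) by simp,
      rh_conj hG (Dom_add hv s), RCLike.norm_conj] at this

lemma K2 (hG : 0 < G) (hv : v ∈ Dom G) {s : ℝ} (hs : 0 ≤ s) :
    √G * ((y0 G v + s) ^ 2 * √(y0 G v + s)) / 20000 ≤ ‖rh G (v + s)‖ ^ 4 := by
  revert hv; refine conj_cases _ ?_ ?_ v
  · intro v h0 hv
    obtain ⟨d, h, -, -, e, h1, h2, h3, h4, h5, h6, h7, h8⟩ :=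
      Tt_metric hG (Dom_add hv s) (by simpa using h0)
    have hm := (mm_bounds hG hv h0 hs).1
    rw [rh_norm hG]
    set m := mm G (v + s)
    have hm0 : 0 ≤ m := norm_nonneg _
    set ω := y0 G v + s
    have hω : 0 < ω := by have := Dom_y0 hv; simp only [ω]; linarith
    -- √ω * √G ≤ 3 G^2 h^2
    have k1 : √ω * √G ≤ 3 * G ^ 2 * h ^ 2 := by
      rw [← Real.sqrt_mul hω.le]
      apply Real.sqrt_le_iff.2 ⟨by positivity, ?_⟩
      have : 2 * m ≤ h ^ 3 := by
        rw [← e]; calc d ^ 2 * h ≤ h ^ 2 * h := by gcongr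
          _ = _ := by ring
      have h34 : h ^ 3 ≤ h ^ 4 := by nlinarith [pow_pos (by linarith : 0 < h) 3]
      calc ω * G ≤ 9 * (G ^ 3 * m) * G := by nlinarith
        _ ≤ 9 * (G ^ 3 * (h ^ 4)) * G := by gcongr; linarith
        _ = _ := by ring
    have k2 : G ^ 3 * (2 * m) * h ≤ 4 * (G ^ 3 * ‖1 + Tt G (v + s) ^ 2‖ ^ 2) := by
      rw [← e]
      have : (d * h / 2) ^ 2 ≤ ‖1 + Tt G (v + s) ^ 2‖ ^ 2 := by gcongr
      have h3 : 0 < G ^ 3 := by positivity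
      nlinarith
    have k3 : 2 * ω * h / 9 ≤ 4 * (G ^ 3 * ‖1 + Tt G (v + s) ^ 2‖ ^ 2) := by
      refine le_trans ?_ k2
      nlinarith
    have k4 : (2 * ω * h / 9) ^ 2 ≤ (4 * (G ^ 3 * ‖1 + Tt G (v + s) ^ 2‖ ^ 2)) ^ 2 := by
      gcongr
    calc √G * (ω ^ 2 * √ω) / 20000 = ω ^ 2 * (√ω * √G) / 20000 := by ring
      _ ≤ ω ^ 2 * (3 * G ^ 2 * h ^ 2) / 20000 := by gcongr
      _ ≤ G ^ 2 * (2 * ω * h / 9) ^ 2 / 256 := by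
          have : 0 ≤ ω ^ 2 * G ^ 2 * h ^ 2 := by positivity
          nlinarith
      _ ≤ G ^ 2 * (4 * (G ^ 3 * ‖1 + Tt G (v + s) ^ 2‖ ^ 2)) ^ 2 / 256 := by gcongr
      _ = _ := by ring
  · intro v h hv
    have := h (Dom_conj hv)
    rw [y0_conj] at this
    rwa [show (starRingEnd ℂ v + (s:ℂ)) = starRingEnd ℂ (v + s) by simp,
      rh_conj hG (Dom_add hv s), RCLike.norm_conj] at this

lemma mm_comp (hG : 0 < G) (hv : v ∈ Dom G) (h0 : 0 ≤ v.im) {s s' : ℝ} (hs : 0 ≤ s)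
    (hs' : s ≤ s') : mm G (v + s) ≤ 351 * mm G (v + s') := by
  have a := (mm_bounds hG hv h0 hs).2
  have b := (mm_bounds hG hv h0 (hs.trans hs')).1
  have h3 : 0 < G ^ 3 := by positivity
  by_contra! h
  have := mul_lt_mul_of_pos_left h h3
  linarith

/-- near the imaginary axis -/
lemma Tt_near (hG : 100 ≤ G) (hv : v ∈ Dom G) :
    |(Tt G v).re| ≤ 1/10 ∧ 3/4 ≤ ‖1 - Tt G v ^ 2‖ ∧ ‖Tt G v + 2 * Complex.I‖ ≤ 4
     ∧ ‖Tt G v‖ ≤ 6/5 := by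
  have hG0 : 0 < G := by linarith
  have hc := tau_cubic (zim hG0 (Dom_im hv))
  have hi := abs_lt.1 (Tt_im hG0 (Dom_im hv))
  change Tt G v ^ 3 + 3 * Tt G v = _ at hc
  have hre := congrArg Complex.re hc
  have e1 : (2 * (3 * v / (G:ℂ) ^ 3)).re = 6 * v.re / G ^ 3 := by
    rw [← Complex.ofReal_pow, ← mul_div_assoc, Complex.div_ofReal_re]; simp; ring
  rw [e1] at hre
  simp [pow_succ] at hre
  set a := (Tt G v).re
  set b := (Tt G v).im
  have hG3 : (100:ℝ) ^ 3 ≤ G ^ 3 := by gcongr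
  have h6 : |6 * v.re / (G * G * G)| ≤ 1/1000 := by
    have : (100:ℝ)^3 ≤ G * G * G := by calc _ ≤ G ^ 3 := hG3
                                    _ = _ := by ring
    rw [abs_div, abs_mul, abs_of_pos (by positivity : 0 < G * G * G), div_le_iff₀ (by positivity)]
    have := hv.1
    norm_num; nlinarith
  have h7 : a * (a ^ 2 + 3 * (1 - b ^ 2)) = 6 * v.re / (G * G * G) := by rw [← hre]; ring
  have hb2 : b ^ 2 < 1 := by nlinarith
  have ha : |a| ≤ 1/10 := by
    by_contra! hcon
    rw [← h7, abs_mul, abs_of_nonneg (by nlinarith [sq_nonneg a] : 0 ≤ a ^ 2 + 3 * (1 - b ^ 2)),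
      ← sq_abs a] at h6
    nlinarith [mul_pos (abs_pos.2 (show a ≠ 0 by rintro h; rw [h] at hcon; norm_num at hcon)) (sub_pos.2 hb2), sq_nonneg |a|]
  have ha' := abs_le.1 ha
  refine ⟨ha, ?_, ?_, ?_⟩
  · refine le_trans ?_ (Complex.re_le_norm _)
    simp [pow_two]; nlinarith
  · refine (Complex.norm_le_abs_re_add_abs_im _).trans ?_
    simp
    have : |b + 2| ≤ 3 := abs_le.2 ⟨by linarith, by linarith⟩
    linarith
  · refine (Complex.norm_le_abs_re_add_abs_im _).trans ?_
    have : |b| ≤ 1 := abs_le.2 ⟨by linarith, by linarith⟩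
    linarith

lemma e1_norm_le (hG : 0 < G) (hu : |u.im| < G ^ 3 / 3) {d : ℝ} (hd : 0 < d)
    (h : ‖Tt G u‖ * d ≤ ‖1 + Tt G u ^ 2‖) : ‖e1 G u‖ ≤ 2 / G / d := by
  have hpos : 0 < ‖1 + Tt G u ^ 2‖ := norm_pos_iff.2 (Tt_ne hG hu)
  unfold e1; rw [norm_mul, norm_div, norm_div]
  simp only [Complex.norm_real, Real.norm_of_nonneg hG.le, Complex.norm_ofNat]
  rw [div_eq_mul_inv (2 / G) d]
  gcongr
  rw [div_le_iff₀ hpos, inv_mul_eq_div, le_div_iff₀ hd]; exact h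

lemma K3 (hG : 100 ≤ G) (hv : v ∈ Dom G) {s : ℝ} (hs : 0 ≤ s) :
    ‖e1 G (v + s)‖ * √(y0 G v) ≤ 300 * √G := by
  have hG0 : 0 < G := by linarith
  revert hv; refine conj_cases _ ?_ ?_ v
  · intro v h0 hv
    obtain ⟨d, h, -, -, e, h1, h2, h3, h4, h5, h6, h7, h8⟩ :=
      Tt_metric hG0 (Dom_add hv s) (by simpa using h0)
    obtain ⟨d', h', -, eh, e', h1', h2', h3', h4', -⟩ :=
      Tt_metric hG0 (Dom_im hv) h0
    have hm : mm G v ≤ 351 * mm G (v + s) := by simpa using mm_comp hG0 hv h0 le_rfl hs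
    have hc : d' ≤ 30 * d := d_comp e' e h1' h2' h3 h4 h4' hm
    have hh' : h' ≤ 4 := eh ▸ (Tt_near hG hv).2.2.1
    have hb := (mm_bounds hG0 hv h0 le_rfl).1
    simp only [Complex.ofReal_zero, add_zero] at hb
    have hy : √(y0 G v) ≤ G * √G * (5 * d') := by
      apply Real.sqrt_le_iff.2 ⟨by positivity, ?_⟩
      have : (G * √G * (5 * d')) ^ 2 = 25 * G ^ 3 * d' ^ 2 := by
        rw [mul_pow, mul_pow, Real.sq_sqrt hG0.le]; ring
      rw [this]
      have h3 : 0 < G ^ 3 := by positivity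
      have : 2 * mm G v ≤ 4 * d' ^ 2 := by rw [← e']; nlinarith
      nlinarith
    calc ‖e1 G (v + s)‖ * √(y0 G v) ≤ (2 / G / d) * (G * √G * (5 * (30 * d))) := by
          gcongr
          · exact e1_norm_le hG0 (Dom_add hv s) h4 h8
          · exact hy.trans (by gcongr)
      _ = 300 * √G := by field_simp; norm_num
  · intro v h hv
    have := h (Dom_conj hv)
    rw [y0_conj] at this
    rwa [show (starRingEnd ℂ v + (s:ℂ)) = starRingEnd ℂ (v + s) by simp,
      e1_conj hG0 (Dom_add hv s), RCLike.norm_conj] at this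

set_option maxHeartbeats 1000000 in
lemma K4 (hG : 100 ≤ G) (hv : v ∈ Dom G) {s s' : ℝ} (hs : 0 ≤ s) (hs' : s ≤ s') :
    ‖e1 G (v + s')‖ * ‖zt G v (v + s)‖ ≤ 3 * 10 ^ 10 * (y0 G v + s) := by
  have hG0 : 0 < G := by linarith
  revert hv; refine conj_cases _ ?_ ?_ v
  · intro v h0 hv
    obtain ⟨d, h, ed, eh, e, h1, h2, h3, h4, h5, h6, h7, h8⟩ :=
      Tt_metric hG0 (Dom_add hv s) (by simpa using h0)
    obtain ⟨d1, j1, -, -, e1', -, -, j3, j4, j5, j6, j7, j8⟩ :=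
      Tt_metric hG0 (Dom_add hv s') (by simpa using h0)
    obtain ⟨d', h', ed', eh', e', h1', h2', h3', h4', -⟩ :=
      Tt_metric hG0 (Dom_im hv) h0
    have hm : mm G v ≤ 351 * mm G (v + s) := by simpa using mm_comp hG0 hv h0 le_rfl hs
    have hc : d' ≤ 30 * d := d_comp e' e h1' h2' h3 h4 h4' hm
    have hc1 : d ≤ 30 * d1 := d_comp e e1' h1 h2 j3 j4 h4 (mm_comp hG0 hv h0 hs hs')
    have hb := (mm_bounds hG0 hv h0 hs).2
    obtain ⟨-, n1, -, n2⟩ := Tt_near hG hv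
    set t := Tt G (v + s)
    set t0 := Tt G v
    have hne : 1 - t0 ^ 2 ≠ 0 := by rw [← norm_pos_iff]; linarith
    have hk : kk t0 = 16 * Complex.I / 5 + 4 / 5 * ((t0 - Complex.I) ^ 4
        * (t0 ^ 3 + 4 * Complex.I * t0 ^ 2 - 6 * t0 - 4 * Complex.I)) / (1 - t0 ^ 2) := by
      unfold kk; field_simp
      have I2 := Complex.I_sq
      have I3 : Complex.I ^ 3 = -Complex.I := by rw [pow_succ, I2]; ring
      have I4 : Complex.I ^ 4 = 1 := Complex.I_pow_four
      have I5 : Complex.I ^ 5 = Complex.I := by rw [pow_succ, I4]; ring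
      ring_nf; simp only [I2, I3, I4, I5]; ring
    have hM : nn t - kk t0 * t = (t - Complex.I) ^ 4 * ((t + 2 * Complex.I) ^ 2 - 1) / 5
        - (kk t0 - 16 * Complex.I / 5) * t := by
      unfold nn
      have I2 := Complex.I_sq
      have I3 : Complex.I ^ 3 = -Complex.I := by rw [pow_succ, I2]; ring
      have I4 : Complex.I ^ 4 = 1 := Complex.I_pow_four
      have I5 : Complex.I ^ 5 = Complex.I := by rw [pow_succ, I4]; ring
      have I6 : Complex.I ^ 6 = -1 := by rw [pow_succ, I5, ← I2]; ring
      ring_nf; simp only [I2, I3, I4, I5, I6]; ring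
    have hq : ‖t0 ^ 3 + 4 * Complex.I * t0 ^ 2 - 6 * t0 - 4 * Complex.I‖ ≤ 19 := by
      calc _ ≤ ‖t0‖ ^ 3 + 4 * ‖t0‖ ^ 2 + 6 * ‖t0‖ + 4 := by
            refine (norm_sub_le _ _).trans ?_
            refine add_le_add ((norm_sub_le _ _).trans (add_le_add ((norm_add_le _ _).trans ?_) ?_)) ?_
            all_goals simp
        _ ≤ (6/5) ^ 3 + 4 * (6/5) ^ 2 + 6 * (6/5) + 4 := by gcongr
        _ ≤ 19 := by norm_num
    have hkn : ‖kk t0 - 16 * Complex.I / 5‖ ≤ 21 * d' ^ 4 := by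
      rw [hk, add_sub_cancel_left, norm_div, norm_mul, norm_mul, norm_pow, ← ed',
        div_le_iff₀ (by linarith)]
      norm_num
      have : 0 ≤ d' ^ 4 := by positivity
      nlinarith [mul_le_mul_of_nonneg_left hq this, mul_le_mul_of_nonneg_left n1 this]
    have hMn : ‖nn t - kk t0 * t‖ ≤ 10 ^ 7 * (d ^ 4 * h ^ 2) := by
      rw [hM]
      have z1 : ‖(t + 2 * Complex.I) ^ 2 - 1‖ ≤ 2 * h ^ 2 := by
        refine (norm_sub_le _ _).trans ?_
        rw [norm_pow, ← eh, norm_one]; nlinarith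
      have z2 : d' ^ 4 ≤ (30 * d) ^ 4 := by gcongr
      have z3 : ‖t‖ ≤ h ^ 2 / 2 := by nlinarith
      calc _ ≤ d ^ 4 * (2 * h ^ 2) / 5 + 21 * (30 * d) ^ 4 * (h ^ 2 / 2) := by
            refine (norm_sub_le _ _).trans ?_
            rw [norm_div, norm_mul, norm_mul, norm_pow, ← ed]
            simp only [Complex.norm_ofNat]
            gcongr
            exact hkn.trans (by gcongr)
        _ ≤ _ := by
            have : 0 ≤ d ^ 4 * h ^ 2 := by positivity
            nlinarith
    have hz : ‖zt G v (v + s)‖ ≤ G ^ 4 * 10 ^ 7 * (mm G (v + s) * d) := by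
      have hpos : 0 < ‖1 + t ^ 2‖ := lt_of_lt_of_le (by positivity) h6
      have : ‖zt G v (v + s)‖ = G ^ 4 / 4 * (‖nn t - kk t0 * t‖ / ‖1 + t ^ 2‖) := by
        unfold zt; rw [norm_mul, norm_div]; simp [t, t0, abs_of_pos hG0]
      rw [this]
      have : ‖nn t - kk t0 * t‖ / ‖1 + t ^ 2‖ ≤ 4 * (10 ^ 7 * (mm G (v + s) * d)) := by
        rw [div_le_iff₀ hpos]
        calc _ ≤ 10 ^ 7 * (d ^ 4 * h ^ 2) := hMn
          _ = 4 * (10 ^ 7 * ((d ^ 2 * h / 2) * d)) * (d * h / 2) := by ring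
          _ = 4 * (10 ^ 7 * (mm G (v + s) * d)) * (d * h / 2) := by rw [e]; ring
          _ ≤ _ := by
            have : 0 ≤ mm G (v + s) := norm_nonneg _
            exact mul_le_mul_of_nonneg_left h6 (by positivity)
      calc _ ≤ G ^ 4 / 4 * (4 * (10 ^ 7 * (mm G (v + s) * d))) := by gcongr
        _ = _ := by ring
    calc _ ≤ (2 / G / d1) * (G ^ 4 * 10 ^ 7 * (mm G (v + s) * (30 * d1))) := by
          gcongr
          · exact e1_norm_le hG0 (Dom_add hv s') j4 j8
          · exact hz.trans (by gcongr; exact norm_nonneg _)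
      _ = 60 * 10 ^ 7 * (G ^ 3 * mm G (v + s)) := by field_simp; ring
      _ ≤ 60 * 10 ^ 7 * (39 * (y0 G v + s)) := by gcongr
      _ ≤ _ := by have := Dom_y0 hv; nlinarith
  · intro v h hv
    have := h (Dom_conj hv)
    rw [y0_conj] at this
    rwa [show (starRingEnd ℂ v + (s:ℂ)) = starRingEnd ℂ (v + s) by simp,
      show (starRingEnd ℂ v + (s':ℂ)) = starRingEnd ℂ (v + s') by simp,
      e1_conj hG0 (Dom_add hv s'), zt_conj hG0 (Dom_im hv) (Dom_add hv s), RCLike.norm_conj,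
      RCLike.norm_conj] at this

lemma K5 (hG : 100 ≤ G) (hv : v ∈ Dom G) :
    3 / 8 * G ^ 2 ≤ ‖ph G v‖ * ‖rh G v‖ ^ 3 ∧ ‖rh G v‖ ^ 2 ≤ 100 * G * y0 G v := by
  have hG0 : 0 < G := by linarith
  revert hv; refine conj_cases _ ?_ ?_ v
  · intro v h0 hv
    obtain ⟨-, n1, n3, n2⟩ := Tt_near hG hv
    obtain ⟨d, h, ed, eh, e, h1, h2, h3, h4, h5, h6, h7, h8⟩ :=
      Tt_metric hG0 (Dom_im hv) h0
    have hpos : 0 < ‖1 + Tt G v ^ 2‖ := lt_of_lt_of_le (by positivity) h6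
    have hb := (mm_bounds hG0 hv h0 le_rfl).2
    simp only [Complex.ofReal_zero, add_zero] at hb
    rw [← eh] at n3
    constructor
    · rw [rh_norm hG0]
      have : ‖ph G v‖ = 4 / G ^ 4 * (‖1 - Tt G v ^ 2‖ / ‖1 + Tt G v ^ 2‖ ^ 3) := by
        unfold ph; rw [norm_mul, norm_div, norm_div, norm_pow, norm_pow]; simp [abs_of_pos hG0]
      rw [this]
      have : 4 / G ^ 4 * (‖1 - Tt G v ^ 2‖ / ‖1 + Tt G v ^ 2‖ ^ 3)
        * (G ^ 2 * ‖1 + Tt G v ^ 2‖ / 2) ^ 3 = G ^ 2 / 2 * ‖1 - Tt G v ^ 2‖ := by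
        field_simp; norm_num
      rw [this]; nlinarith [sq_nonneg G]
    · rw [rh_norm hG0]
      calc (G ^ 2 * ‖1 + Tt G v ^ 2‖ / 2) ^ 2 ≤ (G ^ 2 * (d * h) / 2) ^ 2 := by gcongr
        _ = G ^ 4 * (d ^ 2 * h) * h / 4 := by ring
        _ ≤ G ^ 4 * (2 * mm G v) * 4 / 4 := by
          rw [e]; gcongr; exact mul_nonneg (by positivity) (mul_nonneg (by norm_num) (norm_nonneg _))
        _ = 2 * G * (G ^ 3 * mm G v) := by ring
        _ ≤ 2 * G * (39 * y0 G v) := by gcongr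
        _ ≤ _ := by
          have := Dom_y0 hv
          have : 0 < G * y0 G v := by positivity
          nlinarith
  · intro v h hv
    have := h (Dom_conj hv)
    rw [y0_conj] at this
    rwa [rh_conj hG0 (Dom_im hv), ph_conj hG0 (Dom_im hv), RCLike.norm_conj, RCLike.norm_conj] at this
end

open Real Filter

noncomputable def pw (a : ℝ) (w : ℂ) : ℂ := (1 + w) ^ (a : ℂ)
noncomputable def FF (G q : ℝ) (r : ℂ) : ℂ := G ^ 2 / r ^ 3 - 1 / r ^ 2 * pw (-3 / 2) (q / r ^ 2)
noncomputable def FF' (G q : ℝ) (r : ℂ) : ℂ := -3 * G ^ 2 / r ^ 4 +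
  1 / r ^ 3 * (2 * pw (-3 / 2) (q / r ^ 2) - 3 * (q / r ^ 2) * pw (-5 / 2) (q / r ^ 2))
noncomputable def PP (G q : ℝ) (r : ℂ) : ℂ := -G ^ 2 / (2 * r ^ 2) + 1 / r * pw (-1 / 2) (q / r ^ 2)
noncomputable def NN (G q : ℝ) (r x : ℂ) : ℂ := FF G q (r + x) - F0 G r - F0' G r * x

lemma pw_slit {w : ℂ} (hw : ‖w‖ < 1) : 1 + w ∈ Complex.slitPlane := by
  left; have := (abs_le.1 ((Complex.abs_re_le_norm w).trans hw.le)).1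
  have h2 := Complex.abs_re_le_norm w
  simp only [Complex.add_re, Complex.one_re]
  have := (abs_lt.1 (h2.trans_lt hw)).1; linarith

lemma pw_deriv (a : ℝ) {w : ℂ} (hw : ‖w‖ < 1) : HasDerivAt (pw a) (a * pw (a - 1) w) w := by
  have := ((hasDerivAt_id w).const_add 1).cpow_const (c := (a:ℂ)) (pw_slit hw)
  unfold pw; simpa using this

lemma pw_norm (a : ℝ) {w : ℂ} (hw : ‖w‖ < 1) : ‖pw a w‖ = ‖1 + w‖ ^ a := by
  have h0 : 1 + w ≠ 0 := Complex.slitPlane_ne_zero (pw_slit hw)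
  unfold pw; rw [Complex.norm_cpow_real]

lemma pw_le {w : ℂ} (hw : ‖w‖ ≤ 1 / 2) : ‖pw (-1/2) w‖ ≤ 6 ∧ ‖pw (-3 / 2) w‖ ≤ 6 ∧ ‖pw (-5 / 2) w‖ ≤ 6 := by
  have hw1 : ‖w‖ < 1 := by linarith
  have h1 : 1 / 2 ≤ ‖1 + w‖ := by
    have := norm_sub_le (1 + w) w; simp at this; linarith
  have key : ∀ a : ℝ, 0 ≤ a → a ≤ 5 / 2 → ‖1 + w‖ ^ (-a) ≤ 6 := by
    intro a ha ha'
    calc _ ≤ (1 / 2 : ℝ) ^ (-a) := Real.rpow_le_rpow_of_nonpos (by norm_num) h1 (by linarith)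
      _ ≤ (1 / 2 : ℝ) ^ (-(5 / 2) : ℝ) :=
        Real.rpow_le_rpow_of_exponent_ge (by norm_num) (by norm_num) (by linarith)
      _ ≤ 6 := by
        rw [Real.rpow_neg (by norm_num)]
        have : (1 / 6 : ℝ) ≤ (1 / 2 : ℝ) ^ (5 / 2 : ℝ) := by
          rw [show (5 / 2 : ℝ) = 2 + 1 / 2 by norm_num, Real.rpow_add (by norm_num),
            ← Real.sqrt_eq_rpow]
          have : (7 / 10 : ℝ) ≤ √(1 / 2) := Real.le_sqrt_of_sq_le (by norm_num)
          norm_num at this ⊢; linarith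
        exact inv_le_of_inv_le₀ (by norm_num) (by linarith)
  rw [pw_norm _ hw1, pw_norm _ hw1, pw_norm _ hw1]
  have a1 := key (1/2) (by norm_num) (by norm_num)
  have a2 := key (3/2) (by norm_num) (by norm_num)
  have a3 := key (5/2) (by norm_num) (by norm_num)
  norm_num at a1 a2 a3 ⊢
  exact ⟨a1, a2, a3⟩

lemma pw_sub_one {w : ℂ} (hw : ‖w‖ ≤ 1 / 2) :
    ‖pw (-3 / 2) w - 1‖ ≤ 9 * ‖w‖ := by
  have h := (convex_closedBall (0:ℂ) (1 / 2)).norm_image_sub_le_of_norm_hasDerivWithin_le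
    (f := pw (-3 / 2)) (f' := fun w => ((-3 / 2 : ℝ) : ℂ) * pw (-3 / 2 - 1) w) (C := 9) (x := 0) (y := w)
    (fun x hx => (pw_deriv _ (by have : ‖x‖ ≤ 1 / 2 := by simpa using hx
                                 linarith)).hasDerivWithinAt)
    (fun x hx => by
      have : ‖x‖ ≤ 1 / 2 := by simpa using hx
      have h5 := (pw_le this).2.2
      rw [norm_mul, show (-3 / 2 - 1 : ℝ) = -5 / 2 by norm_num]
      have : ‖((-3 / 2 : ℝ) : ℂ)‖ = 3 / 2 := by rw [Complex.norm_real]; norm_num [abs_of_neg]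
      rw [this]; linarith) (by simp) (by simpa using hw)
  simpa [pw] using h

lemma pw_sub_two {w : ℂ} (hw : ‖w‖ ≤ 1 / 2) :
    ‖1 - pw (-3 / 2) w - 3 / 2 * w‖ ≤ 40 * ‖w‖ ^ 2 := by
  have m1 : ∀ x ∈ Metric.closedBall (0:ℂ) ‖w‖, ‖pw (-5 / 2) x - 1‖ ≤ 26 * ‖w‖ := by
    intro x hx
    have hx' : ‖x‖ ≤ ‖w‖ := by simpa using hx
    have hx2 : ‖x‖ ≤ 1 / 2 := hx'.trans hw
    have hx1 : ‖x‖ < 1 := by linarith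
    have e : pw (-5 / 2) x = pw (-3 / 2) x / (1 + x) := by
      have h0 := Complex.slitPlane_ne_zero (pw_slit hx1)
      have := Complex.cpow_sub ((-3 / 2 : ℝ) : ℂ) 1 h0
      unfold pw; rw [Complex.cpow_one] at this; rw [← this]
      congr 1; push_cast; ring
    have h1 : 1 / 2 ≤ ‖1 + x‖ := by
      have := norm_sub_le (1 + x) x; simp at this; linarith
    have h0 : 1 + x ≠ 0 := Complex.slitPlane_ne_zero (pw_slit hx1)
    rw [e, show pw (-3 / 2) x / (1 + x) - 1 = (pw (-3 / 2) x - 1 - x) / (1 + x) by field_simp; ring,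
      norm_div, div_le_iff₀ (by linarith)]
    have := pw_sub_one hx2
    have h3 := norm_sub_le (pw (-3 / 2) x - 1) x
    nlinarith [norm_nonneg w]
  have h := (convex_closedBall (0:ℂ) ‖w‖).norm_image_sub_le_of_norm_hasDerivWithin_le
    (f := fun w => 1 - pw (-3 / 2) w - 3 / 2 * w)
    (f' := fun w => 0 - ((-3 / 2 : ℝ) : ℂ) * pw (-3 / 2 - 1) w - 3 / 2 * 1) (C := 40 * ‖w‖) (x := 0) (y := w)
    (fun x hx => by
      have : ‖x‖ ≤ ‖w‖ := by simpa using hx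
      exact (((hasDerivAt_const x (1:ℂ)).sub (pw_deriv _ (by linarith))).sub
        ((hasDerivAt_id x).const_mul _)).hasDerivWithinAt)
    (fun x hx => by
      have h5 := m1 x hx
      rw [show (-3 / 2 - 1 : ℝ) = -5 / 2 by norm_num]
      rw [show (0 - ((-3 / 2 : ℝ) : ℂ) * pw (-5 / 2) x - 3 / 2 * 1 : ℂ) = 3 / 2 * (pw (-5 / 2) x - 1) by
        push_cast; ring, norm_mul]
      have : ‖(3 / 2 : ℂ)‖ = 3 / 2 := by norm_num
      rw [this]; linarith [norm_nonneg w]) (by simp) (by simp)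
  simp only [sub_zero] at h
  have e0 : (1:ℂ) - pw (-3 / 2) 0 - 3 / 2 * 0 = 0 := by simp [pw]
  rw [e0, sub_zero] at h
  nlinarith

variable {G q : ℝ} {r x y : ℂ}

lemma w_deriv (hr : r ≠ 0) : HasDerivAt (fun r : ℂ => (q:ℂ) / r ^ 2) (-2 * q / r ^ 3) r := by
  have := (hasDerivAt_const r (q:ℂ)).div (hasDerivAt_pow 2 r) (pow_ne_zero 2 hr)
  refine this.congr_deriv ?_; field_simp; simp; ring

lemma pw_step (a : ℝ) {w : ℂ} (hw : ‖w‖ < 1) : pw a w = pw (a - 1) w * (1 + w) := by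
  unfold pw; push_cast
  rw [Complex.cpow_sub _ _ (Complex.slitPlane_ne_zero (pw_slit hw)), Complex.cpow_one,
    div_mul_cancel₀ _ (Complex.slitPlane_ne_zero (pw_slit hw))]

lemma FF_deriv (hr : r ≠ 0) (hw : ‖(q:ℂ) / r ^ 2‖ < 1) : HasDerivAt (FF G q) (FF' G q r) r := by
  have h1 := (hasDerivAt_const r ((G:ℂ) ^ 2)).div (hasDerivAt_pow 3 r) (pow_ne_zero 3 hr)
  have h2 := (hasDerivAt_const r (1:ℂ)).div (hasDerivAt_pow 2 r) (pow_ne_zero 2 hr)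
  have h3 := (pw_deriv (-3 / 2) hw).comp r (w_deriv hr)
  have := h1.sub (h2.mul h3)
  refine HasDerivAt.congr_deriv (f := FF G q) this ?_
  rw [show (-3 / 2 - 1 : ℝ) = -5 / 2 by norm_num]
  unfold FF'
  simp only [Function.comp, Pi.div_apply]
  push_cast; field_simp; ring

lemma PP_deriv (hr : r ≠ 0) (hw : ‖(q:ℂ) / r ^ 2‖ < 1) : HasDerivAt (PP G q) (FF G q r) r := by
  have h1 := (hasDerivAt_const r (-(G:ℂ) ^ 2)).div ((hasDerivAt_pow 2 r).const_mul 2)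
    (mul_ne_zero two_ne_zero (pow_ne_zero 2 hr))
  have h2 := (hasDerivAt_const r (1:ℂ)).div (hasDerivAt_id r) hr
  have h3 := (pw_deriv (-1 / 2) hw).comp r (w_deriv hr)
  have := h1.add (h2.mul h3)
  refine HasDerivAt.congr_deriv (f := PP G q) this ?_
  have e := pw_step (-1 / 2) hw
  rw [show (-1 / 2 - 1 : ℝ) = -3 / 2 by norm_num] at e ⊢
  unfold FF
  simp only [Function.comp, Pi.div_apply, id]
  rw [e]
  push_cast; field_simp; ring

lemma half_norm (hx : ‖x‖ ≤ ‖r‖ / 2) : ‖r‖ / 2 ≤ ‖r + x‖ := by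
  have := norm_sub_le (r + x) x; simp at this; linarith

lemma F0'_lip (hr : r ≠ 0) (hx : ‖x‖ ≤ ‖r‖ / 2) :
    ‖F0' G (r + x) - F0' G r‖ ≤ ‖x‖ * (432 * G ^ 2 / ‖r‖ ^ 5 + 80 / ‖r‖ ^ 4) := by
  have h1 := half_norm hx
  have hp : 0 < ‖r‖ := norm_pos_iff.2 hr
  have hq : 0 < ‖r + x‖ := by linarith
  have hrx : r + x ≠ 0 := norm_pos_iff.1 hq
  set R := ‖r‖
  have hX := norm_nonneg x
  have n4 : ‖4 * r ^ 3 + 6 * r ^ 2 * x + 4 * r * x ^ 2 + x ^ 3‖ ≤ 9 * R ^ 3 := by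
    have : ‖4 * r ^ 3 + 6 * r ^ 2 * x + 4 * r * x ^ 2 + x ^ 3‖ ≤
        4 * R ^ 3 + 6 * R ^ 2 * ‖x‖ + 4 * R * ‖x‖ ^ 2 + ‖x‖ ^ 3 := by
      refine (norm_add₄_le).trans (le_of_eq ?_); simp [R]
    refine this.trans ?_
    calc _ ≤ 4 * R ^ 3 + 6 * R ^ 2 * (R / 2) + 4 * R * (R / 2) ^ 2 + (R / 2) ^ 3 := by gcongr
      _ ≤ _ := by nlinarith [pow_pos hp 3]
  have n3 : ‖3 * r ^ 2 + 3 * r * x + x ^ 2‖ ≤ 5 * R ^ 2 := by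
    have : ‖3 * r ^ 2 + 3 * r * x + x ^ 2‖ ≤ 3 * R ^ 2 + 3 * R * ‖x‖ + ‖x‖ ^ 2 := by
      refine (norm_add₃_le).trans (le_of_eq ?_); simp [R]
    refine this.trans ?_
    calc _ ≤ 3 * R ^ 2 + 3 * R * (R / 2) + (R / 2) ^ 2 := by gcongr
      _ ≤ _ := by nlinarith [pow_pos hp 2]
  have e : F0' G (r + x) - F0' G r =
      x * (3 * G ^ 2 * ((4 * r ^ 3 + 6 * r ^ 2 * x + 4 * r * x ^ 2 + x ^ 3) / (r ^ 4 * (r + x) ^ 4)) -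
      2 * ((3 * r ^ 2 + 3 * r * x + x ^ 2) / (r ^ 3 * (r + x) ^ 3))) := by
    unfold F0'; field_simp; ring
  have m4 : ‖(4 * r ^ 3 + 6 * r ^ 2 * x + 4 * r * x ^ 2 + x ^ 3) / (r ^ 4 * (r + x) ^ 4)‖ ≤ 144 / R ^ 5 := by
    rw [norm_div, norm_mul, norm_pow, norm_pow]
    calc _ ≤ 9 * R ^ 3 / (R ^ 4 * (R / 2) ^ 4) := by gcongr
      _ = _ := by field_simp; norm_num
  have m3 : ‖(3 * r ^ 2 + 3 * r * x + x ^ 2) / (r ^ 3 * (r + x) ^ 3)‖ ≤ 40 / R ^ 4 := by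
    rw [norm_div, norm_mul, norm_pow, norm_pow]
    calc _ ≤ 5 * R ^ 2 / (R ^ 3 * (R / 2) ^ 3) := by gcongr
      _ = _ := by field_simp; norm_num
  rw [e, norm_mul]
  gcongr
  refine (norm_sub_le _ _).trans ?_
  rw [norm_mul, norm_mul, norm_mul]
  have : ‖(G:ℂ) ^ 2‖ = G ^ 2 := by rw [norm_pow, Complex.norm_real, Real.norm_eq_abs, sq_abs]
  rw [this]; simp only [Complex.norm_ofNat]
  calc _ ≤ 3 * G ^ 2 * (144 / R ^ 5) + 2 * (40 / R ^ 4) := by gcongr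
    _ = _ := by ring

lemma w_le (hq0 : 0 ≤ q) (hq : q ≤ 1) {R : ℝ} (hR : 2 ≤ R) (hr : R ≤ ‖r‖) :
    ‖(q:ℂ) / r ^ 2‖ ≤ 1 / R ^ 2 ∧ ‖(q:ℂ) / r ^ 2‖ ≤ 1 / 2 := by
  have : ‖(q:ℂ) / r ^ 2‖ ≤ 1 / R ^ 2 := by
    rw [norm_div, norm_pow, Complex.norm_real, Real.norm_eq_abs, abs_of_nonneg hq0]; gcongr
  refine ⟨this, this.trans ?_⟩
  exact one_div_le_one_div_of_le (by norm_num) (by nlinarith)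

lemma FF'_sub (hq0 : 0 ≤ q) (hq : q ≤ 1) {R : ℝ} (hR : 2 ≤ R) (hr : R ≤ ‖r‖) :
    ‖FF' G q r - F0' G r‖ ≤ 36 / R ^ 5 := by
  obtain ⟨h1, h2⟩ := w_le hq0 hq hR hr
  have e : FF' G q r - F0' G r = 1 / r ^ 3 *
      (2 * (pw (-3 / 2) (q / r ^ 2) - 1) - 3 * (q / r ^ 2) * pw (-5 / 2) (q / r ^ 2)) := by
    unfold FF' F0'; ring
  rw [e, norm_mul, norm_div, norm_one, norm_pow]
  have p1 := pw_sub_one h2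
  have p2 := (pw_le h2).2.2
  set w := (q:ℂ) / r ^ 2
  have : ‖2 * (pw (-3 / 2) w - 1) - 3 * w * pw (-5 / 2) w‖ ≤ 36 * (1 / R ^ 2) := by
    refine (norm_sub_le _ _).trans ?_
    rw [norm_mul, norm_mul, norm_mul]; simp only [Complex.norm_ofNat]
    nlinarith [norm_nonneg w, mul_le_mul_of_nonneg_left p2 (norm_nonneg w)]
  calc _ ≤ 1 / R ^ 3 * (36 * (1 / R ^ 2)) := by gcongr
    _ = _ := by field_simp

/-- abstract data: a=√G, b=√ω -/
lemma NN_lip_abs {a b k : ℝ} (ha : 10 ^ 10 ≤ a) (hb : 1 ≤ b) (hG : G = a ^ 2) (hq0 : 0 ≤ q) (hq : q ≤ 1)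
    (h1 : a * b / 7 ≤ ‖r‖) (h2 : a * b ^ 5 / 20000 ≤ ‖r‖ ^ 4) (hk : k ≤ 10 ^ 16 / a ^ 4)
    {x y : ℂ} (hx : ‖x‖ ≤ k * b) (hy : ‖y‖ ≤ k * b) :
    ‖x‖ ≤ ‖r‖ / 2 ∧ ‖NN G q r x - NN G q r y‖ ≤ 10 ^ 23 / (a ^ 5 * b ^ 4) * ‖x - y‖ := by
  have ha0 : 0 < a := by linarith
  have hb0 : 0 < b := by linarith
  have hk1 : k ≤ a / 100 := hk.trans (by
    rw [div_le_div_iff₀ (by positivity) (by norm_num)]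
    calc (10:ℝ) ^ 16 * 100 ≤ (10 ^ 10) ^ 5 := by norm_num
      _ ≤ a ^ 5 := by gcongr
      _ = _ := by ring)
  have hab : 10 ^ 10 ≤ a * b := by nlinarith
  have hkb : k * b ≤ ‖r‖ / 2 := by nlinarith
  have hr2 : 4 ≤ ‖r‖ := by linarith
  have hr : r ≠ 0 := norm_pos_iff.1 (by linarith)
  have i5 : 1 / ‖r‖ ^ 5 ≤ 16807 / (a ^ 5 * b ^ 5) := by
    calc _ ≤ 1 / (a * b / 7) ^ 5 := by gcongr
      _ = _ := by field_simp; norm_num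
  have i4 : 1 / ‖r‖ ^ 4 ≤ 20000 / (a * b ^ 5) := by
    calc _ ≤ 1 / (a * b ^ 5 / 20000) := by gcongr
      _ = _ := by field_simp
  refine ⟨hx.trans hkb, ?_⟩
  have hn : ∀ z ∈ Metric.closedBall (0:ℂ) (k * b), ‖z‖ ≤ ‖r‖ / 2 := by
    intro z hz; have : ‖z‖ ≤ k * b := by simpa using hz
    linarith
  refine (convex_closedBall (0:ℂ) (k * b)).norm_image_sub_le_of_norm_hasDerivWithin_le
    (f := NN G q r) (f' := fun z => FF' G q (r + z) - F0' G r * 1)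
    (fun z hz => ?_) (fun z hz => ?_) (by simpa using hy) (by simpa using hx)
  · have hh := half_norm (hn z hz)
    have hw := w_le (r := r + z) hq0 hq (R := ‖r‖ / 2) (by linarith) hh
    have := (FF_deriv (G := G) (norm_pos_iff.1 (by linarith : 0 < ‖r + z‖)) (by linarith [hw.2])).comp_const_add r z
    exact ((this.sub_const (F0 G r)).sub ((hasDerivAt_id z).const_mul (F0' G r))).hasDerivWithinAt
  · have hh := half_norm (hn z hz)
    have s1 := FF'_sub (G := G) (r := r + z) hq0 hq (R := ‖r‖ / 2) (by linarith) hh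
    have s2 := F0'_lip (G := G) hr (hn z hz)
    have hz' : ‖z‖ ≤ 10 ^ 16 / a ^ 4 * b := by
      have : ‖z‖ ≤ k * b := by simpa using hz
      exact this.trans (by gcongr)
    rw [mul_one, show FF' G q (r + z) - F0' G r = (FF' G q (r + z) - F0' G (r + z)) + (F0' G (r + z) - F0' G r) by ring]
    refine (norm_add_le _ _).trans ((add_le_add s1 s2).trans ?_)
    calc _ = 1152 * (1 / ‖r‖ ^ 5) + ‖z‖ * (432 * G ^ 2 * (1 / ‖r‖ ^ 5) + 80 * (1 / ‖r‖ ^ 4)) := by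
          rw [div_pow]; field_simp; norm_num
      _ ≤ 1152 * (16807 / (a ^ 5 * b ^ 5)) + (10 ^ 16 / a ^ 4 * b) *
          (432 * G ^ 2 * (16807 / (a ^ 5 * b ^ 5)) + 80 * (20000 / (a * b ^ 5))) := by gcongr
      _ = (1152 * 16807 * (1 / b) + 10 ^ 16 * (432 * 16807 + 80 * 20000)) / (a ^ 5 * b ^ 4) := by
          rw [hG]; field_simp
      _ ≤ _ := by
          have : 1 / b ≤ 1 := by rw [div_le_one hb0]; exact hb
          gcongr; linarith

lemma NN0_eq : NN G q r 0 = 1 / r ^ 2 * (1 - pw (-3 / 2) (q / r ^ 2)) := by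
  unfold NN FF F0; simp only [add_zero]; ring

lemma NN0_abs {a b : ℝ} (ha : 10 ^ 10 ≤ a) (hb : 1 ≤ b) (hq0 : 0 ≤ q) (hq : q ≤ 1)
    (h1 : a * b / 7 ≤ ‖r‖) : ‖NN G q r 0‖ ≤ 21609 / (a * b) ^ 4 ∧
    ‖NN G q r 0 - 3 / 2 * q / r ^ 4‖ ≤ 40 * 7 ^ 6 / (a * b) ^ 6 := by
  have ha0 : 0 < a := by linarith
  have hb0 : 0 < b := by linarith
  have hab : 10 ^ 10 ≤ a * b := by nlinarith
  obtain ⟨w1, w2⟩ := w_le (r := r) hq0 hq (R := a * b / 7) (by linarith) h1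
  have i2 : 1 / ‖r‖ ^ 2 ≤ 1 / (a * b / 7) ^ 2 := by gcongr
  have hr : r ≠ 0 := norm_pos_iff.1 (by linarith)
  constructor
  · rw [NN0_eq, norm_mul, norm_div, norm_one, norm_pow, norm_sub_rev]
    have := pw_sub_one w2
    calc _ ≤ 1 / (a * b / 7) ^ 2 * (9 * (1 / (a * b / 7) ^ 2)) := by gcongr; linarith
      _ = _ := by field_simp; norm_num
  · have e : NN G q r 0 - 3 / 2 * q / r ^ 4 = 1 / r ^ 2 * (1 - pw (-3 / 2) (q / r ^ 2) - 3 / 2 * (q / r ^ 2)) := by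
      rw [NN0_eq]; field_simp
    rw [e, norm_mul, norm_div, norm_one, norm_pow]
    have := pw_sub_two w2
    calc _ ≤ 1 / (a * b / 7) ^ 2 * (40 * (1 / (a * b / 7) ^ 2) ^ 2) := by
          gcongr; exact this.trans (by gcongr)
      _ = _ := by field_simp

open Real Filter MeasureTheory Set Topology

lemma holo_integral {U : Set ℂ} (hU : IsOpen U) {μ : Measure ℝ} {f : ℂ → ℝ → ℂ}
    (hd : ∀ᵐ a ∂μ, DifferentiableOn ℂ (fun v => f v a) U)
    (hm : ∀ v ∈ U, AEStronglyMeasurable (f v) μ)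
    {B : ℝ → ℝ} (hB : Integrable B μ) (hBe : ∀ᵐ a ∂μ, ∀ w ∈ U, ‖f w a‖ ≤ B a) :
    DifferentiableOn ℂ (fun v => ∫ a, f v a ∂μ) U := by
  intro v hv
  obtain ⟨e', he', hU'⟩ := Metric.isOpen_iff.1 hU v hv
  set d := e' / 2 with hd'
  have hd0 : 0 < d := by positivity
  have hsub : Metric.closedBall v d ⊆ U := (Metric.closedBall_subset_ball (by linarith)).trans hU'
  have hmem : ∀ x ∈ Metric.ball v (d / 2), Metric.closedBall x (d / 2) ⊆ Metric.closedBall v d := by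
    intro x hx; apply Metric.closedBall_subset_closedBall'
    have := Metric.mem_ball.1 hx; linarith
  have hderiv : ∀ᵐ a ∂μ, ∀ x ∈ Metric.ball v (d / 2), HasDerivAt (fun w => f w a) (deriv (fun w => f w a) x) x := by
    filter_upwards [hd] with a ha x hx
    exact (ha.differentiableAt (hU.mem_nhds (hsub (Metric.ball_subset_closedBall
      (Metric.ball_subset_ball (by linarith) hx))))).hasDerivAt
  have hint : Integrable (f v) μ := hB.mono' (hm v hv) (by
    filter_upwards [hBe] with a ha using ha v hv)
  have hmeas : AEStronglyMeasurable (fun a => deriv (fun w => f w a) v) μ := by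
    have hlim : Tendsto (fun n : ℕ => v + ((1 / ((n:ℝ) + 1) : ℝ) : ℂ)) atTop (𝓝 v) := by
      have h1 : Tendsto (fun n : ℕ => ((1 / ((n:ℝ) + 1) : ℝ) : ℂ)) atTop (𝓝 ((0:ℝ):ℂ)) :=
        (Complex.continuous_ofReal.tendsto 0).comp tendsto_one_div_add_atTop_nhds_zero_nat
      simpa using h1.const_add v
    have hev : ∀ᶠ n : ℕ in atTop, v + ((1 / ((n:ℝ) + 1) : ℝ) : ℂ) ∈ U := hlim.eventually (hU.mem_nhds hv)
    obtain ⟨n0, hn0⟩ := eventually_atTop.1 hev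
    have h2 : Tendsto (fun n : ℕ => v + ((1 / (((n + n0 : ℕ):ℝ) + 1) : ℝ) : ℂ)) atTop (𝓝[≠] v) := by
      refine tendsto_nhdsWithin_iff.2 ⟨hlim.comp (tendsto_add_atTop_nat n0), Eventually.of_forall fun n => ?_⟩
      have : ((1 / (((n + n0 : ℕ):ℝ) + 1) : ℝ) : ℂ) ≠ 0 := by
        exact_mod_cast (one_div_pos.2 (by positivity : (0:ℝ) < ((n + n0 : ℕ):ℝ) + 1)).ne'
      simpa using this
    refine aestronglyMeasurable_of_tendsto_ae atTop
      (f := fun (n : ℕ) a => slope (fun w => f w a) v (v + ((1 / (((n + n0 : ℕ):ℝ) + 1) : ℝ) : ℂ))) (fun n => ?_) ?_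
    · simp only [slope_def_field, div_eq_mul_inv]
      exact ((hm _ (hn0 (n + n0) (by omega))).sub (hm v hv)).mul_const _
    · filter_upwards [hderiv] with a ha
      exact (hasDerivAt_iff_tendsto_slope.1 (ha v (Metric.mem_ball_self (by linarith)))).comp h2
  refine (hasDerivAt_integral_of_dominated_loc_of_deriv_le (F := f) (F' := fun x a => deriv (fun w => f w a) x)
    (bound := fun a => B a / (d / 2)) (Metric.ball_mem_nhds v (by linarith : 0 < d / 2)) ?_ hint hmeas ?_
    (hB.div_const _) hderiv).2.differentiableAt.differentiableWithinAt
  · filter_upwards [hU.mem_nhds hv] with w hw using hm w hw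
  · filter_upwards [hd, hBe] with a ha hb x hx
    refine Complex.norm_deriv_le_of_forall_mem_sphere_norm_le (by linarith) ?_ ?_
    · refine (DifferentiableOn.mono ha ?_).diffContOnCl
      rw [closure_ball _ (by linarith)]
      exact (hmem x hx).trans hsub
    · intro z hz
      exact hb z (hsub (hmem x hx (Metric.sphere_subset_closedBall hz)))

lemma sq_c {c : ℝ} (hc : 0 < c) (s : ℝ) (hs : 0 ≤ s) : HasDerivAt (fun x => -2 / √(c + x)) (1 / √(c + s) ^ 3) s ∧
    HasDerivAt (fun x => 2 * √(c + x)) (1 / √(c + s)) s := by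
  have h0 : 0 < c + s := by linarith
  have h1 : HasDerivAt (fun x => √(c + x)) (1 / (2 * √(c + s))) s :=
    ((hasDerivAt_id s).const_add c).sqrt h0.ne'
  have hp : 0 < √(c + s) := sqrt_pos.2 h0
  constructor
  · refine ((hasDerivAt_const s (-2:ℝ)).div h1 hp.ne').congr_deriv ?_
    field_simp; norm_num
  · refine (h1.const_mul 2).congr_deriv ?_
    field_simp

lemma w32 {c : ℝ} (hc : 0 < c) {s : ℝ} (hs : 0 ≤ s) :
    IntegrableOn (fun x => 1 / √(c + x) ^ 3) (Ioi s) ∧ ∫ x in Ioi s, 1 / √(c + x) ^ 3 = 2 / √(c + s) := by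
  have hl : Tendsto (fun x => -2 / √(c + x)) atTop (𝓝 0) :=
    Tendsto.const_div_atTop (tendsto_sqrt_atTop.comp (tendsto_atTop_add_const_left _ c tendsto_id)) _
  have hd : ∀ x ∈ Ici s, HasDerivAt (fun x => -2 / √(c + x)) (1 / √(c + x) ^ 3) x :=
    fun x hx => (sq_c hc x (hs.trans hx)).1
  refine ⟨integrableOn_Ioi_deriv_of_nonneg' hd (fun x _ => by positivity) hl, ?_⟩
  rw [integral_Ioi_of_hasDerivAt_of_nonneg' hd (fun x _ => by positivity) hl]; ring

lemma Blem {c s H : ℝ} (hc : 0 < c) (hs : 0 ≤ s) (hH : 0 ≤ H) {f : ℝ → ℂ}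
    (hm : AEStronglyMeasurable f (volume.restrict (Ioi 0)))
    (hf : ∀ x > 0, ‖f x‖ ≤ H * (c + min s x) * (1 / √(c + x) ^ 3)) :
    IntegrableOn f (Ioi 0) ∧ ‖∫ x in Ioi 0, f x‖ ≤ 4 * H * √(c + s) := by
  have hi : IntegrableOn f (Ioi 0) := by
    refine Integrable.mono' ((w32 hc le_rfl).1.const_mul (H * (c + s))) hm ?_
    refine (ae_restrict_iff' measurableSet_Ioi).2 (Eventually.of_forall fun x hx => (hf x hx).trans ?_)
    gcongr; exact min_le_left _ _
  refine ⟨hi, ?_⟩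
  have hp : 0 < √(c + s) := sqrt_pos.2 (by linarith)
  have hsp : Ioc 0 s ∪ Ioi s = Ioi 0 := Ioc_union_Ioi_eq_Ioi hs
  rw [← hsp, setIntegral_union Ioc_disjoint_Ioi_same measurableSet_Ioi
    (hi.mono_set Ioc_subset_Ioi_self) (hi.mono_set (Ioi_subset_Ioi hs))]
  have b2 : ‖∫ x in Ioi s, f x‖ ≤ H * (c + s) * (2 / √(c + s)) := by
    rw [← (w32 hc hs).2, ← integral_const_mul]
    refine norm_integral_le_of_norm_le ((w32 hc hs).1.const_mul _) ?_
    refine (ae_restrict_iff' measurableSet_Ioi).2 (Eventually.of_forall fun x hx => ?_)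
    have := hf x (hs.trans_lt hx)
    rwa [min_eq_left (le_of_lt hx)] at this
  have hcont : ContinuousOn (fun x => 1 / √(c + x)) (uIcc 0 s) := by
    rw [uIcc_of_le hs]
    refine ContinuousOn.div continuousOn_const (by fun_prop) fun x hx => (sqrt_pos.2 (by linarith [hx.1])).ne'
  have b1 : ‖∫ x in Ioc 0 s, f x‖ ≤ H * (2 * √(c + s) - 2 * √(c + 0)) := by
    rw [← intervalIntegral.integral_eq_sub_of_hasDerivAt
      (fun x hx => (sq_c hc x (by rw [uIcc_of_le hs] at hx; exact hx.1)).2) hcont.intervalIntegrable,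
      intervalIntegral.integral_of_le hs, ← integral_const_mul]
    refine norm_integral_le_of_norm_le ((hcont.intervalIntegrable.1).const_mul _) ?_
    refine (ae_restrict_iff' measurableSet_Ioc).2 (Eventually.of_forall fun x hx => ?_)
    have := hf x hx.1
    rw [min_eq_right hx.2] at this
    refine this.trans (le_of_eq ?_)
    have h0 : 0 < c + x := by linarith [hx.1]
    have hq := sq_sqrt h0.le
    have : 0 < √(c + x) := sqrt_pos.2 h0
    nth_rewrite 1 [← hq]; field_simp
  have e : (c + s) * (2 / √(c + s)) = 2 * √(c + s) := by
    have hq := sq_sqrt (by linarith : 0 ≤ c + s)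
    nth_rewrite 1 [← hq]; field_simp
  have := norm_add_le (∫ x in Ioc 0 s, f x) (∫ x in Ioi s, f x)
  rw [mul_assoc, e] at b2
  have := sqrt_nonneg (c + 0)
  nlinarith

open Real Filter MeasureTheory Set Topology

noncomputable def Gr (G : ℝ) (v : ℂ) (s x : ℝ) : ℂ :=
  e1 G (v + (max s x : ℝ)) * zt G v (v + (min s x : ℝ))
noncomputable def Nx (G : ℝ) (ξ : ℂ → ℝ → ℝ → ℂ) (v : ℂ) (t x : ℝ) : ℂ :=
  NN G (qq (t + x)) (rh G (v + x)) (ξ v x t)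
noncomputable def TT (G : ℝ) (ξ : ℂ → ℝ → ℝ → ℂ) (v : ℂ) (s t : ℝ) : ℂ :=
  -∫ x in Ioi 0, Gr G v s x * Nx G ξ v t x

section
variable {G : ℝ} {v : ℂ} {ξ : ℂ → ℝ → ℝ → ℂ}

lemma base (hG : 10 ^ 20 ≤ G) (hv : v ∈ Dom G) {s : ℝ} (hs : 0 ≤ s) :
    10 ^ 10 ≤ √G ∧ 1 ≤ √(y0 G v + s) ∧ G = √G ^ 2 ∧ √G * √(y0 G v + s) / 7 ≤ ‖rh G (v + s)‖ ∧
    √G * √(y0 G v + s) ^ 5 / 20000 ≤ ‖rh G (v + s)‖ ^ 4 ∧ y0 G v + s = √(y0 G v + s) ^ 2 := by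
  have hG0 : 0 < G := by linarith
  have hy := Dom_y0 hv
  have hw : 0 ≤ y0 G v + s := by linarith
  have e1 := (sq_sqrt hG0.le).symm
  have e2 := (sq_sqrt hw).symm
  refine ⟨Real.le_sqrt_of_sq_le (by norm_num; linarith), Real.le_sqrt_of_sq_le (by linarith), e1, ?_, ?_, e2⟩
  · refine abs_le_of_sq_le_sq' ?_ (norm_nonneg _) |>.2
    refine le_trans ?_ (K1 hG0 hv hs)
    rw [div_pow, mul_pow, ← e1, ← e2]
    have : 0 ≤ G * (y0 G v + s) := by positivity
    linarith
  · refine le_trans (le_of_eq ?_) (K2 hG0 hv hs)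
    nth_rewrite 2 [e2]; ring

lemma strip_open (G : ℝ) : IsOpen {u : ℂ | |u.im| < G ^ 3 / 3} :=
  isOpen_lt (by fun_prop) continuous_const

lemma one_sub_ne (hG : 100 ≤ G) (hv : v ∈ Dom G) : 1 - Tt G v ^ 2 ≠ 0 :=
  norm_pos_iff.1 (by linarith [(Tt_near hG hv).2.1])

lemma Tt_contAt (hG : 0 < G) (hv : |v.im| < G ^ 3 / 3) : ContinuousAt (Tt G) v := (Tt_deriv hG hv).continuousAt
lemma e1_contAt (hG : 0 < G) (hv : |v.im| < G ^ 3 / 3) : ContinuousAt (e1 G) v := (e1_deriv hG hv).continuousAt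
lemma rh_contAt (hG : 0 < G) (hv : |v.im| < G ^ 3 / 3) : ContinuousAt (rh G) v := (rh_deriv hG hv).continuousAt

/-- joint continuity of zt -/
lemma zt_contAt (hG : 100 ≤ G) (hv : v ∈ Dom G) {u : ℂ} (hu : |u.im| < G ^ 3 / 3) :
    ContinuousAt (fun p : ℂ × ℂ => zt G p.1 p.2) (v, u) := by
  have hG0 : 0 < G := by linarith
  have h1 : ContinuousAt (fun p : ℂ × ℂ => Tt G p.1) (v, u) :=
    ContinuousAt.comp (f := Prod.fst) (Tt_contAt hG0 (Dom_im hv)) continuousAt_fst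
  have h2 : ContinuousAt (fun p : ℂ × ℂ => Tt G p.2) (v, u) :=
    ContinuousAt.comp (f := Prod.snd) (Tt_contAt hG0 hu) continuousAt_snd
  have n1 := one_sub_ne hG hv
  have n2 := Tt_ne hG0 hu
  unfold zt kk nn
  exact continuousAt_const.mul (ContinuousAt.div (by fun_prop (disch := assumption)) (by fun_prop) n2)

lemma dz_aux {T T2 : ℂ → ℂ} {c v : ℂ} (h1 : DifferentiableAt ℂ T v) (h2 : DifferentiableAt ℂ T2 v)
    (n1 : 1 - T v ^ 2 ≠ 0) (n2 : 1 + T2 v ^ 2 ≠ 0) :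
    DifferentiableAt ℂ (fun v => c * ((nn (T2 v) - kk (T v) * T2 v) / (1 + T2 v ^ 2))) v := by
  unfold nn kk
  fun_prop (disch := assumption)

lemma F0'_diff {r : ℂ} (hr : r ≠ 0) : DifferentiableAt ℂ (F0' G) r := by
  have n3 : r ^ 3 ≠ 0 := pow_ne_zero _ hr
  have n4 : r ^ 4 ≠ 0 := pow_ne_zero _ hr
  unfold F0'
  fun_prop (disch := assumption)

lemma zt_hol (hG : 100 ≤ G) (c : ℝ) : DifferentiableOn ℂ (fun v => zt G v (v + c)) (Dom G) := by
  intro v hv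
  have hG0 : 0 < G := by linarith
  have h1 : DifferentiableAt ℂ (fun v => Tt G v) v := (Tt_deriv hG0 (Dom_im hv)).differentiableAt
  have h2 : DifferentiableAt ℂ (fun v => Tt G (v + c)) v :=
    ((Tt_deriv hG0 (Dom_add hv c)).comp_add_const v c).differentiableAt
  have n1 := one_sub_ne hG hv
  have n2 := Tt_ne hG0 (Dom_add hv c)
  apply DifferentiableAt.differentiableWithinAt
  exact dz_aux h1 h2 n1 n2

lemma Gr_cont (hG : 100 ≤ G) : ContinuousOn (fun p : ℂ × ℝ × ℝ => Gr G p.1 p.2.1 p.2.2) (Dom G ×ˢ univ) := by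
  have hG0 : 0 < G := by linarith
  rintro ⟨v, s, x⟩ ⟨hv, -⟩
  apply ContinuousAt.continuousWithinAt
  unfold Gr
  refine ContinuousAt.mul ?_ ?_
  · exact ContinuousAt.comp (f := fun p : ℂ × ℝ × ℝ => p.1 + ((max p.2.1 p.2.2 : ℝ) : ℂ))
      (e1_contAt hG0 (Dom_add hv _)) (by fun_prop)
  · exact ContinuousAt.comp (f := fun p : ℂ × ℝ × ℝ => (p.1, p.1 + ((min p.2.1 p.2.2 : ℝ) : ℂ)))
      (zt_contAt hG hv (Dom_add hv _)) (by fun_prop)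

lemma Gr_hol (hG : 100 ≤ G) (s x : ℝ) : DifferentiableOn ℂ (fun v => Gr G v s x) (Dom G) := by
  have hG0 : 0 < G := by linarith
  refine DifferentiableOn.mul (fun v hv => ?_) (zt_hol hG _)
  exact ((e1_deriv hG0 (Dom_add hv (max s x))).comp_add_const v _).differentiableAt.differentiableWithinAt

lemma Gr_le (hG : 100 ≤ G) (hv : v ∈ Dom G) {s x : ℝ} (hs : 0 ≤ s) (hx : 0 ≤ x) :
    ‖Gr G v s x‖ ≤ 3 * 10 ^ 10 * (y0 G v + min s x) := by
  unfold Gr; rw [norm_mul]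
  exact K4 hG hv (le_min hs hx) (min_le_max)

lemma NN_contAt {q : ℝ} {r x : ℂ} (hr : r ≠ 0) (hrx : r + x ≠ 0) (hw : ‖(q:ℂ) / (r + x) ^ 2‖ < 1) :
    ContinuousAt (fun p : ℝ × ℂ × ℂ => NN G p.1 p.2.1 p.2.2) (q, r, x) := by
  have hs := pw_slit hw
  unfold NN FF F0 F0' pw
  have h2 : (r + x) ^ 2 ≠ 0 := pow_ne_zero _ hrx
  have h3 : (r + x) ^ 3 ≠ 0 := pow_ne_zero _ hrx
  have g2 : r ^ 2 ≠ 0 := pow_ne_zero _ hr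
  have g3 : r ^ 3 ≠ 0 := pow_ne_zero _ hr
  have g4 : r ^ 4 ≠ 0 := pow_ne_zero _ hr
  have hc : ContinuousAt (fun p : ℝ × ℂ × ℂ => (p.1 : ℂ)) (q, r, x) := by fun_prop
  have hp : ContinuousAt (fun p : ℝ × ℂ × ℂ => (1 + (p.1 : ℂ) / (p.2.1 + p.2.2) ^ 2) ^ (((-3 / 2 : ℝ)) : ℂ)) (q, r, x) :=
    ContinuousAt.cpow (by fun_prop (disch := assumption)) continuousAt_const hs
  fun_prop (disch := assumption)

structure Good (G k : ℝ) (ξ : ℂ → ℝ → ℝ → ℂ) : Prop where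
  hol : ∀ s ≥ 0, ∀ t, DifferentiableOn ℂ (fun v => ξ v s t) (Dom G)
  cont : ContinuousOn (fun p : ℂ × ℝ × ℝ => ξ p.1 p.2.1 p.2.2) (Dom G ×ˢ Ici 0 ×ˢ univ)
  bd : ∀ v ∈ Dom G, ∀ s ≥ 0, ∀ t, ‖ξ v s t‖ ≤ k * √(y0 G v + s)
  per : ∀ v s t, ξ v s (t + 2 * π) = ξ v s t
  conj : ∀ v ∈ Dom G, ∀ s ≥ 0, ∀ t, ξ (starRingEnd ℂ v) s t = starRingEnd ℂ (ξ v s t)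

lemma NN_all (hG : 10 ^ 20 ≤ G) (hv : v ∈ Dom G) {s k : ℝ} (hs : 0 ≤ s) (hk : k ≤ 10 ^ 16 / G ^ 2) (t : ℝ)
    {x y : ℂ} (hx : ‖x‖ ≤ k * √(y0 G v + s)) (hy : ‖y‖ ≤ k * √(y0 G v + s)) :
    ‖x‖ ≤ ‖rh G (v + s)‖ / 2 ∧ 8 ≤ ‖rh G (v + s)‖ ∧ ‖NN G (qq t) (rh G (v + s)) x - NN G (qq t) (rh G (v + s)) y‖
      ≤ 10 ^ 23 / (√G ^ 5 * √(y0 G v + s) ^ 4) * ‖x - y‖ := by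
  obtain ⟨a1, a2, a3, a4, a5, a6⟩ := base hG hv hs
  have hk' : k ≤ 10 ^ 16 / √G ^ 4 := by
    rwa [show √G ^ 4 = (√G ^ 2) ^ 2 by ring, ← a3]
  have := NN_lip_abs (r := rh G (v + s)) a1 a2 a3 (qq_nonneg t) (qq_le_one t) a4 a5 hk' hx hy
  exact ⟨this.1, by nlinarith, this.2⟩

lemma NN_w (hG : 10 ^ 20 ≤ G) (hv : v ∈ Dom G) {s k : ℝ} (hs : 0 ≤ s) (hk : k ≤ 10 ^ 16 / G ^ 2) (t : ℝ)
    {x : ℂ} (hx : ‖x‖ ≤ k * √(y0 G v + s)) :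
    rh G (v + s) + x ≠ 0 ∧ ‖((qq t : ℝ):ℂ) / (rh G (v + s) + x) ^ 2‖ < 1 := by
  obtain ⟨h1, h2, -⟩ := NN_all hG hv hs hk t hx hx
  have h3 := half_norm h1
  exact ⟨norm_pos_iff.1 (by linarith), by
    linarith [(w_le (qq_nonneg t) (qq_le_one t) (R := ‖rh G (v + s)‖ / 2) (by linarith) h3).2]⟩

lemma Nx_cont (hG : 10 ^ 20 ≤ G) {k : ℝ} (hk : k ≤ 10 ^ 16 / G ^ 2) (hξ : Good G k ξ) :
    ContinuousOn (fun p : ℂ × ℝ × ℝ => Nx G ξ p.1 p.2.1 p.2.2) (Dom G ×ˢ univ ×ˢ Ici 0) := by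
  have hG0 : 0 < G := by linarith
  rintro ⟨v, t, x⟩ ⟨hv, -, hx⟩
  simp only [mem_Ici] at hx hv
  have hw := NN_w hG hv hx hk (t + x) (hξ.bd v hv x hx t)
  refine ContinuousAt.comp_continuousWithinAt (f := fun p : ℂ × ℝ × ℝ => (qq (p.2.1 + p.2.2), rh G (p.1 + p.2.2), ξ p.1 p.2.2 p.2.1))
    (g := fun p : ℝ × ℂ × ℂ => NN G p.1 p.2.1 p.2.2) (NN_contAt (rh_ne hG0 (Dom_add hv x)) hw.1 hw.2) ?_
  refine ContinuousWithinAt.prodMk ?_ (ContinuousWithinAt.prodMk ?_ ?_)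
  · exact (qq_cont.comp (by fun_prop : Continuous fun p : ℂ × ℝ × ℝ => p.2.1 + p.2.2)).continuousWithinAt
  · exact (ContinuousAt.comp (f := fun p : ℂ × ℝ × ℝ => p.1 + (p.2.2:ℂ)) (rh_contAt hG0 (Dom_add hv x)) (by fun_prop)).continuousWithinAt
  · have := hξ.cont (v, x, t) ⟨hv, hx, mem_univ _⟩
    exact ContinuousWithinAt.comp (f := fun p : ℂ × ℝ × ℝ => (p.1, p.2.2, p.2.1)) (x := (v, t, x)) this (by fun_prop)
      (fun p hp => ⟨hp.1, hp.2.2, mem_univ _⟩)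

lemma Nx_hol (hG : 10 ^ 20 ≤ G) {k : ℝ} (hk : k ≤ 10 ^ 16 / G ^ 2) (hξ : Good G k ξ) (t : ℝ) {x : ℝ} (hx : 0 ≤ x) :
    DifferentiableOn ℂ (fun v => Nx G ξ v t x) (Dom G) := by
  have hG0 : 0 < G := by linarith
  intro v hv
  have hw := NN_w hG hv hx hk (t + x) (hξ.bd v hv x hx t)
  have h1 : DifferentiableWithinAt ℂ (fun v => ξ v x t) (Dom G) v := hξ.hol x hx t v hv
  have hr := (rh_deriv hG0 (Dom_add hv x)).comp_add_const v (x:ℂ)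
  have h2 : DifferentiableWithinAt ℂ (fun v => rh G (v + x)) (Dom G) v := hr.differentiableAt.differentiableWithinAt
  unfold Nx NN
  refine DifferentiableWithinAt.sub (DifferentiableWithinAt.sub ?_ ?_) (DifferentiableWithinAt.mul ?_ h1)
  · exact (FF_deriv hw.1 hw.2).differentiableAt.comp_differentiableWithinAt (f := fun v => rh G (v + x) + ξ v x t) v (h2.add h1)
  · exact (F0_deriv (rh_ne hG0 (Dom_add hv x))).differentiableAt.comp_differentiableWithinAt v h2
  · exact (F0'_diff (rh_ne hG0 (Dom_add hv x))).comp_differentiableWithinAt v h2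

lemma Nx_le (hG : 10 ^ 20 ≤ G) {k : ℝ} (hk0 : 0 ≤ k) (hk : k ≤ 10 ^ 16 / G ^ 2) (t : ℝ) {s : ℝ} (hs : 0 ≤ s)
    (hv : v ∈ Dom G) {x : ℂ} (hx : ‖x‖ ≤ k * √(y0 G v + s)) :
    ‖NN G (qq t) (rh G (v + s)) x‖ ≤ 30000 / G ^ 2 * (1 / √(y0 G v + s) ^ 3) ∧
    ‖NN G (qq t) (rh G (v + s)) x - NN G (qq t) (rh G (v + s)) 0‖ ≤ 10 ^ 39 / √G ^ 9 * (1 / √(y0 G v + s) ^ 3) := by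
  obtain ⟨a1, a2, a3, a4, a5, a6⟩ := base hG hv hs
  have h0 : ‖(0:ℂ)‖ ≤ k * √(y0 G v + s) := by simp; positivity
  have h1 := (NN_all hG hv hs hk t hx h0).2.2
  have h2 := (NN0_abs (G := G) a1 a2 (qq_nonneg t) (qq_le_one t) a4).1
  set a := √G
  set b := √(y0 G v + s)
  have ha : 0 < a := by linarith
  have hb : 0 < b := by linarith
  have hx' : ‖x - 0‖ ≤ 10 ^ 16 / a ^ 4 * b := by
    rw [sub_zero]; refine hx.trans ?_
    rw [show a ^ 4 = (a ^ 2) ^ 2 by ring, ← a3]; gcongr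
  have h3 : ‖NN G (qq t) (rh G (v + s)) x - NN G (qq t) (rh G (v + s)) 0‖ ≤ 10 ^ 39 / a ^ 9 * (1 / b ^ 3) := by
    refine h1.trans ?_
    calc _ ≤ 10 ^ 23 / (a ^ 5 * b ^ 4) * (10 ^ 16 / a ^ 4 * b) := by gcongr
      _ = _ := by field_simp
  refine ⟨?_, h3⟩
  have h4 : ‖NN G (qq t) (rh G (v + s)) 0‖ ≤ 21609 / a ^ 4 * (1 / b ^ 3) := by
    refine h2.trans ?_
    rw [mul_pow, div_mul_div_comm, mul_one]
    gcongr; norm_num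
  have h5 : (10:ℝ) ^ 39 / a ^ 9 ≤ 1 / a ^ 4 := by
    rw [div_le_div_iff₀ (by positivity) (by positivity)]
    calc (10:ℝ) ^ 39 * a ^ 4 ≤ (10 ^ 10) ^ 5 * a ^ 4 := by gcongr; norm_num
      _ ≤ a ^ 5 * a ^ 4 := by gcongr
      _ = _ := by ring
  have h6 : G ^ 2 = a ^ 4 := by nth_rewrite 1 [a3]; ring
  rw [h6]
  calc ‖NN G (qq t) (rh G (v + s)) x‖ ≤ _ + _ := norm_le_norm_add_norm_sub' _ (NN G (qq t) (rh G (v + s)) 0)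
    _ ≤ 21609 / a ^ 4 * (1 / b ^ 3) + 1 / a ^ 4 * (1 / b ^ 3) := by
        refine add_le_add h4 (h3.trans (by gcongr))
    _ = 21610 / a ^ 4 * (1 / b ^ 3) := by ring
    _ ≤ _ := by gcongr; norm_num
end

open Real Filter MeasureTheory Set Topology

section
variable {G : ℝ} {v : ℂ} {ξ : ℂ → ℝ → ℝ → ℂ}

lemma pw_conj (a : ℝ) {w : ℂ} (hw : ‖w‖ < 1) : pw a (starRingEnd ℂ w) = starRingEnd ℂ (pw a w) := by
  unfold pw
  rw [show (1:ℂ) + starRingEnd ℂ w = starRingEnd ℂ (1 + w) by simp,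
    Complex.conj_cpow _ _ (Complex.slitPlane_arg_ne_pi (pw_slit hw)), Complex.conj_ofReal]

lemma NN_conj {q : ℝ} {r x : ℂ} (hw : ‖(q:ℂ) / (r + x) ^ 2‖ < 1) :
    NN G q (starRingEnd ℂ r) (starRingEnd ℂ x) = starRingEnd ℂ (NN G q r x) := by
  have := pw_conj (-3 / 2) hw
  simp only [map_div₀, map_pow, map_add, Complex.conj_ofReal] at this
  unfold NN FF F0 F0'
  simp only [map_sub, map_mul, map_div₀, map_pow, map_add, map_neg, map_one, Complex.conj_ofReal, this, Complex.conj_ofNat]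

lemma Gr_conj (hG : 0 < G) (hv : v ∈ Dom G) (s x : ℝ) : Gr G (starRingEnd ℂ v) s x = starRingEnd ℂ (Gr G v s x) := by
  unfold Gr
  rw [map_mul, ← e1_conj hG (Dom_add hv _), ← zt_conj hG (Dom_im hv) (Dom_add hv _)]
  simp only [map_add, Complex.conj_ofReal]

/-- bound of integrand -/
lemma GN_le (hG : 10 ^ 20 ≤ G) (hv : v ∈ Dom G) {s x : ℝ} (hs : 0 ≤ s) (hx : 0 ≤ x) {n : ℂ} {c : ℝ}
    (hn : ‖n‖ ≤ c * (1 / √(y0 G v + x) ^ 3)) :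
    ‖Gr G v s x * n‖ ≤ 3 * 10 ^ 10 * c * (y0 G v + min s x) * (1 / √(y0 G v + x) ^ 3) := by
  rw [norm_mul]
  have h1 := Gr_le (by linarith) hv hs hx
  have h2 : 0 ≤ y0 G v + min s x := by linarith [Dom_y0 hv, le_min hs hx]
  calc _ ≤ 3 * 10 ^ 10 * (y0 G v + min s x) * (c * (1 / √(y0 G v + x) ^ 3)) := by gcongr
    _ = _ := by ring

lemma GN_dom (hG : 10 ^ 20 ≤ G) (hv : v ∈ Dom G) {s x S : ℝ} (hs : 0 ≤ s) (hS : s ≤ S) (hx : 0 ≤ x) {n : ℂ} {c : ℝ} (hc : 0 ≤ c)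
    (hn : ‖n‖ ≤ c * (1 / √(y0 G v + x) ^ 3)) :
    ‖Gr G v s x * n‖ ≤ 3 * 10 ^ 10 * c * (G ^ 3 / 3 + S) * (1 / √(1 + x) ^ 3) := by
  have hy := Dom_y0 hv
  have hy' : y0 G v ≤ G ^ 3 / 3 := y0_le
  refine (GN_le hG hv hs hx hn).trans ?_
  have hS0 : 0 ≤ S := hs.trans hS
  gcongr
  exact (min_le_left _ _).trans hS

lemma Nx_bd (hG : 10 ^ 20 ≤ G) {k : ℝ} (hk0 : 0 ≤ k) (hk : k ≤ 10 ^ 16 / G ^ 2) (hξ : Good G k ξ) (hv : v ∈ Dom G) (t : ℝ)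
    {x : ℝ} (hx : 0 ≤ x) : ‖Nx G ξ v t x‖ ≤ 30000 / G ^ 2 * (1 / √(y0 G v + x) ^ 3) :=
  (Nx_le hG hk0 hk (t + x) hx hv (hξ.bd v hv x hx t)).1

lemma GN_cont (hG : 10 ^ 20 ≤ G) {k : ℝ} (hk : k ≤ 10 ^ 16 / G ^ 2) (hξ : Good G k ξ) :
    ContinuousOn (fun p : (ℂ × ℝ × ℝ) × ℝ => Gr G p.1.1 p.1.2.1 p.2 * Nx G ξ p.1.1 p.1.2.2 p.2)
      ((Dom G ×ˢ Ici 0 ×ˢ univ) ×ˢ Ici 0) := by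
  refine ContinuousOn.mul ?_ ?_
  · exact (Gr_cont (by linarith)).comp (f := fun p : (ℂ × ℝ × ℝ) × ℝ => (p.1.1, p.1.2.1, p.2)) (by fun_prop)
      (fun p hp => ⟨hp.1.1, mem_univ _⟩)
  · exact (Nx_cont hG hk hξ).comp (f := fun p : (ℂ × ℝ × ℝ) × ℝ => (p.1.1, p.1.2.2, p.2)) (by fun_prop)
      (fun p hp => ⟨hp.1.1, mem_univ _, hp.2⟩)

lemma GN_meas (hG : 10 ^ 20 ≤ G) {k : ℝ} (hk : k ≤ 10 ^ 16 / G ^ 2) (hξ : Good G k ξ) (hv : v ∈ Dom G) {s t : ℝ} (hs : 0 ≤ s) :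
    AEStronglyMeasurable (fun x => Gr G v s x * Nx G ξ v t x) (volume.restrict (Ioi 0)) := by
  refine ContinuousOn.aestronglyMeasurable ?_ measurableSet_Ioi
  exact (GN_cont hG hk hξ).comp (f := fun x : ℝ => ((v, s, t), x)) (by fun_prop)
    (fun x hx => ⟨⟨hv, hs, mem_univ _⟩, mem_Ici.2 (le_of_lt hx)⟩)

set_option maxHeartbeats 800000 in
lemma TT_good (hG : 10 ^ 20 ≤ G) {k : ℝ} (hk0 : 4 * 10 ^ 15 / G ^ 2 ≤ k) (hk : k ≤ 10 ^ 16 / G ^ 2) (hξ : Good G k ξ) :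
    Good G k (TT G ξ) := by
  have hG0 : 0 < G := by linarith
  have hk00 : 0 ≤ k := le_trans (by positivity) hk0
  have hc0 : 0 ≤ 30000 / G ^ 2 := by positivity
  have hdi : ∀ S : ℝ, Integrable (fun x => 3 * 10 ^ 10 * (30000 / G ^ 2) * (G ^ 3 / 3 + S) * (1 / √(1 + x) ^ 3)) (volume.restrict (Ioi 0)) :=
    fun S => (w32 one_pos le_rfl).1.const_mul _
  refine ⟨?_, ?_, ?_, ?_, ?_⟩
  · intro s hs t
    unfold TT
    refine DifferentiableOn.neg (holo_integral Dom_open ?_ (fun v hv => GN_meas hG hk hξ hv hs) (hdi s) ?_)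
    · refine (ae_restrict_iff' measurableSet_Ioi).2 (Eventually.of_forall fun x hx => ?_)
      exact (Gr_hol (by linarith) s x).mul (Nx_hol hG hk hξ t (le_of_lt hx))
    · refine (ae_restrict_iff' measurableSet_Ioi).2 (Eventually.of_forall fun x hx w hw => ?_)
      exact GN_dom hG hw hs le_rfl (le_of_lt hx) hc0 (Nx_bd hG hk00 hk hξ hw t (le_of_lt hx))
  · rintro ⟨v, s, t⟩ ⟨hv, hs, -⟩
    unfold TT
    refine ContinuousWithinAt.neg (continuousWithinAt_of_dominated (bound := fun x => 3 * 10 ^ 10 * (30000 / G ^ 2) * (G ^ 3 / 3 + (s + 1)) * (1 / √(1 + x) ^ 3)) ?_ ?_ (hdi _) ?_)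
    · filter_upwards [self_mem_nhdsWithin] with p hp
      exact GN_meas hG hk hξ hp.1 hp.2.1
    · have : ∀ᶠ p : ℂ × ℝ × ℝ in 𝓝[Dom G ×ˢ Ici 0 ×ˢ univ] (v, s, t), p.2.1 < s + 1 :=
        nhdsWithin_le_nhds ((isOpen_lt (by fun_prop : Continuous fun p : ℂ × ℝ × ℝ => p.2.1) continuous_const).mem_nhds (by simp))
      filter_upwards [self_mem_nhdsWithin, this] with p hp hp2
      refine (ae_restrict_iff' measurableSet_Ioi).2 (Eventually.of_forall fun x hx => ?_)
      exact GN_dom hG hp.1 hp.2.1 hp2.le (le_of_lt hx) hc0 (Nx_bd hG hk00 hk hξ hp.1 _ (le_of_lt hx))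
    · refine (ae_restrict_iff' measurableSet_Ioi).2 (Eventually.of_forall fun x hx => ?_)
      exact ((GN_cont hG hk hξ) ((v, s, t), x) ⟨⟨hv, hs, mem_univ _⟩, mem_Ici.2 (le_of_lt hx)⟩).comp
        (f := fun p : ℂ × ℝ × ℝ => (p, x)) (x := (v, s, t)) (by fun_prop) (fun p hp => ⟨hp, mem_Ici.2 (le_of_lt hx)⟩)
  · intro v hv s hs t
    unfold TT
    rw [norm_neg]
    refine ((Blem (by linarith [Dom_y0 hv]) hs (by positivity) (GN_meas hG hk hξ hv hs)
      (fun x hx => GN_le hG hv hs (le_of_lt hx) (Nx_bd hG hk00 hk hξ hv t (le_of_lt hx)))).2).trans ?_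
    gcongr
    refine le_trans ?_ hk0
    rw [show 4 * (3 * 10 ^ 10 * (30000 / G ^ 2)) = 36 * 10 ^ 14 / G ^ 2 by ring]
    exact div_le_div_of_nonneg_right (by norm_num) (by positivity)
  · intro v s t
    unfold TT Nx
    congr 2; ext x
    rw [hξ.per, show t + 2 * π + x = t + x + 2 * π by ring, qq_per]
  · intro v hv s hs t
    unfold TT
    rw [map_neg, ← integral_conj]
    congr 1
    refine setIntegral_congr_fun measurableSet_Ioi fun x hx => ?_
    have hx : 0 ≤ x := le_of_lt hx
    have hw := NN_w hG hv hx hk (t + x) (hξ.bd v hv x hx t)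
    have e : starRingEnd ℂ v + (x:ℂ) = starRingEnd ℂ (v + x) := by rw [map_add, Complex.conj_ofReal]
    have h2 : Nx G ξ (starRingEnd ℂ v) t x = starRingEnd ℂ (Nx G ξ v t x) := by
      unfold Nx
      rw [hξ.conj v hv x hx t, e, rh_conj hG0 (Dom_add hv x), NN_conj hw.2]
    have h1 := Gr_conj hG0 hv s x
    generalize Gr G (starRingEnd ℂ v) s x = A, Gr G v s x = B, Nx G ξ (starRingEnd ℂ v) t x = C, Nx G ξ v t x = D at h1 h2
    simp only [h1, h2, map_mul]
end

open Real Filter MeasureTheory Set Topology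

noncomputable def NI (G : ℝ) (v : ℂ) (t : ℝ) (η : ℝ → ℂ) (x : ℝ) : ℂ :=
  NN G (qq (t + x)) (rh G (v + x)) (η x)
/-- admissible functions -/
def Adm (G k : ℝ) (v : ℂ) (η : ℝ → ℂ) : Prop :=
  ContinuousOn η (Ici 0) ∧ ∀ s ≥ 0, ‖η s‖ ≤ k * √(y0 G v + s)

section
variable {G : ℝ} {v : ℂ} {ξ : ℂ → ℝ → ℝ → ℂ} {k t : ℝ} {η ζ : ℝ → ℂ}

lemma Good.adm (hξ : Good G k ξ) (hv : v ∈ Dom G) (t : ℝ) : Adm G k v (fun s => ξ v s t) :=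
  ⟨hξ.cont.comp (f := fun s : ℝ => (v, s, t)) (by fun_prop) (fun s hs => ⟨hv, hs, mem_univ _⟩), fun s hs => hξ.bd v hv s hs t⟩

lemma NI_cont (hG : 10 ^ 20 ≤ G) (hk : k ≤ 10 ^ 16 / G ^ 2) (hv : v ∈ Dom G) (hη : Adm G k v η) :
    ContinuousOn (NI G v t η) (Ici 0) := by
  have hG0 : 0 < G := by linarith
  intro x hx
  have hx : 0 ≤ x := hx
  have hw := NN_w hG hv hx hk (t + x) (hη.2 x hx)
  refine ContinuousAt.comp_continuousWithinAt (f := fun x : ℝ => (qq (t + x), rh G (v + x), η x))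
    (g := fun p : ℝ × ℂ × ℂ => NN G p.1 p.2.1 p.2.2) (NN_contAt (rh_ne hG0 (Dom_add hv x)) hw.1 hw.2) ?_
  refine ContinuousWithinAt.prodMk ?_ (ContinuousWithinAt.prodMk ?_ (hη.1 x hx))
  · exact (qq_cont.comp (by fun_prop : Continuous fun p : ℝ => t + p)).continuousWithinAt
  · exact (ContinuousAt.comp (f := fun p : ℝ => v + (p:ℂ)) (rh_contAt hG0 (Dom_add hv x)) (by fun_prop)).continuousWithinAt

lemma NI_bd (hG : 10 ^ 20 ≤ G) (hk0 : 0 ≤ k) (hk : k ≤ 10 ^ 16 / G ^ 2) (hv : v ∈ Dom G) (hη : Adm G k v η)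
    {x : ℝ} (hx : 0 ≤ x) : ‖NI G v t η x‖ ≤ 30000 / G ^ 2 * (1 / √(y0 G v + x) ^ 3) :=
  (Nx_le hG hk0 hk (t + x) hx hv (hη.2 x hx)).1

lemma Gr_cont1 (hG : 100 ≤ G) (hv : v ∈ Dom G) (s : ℝ) : Continuous (Gr G v s) := by
  rw [← continuousOn_univ]
  exact (Gr_cont hG).comp (f := fun x : ℝ => (v, s, x)) (by fun_prop) (fun x _ => ⟨hv, mem_univ _⟩)

lemma GI_meas {g : ℝ → ℂ} (hG : 10 ^ 20 ≤ G) (hv : v ∈ Dom G) (s : ℝ) (hg : ContinuousOn g (Ici 0)) :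
    AEStronglyMeasurable (fun x => Gr G v s x * g x) (volume.restrict (Ioi 0)) :=
  ContinuousOn.aestronglyMeasurable ((Gr_cont1 (by linarith) hv s).continuousOn.mul (hg.mono Ioi_subset_Ici_self)) measurableSet_Ioi

/-- integrability and bound for Green integral -/
lemma GI {g : ℝ → ℂ} {c : ℝ} (hc : 0 ≤ c) (hG : 10 ^ 20 ≤ G) (hv : v ∈ Dom G) {s : ℝ} (hs : 0 ≤ s) (hg : ContinuousOn g (Ici 0))
    (hb : ∀ x ≥ 0, ‖g x‖ ≤ c * (1 / √(y0 G v + x) ^ 3)) :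
    IntegrableOn (fun x => Gr G v s x * g x) (Ioi 0) ∧ ‖∫ x in Ioi 0, Gr G v s x * g x‖ ≤ 4 * (3 * 10 ^ 10 * c) * √(y0 G v + s) :=
  Blem (by linarith [Dom_y0 hv]) hs (by positivity) (GI_meas hG hv s hg)
      (fun x hx => GN_le hG hv hs (le_of_lt hx) (hb x (le_of_lt hx)))

lemma contr (hG : 10 ^ 20 ≤ G) (hk0 : 0 ≤ k) (hk : k ≤ 10 ^ 16 / G ^ 2) (hv : v ∈ Dom G) (hη : Adm G k v η) (hζ : Adm G k v ζ)
    {D : ℝ} (hD : 0 ≤ D) (hd : ∀ s ≥ 0, ‖η s - ζ s‖ ≤ D * √(y0 G v + s)) {s : ℝ} (hs : 0 ≤ s) :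
    ‖(-∫ x in Ioi 0, Gr G v s x * NI G v t η x) - (-∫ x in Ioi 0, Gr G v s x * NI G v t ζ x)‖ ≤ D / 2 * √(y0 G v + s) := by
  have c0 : (0:ℝ) ≤ 30000 / G ^ 2 := by positivity
  have i1 := (GI c0 hG hv hs (NI_cont (t := t) hG hk hv hη) (fun x hx => NI_bd hG hk0 hk hv hη hx)).1
  have i2 := (GI c0 hG hv hs (NI_cont (t := t) hG hk hv hζ) (fun x hx => NI_bd hG hk0 hk hv hζ hx)).1
  rw [← neg_sub', norm_neg, ← integral_sub i1 i2]
  simp only [← mul_sub]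
  refine ((GI (c := 10 ^ 23 / √G ^ 5 * D) (by positivity) hG hv hs
    ((NI_cont (t := t) hG hk hv hη).sub (NI_cont (t := t) hG hk hv hζ)) ?_).2).trans ?_
  · intro x hx
    obtain ⟨a1, a2, -⟩ := base hG hv hx
    refine (NN_all hG hv hx hk (t + x) (hη.2 x hx) (hζ.2 x hx)).2.2.trans ?_
    have hb : 0 < √(y0 G v + x) := by linarith
    have ha : 0 < √G := by linarith
    calc _ ≤ 10 ^ 23 / (√G ^ 5 * √(y0 G v + x) ^ 4) * (D * √(y0 G v + x)) := by
          gcongr; exact hd x hx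
      _ = _ := by field_simp
  · have ha := (base hG hv hs).1
    have h5 : (10:ℝ) ^ 23 / √G ^ 5 ≤ 1 / 10 ^ 27 := by
      rw [div_le_div_iff₀ (by positivity) (by positivity)]
      calc (10:ℝ) ^ 23 * 10 ^ 27 = (10 ^ 10) ^ 5 := by norm_num
        _ ≤ √G ^ 5 := by gcongr
        _ = _ := by ring
    gcongr
    calc 4 * (3 * 10 ^ 10 * (10 ^ 23 / √G ^ 5 * D)) ≤ 4 * (3 * 10 ^ 10 * (1 / 10 ^ 27 * D)) := by gcongr
      _ ≤ _ := by linarith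

lemma uniq_fix (hG : 10 ^ 20 ≤ G) (hk0 : 0 ≤ k) (hk : k ≤ 10 ^ 16 / G ^ 2) (hv : v ∈ Dom G) (hη : Adm G k v η) (hζ : Adm G k v ζ)
    (e1 : ∀ s ≥ 0, η s = -∫ x in Ioi 0, Gr G v s x * NI G v t η x)
    (e2 : ∀ s ≥ 0, ζ s = -∫ x in Ioi 0, Gr G v s x * NI G v t ζ x) : ∀ s ≥ 0, η s = ζ s := by
  have key : ∀ n : ℕ, ∀ s ≥ 0, ‖η s - ζ s‖ ≤ 2 * k / 2 ^ n * √(y0 G v + s) := by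
    intro n
    induction n with
    | zero => intro s hs; refine (norm_sub_le _ _).trans ?_; linarith [hη.2 s hs, hζ.2 s hs]
    | succ n ih =>
      intro s hs
      have := contr (t := t) hG hk0 hk hv hη hζ (by positivity) ih hs
      rw [← e1 s hs, ← e2 s hs] at this
      refine this.trans (le_of_eq ?_); rw [pow_succ]; ring
  intro s hs
  rw [← sub_eq_zero, ← norm_le_zero_iff]
  have hl : Tendsto (fun n : ℕ => 2 * k / 2 ^ n * √(y0 G v + s)) atTop (𝓝 0) := by
    have := (tendsto_pow_atTop_nhds_zero_of_lt_one (by norm_num : (0:ℝ) ≤ 1/2) (by norm_num)).mul_const (2 * k * √(y0 G v + s))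
    rw [zero_mul] at this
    refine this.congr fun n => ?_
    simp only [one_div, inv_pow]; ring
  exact ge_of_tendsto hl (Eventually.of_forall fun n => key n s hs)

/-- Picard iterates -/
noncomputable def xin (G : ℝ) : ℕ → ℂ → ℝ → ℝ → ℂ
  | 0 => fun _ _ _ => 0
  | n + 1 => TT G (xin G n)
noncomputable def xi (G : ℝ) (v : ℂ) (s t : ℝ) : ℂ := limUnder atTop (fun n => xin G n v s t)
noncomputable def k0 (G : ℝ) : ℝ := 4 * 10 ^ 15 / G ^ 2

lemma xin_good (hG : 10 ^ 20 ≤ G) (n : ℕ) : Good G (k0 G) (xin G n) := by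
  have hG0 : 0 < G := by linarith
  induction n with
  | zero =>
    refine ⟨fun s _ t => differentiableOn_const _, continuousOn_const, fun v hv s hs t => ?_, fun v s t => rfl, fun v hv s hs t => by simp [xin]⟩
    simp only [xin, norm_zero]; unfold k0; positivity
  | succ n ih => exact TT_good hG le_rfl (by unfold k0; gcongr; norm_num) ih

lemma k0_le (hG : 10 ^ 20 ≤ G) : 0 ≤ k0 G ∧ k0 G ≤ 10 ^ 16 / G ^ 2 ∧ 2 * k0 G ≤ 10 ^ 16 / G ^ 2 := by
  have hG0 : 0 < G := by linarith
  have : 0 ≤ 10 ^ 15 / G ^ 2 := by positivity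
  refine ⟨by unfold k0; positivity, ?_, ?_⟩
  · unfold k0; rw [show 4 * 10 ^ 15 / G ^ 2 = 4 * (10 ^ 15 / G ^ 2) by ring, show 10 ^ 16 / G ^ 2 = 10 * (10 ^ 15 / G ^ 2) by ring]; linarith
  · unfold k0; rw [show 4 * 10 ^ 15 / G ^ 2 = 4 * (10 ^ 15 / G ^ 2) by ring, show 10 ^ 16 / G ^ 2 = 10 * (10 ^ 15 / G ^ 2) by ring]; linarith

lemma xin_step (hG : 10 ^ 20 ≤ G) (hv : v ∈ Dom G) (t : ℝ) (n : ℕ) : ∀ s ≥ 0,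
    ‖xin G (n + 1) v s t - xin G n v s t‖ ≤ k0 G * √(y0 G v + s) / 2 ^ n := by
  obtain ⟨h0, h1, -⟩ := k0_le hG
  induction n with
  | zero => intro s hs; simpa [xin] using (xin_good hG 1).bd v hv s hs t
  | succ n ih =>
    intro s hs
    have := contr (t := t) (D := k0 G / 2 ^ n) hG h0 h1 hv ((xin_good hG (n + 1)).adm hv t) ((xin_good hG n).adm hv t) (by positivity)
      (fun s hs => (ih s hs).trans (le_of_eq (by ring))) hs
    refine le_trans (le_of_eq ?_) (this.trans (le_of_eq ?_))
    · rfl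
    · rw [pow_succ]; ring

lemma xi_lim (hG : 10 ^ 20 ≤ G) (hv : v ∈ Dom G) {s : ℝ} (hs : 0 ≤ s) (t : ℝ) :
    Tendsto (fun n => xin G n v s t) atTop (𝓝 (xi G v s t)) ∧
    ∀ n, ‖xin G n v s t - xi G v s t‖ ≤ k0 G * √(y0 G v + s) * 2 / 2 ^ n := by
  have hc : ∀ n, dist (xin G n v s t) (xin G (n + 1) v s t) ≤ k0 G * √(y0 G v + s) * 2 / 2 / 2 ^ n := by
    intro n; rw [dist_comm, dist_eq_norm, mul_div_assoc _ 2 2, div_self two_ne_zero, mul_one]; exact xin_step hG hv t n s hs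
  have hcs := cauchySeq_of_le_geometric_two hc
  have hl := hcs.tendsto_limUnder
  refine ⟨hl, fun n => ?_⟩
  have := dist_le_of_le_geometric_two_of_tendsto hc hl n
  rwa [dist_eq_norm] at this
end

open Real Filter MeasureTheory Set Topology

section
variable {G : ℝ} {v : ℂ}

lemma geo0 (c : ℝ) : Tendsto (fun n : ℕ => c * 2 / 2 ^ n) atTop (𝓝 0) := by
  have := (tendsto_pow_atTop_nhds_zero_of_lt_one (by norm_num : (0:ℝ) ≤ 1/2) (by norm_num)).mul_const (c * 2)
  rw [zero_mul] at this
  refine this.congr fun n => ?_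
  simp only [one_div, inv_pow]; ring

lemma xi_good (hG : 10 ^ 20 ≤ G) : Good G (k0 G) (xi G) := by
  obtain ⟨hk0, -, -⟩ := k0_le hG
  refine ⟨?_, ?_, ?_, ?_, ?_⟩
  · intro s hs t
    have hu : TendstoUniformlyOn (fun n v => xin G n v s t) (fun v => xi G v s t) atTop (Dom G) := by
      rw [Metric.tendstoUniformlyOn_iff]
      intro ε hε
      filter_upwards [(geo0 (k0 G * √(G ^ 3 / 3 + s))).eventually (gt_mem_nhds hε)] with n hn v hv
      rw [dist_comm, dist_eq_norm]
      refine lt_of_le_of_lt (((xi_lim hG hv hs t).2 n).trans ?_) hn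
      have hy' : y0 G v ≤ G ^ 3 / 3 := y0_le
      gcongr
    exact hu.tendstoLocallyUniformlyOn.differentiableOn (Eventually.of_forall fun n => (xin_good hG n).hol s hs t) Dom_open
  · have hu : TendstoLocallyUniformlyOn (fun n (p : ℂ × ℝ × ℝ) => xin G n p.1 p.2.1 p.2.2) (fun p => xi G p.1 p.2.1 p.2.2) atTop
        (Dom G ×ˢ Ici 0 ×ˢ univ) := by
      rw [Metric.tendstoLocallyUniformlyOn_iff]
      rintro ε hε ⟨v, s, t⟩ hp
      refine ⟨{p | p.2.1 < s + 1} ∩ (Dom G ×ˢ Ici 0 ×ˢ univ), inter_mem (nhdsWithin_le_nhds ((isOpen_lt (by fun_prop : Continuous fun p : ℂ × ℝ × ℝ => p.2.1) continuous_const).mem_nhds (by simp))) self_mem_nhdsWithin, ?_⟩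
      filter_upwards [(geo0 (k0 G * √(G ^ 3 / 3 + (s + 1)))).eventually (gt_mem_nhds hε)] with n hn
      rintro ⟨v', s', t'⟩ ⟨h1, h2, h3, -⟩
      rw [dist_comm, dist_eq_norm]
      simp only [mem_setOf_eq] at h1
      refine lt_of_le_of_lt (((xi_lim hG h2 h3 t').2 n).trans ?_) hn
      have hy' : y0 G v' ≤ G ^ 3 / 3 := y0_le
      gcongr
    exact hu.continuousOn (Eventually.of_forall fun n => (xin_good hG n).cont).frequently
  · intro v hv s hs t
    exact le_of_tendsto (xi_lim hG hv hs t).1.norm (Eventually.of_forall fun n => (xin_good hG n).bd v hv s hs t)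
  · intro v s t
    unfold xi
    congr 1; ext n; exact (xin_good hG n).per v s t
  · intro v hv s hs t
    refine tendsto_nhds_unique (xi_lim hG (Dom_conj hv) hs t).1 ?_
    refine ((Complex.continuous_conj.tendsto _).comp (xi_lim hG hv hs t).1).congr fun n => ?_
    exact ((xin_good hG n).conj v hv s hs t).symm

lemma xi_fix (hG : 10 ^ 20 ≤ G) (hv : v ∈ Dom G) {s : ℝ} (hs : 0 ≤ s) (t : ℝ) :
    xi G v s t = -∫ x in Ioi 0, Gr G v s x * NI G v t (fun s => xi G v s t) x := by
  obtain ⟨hk0, hk1, -⟩ := k0_le hG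
  refine tendsto_nhds_unique ((tendsto_add_atTop_iff_nat 1).2 (xi_lim hG hv hs t).1) ?_
  rw [tendsto_iff_norm_sub_tendsto_zero]
  refine squeeze_zero (fun n => norm_nonneg _) (fun n => ?_) (geo0 (k0 G / 2 * √(y0 G v + s)))
  have := contr (t := t) (D := k0 G * 2 / 2 ^ n) hG hk0 hk1 hv ((xin_good hG n).adm hv t) ((xi_good hG).adm hv t) (by positivity)
    (fun s hs => ((xi_lim hG hv hs t).2 n).trans (le_of_eq (by ring))) hs
  refine this.trans (le_of_eq (by ring))
end

open Real Filter MeasureTheory Set Topology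

section
variable {G : ℝ} {v : ℂ}

lemma along {f : ℂ → ℂ} {f' v : ℂ} {s : ℝ} (h : HasDerivAt f f' (v + s)) : HasDerivAt (fun x : ℝ => f (v + x)) f' s := by
  have h2 : HasDerivAt (fun x : ℂ => f (v + x)) f' (s:ℂ) := HasDerivAt.comp_const_add v (s:ℂ) h
  exact h2.comp_ofReal

lemma ph_ne (hG : 100 ≤ G) (hv : v ∈ Dom G) : ph G v ≠ 0 := by
  intro h
  have := (K5 hG hv).1
  rw [h] at this; simp at this; nlinarith

set_option maxHeartbeats 800000 in
lemma green {g : ℝ → ℂ} {c : ℝ} (hc : 0 ≤ c) (hG : 10 ^ 20 ≤ G) (hv : v ∈ Dom G) (hg : ContinuousOn g (Ici 0))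
    (hb : ∀ x ≥ 0, ‖g x‖ ≤ c * (1 / √(y0 G v + x) ^ 3)) :
    ∃ w w' : ℝ → ℂ, (∀ s, HasDerivAt w (w' s) s) ∧ (∀ s : ℝ, 0 ≤ s → HasDerivAt w' (F0' G (rh G (v + s)) * w s + g s) s) ∧
      (∀ s ≥ 0, w s = -∫ x in Ioi 0, Gr G v s x * g x) ∧ w' 0 = 0 ∧
      w 0 * ph G v = ∫ x in Ioi 0, e1 G (v + (x:ℝ)) * g x := by
  have hG1 : 100 ≤ G := by linarith
  have hG0 : 0 < G := by linarith
  set γ : ℝ → ℂ := fun x => g (max x 0) with hγ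
  have hγc : Continuous γ := by
    rw [← continuousOn_univ]
    exact hg.comp (f := fun x : ℝ => max x 0) (by fun_prop) (fun x _ => mem_Ici.2 (le_max_right _ _))
  have hγg : ∀ x ≥ 0, γ x = g x := fun x hx => by simp [hγ, max_eq_left hx]
  have he : ∀ x : ℝ, HasDerivAt (fun x : ℝ => e1 G (v + x)) (ph G (v + x)) x := fun x => along (e1_deriv hG0 (Dom_add hv x))
  have hp : ∀ x : ℝ, HasDerivAt (fun x : ℝ => ph G (v + x)) (F0' G (rh G (v + x)) * e1 G (v + x)) x := fun x => along (ph_deriv hG0 (Dom_add hv x))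
  have hz : ∀ x : ℝ, HasDerivAt (fun x : ℝ => zt G v (v + x)) (zt1 G v (v + x)) x := fun x => along (zt_deriv hG0 (Dom_add hv x))
  have hz1 : ∀ x : ℝ, HasDerivAt (fun x : ℝ => zt1 G v (v + x)) (F0' G (rh G (v + x)) * zt G v (v + x)) x := fun x => along (zt1_deriv hG0 (Dom_add hv x))
  have hec : Continuous (fun x : ℝ => e1 G (v + x)) := continuous_iff_continuousAt.2 fun x => (he x).continuousAt
  have hzc : Continuous (fun x : ℝ => zt G v (v + x)) := continuous_iff_continuousAt.2 fun x => (hz x).continuousAt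
  have hA : ∀ s : ℝ, HasDerivAt (fun s : ℝ => ∫ x in (0:ℝ)..s, zt G v (v + x) * γ x) (zt G v (v + s) * γ s) s := fun s =>
    ((hzc.mul hγc).integral_hasStrictDerivAt 0 s).hasDerivAt
  have hB : ∀ s : ℝ, HasDerivAt (fun s : ℝ => (∫ x in Ioi 0, e1 G (v + (x:ℝ)) * g x) - ∫ x in (0:ℝ)..s, e1 G (v + x) * γ x) (-(e1 G (v + s) * γ s)) s := fun s =>
    (((hec.mul hγc).integral_hasStrictDerivAt 0 s).hasDerivAt).const_sub _
  set A := fun s : ℝ => ∫ x in (0:ℝ)..s, zt G v (v + x) * γ x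
  set B := fun s : ℝ => (∫ x in Ioi 0, e1 G (v + (x:ℝ)) * g x) - ∫ x in (0:ℝ)..s, e1 G (v + x) * γ x
  have zn : ∀ s : ℝ, 0 ≤ s → ∀ x > s, Gr G v s x = e1 G (v + (x:ℝ)) * zt G v (v + (s:ℝ)) := fun s hs x hx => by
    unfold Gr; rw [max_eq_right hx.le, min_eq_left hx.le]
  have hzz : zt G v v * ph G v = -1 := by
    have := wronsk (v := v) hG0 (Dom_im hv)
    rw [zt1_self (one_sub_ne hG1 hv)] at this; linear_combination -this
  have hzz0 : zt G v (v + (0:ℝ)) ≠ 0 := by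
    intro h; simp only [Complex.ofReal_zero, add_zero] at h; rw [h] at hzz; simp at hzz
  have hei : IntegrableOn (fun x : ℝ => e1 G (v + x) * g x) (Ioi 0) := by
    have h0 := (GI hc hG hv le_rfl hg hb).1
    have h1 := h0.const_mul (zt G v (v + (0:ℝ)))⁻¹
    refine IntegrableOn.congr_fun h1 (fun x hx => ?_) measurableSet_Ioi
    simp only [zn 0 le_rfl x hx]
    field_simp
  refine ⟨fun s : ℝ => -(e1 G (v + s) * A s + zt G v (v + s) * B s), fun s : ℝ => -(ph G (v + s) * A s + zt1 G v (v + s) * B s), ?_, ?_, ?_, ?_, ?_⟩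
  · intro s
    refine (((he s).mul (hA s)).add ((hz s).mul (hB s))).neg.congr_deriv ?_
    ring
  · intro s hs
    refine (((hp s).mul (hA s)).add ((hz1 s).mul (hB s))).neg.congr_deriv ?_
    rw [hγg s hs]
    have := wronsk (v := v) hG0 (Dom_add hv s)
    linear_combination g s * this
  · intro s hs
    change -(e1 G (v + s) * A s + zt G v (v + s) * B s) = _
    congr 1
    have hI := (GI hc hG hv hs hg hb).1
    have hsplit : Ioi (0:ℝ) = Ioc 0 s ∪ Ioi s := (Ioc_union_Ioi_eq_Ioi hs).symm
    have d1 : Disjoint (Ioc 0 s) (Ioi s) := Set.Ioc_disjoint_Ioi le_rfl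
    have eB : B s = ∫ x in Ioi s, e1 G (v + (x:ℝ)) * g x := by
      have h1 : ∫ x in Ioi 0, e1 G (v + (x:ℝ)) * g x = (∫ x in Ioc 0 s, e1 G (v + (x:ℝ)) * g x) + ∫ x in Ioi s, e1 G (v + (x:ℝ)) * g x := by
        rw [hsplit, setIntegral_union d1 measurableSet_Ioi (hei.mono_set Ioc_subset_Ioi_self) (hei.mono_set (Ioi_subset_Ioi hs))]
      have h2 : ∫ x in (0:ℝ)..s, e1 G (v + x) * γ x = ∫ x in Ioc 0 s, e1 G (v + (x:ℝ)) * g x := by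
        rw [intervalIntegral.integral_of_le hs]
        exact setIntegral_congr_fun measurableSet_Ioc fun x hx => by simp only [hγg x hx.1.le]
      simp only [B]; rw [h1, h2]; ring
    have eA : A s = ∫ x in Ioc 0 s, zt G v (v + (x:ℝ)) * g x := by
      simp only [A]
      rw [intervalIntegral.integral_of_le hs]
      exact setIntegral_congr_fun measurableSet_Ioc fun x hx => by simp only [hγg x hx.1.le]
    rw [hsplit, setIntegral_union d1 measurableSet_Ioi (hI.mono_set Ioc_subset_Ioi_self) (hI.mono_set (Ioi_subset_Ioi hs)),
      eA, eB, ← integral_const_mul, ← integral_const_mul]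
    congr 1
    · refine setIntegral_congr_fun measurableSet_Ioc fun x hx => ?_
      simp only [Gr]; rw [max_eq_left hx.2, min_eq_right hx.2]; ring
    · refine setIntegral_congr_fun measurableSet_Ioi fun x hx => ?_
      simp only [zn s hs x hx]; ring
  · have : A 0 = 0 := by simp [A]
    simp only [this, Complex.ofReal_zero, add_zero, zt1_self (one_sub_ne hG1 hv)]; simp
  · have h1 : A 0 = 0 := by simp [A]
    have h2 : B 0 = ∫ x in Ioi 0, e1 G (v + (x:ℝ)) * g x := by simp [B]
    simp only [h1, h2, Complex.ofReal_zero, add_zero]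
    linear_combination -(∫ x in Ioi 0, e1 G (v + (x:ℝ)) * g x) * hzz

lemma Tt_cub (hG : 0 < G) {u : ℂ} (hu : |u.im| < G ^ 3 / 3) : Tt G u ^ 3 + 3 * Tt G u = 2 * (3 * u / G ^ 3) :=
  tau_cubic (zim hG hu)

/-- the growing solution is not dominated by a square root -/
lemma zt_grow (hG : 0 < G) (hv : v ∈ Dom G) {c : ℂ} {C : ℝ} (h : ∀ s : ℝ, 0 ≤ s → ‖c * zt G v (v + s)‖ ≤ C * √(y0 G v + s)) : c = 0 := by
  by_contra hc
  have hc0 : 0 < ‖c‖ := norm_pos_iff.2 hc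
  have hC : 0 ≤ C := by
    have h1 := (norm_nonneg _).trans (h 0 le_rfl)
    have h2 : 0 < √(y0 G v + 0) := sqrt_pos.2 (by linarith [Dom_y0 hv])
    by_contra hh; push Not at hh; nlinarith
  set K := ‖kk (Tt G v)‖ with hK
  have hK0 : 0 ≤ K := norm_nonneg _
  have hy := Dom_y0 hv
  obtain ⟨X, hX1, hX2⟩ : ∃ X : ℝ, 1 ≤ X ∧ ‖c‖ * G ^ 4 / 4 * (X ^ 2 / 5 - (5 + K)) > C * (G ^ 3 + y0 G v + ‖v‖) * 2 := by
    have hp : 0 < ‖c‖ * G ^ 4 / 4 := by positivity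
    have hq : 0 ≤ C * (G ^ 3 + y0 G v + ‖v‖) * 2 := by have := norm_nonneg v; positivity
    set Q := C * (G ^ 3 + y0 G v + ‖v‖) * 2 / (‖c‖ * G ^ 4 / 4) with hQ
    have hQ0 : 0 ≤ Q := by positivity
    refine ⟨5 * (Q + 6 + K), by linarith, ?_⟩
    have e : C * (G ^ 3 + y0 G v + ‖v‖) * 2 = ‖c‖ * G ^ 4 / 4 * Q := by rw [hQ]; field_simp
    rw [e]
    apply mul_lt_mul_of_pos_left _ hp
    nlinarith
  set s : ℝ := G ^ 3 * (X ^ 3 + 3 * X) + ‖v‖ with hs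
  have hX0 : 0 < X := by linarith
  have hs0 : 0 ≤ s := by have := norm_nonneg v; positivity
  have hcub := Tt_cub hG (Dom_add hv s)
  set τ := Tt G (v + s) with hτ
  have hn1 : ‖2 * (3 * (v + s) / (G:ℂ) ^ 3)‖ = 6 * ‖v + s‖ / G ^ 3 := by
    rw [norm_mul, norm_div, norm_mul, norm_pow, Complex.norm_real, Real.norm_eq_abs, abs_of_pos hG]; norm_num; ring
  have hvs : s - ‖v‖ ≤ ‖v + s‖ := by
    have := norm_sub_le (v + s) v
    simp only [add_sub_cancel_left, Complex.norm_real, Real.norm_eq_abs, abs_of_nonneg hs0] at this; linarith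
  have hup : 6 * ‖v + s‖ / G ^ 3 ≤ ‖τ‖ ^ 3 + 3 * ‖τ‖ := by
    rw [← hn1, ← hcub]
    refine (norm_add_le _ _).trans (le_of_eq ?_); rw [norm_pow, norm_mul]; norm_num
  have hτX : X ≤ ‖τ‖ := by
    by_contra hh; push Not at hh
    have h0 := norm_nonneg τ
    have h1 : ‖τ‖ ^ 3 ≤ X ^ 3 := by gcongr
    have h2 : X ^ 3 + 3 * X ≤ ‖v + s‖ / G ^ 3 := by
      rw [le_div_iff₀ (by positivity)]; linarith
    have h3 : 0 < X ^ 3 := by positivity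
    have h4 : 6 * ‖v + s‖ / G ^ 3 = 6 * (‖v + s‖ / G ^ 3) := by ring
    linarith
  have h1τ : 1 ≤ ‖τ‖ := hX1.trans hτX
  have hω : y0 G v + s ≤ (G ^ 3 + y0 G v + ‖v‖) * ‖τ‖ ^ 4 := by
    have h1 : ‖v + s‖ ≤ G ^ 3 * ‖τ‖ ^ 4 := by
      have a : ‖τ‖ ^ 3 ≤ ‖τ‖ ^ 4 := pow_le_pow_right₀ h1τ (by norm_num)
      have b : ‖τ‖ ^ 1 ≤ ‖τ‖ ^ 4 := pow_le_pow_right₀ h1τ (by norm_num)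
      rw [div_le_iff₀ (by positivity)] at hup
      have : (‖τ‖ ^ 3 + 3 * ‖τ‖) * G ^ 3 ≤ 4 * ‖τ‖ ^ 4 * G ^ 3 := by gcongr; linarith
      have : 0 ≤ ‖τ‖ ^ 4 * G ^ 3 := by positivity
      linarith
    have h2 : 1 ≤ ‖τ‖ ^ 4 := one_le_pow₀ h1τ
    have := norm_nonneg v
    nlinarith
  have hsq : √(y0 G v + s) ≤ (G ^ 3 + y0 G v + ‖v‖) * ‖τ‖ ^ 2 := by
    have hM : 1 ≤ G ^ 3 + y0 G v + ‖v‖ := by have := norm_nonneg v; have : 0 < G ^ 3 := by positivity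
                                             linarith
    refine Real.sqrt_le_iff.2 ⟨by positivity, hω.trans ?_⟩
    rw [mul_pow, ← pow_mul]
    gcongr
    nlinarith
  have key := h s hs0
  have hden : ‖1 + τ ^ 2‖ ≤ 2 * ‖τ‖ ^ 2 := by
    refine (norm_add_le _ _).trans ?_
    rw [norm_one, norm_pow]; nlinarith
  have hne := Tt_ne hG (Dom_add hv s)
  have hnum : ‖nn τ - kk (Tt G v) * τ‖ ≥ ‖τ‖ ^ 6 / 5 - (5 + K) * ‖τ‖ ^ 4 := by
    have e : nn τ - kk (Tt G v) * τ = τ ^ 6 / 5 - (1 - 3 * τ ^ 2 - τ ^ 4 + kk (Tt G v) * τ) := by unfold nn; ring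
    rw [e]
    have h1 := norm_sub_norm_le (τ ^ 6 / 5) (1 - 3 * τ ^ 2 - τ ^ 4 + kk (Tt G v) * τ)
    have h2 : ‖1 - 3 * τ ^ 2 - τ ^ 4 + kk (Tt G v) * τ‖ ≤ 1 + 3 * ‖τ‖ ^ 2 + ‖τ‖ ^ 4 + K * ‖τ‖ := by
      refine (norm_add_le _ _).trans (add_le_add ((norm_sub_le _ _).trans (add_le_add ((norm_sub_le _ _).trans ?_) ?_)) ?_)
      · rw [norm_mul, norm_pow]; norm_num
      · rw [norm_pow]
      · rw [norm_mul]
    have h3 : ‖τ ^ 6 / 5‖ = ‖τ‖ ^ 6 / 5 := by rw [norm_div, norm_pow]; norm_num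
    have a : ‖τ‖ ^ 2 ≤ ‖τ‖ ^ 4 := pow_le_pow_right₀ h1τ (by norm_num)
    have b : ‖τ‖ ^ 1 ≤ ‖τ‖ ^ 4 := pow_le_pow_right₀ h1τ (by norm_num)
    have d : 1 ≤ ‖τ‖ ^ 4 := one_le_pow₀ h1τ
    rw [pow_one] at b
    have : K * ‖τ‖ ≤ K * ‖τ‖ ^ 4 := by gcongr
    linarith
  have hkey2 : ‖c‖ * (G ^ 4 / 4) * ‖nn τ - kk (Tt G v) * τ‖ ≤ C * ((G ^ 3 + y0 G v + ‖v‖) * ‖τ‖ ^ 2) * (2 * ‖τ‖ ^ 2) := by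
    have e : ‖c * zt G v (v + s)‖ * ‖1 + τ ^ 2‖ = ‖c‖ * (G ^ 4 / 4) * ‖nn τ - kk (Tt G v) * τ‖ := by
      unfold zt; rw [← hτ, norm_mul, norm_mul, norm_div, norm_div, norm_pow, Complex.norm_real, Real.norm_eq_abs, abs_of_pos hG]
      have : ‖1 + τ ^ 2‖ ≠ 0 := norm_ne_zero_iff.2 hne
      field_simp; norm_num; ring
    rw [← e]
    gcongr
    exact key.trans (by gcongr)
  have : ‖c‖ * (G ^ 4 / 4) * (‖τ‖ ^ 6 / 5 - (5 + K) * ‖τ‖ ^ 4) ≤ C * ((G ^ 3 + y0 G v + ‖v‖) * ‖τ‖ ^ 2) * (2 * ‖τ‖ ^ 2) :=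
    le_trans (by gcongr) hkey2
  have h4 : 0 < ‖τ‖ ^ 4 := by positivity
  have h5 : ‖c‖ * G ^ 4 / 4 * (‖τ‖ ^ 2 / 5 - (5 + K)) * ‖τ‖ ^ 4 ≤ C * (G ^ 3 + y0 G v + ‖v‖) * 2 * ‖τ‖ ^ 4 := by
    calc _ = ‖c‖ * (G ^ 4 / 4) * (‖τ‖ ^ 6 / 5 - (5 + K) * ‖τ‖ ^ 4) := by ring
      _ ≤ _ := this
      _ = _ := by ring
  have h6 := le_of_mul_le_mul_right h5 h4
  have h7 : ‖c‖ * G ^ 4 / 4 * (X ^ 2 / 5 - (5 + K)) ≤ ‖c‖ * G ^ 4 / 4 * (‖τ‖ ^ 2 / 5 - (5 + K)) := by gcongr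
  linarith

lemma converse {g δ δ' : ℝ → ℂ} {c C : ℝ} (hc : 0 ≤ c) (hG : 10 ^ 20 ≤ G) (hv : v ∈ Dom G) (hg : ContinuousOn g (Ici 0))
    (hb : ∀ x ≥ 0, ‖g x‖ ≤ c * (1 / √(y0 G v + x) ^ 3))
    (h1 : ∀ s : ℝ, 0 ≤ s → HasDerivAt δ (δ' s) s) (h2 : ∀ s : ℝ, 0 ≤ s → HasDerivAt δ' (F0' G (rh G (v + s)) * δ s + g s) s)
    (h0 : δ' 0 = 0) (hC : ∀ s : ℝ, 0 ≤ s → ‖δ s‖ ≤ C * √(y0 G v + s)) :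
    ∀ s ≥ 0, δ s = -∫ x in Ioi 0, Gr G v s x * g x := by
  have hG1 : 100 ≤ G := by linarith
  have hG0 : 0 < G := by linarith
  obtain ⟨w, w', w1, w2, w3, w4, -⟩ := green hc hG hv hg hb
  have he : ∀ x : ℝ, HasDerivAt (fun x : ℝ => e1 G (v + x)) (ph G (v + x)) x := fun x => along (e1_deriv hG0 (Dom_add hv x))
  have hp : ∀ x : ℝ, HasDerivAt (fun x : ℝ => ph G (v + x)) (F0' G (rh G (v + x)) * e1 G (v + x)) x := fun x => along (ph_deriv hG0 (Dom_add hv x))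
  have hz : ∀ x : ℝ, HasDerivAt (fun x : ℝ => zt G v (v + x)) (zt1 G v (v + x)) x := fun x => along (zt_deriv hG0 (Dom_add hv x))
  have hz1 : ∀ x : ℝ, HasDerivAt (fun x : ℝ => zt1 G v (v + x)) (F0' G (rh G (v + x)) * zt G v (v + x)) x := fun x => along (zt1_deriv hG0 (Dom_add hv x))
  have cst : ∀ f : ℝ → ℂ, (∀ s : ℝ, 0 ≤ s → HasDerivAt f 0 s) → ∀ s ≥ 0, f s = f 0 := by
    intro f hf s hs
    refine constant_of_has_deriv_right_zero (a := 0) (b := s) (fun x hx => (hf x hx.1).continuousAt.continuousWithinAt)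
      (fun x hx => (hf x hx.1).hasDerivWithinAt) s ⟨hs, le_rfl⟩
  have a1 := cst (fun s => (δ s - w s) * zt1 G v (v + s) - (δ' s - w' s) * zt G v (v + s)) (fun s hs => by
    refine ((((h1 s hs).sub (w1 s)).mul (hz1 s)).sub (((h2 s hs).sub (w2 s hs)).mul (hz s))).congr_deriv ?_
    simp only [Pi.sub_apply]; ring)
  have a2 := cst (fun s => e1 G (v + s) * (δ' s - w' s) - ph G (v + s) * (δ s - w s)) (fun s hs => by
    refine (((he s).mul ((h2 s hs).sub (w2 s hs))).sub ((hp s).mul ((h1 s hs).sub (w1 s)))).congr_deriv ?_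
    simp only [Pi.sub_apply]; ring)
  simp only [Complex.ofReal_zero, add_zero, zt1_self (one_sub_ne hG1 hv), h0, w4] at a1 a2
  set κ := e1 G v * ((0:ℂ) - 0) - ph G v * (δ 0 - w 0)
  have a3 : ∀ s : ℝ, 0 ≤ s → δ s - w s = κ * zt G v (v + s) := by
    intro s hs
    have := wronsk (v := v) hG0 (Dom_add hv s)
    linear_combination -(δ s - w s) * this + e1 G (v + s) * a1 s hs + zt G v (v + s) * a2 s hs
  have hκ : κ = 0 := by
    refine zt_grow (C := C + 4 * (3 * 10 ^ 10 * c)) hG0 hv fun s hs => ?_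
    rw [← a3 s hs, add_mul]
    refine (norm_sub_le _ _).trans (add_le_add (hC s hs) ?_)
    rw [w3 s hs, norm_neg]
    exact (GI hc hG hv hs hg hb).2
  intro s hs
  rw [← w3 s hs, ← sub_eq_zero, a3 s hs, hκ, zero_mul]
end

open Real Filter MeasureTheory Set Topology

noncomputable def Ph (G : ℝ) (v : ℂ) (t : ℝ) : ℂ := rh G v + xi G v 0 t

section
variable {G : ℝ} {v : ℂ}

lemma deriv_joint {U : Set ℂ} (hU : IsOpen U) {f : ℂ → ℝ → ℂ} (hc : ContinuousOn (fun p : ℂ × ℝ => f p.1 p.2) (U ×ˢ univ))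
    (hd : ∀ t, DifferentiableOn ℂ (fun v => f v t) U) :
    ContinuousOn (fun p : ℂ × ℝ => deriv (fun v => f v p.2) p.1) (U ×ˢ univ) := by
  rintro ⟨v, t⟩ ⟨hv, -⟩
  apply ContinuousAt.continuousWithinAt
  obtain ⟨r, hr, hsub⟩ := Metric.nhds_basis_closedBall.mem_iff.1 (hU.mem_nhds hv)
  have hd0 : ContinuousAt (deriv (fun v => f v t)) v :=
    ((hd t).deriv hU).continuousOn.continuousAt (hU.mem_nhds hv)
  rw [Metric.continuousAt_iff]
  intro ε hε
  obtain ⟨δ1, hδ1, h1⟩ := Metric.continuousAt_iff.1 hd0 (ε / 2) (by linarith)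
  have hcomp : IsCompact (Metric.closedBall v r) := isCompact_closedBall v r
  obtain ⟨V, hV, h2⟩ := hcomp.mem_uniformity_of_prod (f := fun (τ : ℝ) (z : ℂ) => f z τ) (s := univ) (q := t) (u := {p : ℂ × ℂ | dist p.1 p.2 < ε / 2 * (r / 2)})
    (by
      refine hc.comp (f := fun p : ℝ × ℂ => (p.2, p.1)) (by fun_prop) (fun p hp => ⟨hsub hp.2, mem_univ _⟩)) (mem_univ _)
    (Metric.dist_mem_uniformity (by positivity))
  rw [nhdsWithin_univ] at hV
  obtain ⟨δ2, hδ2, h3⟩ := Metric.mem_nhds_iff.1 hV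
  refine ⟨min (min δ1 δ2) (r / 2), by positivity, fun {p} hp => ?_⟩
  rw [Prod.dist_eq, max_lt_iff, lt_min_iff, lt_min_iff, lt_min_iff, lt_min_iff] at hp
  obtain ⟨⟨⟨p1, -⟩, p2⟩, ⟨⟨-, p4⟩, -⟩⟩ := hp
  have hb : Metric.closedBall p.1 (r / 2) ⊆ Metric.closedBall v r := by
    apply Metric.closedBall_subset_closedBall'; simp only at p2; linarith
  have hmem : p.1 ∈ U := hsub (hb (Metric.mem_closedBall_self (by linarith)))
  have e : deriv (fun v => f v p.2) p.1 - deriv (fun v => f v t) p.1 = deriv (fun v => f v p.2 - f v t) p.1 := by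
    refine (deriv_sub ?_ ?_).symm
    · exact (hd _).differentiableAt (hU.mem_nhds hmem)
    · exact (hd _).differentiableAt (hU.mem_nhds hmem)
  have h4 : ‖deriv (fun v => f v p.2) p.1 - deriv (fun v => f v t) p.1‖ ≤ ε / 2 * (r / 2) / (r / 2) := by
    rw [e]
    refine Complex.norm_deriv_le_of_forall_mem_sphere_norm_le (by linarith) ?_ ?_
    · refine (DifferentiableOn.mono ((hd _).sub (hd _)) ?_).diffContOnCl
      rw [closure_ball _ (by linarith)]
      exact hb.trans hsub
    · intro z hz
      have := h2 p.2 (h3 p4) z (hb (Metric.sphere_subset_closedBall hz))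
      have h5 : dist (f z p.2) (f z t) < ε / 2 * (r / 2) := this
      rw [dist_eq_norm] at h5; exact h5.le
  rw [mul_div_cancel_right₀ _ (by positivity)] at h4
  have h6 := h1 p1
  calc _ ≤ dist (deriv (fun v => f v p.2) p.1) (deriv (fun v => f v t) p.1) + dist (deriv (fun v => f v t) p.1) (deriv (fun v => f v t) v) := dist_triangle _ _ _
    _ < ε := by rw [dist_eq_norm]; linarith

lemma Ph_hol (hG : 10 ^ 20 ≤ G) (t : ℝ) : DifferentiableOn ℂ (fun v => Ph G v t) (Dom G) :=
  DifferentiableOn.add (fun v hv => (rh_deriv (by linarith) (Dom_im hv)).differentiableAt.differentiableWithinAt)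
    ((xi_good hG).hol 0 le_rfl t)

lemma Ph_cont (hG : 10 ^ 20 ≤ G) : ContinuousOn (fun p : ℂ × ℝ => Ph G p.1 p.2) (Dom G ×ˢ univ) := by
  refine ContinuousOn.add ?_ ?_
  · rintro ⟨v, t⟩ hp
    exact (ContinuousAt.comp (f := fun p : ℂ × ℝ => p.1) (x := (v, t)) (rh_contAt (by linarith) (Dom_im hp.1)) (by fun_prop)).continuousWithinAt
  · exact (xi_good hG).cont.comp (f := fun p : ℂ × ℝ => (p.1, (0:ℝ), p.2)) (by fun_prop) (fun p hp => ⟨hp.1, mem_Ici.2 le_rfl, mem_univ _⟩)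

lemma R_ode (hG : 10 ^ 20 ≤ G) (hv : v ∈ Dom G) (t : ℝ) : ∃ R R' : ℝ → ℂ,
    (∀ s : ℝ, 0 ≤ s → R s = rh G (v + s) + xi G v s t) ∧ (∀ s, HasDerivAt R (R' s) s) ∧
    (∀ s : ℝ, 0 ≤ s → HasDerivAt R' (FF G (qq (t + s)) (R s)) s) ∧ R' 0 = e1 G v ∧
    xi G v 0 t * ph G v = ∫ x in Ioi 0, e1 G (v + (x:ℝ)) * NI G v t (fun s => xi G v s t) x := by
  have hG0 : 0 < G := by linarith
  obtain ⟨h0, h1, -⟩ := k0_le hG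
  have ha := (xi_good hG).adm hv t
  obtain ⟨w, w', w1, w2, w3, w4, w5⟩ := green (g := NI G v t (fun s => xi G v s t)) (c := 30000 / G ^ 2) (by positivity) hG hv
    (NI_cont hG h1 hv ha) (fun x hx => NI_bd hG h0 h1 hv ha hx)
  have hw : ∀ s : ℝ, 0 ≤ s → w s = xi G v s t := fun s hs => by rw [w3 s hs, xi_fix hG hv hs]
  refine ⟨fun s => rh G (v + s) + w s, fun s => e1 G (v + s) + w' s, fun s hs => by simp only [hw s hs], fun s => ?_, fun s hs => ?_, by simp [w4], ?_⟩
  · exact (along (rh_deriv hG0 (Dom_add hv s))).add (w1 s)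
  · refine ((along (e1_deriv hG0 (Dom_add hv s))).add (w2 s hs)).congr_deriv ?_
    unfold NI NN
    simp only [hw s hs]
    rw [ph_eq hG0 (Dom_add hv s)]; ring
  · rw [← w5, hw 0 le_rfl]
end

open Real Filter MeasureTheory Set Topology

section
variable {G : ℝ} {v u : ℂ}

lemma Dom_convex : Convex ℝ (Dom G) := by
  have : Dom G = Complex.reLm ⁻¹' (Ioo (-12) 12) ∩ Complex.imLm ⁻¹' (Ioo (-(G ^ 3 / 3 - 1)) (G ^ 3 / 3 - 1)) := by
    ext z; simp [Dom, abs_lt]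
  rw [this]
  exact ((convex_Ioo _ _).linear_preimage _).inter ((convex_Ioo _ _).linear_preimage _)

lemma e1_le (hG : 100 ≤ G) (hv : v ∈ Dom G) {s : ℝ} (hs : 0 ≤ s) : ‖e1 G (v + s)‖ ≤ 300 * √G := by
  have h1 := K3 hG hv hs
  have h2 : 1 ≤ √(y0 G v) := Real.one_le_sqrt.2 (Dom_y0 hv).le
  nlinarith [norm_nonneg (e1 G (v + s))]

lemma rh_lip (hG : 100 ≤ G) (hv : v ∈ Dom G) (hu : u ∈ Dom G) {s : ℝ} (hs : 0 ≤ s) :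
    ‖rh G (v + s) - rh G (u + s)‖ ≤ 300 * √G * ‖v - u‖ := by
  refine Dom_convex.norm_image_sub_le_of_norm_hasDerivWithin_le (𝕜 := ℂ) (f := fun w => rh G (w + s)) (f' := fun w => e1 G (w + s)) (fun w hw => ?_) (fun w hw => e1_le hG hw hs) hu hv
  exact ((rh_deriv (by linarith) (Dom_add hw s)).comp_add_const w (s:ℂ)).hasDerivWithinAt

lemma semi_core (hG : 10 ^ 20 ≤ G) (hv : v ∈ Dom G) {t : ℝ} {R R' : ℝ → ℂ} (r1 : ∀ s : ℝ, 0 ≤ s → R s = rh G (v + s) + xi G v s t)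
    (r2 : ∀ s, HasDerivAt R (R' s) s) (r3 : ∀ s : ℝ, 0 ≤ s → HasDerivAt R' (FF G (qq (t + s)) (R s)) s)
    {h : ℝ} (hh : 0 ≤ h) (hh1 : h ≤ 1 / 2) (hvh : v + h ∈ Dom G) (hu : u ∈ Dom G) (he : e1 G u = R' h) (hd : ‖v + h - u‖ ≤ 1 / 2)
    (hd1 : 300 * √G * ‖v + h - u‖ ≤ k0 G / 2) : Ph G u (t + h) = R h := by
  have hG0 : 0 < G := by linarith
  have hG1 : 100 ≤ G := by linarith
  obtain ⟨h0, h1, h2⟩ := k0_le hG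
  have b := (xi_good hG).bd v hv
  have hy := Dom_y0 hu
  have hyv : y0 G v ≤ y0 G u + 1 / 2 := by
    have : |(v + h - u).im| ≤ 1 / 2 := (Complex.abs_im_le_norm _).trans hd
    simp only [Complex.sub_im, Complex.add_im, Complex.ofReal_im, add_zero] at this
    unfold y0
    have := abs_sub_abs_le_abs_sub u.im v.im
    rw [abs_sub_comm] at this
    linarith
  set δ : ℝ → ℂ := fun σ => R (h + σ) - rh G (u + σ) with hδ
  have d1 : ∀ s : ℝ, HasDerivAt δ (R' (h + s) - e1 G (u + s)) s := fun s =>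
    ((r2 (h + s)).comp_const_add h s).sub (along (rh_deriv hG0 (Dom_add hu s)))
  have d2 : ∀ s : ℝ, 0 ≤ s → HasDerivAt (fun s : ℝ => R' (h + s) - e1 G (u + s)) (F0' G (rh G (u + s)) * δ s + NI G u (t + h) δ s) s := by
    intro s hs
    refine (((r3 (h + s) (by linarith)).comp_const_add h s).sub (along (e1_deriv hG0 (Dom_add hu s)))).congr_deriv ?_
    unfold NI NN
    rw [ph_eq hG0 (Dom_add hu s), add_assoc t h s]
    simp only [hδ, add_sub_cancel]
    try ring
  have hbd : ∀ s : ℝ, 0 ≤ s → ‖δ s‖ ≤ 2 * k0 G * √(y0 G u + s) := by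
    intro s hs
    have e : δ s = xi G v (h + s) t + (rh G (v + h + s) - rh G (u + s)) := by
      simp only [hδ, r1 (h + s) (by linarith)]; push_cast; rw [← add_assoc v]; ring
    have h3 := b (h + s) (by linarith) t
    have h4 := rh_lip hG1 hvh hu hs
    have h5 : √(y0 G v + (h + s)) ≤ 3 / 2 * √(y0 G u + s) := by
      rw [show (3 / 2 : ℝ) = √(9 / 4) by rw [show (9 / 4 : ℝ) = (3 / 2) ^ 2 by norm_num, Real.sqrt_sq (by norm_num)], ← Real.sqrt_mul (by norm_num)]
      exact Real.sqrt_le_sqrt (by linarith)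
    have h6 : 1 ≤ √(y0 G u + s) := Real.one_le_sqrt.2 (by linarith)
    rw [e]
    refine (norm_add_le _ _).trans ?_
    nlinarith [mul_le_mul_of_nonneg_left h5 h0, mul_le_mul_of_nonneg_left h6 h0]
  have ha : Adm G (2 * k0 G) u δ := ⟨fun s _ => (d1 s).continuousAt.continuousWithinAt, hbd⟩
  have hk0 : 0 ≤ 2 * k0 G := by linarith
  have c := converse (g := NI G u (t + h) δ) (c := 30000 / G ^ 2) (by positivity) hG hu (NI_cont hG h2 hu ha) (fun x hx => NI_bd hG hk0 h2 hu ha hx)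
    (fun s _ => d1 s) d2 (by simp [he]) hbd
  have ha' := (xi_good hG).adm hu (t + h)
  have ha2 : Adm G (2 * k0 G) u (fun s => xi G u s (t + h)) := ⟨ha'.1, fun s hs => (ha'.2 s hs).trans (by
    have := Real.sqrt_nonneg (y0 G u + s)
    nlinarith)⟩
  have := uniq_fix hG hk0 h2 hu ha ha2 c (fun s hs => xi_fix hG hu hs (t + h)) 0 le_rfl
  unfold Ph
  rw [← this]
  simp [hδ]

lemma semi (hG : 10 ^ 20 ≤ G) (hv : v ∈ Dom G) (t : ℝ) : ∃ vh R : ℝ → ℂ, vh 0 = v ∧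
    HasDerivAt vh (FF G (qq t) (Ph G v t) / ph G v) 0 ∧ R 0 = Ph G v t ∧ HasDerivAt R (e1 G v) 0 ∧
    ∀ᶠ h : ℝ in 𝓝[≥] 0, Ph G (vh h) (t + h) = R h := by
  have hG0 : 0 < G := by linarith
  have hG1 : 100 ≤ G := by linarith
  obtain ⟨R, R', r1, r2, r3, r4, -⟩ := R_ode hG hv t
  have hO : IsOpen {z : ℂ | |z.im| < G ^ 3 / 3} := isOpen_lt (by fun_prop) continuous_const
  have hs : HasStrictDerivAt (e1 G) (ph G v) v := by
    have hdo : DifferentiableOn ℂ (e1 G) {z : ℂ | |z.im| < G ^ 3 / 3} := fun z hz => (e1_deriv hG0 hz).differentiableAt.differentiableWithinAt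
    have := (hdo.analyticAt (hO.mem_nhds (Dom_im hv))).hasStrictDerivAt
    rwa [(e1_deriv hG0 (Dom_im hv)).deriv] at this
  have hne := ph_ne hG1 hv
  set f := hs.localInverse (e1 G) (ph G v) v hne
  have hf := (hs.to_localInverse hne).hasDerivAt
  have hf0 : f (e1 G v) = v := HasStrictFDerivAt.localInverse_apply_image _
  have hright : ∀ᶠ y in 𝓝 (e1 G v), e1 G (f y) = y := HasStrictFDerivAt.eventually_right_inverse _
  have hr0 : R 0 = Ph G v t := by rw [r1 0 le_rfl]; simp [Ph]
  have hd := r3 0 le_rfl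
  rw [add_zero, hr0] at hd
  have hD : HasDerivAt (fun h => f (R' h)) (FF G (qq t) (Ph G v t) / ph G v) 0 := by
    have := HasDerivAt.scomp (𝕜 := ℝ) (0:ℝ) (by rw [r4]; exact hf) hd
    refine this.congr_deriv ?_
    simp [div_eq_mul_inv]
  refine ⟨fun h => f (R' h), R, by simp only [r4, hf0], hD, hr0, r4 ▸ r2 0, ?_⟩
  have hk : 0 < k0 G := by unfold k0; positivity
  have hc := hD.continuousAt
  have hc0 : Tendsto (fun h => f (R' h)) (𝓝 0) (𝓝 v) := by
    have := hc.tendsto; simp only [r4, hf0] at this; exact this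
  have hc1 : Tendsto (fun h : ℝ => v + (h:ℂ)) (𝓝 0) (𝓝 v) := by
    have : Continuous (fun h : ℝ => v + (h:ℂ)) := by fun_prop
    simpa using this.tendsto 0
  have hc2 : Tendsto (fun h : ℝ => ‖v + (h:ℂ) - f (R' h)‖) (𝓝 0) (𝓝 0) := by
    simpa using (hc1.sub hc0).norm
  have hc3 : Tendsto R' (𝓝 0) (𝓝 (e1 G v)) := by rw [← r4]; exact hd.continuousAt.tendsto
  have hGs : 0 < √G := Real.sqrt_pos.2 hG0
  have A := nhdsWithin_le_nhds (s := Ici (0:ℝ)) (hc0.eventually (Dom_open.mem_nhds hv))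
  have B := nhdsWithin_le_nhds (s := Ici (0:ℝ)) (hc1.eventually (Dom_open.mem_nhds hv))
  have C := nhdsWithin_le_nhds (s := Ici (0:ℝ)) (hc2.eventually (gt_mem_nhds (show (0:ℝ) < 1 / 2 by norm_num)))
  have D := nhdsWithin_le_nhds (s := Ici (0:ℝ)) (hc2.eventually (gt_mem_nhds (show (0:ℝ) < k0 G / 2 / (300 * √G) by positivity)))
  have E := nhdsWithin_le_nhds (s := Ici (0:ℝ)) (hc3.eventually hright)
  have F := nhdsWithin_le_nhds (s := Ici (0:ℝ)) (gt_mem_nhds (show (0:ℝ) < 1 / 2 by norm_num))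
  filter_upwards [A, B, C, D, E, F, self_mem_nhdsWithin] with h a b c d e f' g
  refine semi_core hG hv r1 r2 r3 g (le_of_lt f') b a e c.le ?_
  rw [lt_div_iff₀ (by positivity)] at d
  linarith


lemma diag0 {U : Set ℂ} (hU : IsOpen U) {f : ℂ → ℝ → ℂ} (hc : ContinuousOn (fun p : ℂ × ℝ => f p.1 p.2) (U ×ˢ univ))
    (hd : ∀ t, DifferentiableOn ℂ (fun v => f v t) U) (hv : v ∈ U) {t : ℝ} {w₁ w₂ : ℝ → ℂ} {d₁ d₂ : ℂ} {s : Set ℝ}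
    (h1 : w₁ 0 = v) (h2 : w₂ 0 = v) (hw1 : HasDerivWithinAt w₁ d₁ s 0) (hw2 : HasDerivWithinAt w₂ d₂ s 0) (h0 : (0:ℝ) ∈ s) :
    HasDerivWithinAt (fun h => f (w₁ h) (t + h) - f (w₂ h) (t + h)) (deriv (fun v => f v t) v * (d₁ - d₂)) s 0 := by
  set L := deriv (fun v => f v t) v
  have hj := deriv_joint hU hc hd
  have hj1 : ContinuousAt (fun p : ℂ × ℝ => deriv (fun v => f v p.2) p.1) (v, t) :=
    hj.continuousAt ((hU.prod isOpen_univ).mem_nhds ⟨hv, mem_univ _⟩)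
  have hA : HasDerivWithinAt (fun h => L * (w₁ h - w₂ h)) (L * (d₁ - d₂)) s 0 := (hw1.sub hw2).const_mul L
  have hB : HasDerivWithinAt (fun h => f (w₁ h) (t + h) - f (w₂ h) (t + h) - L * (w₁ h - w₂ h)) 0 s 0 := by
    rw [hasDerivWithinAt_iff_isLittleO]
    simp only [h1, h2, sub_self, mul_zero, sub_zero, smul_zero]
    have hO : (fun h : ℝ => w₁ h - w₂ h) =O[𝓝[s] 0] fun h : ℝ => h := by
      have := (hw1.sub hw2).hasFDerivWithinAt.isBigO_sub
      simpa [h1, h2] using this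
    refine Asymptotics.IsLittleO.trans_isBigO ?_ hO
    rw [Asymptotics.isLittleO_iff]
    intro ε hε
    have e1 : ∀ᶠ p : ℂ × ℝ in 𝓝 (v, t), p.1 ∈ U ∧ ‖deriv (fun v => f v p.2) p.1 - L‖ < ε := by
      refine Filter.Eventually.and ((hU.prod isOpen_univ).mem_nhds ⟨hv, mem_univ _⟩ |> fun h => by filter_upwards [h] with p hp using hp.1) ?_
      have := Metric.continuousAt_iff'.1 hj1 ε hε
      simpa [dist_eq_norm] using this
    obtain ⟨r, hr, hsub⟩ := Metric.eventually_nhds_iff_ball.1 e1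
    have c1 : ∀ᶠ h in 𝓝[s] (0:ℝ), w₁ h ∈ Metric.ball v r := by
      have := hw1.continuousWithinAt.tendsto; rw [h1] at this; exact this.eventually (Metric.ball_mem_nhds v hr)
    have c2 : ∀ᶠ h in 𝓝[s] (0:ℝ), w₂ h ∈ Metric.ball v r := by
      have := hw2.continuousWithinAt.tendsto; rw [h2] at this; exact this.eventually (Metric.ball_mem_nhds v hr)
    have c3 : ∀ᶠ h in 𝓝[s] (0:ℝ), h ∈ Metric.ball (0:ℝ) r := nhdsWithin_le_nhds (Metric.ball_mem_nhds 0 hr)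
    filter_upwards [c1, c2, c3] with h a b c
    have hin : ∀ z ∈ Metric.ball v r, z ∈ U ∧ ‖deriv (fun v => f v (t + h)) z - L‖ < ε := fun z hz => hsub (z, t + h) (by
      rw [Metric.mem_ball, Prod.dist_eq, max_lt_iff]
      refine ⟨hz, ?_⟩
      simpa [Real.dist_eq] using c)
    have := (convex_ball v r).norm_image_sub_le_of_norm_hasDerivWithin_le (𝕜 := ℂ) (f := fun z => f z (t + h) - L * z) (f' := fun z => deriv (fun v => f v (t + h)) z - L)
      (C := ε) (fun z hz => (((hd (t + h)).differentiableAt (hU.mem_nhds (hin z hz).1)).hasDerivAt.sub (by simpa using (hasDerivAt_id z).const_mul L)).hasDerivWithinAt)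
      (fun z hz => (hin z hz).2.le) b a
    calc _ = ‖f (w₁ h) (t + h) - L * w₁ h - (f (w₂ h) (t + h) - L * w₂ h)‖ := by congr 1; ring
      _ ≤ _ := this
  refine ((hB.add hA).congr_deriv (zero_add _)).congr_of_mem (fun h _ => ?_) h0
  simp

lemma right_two {f g : ℝ → ℂ} {a b : ℝ} (hf : ContinuousOn f (Icc a b)) (hg : ContinuousOn g (Icc a b))
    (hd : ∀ x ∈ Ioo a b, HasDerivWithinAt f (g x) (Ioi x) x) {x : ℝ} (hx : x ∈ Ioo a b) : HasDerivAt f (g x) x := by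
  have hI : ∀ y ∈ Icc a b, IntervalIntegrable g volume a y := fun y hy => by
    apply ContinuousOn.intervalIntegrable
    rw [uIcc_of_le hy.1]; exact hg.mono (Icc_subset_Icc_right hy.2)
  have e : ∀ y ∈ Icc a b, f y = f a + ∫ z in a..y, g z := fun y hy => by
    rw [intervalIntegral.integral_eq_sub_of_hasDeriv_right (a := a) (b := y) (f := f)]
    · ring
    · rw [uIcc_of_le hy.1]; exact hf.mono (Icc_subset_Icc_right hy.2)
    · rw [min_eq_left hy.1, max_eq_right hy.1]
      exact fun z hz => hd z ⟨hz.1, hz.2.trans_le hy.2⟩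
    · exact hI y hy
  have hn : Icc a b ∈ 𝓝 x := Icc_mem_nhds hx.1 hx.2
  have := (intervalIntegral.integral_hasDerivAt_right (hI x ⟨hx.1.le, hx.2.le⟩)
    (hg.stronglyMeasurableAtFilter_nhdsWithin measurableSet_Icc x |>.filter_mono (by rw [nhdsWithin_eq_nhds.2 hn])) (hg.continuousAt hn)).const_add (f a)
  exact this.congr_of_eventuallyEq (by filter_upwards [hn] with y hy using e y hy)

lemma FF_contAt {q : ℝ} {r : ℂ} (hr : r ≠ 0) (hw : ‖(q:ℂ) / r ^ 2‖ < 1) :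
    ContinuousAt (fun p : ℝ × ℂ => FF G p.1 p.2) (q, r) ∧ ContinuousAt (fun p : ℝ × ℂ => PP G p.1 p.2) (q, r) := by
  have hs := pw_slit hw
  unfold FF PP pw
  have h2 : r ^ 2 ≠ 0 := pow_ne_zero _ hr
  have h3 : r ^ 3 ≠ 0 := pow_ne_zero _ hr
  have h4 : 2 * r ^ 2 ≠ 0 := mul_ne_zero two_ne_zero h2
  constructor <;>
  fun_prop (disch := first | assumption | (left; assumption))

lemma Ph_big (hG : 10 ^ 20 ≤ G) (hv : v ∈ Dom G) (t : ℝ) : ‖xi G v 0 t‖ ≤ ‖rh G v‖ / 2 ∧ 4 ≤ ‖Ph G v t‖ := by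
  obtain ⟨h0, h1, h2⟩ := k0_le hG
  have b := (xi_good hG).bd v hv 0 le_rfl t
  obtain ⟨c1, c2, -⟩ := NN_all hG hv le_rfl h1 t b b
  simp only [Complex.ofReal_zero, add_zero] at c1 c2
  exact ⟨c1, by unfold Ph; linarith [half_norm c1]⟩

lemma big_ne {r : ℂ} (hr : 4 ≤ ‖r‖) (t : ℝ) : r ≠ 0 ∧ ‖(qq t:ℂ) / r ^ 2‖ < 1 := by
  refine ⟨fun h => by simp [h] at hr; linarith, ?_⟩
  have := (w_le (qq_nonneg t) (qq_le_one t) (R := 4) (by norm_num) hr).2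
  linarith

/-- the PDE for `Ph` -/
lemma Ph_diag (hG : 10 ^ 20 ≤ G) (hv : v ∈ Dom G) (t : ℝ) : HasDerivAt (fun s : ℝ => Ph G (v + s) (t + s))
    (e1 G v + deriv (fun w => Ph G w t) v * (1 - FF G (qq t) (Ph G v t) / ph G v)) 0 := by
  have hG0 : 0 < G := by linarith
  have hG1 : 100 ≤ G := by linarith
  have hr : ∀ u ∈ Dom G, ∀ t, HasDerivWithinAt (fun s : ℝ => Ph G (u + s) (t + s))
      (e1 G u + deriv (fun w => Ph G w t) u * (1 - FF G (qq t) (Ph G u t) / ph G u)) (Ici 0) 0 := by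
    intro u hu t
    obtain ⟨vh, R, a1, a2, a3, a4, a5⟩ := semi hG hu t
    have h1 : HasDerivWithinAt (fun s : ℝ => u + (s:ℂ)) 1 (Ici 0) 0 := by
      simpa using ((hasDerivAt_id (0:ℝ)).ofReal_comp.const_add u).hasDerivWithinAt
    have := diag0 (t := t) Dom_open (Ph_cont hG) (Ph_hol hG) hu (w₁ := fun s : ℝ => u + (s:ℂ)) (w₂ := vh) (s := Ici 0) (by simp) a1 h1 a2.hasDerivWithinAt (mem_Ici.2 le_rfl)
    refine ((a4.hasDerivWithinAt (s := Ici 0)).add this).congr_of_eventuallyEq_of_mem ?_ (mem_Ici.2 le_rfl)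
    filter_upwards [a5] with h hh
    simp only [Pi.add_apply]
    rw [← hh]; ring
  have hO : ∀ᶠ s : ℝ in 𝓝 0, v + s ∈ Dom G := by
    have : Continuous (fun h : ℝ => v + (h:ℂ)) := by fun_prop
    exact this.continuousAt.eventually (Dom_open.mem_nhds (by simpa using hv))
  obtain ⟨ε, hε, hsub⟩ := Metric.nhds_basis_closedBall.mem_iff.1 hO
  rw [Real.closedBall_eq_Icc, zero_sub, zero_add] at hsub
  have hm : MapsTo (fun s : ℝ => (v + (s:ℂ), t + s)) (Icc (-ε) ε) (Dom G ×ˢ univ) := fun s hs => ⟨hsub hs, mem_univ _⟩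
  have hcP : ContinuousOn (fun s : ℝ => Ph G (v + s) (t + s)) (Icc (-ε) ε) :=
    (Ph_cont hG).comp (f := fun s : ℝ => (v + (s:ℂ), t + s)) (by fun_prop) hm
  have hcd : ContinuousOn (fun s : ℝ => deriv (fun w => Ph G w (t + s)) (v + s)) (Icc (-ε) ε) :=
    (deriv_joint Dom_open (Ph_cont hG) (Ph_hol hG)).comp (f := fun s : ℝ => (v + (s:ℂ), t + s)) (by fun_prop) hm
  have := right_two (f := fun s : ℝ => Ph G (v + s) (t + s)) (a := -ε) (b := ε) (x := 0)
    (g := fun s : ℝ => e1 G (v + s) + deriv (fun w => Ph G w (t + s)) (v + s) * (1 - FF G (qq (t + s)) (Ph G (v + s) (t + s)) / ph G (v + s))) hcP ?_ ?_ ⟨by linarith, hε⟩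
  · simpa using this
  · intro s hs
    have hd := hsub hs
    have hc1 : Continuous (fun h : ℝ => v + (h:ℂ)) := by fun_prop
    have hc2 : ContinuousWithinAt (fun s : ℝ => FF G (qq (t + s)) (Ph G (v + s) (t + s))) (Icc (-ε) ε) s := by
      obtain ⟨n1, n2⟩ := big_ne (Ph_big hG hd (t + s)).2 (t + s)
      exact ContinuousAt.comp_continuousWithinAt (f := fun s : ℝ => (qq (t + s), Ph G (v + s) (t + s))) (FF_contAt (G := G) n1 n2).1
        ((qq_cont.comp (by fun_prop)).continuousWithinAt.prodMk (hcP s hs))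
    refine ContinuousWithinAt.add ?_ ((hcd s hs).mul (continuousWithinAt_const.sub (hc2.div ?_ (ph_ne hG1 hd))))
    · exact (ContinuousAt.comp (f := fun h : ℝ => v + (h:ℂ)) (e1_contAt hG0 (Dom_im hd)) hc1.continuousAt).continuousWithinAt
    · exact (ContinuousAt.comp (f := fun h : ℝ => v + (h:ℂ)) (ph_deriv hG0 (Dom_im hd)).continuousAt hc1.continuousAt).continuousWithinAt
  · intro s hs
    have := hr (v + s) (hsub ⟨hs.1.le, hs.2.le⟩) (t + s)
    have h2 : HasDerivWithinAt (fun x : ℝ => x - s) 1 (Ioi s) s := ((hasDerivAt_id s).sub_const s).hasDerivWithinAt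
    have h3 := HasDerivWithinAt.scomp (𝕜 := ℝ) (t' := Ici 0) s (g₁ := fun x : ℝ => Ph G (v + s + x) (t + s + x)) (h := fun x : ℝ => x - s) (by simpa using this) h2 (fun x hx => by have : s < x := hx; simp; linarith)
    rw [one_smul] at h3
    refine h3.congr_of_eventuallyEq (Eventually.of_forall fun x => ?_) ?_ <;> simp [Function.comp]

end

open Real Filter MeasureTheory Set Topology

section
variable {G : ℝ} {v u : ℂ}

lemma w2i {c : ℝ} (hc : 0 < c) :
    IntegrableOn (fun x => 1 / √(c + x) ^ 4) (Ioi 0) ∧ ∫ x in Ioi 0, 1 / √(c + x) ^ 4 = 1 / √c ^ 2 := by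
  have hl : Tendsto (fun x => -1 / (c + x)) atTop (𝓝 0) :=
    Tendsto.const_div_atTop (tendsto_atTop_add_const_left _ c tendsto_id) _
  have hd : ∀ x ∈ Ici (0:ℝ), HasDerivAt (fun x => -1 / (c + x)) (1 / √(c + x) ^ 4) x := by
    intro x hx
    have hx : 0 ≤ x := hx
    have h0 : 0 < c + x := by linarith
    have := (((hasDerivAt_id x).const_add c).inv h0.ne').const_mul (-1)
    refine (this.congr_deriv ?_).congr_of_eventuallyEq (Eventually.of_forall fun y => by simp [div_eq_mul_inv])
    rw [show √(c + x) ^ 4 = (√(c + x) ^ 2) ^ 2 by ring, Real.sq_sqrt h0.le]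
    simp; ring
  refine ⟨integrableOn_Ioi_deriv_of_nonneg' hd (fun x _ => by positivity) hl, ?_⟩
  rw [integral_Ioi_of_hasDerivAt_of_nonneg' hd (fun x _ => by positivity) hl, Real.sq_sqrt hc.le]; simp [neg_div]

lemma NN_est (hG : 10 ^ 20 ≤ G) {k : ℝ} (hk0 : 0 ≤ k) (hk : k ≤ 10 ^ 16 / G ^ 2) (t : ℝ) {s : ℝ} (hs : 0 ≤ s)
    (hv : v ∈ Dom G) {x : ℂ} (hx : ‖x‖ ≤ k * √(y0 G v + s)) :
    ‖NN G (qq t) (rh G (v + s)) x‖ ≤ 21609 / √G ^ 4 * (1 / √(y0 G v + s) ^ 4) + 10 ^ 39 / √G ^ 9 * (1 / √(y0 G v + s) ^ 3) ∧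
    ‖NN G (qq t) (rh G (v + s)) x - 3 / 2 * qq t / rh G (v + s) ^ 4‖ ≤ 40 * 7 ^ 6 / √G ^ 6 * (1 / √(y0 G v + s) ^ 4) + 10 ^ 39 / √G ^ 9 * (1 / √(y0 G v + s) ^ 3) := by
  obtain ⟨a1, a2, a3, a4, a5, a6⟩ := base hG hv hs
  have h1 := (Nx_le hG hk0 hk t hs hv hx).2
  obtain ⟨h2, h3⟩ := NN0_abs (G := G) a1 a2 (qq_nonneg t) (qq_le_one t) a4
  set a := √G
  set b := √(y0 G v + s)
  have ha : 0 < a := by linarith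
  have hb : 0 < b := by linarith
  constructor
  · rw [mul_pow] at h2
    calc _ = ‖NN G (qq t) (rh G (v + s)) 0 + (NN G (qq t) (rh G (v + s)) x - NN G (qq t) (rh G (v + s)) 0)‖ := by congr 1; ring
      _ ≤ _ := (norm_add_le _ _).trans (add_le_add (h2.trans (le_of_eq (by field_simp))) h1)
  · rw [mul_pow] at h3
    have h4 : 40 * 7 ^ 6 / (a ^ 6 * b ^ 6) ≤ 40 * 7 ^ 6 / a ^ 6 * (1 / b ^ 4) := by
      rw [div_mul_div_comm, mul_one]
      gcongr; norm_num
    calc _ = ‖(NN G (qq t) (rh G (v + s)) 0 - 3 / 2 * qq t / rh G (v + s) ^ 4) + (NN G (qq t) (rh G (v + s)) x - NN G (qq t) (rh G (v + s)) 0)‖ := by congr 1; ring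
      _ ≤ _ := (norm_add_le _ _).trans (add_le_add (h3.trans h4) h1)

lemma y0_sqrt (hG : 0 < G) : √(y0 G v) ≤ √G ^ 3 := by
  apply Real.sqrt_le_iff.2 ⟨by positivity, ?_⟩
  rw [← pow_mul, show √G ^ (3 * 2) = (√G ^ 2) ^ 3 by ring, Real.sq_sqrt hG.le]
  have := y0_le (G := G) (v := v)
  have : 0 < G ^ 3 := by positivity
  linarith

lemma int_est (hG : 10 ^ 20 ≤ G) (hv : v ∈ Dom G) {g : ℝ → ℂ} {A B : ℝ}
    (hb : ∀ x ≥ 0, ‖g x‖ ≤ A * (1 / √(y0 G v + x) ^ 4) + B * (1 / √(y0 G v + x) ^ 3)) :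
    ‖∫ x in Ioi 0, e1 G (v + (x:ℝ)) * g x‖ ≤ 300 * √G / √(y0 G v) * (A * (1 / √(y0 G v) ^ 2) + B * (2 / √(y0 G v))) ∧
    (ContinuousOn g (Ici 0) → IntegrableOn (fun x : ℝ => e1 G (v + (x:ℝ)) * g x) (Ioi 0)) := by
  have hy : 0 < y0 G v := by linarith [Dom_y0 hv]
  have h1 := w2i hy
  have h2 := w32 hy le_rfl
  have hs : 0 < √(y0 G v) := Real.sqrt_pos.2 hy
  rw [add_zero] at h2
  rw [← h1.2, ← h2.2, ← integral_const_mul, ← integral_const_mul, ← integral_add (h1.1.const_mul A) (h2.1.const_mul B), ← integral_const_mul]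
  suffices hh : ∀ᵐ x ∂(volume.restrict (Ioi (0:ℝ))), ‖e1 G (v + (x:ℝ)) * g x‖ ≤ 300 * √G / √(y0 G v) * (A * (1 / √(y0 G v + x) ^ 4) + B * (1 / √(y0 G v + x) ^ 3)) by
    have hI := ((h1.1.const_mul A).add (h2.1.const_mul B)).const_mul (300 * √G / √(y0 G v))
    refine ⟨norm_integral_le_of_norm_le hI hh, fun hc => hI.mono' ?_ hh⟩
    refine ContinuousOn.aestronglyMeasurable (ContinuousOn.mul (fun x _ => ?_) (hc.mono Ioi_subset_Ici_self)) measurableSet_Ioi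
    exact ((along (e1_deriv (by linarith) (Dom_add hv x))).continuousAt).continuousWithinAt
  refine (ae_restrict_iff' measurableSet_Ioi).2 (Eventually.of_forall fun x hx => ?_)
  have hx : 0 < x := hx
  rw [norm_mul]
  have h3 := K3 (by linarith) hv hx.le
  have := hb x hx.le
  refine mul_le_mul ?_ this (norm_nonneg _) (by positivity)
  rw [le_div_iff₀ hs]; exact h3

lemma H4i (hG : 10 ^ 20 ≤ G) (hv : v ∈ Dom G) (t : ℝ) :
    IntegrableOn (fun x : ℝ => e1 G (v + (x:ℝ)) * (3 / 2 * qq (t + x) / rh G (v + x) ^ 4)) (Ioi 0) := by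
  have hG0 : 0 < G := by linarith
  refine (int_est (A := 3 / 2 * 7 ^ 4 / √G ^ 4) (B := 0) hG hv (fun x hx => ?_)).2 fun x hx => ?_
  · obtain ⟨a1, a2, -, a4, -⟩ := base hG hv hx
    have h1 : √G * √(y0 G v + x) > 0 := by have : 0 < √G := by linarith
                                           have : 0 < √(y0 G v + x) := by linarith
                                           positivity
    rw [norm_div, norm_pow, norm_mul, Complex.norm_real, Real.norm_eq_abs, abs_of_nonneg (qq_nonneg _)]
    norm_num
    calc _ ≤ 3 / 2 * 1 / (√G * √(y0 G v + x) / 7) ^ 4 := by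
          gcongr; exact qq_le_one _
      _ = _ := by rw [div_pow, mul_pow]; field_simp; norm_num
  · refine ContinuousWithinAt.div ?_ ?_ (pow_ne_zero _ (rh_ne hG0 (Dom_add hv x)))
    · have : Continuous fun x : ℝ => (3 / 2 * (qq (t + x) : ℂ)) := continuous_const.mul (Complex.continuous_ofReal.comp (qq_cont.comp (by fun_prop)))
      exact this.continuousWithinAt
    · exact ((along (rh_deriv hG0 (Dom_add hv x))).continuousAt.pow 4).continuousWithinAt

lemma xph_le (hG : 10 ^ 20 ≤ G) (hv : v ∈ Dom G) (t : ℝ) : ‖xi G v 0 t * ph G v‖ ≤ 10 ^ 22 / (√G ^ 3 * √(y0 G v) ^ 3) ∧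
    ‖xi G v 0 t * ph G v - ∫ x in Ioi 0, e1 G (v + (x:ℝ)) * (3 / 2 * qq (t + x) / rh G (v + x) ^ 4)‖ ≤ 10 ^ 12 / √G ^ 5 ∧ ‖xi G v 0 t‖ ≤ 10 ^ 26 / √G ^ 4 := by
  have hG0 : 0 < G := by linarith
  have hG1 : 100 ≤ G := by linarith
  obtain ⟨h0, h1, h2⟩ := k0_le hG
  obtain ⟨-, -, -, -, -, -, e⟩ := R_ode hG hv t
  have b := (xi_good hG).bd v hv
  obtain ⟨a1, a2, a3, a4, -, a6⟩ := base hG hv le_rfl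
  simp only [add_zero, Complex.ofReal_zero] at a2 a4 a6
  have hys := y0_sqrt (v := v) hG0
  have E1 := int_est hG hv (fun x hx => (NN_est hG h0 h1 (t + x) hx hv (b x hx t)).1)
  have E2 := int_est hG hv (fun x hx => (NN_est hG h0 h1 (t + x) hx hv (b x hx t)).2)
  have ha : 0 < √G := by linarith
  have hb : 0 < √(y0 G v) := by linarith
  have k5 := K5 hG1 hv
  set c := √(y0 G v) with hc
  set a := √G with ha'
  have F1 : ‖xi G v 0 t * ph G v‖ ≤ 10 ^ 22 / (a ^ 3 * c ^ 3) := by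
    rw [e]
    refine E1.1.trans ?_
    have e1 : 300 * a / c * (21609 / a ^ 4 * (1 / c ^ 2) + 10 ^ 39 / a ^ 9 * (2 / c)) = 300 * (21609 + 2 * 10 ^ 39 * c / a ^ 5) / (a ^ 3 * c ^ 3) := by
      field_simp
    rw [e1]
    have e2 : 2 * 10 ^ 39 * c / a ^ 5 ≤ 2 * 10 ^ 19 := by
      rw [div_le_iff₀ (by positivity)]
      have : 10 ^ 20 * c ≤ a ^ 2 * a ^ 3 := by
        have : (10:ℝ) ^ 20 ≤ a ^ 2 := by nlinarith
        gcongr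
      nlinarith
    gcongr
    linarith
  refine ⟨F1, ?_, ?_⟩
  · rw [e, ← integral_sub]
    · refine le_trans (le_of_eq ?_) (E2.1.trans ?_)
      · congr 1; apply integral_congr_ae; exact Eventually.of_forall fun x => by simp only [NI]; ring
      · have e1 : 300 * a / c * (40 * 7 ^ 6 / a ^ 6 * (1 / c ^ 2) + 10 ^ 39 / a ^ 9 * (2 / c)) = 300 * (40 * 7 ^ 6 / (c ^ 3) + 2 * 10 ^ 39 / (a ^ 3 * c ^ 2)) / a ^ 5 := by
          field_simp
        rw [e1]
        have e2 : 2 * 10 ^ 39 / (a ^ 3 * c ^ 2) ≤ 2 * 10 ^ 9 := by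
          have h3 : ((10:ℝ) ^ 10) ^ 3 ≤ a ^ 3 := by gcongr
          have h4 : 1 ≤ c ^ 2 := one_le_pow₀ a2
          rw [div_le_iff₀ (by positivity)]
          nlinarith
        have e3 : 40 * 7 ^ 6 / (c ^ 3) ≤ 40 * 7 ^ 6 := div_le_self (by norm_num) (one_le_pow₀ a2)
        gcongr
        linarith
    · exact E1.2 (NI_cont hG h1 hv ((xi_good hG).adm hv t))
    · exact H4i hG hv t
  · have hr : ‖rh G v‖ ≤ 10 * a * c := by
      apply abs_le_of_sq_le_sq' _ (by positivity) |>.2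
      calc _ ≤ _ := k5.2
        _ = 100 * a ^ 2 * c ^ 2 := by rw [← a3, ← a6]
        _ = _ := by ring
    have h3 : ‖xi G v 0 t‖ * ‖ph G v‖ ≤ 10 ^ 22 / (a ^ 3 * c ^ 3) := by rwa [norm_mul] at F1
    have h4 : 3 / 8 * a ^ 4 ≤ ‖ph G v‖ * (10 * a * c) ^ 3 := by
      calc 3 / 8 * a ^ 4 = 3 / 8 * G ^ 2 := by rw [a3]; ring
        _ ≤ _ := k5.1.trans (by gcongr)
    rw [le_div_iff₀ (by positivity)] at h3 ⊢
    nlinarith [mul_le_mul_of_nonneg_left h4 (norm_nonneg (xi G v 0 t))]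

end

open Real Filter MeasureTheory Set Topology

noncomputable def Pf (G : ℝ) (v : ℂ) (t : ℝ) : ℂ := ph G v * (Ph G (-v) (-t) - Ph G v t)
noncomputable def Xf (G : ℝ) (v : ℂ) (t : ℝ) : ℂ := PP G (qq t) (Ph G (-v) (-t)) - PP G (qq t) (Ph G v t) - Pf G v t

section
variable {G : ℝ} {v u : ℂ}

lemma Dom_neg (hv : v ∈ Dom G) : -v ∈ Dom G := by simpa [Dom] using hv
lemma y0_neg : y0 G (-v) = y0 G v := by simp [y0]

lemma bX (hG : 10 ^ 20 ≤ G) (hv : v ∈ Dom G) (t : ℝ) {x : ℂ} (h1 : ‖x‖ ≤ k0 G * √(y0 G v)) (h2 : ‖x‖ ≤ 10 ^ 26 / √G ^ 4) :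
    ‖FF G (qq t) (rh G v + x) - ph G v‖ ≤ 10 ^ 29 / (√G ^ 5 * √(y0 G v)) * ‖ph G v‖ := by
  have hG0 : 0 < G := by linarith
  have hG1 : 100 ≤ G := by linarith
  obtain ⟨k1, k2, -⟩ := k0_le hG
  obtain ⟨a1, a2, a3, a4, -, a6⟩ := base hG hv le_rfl
  have hN := (NN_est hG k1 k2 t le_rfl hv (x := x) (by simpa using h1)).1
  simp only [add_zero, Complex.ofReal_zero] at a2 a4 a6 hN
  have hys := y0_sqrt (v := v) hG0
  have ha : 0 < √G := by linarith
  have hb : 0 < √(y0 G v) := by linarith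
  have k5 := K5 hG1 hv
  set c := √(y0 G v) with hc
  set a := √G with ha'
  have hr : ‖rh G v‖ ≤ 10 * a * c := by
    apply abs_le_of_sq_le_sq' _ (by positivity) |>.2
    calc _ ≤ _ := k5.2
      _ = 100 * a ^ 2 * c ^ 2 := by rw [← a3, ← a6]
      _ = _ := by ring
  have hr0 : 0 < ‖rh G v‖ := by have : 0 < a * c := by positivity
                                linarith
  have hp : 3 / 8 * a ^ 4 / ‖rh G v‖ ^ 3 ≤ ‖ph G v‖ := by
    rw [div_le_iff₀ (by positivity)]
    calc 3 / 8 * a ^ 4 = 3 / 8 * G ^ 2 := by rw [a3]; ring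
        _ ≤ _ := k5.1
  have e : FF G (qq t) (rh G v + x) - ph G v = NN G (qq t) (rh G v) x + F0' G (rh G v) * x := by
    rw [ph_eq hG0 (Dom_im hv)]; unfold NN; ring
  have hF : ‖F0' G (rh G v)‖ ≤ 3 * a ^ 4 / ‖rh G v‖ ^ 4 + 2 / ‖rh G v‖ ^ 3 := by
    unfold F0'
    refine (norm_add_le _ _).trans (le_of_eq ?_)
    simp only [norm_div, norm_mul, norm_neg, norm_pow, Complex.norm_real, Real.norm_eq_abs, abs_of_pos hG0]
    rw [a3]; norm_num; ring
  rw [e]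
  have hca : c / a ^ 3 ≤ 1 := by rw [div_le_one (by positivity)]; exact hys
  calc _ ≤ (21609 / a ^ 4 * (1 / c ^ 4) + 10 ^ 39 / a ^ 9 * (1 / c ^ 3)) + (3 * a ^ 4 / ‖rh G v‖ ^ 4 + 2 / ‖rh G v‖ ^ 3) * (10 ^ 26 / a ^ 4) := by
        refine (norm_add_le _ _).trans (add_le_add hN ?_)
        rw [norm_mul]; gcongr
    _ = ((21609 / a ^ 4 * (1 / c ^ 4) + 10 ^ 39 / a ^ 9 * (1 / c ^ 3)) * ‖rh G v‖ ^ 3 + (3 * a ^ 4 / ‖rh G v‖ + 2) * (10 ^ 26 / a ^ 4)) / ‖rh G v‖ ^ 3 := by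
        field_simp
    _ ≤ ((21609 / a ^ 4 * (1 / c ^ 4) + 10 ^ 39 / a ^ 9 * (1 / c ^ 3)) * (10 * a * c) ^ 3 + (3 * a ^ 4 / (a * c / 7) + 2) * (10 ^ 26 / a ^ 4)) / ‖rh G v‖ ^ 3 := by gcongr
    _ = ((21609 * 1000 + 10 ^ 42 * (c / a ^ 3) / a ^ 2 + 21 * 10 ^ 26 + 2 * 10 ^ 26 * (c / a ^ 3)) / (a * c)) / ‖rh G v‖ ^ 3 := by
        congr 1; field_simp; ring
    _ ≤ ((21609 * 1000 + 10 ^ 42 * 1 / (10 ^ 10) ^ 2 + 21 * 10 ^ 26 + 2 * 10 ^ 26 * 1) / (a * c)) / ‖rh G v‖ ^ 3 := by gcongr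
    _ ≤ (10 ^ 29 * (3 / 8) / (a * c)) / ‖rh G v‖ ^ 3 := by gcongr; norm_num
    _ = 10 ^ 29 / (a ^ 5 * c) * (3 / 8 * a ^ 4 / ‖rh G v‖ ^ 3) := by field_simp
    _ ≤ _ := by gcongr

lemma Xf_le (hG : 10 ^ 20 ≤ G) (hv : v ∈ Dom G) (t : ℝ) : ‖Xf G v t‖ ≤ 10 ^ 29 / (√G ^ 5 * √(y0 G v)) * ‖Pf G v t‖ := by
  have hG0 : 0 < G := by linarith
  have b1 := (xi_good hG).bd v hv 0 le_rfl t
  have b2 := (xi_good hG).bd (-v) (Dom_neg hv) 0 le_rfl (-t)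
  have b3 := (xph_le hG hv t).2.2
  have b4 := (xph_le hG (Dom_neg hv) (-t)).2.2
  rw [add_zero] at b1 b2
  rw [y0_neg] at b2
  set m := min (k0 G * √(y0 G v)) (10 ^ 26 / √G ^ 4)
  have c1 : Ph G v t ∈ Metric.closedBall (rh G v) m := by
    rw [mem_closedBall_iff_norm, Ph, add_sub_cancel_left]; exact le_min b1 b3
  have c2 : Ph G (-v) (-t) ∈ Metric.closedBall (rh G v) m := by
    rw [mem_closedBall_iff_norm, Ph, rh_neg hG0 (Dom_im hv), add_sub_cancel_left]; exact le_min b2 b4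
  have := (convex_closedBall (rh G v) m).norm_image_sub_le_of_norm_hasDerivWithin_le (𝕜 := ℂ) (f := fun r => PP G (qq t) r - ph G v * r)
    (f' := fun r => FF G (qq t) r - ph G v) (C := 10 ^ 29 / (√G ^ 5 * √(y0 G v)) * ‖ph G v‖) (fun r hr => ?_) (fun r hr => ?_) c1 c2
  · unfold Xf Pf
    rw [norm_mul, ← mul_assoc]
    refine le_trans (le_of_eq ?_) this
    congr 1; ring
  · rw [mem_closedBall_iff_norm] at hr
    have h1 : ‖r - rh G v‖ ≤ k0 G * √(y0 G v + 0) := by rw [add_zero]; exact hr.trans (min_le_left _ _)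
    obtain ⟨d1, d2, -⟩ := NN_all hG hv le_rfl (k0_le hG).2.1 t h1 h1
    rw [Complex.ofReal_zero, add_zero] at d1 d2
    have := half_norm d1
    rw [add_sub_cancel] at this
    obtain ⟨n1, n2⟩ := big_ne (r := r) (by linarith) t
    exact ((PP_deriv n1 n2).sub (by simpa using (hasDerivAt_id r).const_mul (ph G v))).hasDerivWithinAt
  · rw [mem_closedBall_iff_norm] at hr
    have := bX hG hv t (x := r - rh G v) (hr.trans (min_le_left _ _)) (hr.trans (min_le_right _ _))
    rwa [add_sub_cancel] at this

lemma Pf_eq (hG : 10 ^ 20 ≤ G) (hv : v ∈ Dom G) (t : ℝ) : Pf G v t = xi G (-v) 0 (-t) * ph G (-v) - xi G v 0 t * ph G v := by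
  have hG0 : 0 < G := by linarith
  unfold Pf Ph
  rw [rh_neg hG0 (Dom_im hv), ph_neg hG0 (Dom_im hv)]; ring

lemma Pf_le (hG : 10 ^ 20 ≤ G) (hv : v ∈ Dom G) (t : ℝ) : ‖Pf G v t‖ ≤ 2 * 10 ^ 22 / (√G ^ 3 * √(y0 G v) ^ 3) := by
  rw [Pf_eq hG hv]
  have h1 := (xph_le hG hv t).1
  have h2 := (xph_le hG (Dom_neg hv) (-t)).1
  rw [y0_neg] at h2
  refine (norm_sub_le _ _).trans ?_
  linarith [show 2 * 10 ^ 22 / (√G ^ 3 * √(y0 G v) ^ 3) = 10 ^ 22 / (√G ^ 3 * √(y0 G v) ^ 3) + 10 ^ 22 / (√G ^ 3 * √(y0 G v) ^ 3) by ring]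

lemma Pf_odd (hG : 10 ^ 20 ≤ G) (hv : v ∈ Dom G) (t : ℝ) : Pf G (-v) (-t) = - Pf G v t := by
  rw [Pf_eq hG hv, Pf_eq hG (Dom_neg hv)]; simp

lemma Ph_per (hG : 10 ^ 20 ≤ G) (v : ℂ) (t : ℝ) : Ph G v (t + 2 * π) = Ph G v t := by
  unfold Ph; rw [(xi_good hG).per]

lemma Pf_per (hG : 10 ^ 20 ≤ G) (v : ℂ) (t : ℝ) : Pf G v (t + 2 * π) = Pf G v t := by
  unfold Pf
  rw [Ph_per hG, ← Ph_per hG (-v) (-(t + 2 * π))]; congr 4; ring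

lemma Phu_cont (hG : 10 ^ 20 ≤ G) : ContinuousOn (fun p : ℂ × ℝ => Ph G (-p.1) (-p.2)) (Dom G ×ˢ univ) :=
  (Ph_cont hG).comp (f := fun p : ℂ × ℝ => (-p.1, -p.2)) (by fun_prop) fun _ hp => ⟨Dom_neg hp.1, mem_univ _⟩

lemma Phu_hd (hG : 10 ^ 20 ≤ G) (hv : v ∈ Dom G) (t : ℝ) : HasDerivAt (fun v => Ph G (-v) (-t)) (-deriv (fun w => Ph G w (-t)) (-v)) v := by
  have := ((Ph_hol hG (-t)).differentiableAt (Dom_open.mem_nhds (Dom_neg hv))).hasDerivAt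
  exact (HasDerivAt.comp (h₂ := fun w => Ph G w (-t)) v this (hasDerivAt_neg v)).congr_deriv (by simp)

lemma Ph_hd (hG : 10 ^ 20 ≤ G) (hv : v ∈ Dom G) (t : ℝ) : HasDerivAt (fun v => Ph G v t) (deriv (fun w => Ph G w t) v) v :=
  ((Ph_hol hG t).differentiableAt (Dom_open.mem_nhds hv)).hasDerivAt

lemma Pf_cont (hG : 10 ^ 20 ≤ G) : ContinuousOn (fun p : ℂ × ℝ => Pf G p.1 p.2) (Dom G ×ˢ univ) := by
  refine ContinuousOn.mul (fun p hp => ?_) ((Phu_cont hG).sub (Ph_cont hG))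
  exact (ContinuousAt.comp (f := fun p : ℂ × ℝ => p.1) (ph_deriv (by linarith) (Dom_im hp.1)).continuousAt continuousAt_fst).continuousWithinAt

lemma PP_contOn {g : ℂ × ℝ → ℂ} (hg : ContinuousOn g (Dom G ×ˢ univ)) (hb : ∀ p ∈ Dom G ×ˢ univ, 4 ≤ ‖g p‖) :
    ContinuousOn (fun p : ℂ × ℝ => PP G (qq p.2) (g p)) (Dom G ×ˢ univ) := by
  intro p hp
  obtain ⟨n1, n2⟩ := big_ne (hb p hp) p.2
  exact ContinuousAt.comp_continuousWithinAt (f := fun p : ℂ × ℝ => (qq p.2, g p)) (FF_contAt (G := G) n1 n2).2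
        ((qq_cont.comp continuous_snd).continuousWithinAt.prodMk (hg p hp))

lemma Xf_cont (hG : 10 ^ 20 ≤ G) : ContinuousOn (fun p : ℂ × ℝ => Xf G p.1 p.2) (Dom G ×ˢ univ) :=
  ((PP_contOn (Phu_cont hG) fun _ hp => (Ph_big hG (Dom_neg hp.1) _).2).sub (PP_contOn (Ph_cont hG) fun _ hp => (Ph_big hG hp.1 _).2)).sub (Pf_cont hG)

lemma Pf_hd (hG : 10 ^ 20 ≤ G) (hv : v ∈ Dom G) (t : ℝ) : HasDerivAt (fun v => Pf G v t)
    (F0' G (rh G v) * e1 G v * (Ph G (-v) (-t) - Ph G v t) + ph G v * (-deriv (fun w => Ph G w (-t)) (-v) - deriv (fun w => Ph G w t) v)) v :=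
  (ph_deriv (by linarith) (Dom_im hv)).mul ((Phu_hd hG hv t).sub (Ph_hd hG hv t))

lemma Xf_hd (hG : 10 ^ 20 ≤ G) (hv : v ∈ Dom G) (t : ℝ) : HasDerivAt (fun v => Xf G v t)
    (FF G (qq t) (Ph G (-v) (-t)) * (-deriv (fun w => Ph G w (-t)) (-v)) - FF G (qq t) (Ph G v t) * deriv (fun w => Ph G w t) v - 
    (F0' G (rh G v) * e1 G v * (Ph G (-v) (-t) - Ph G v t) + ph G v * (-deriv (fun w => Ph G w (-t)) (-v) - deriv (fun w => Ph G w t) v))) v := by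
  obtain ⟨n1, n2⟩ := big_ne (Ph_big hG hv t).2 t
  obtain ⟨m1, m2⟩ := big_ne (Ph_big hG (Dom_neg hv) (-t)).2 t
  exact (((PP_deriv (G := G) m1 m2).comp v (Phu_hd hG hv t)).sub ((PP_deriv (G := G) n1 n2).comp v (Ph_hd hG hv t))).sub (Pf_hd hG hv t)

lemma Pf_hol (hG : 10 ^ 20 ≤ G) (t : ℝ) : DifferentiableOn ℂ (fun v => Pf G v t) (Dom G) := fun _ hv =>
  (Pf_hd hG hv t).differentiableAt.differentiableWithinAt
lemma Xf_hol (hG : 10 ^ 20 ≤ G) (t : ℝ) : DifferentiableOn ℂ (fun v => Xf G v t) (Dom G) := fun _ hv =>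
  (Xf_hd hG hv t).differentiableAt.differentiableWithinAt

lemma Pf_diag (hG : 10 ^ 20 ≤ G) (hv : v ∈ Dom G) (t : ℝ) : HasDerivAt (fun s : ℝ => Pf G (v + s) (t + s)) (-deriv (fun w => Xf G w t) v) 0 := by
  have hG0 : 0 < G := by linarith
  have h1 := Ph_diag hG hv t
  have h2 := Ph_diag hG (Dom_neg hv) (-t)
  have h3 := HasDerivAt.scomp (𝕜 := ℝ) (0:ℝ) (by simpa using h2) (hasDerivAt_neg (0:ℝ))
  have h4 : HasDerivAt (fun s : ℝ => ph G (v + s)) (F0' G (rh G v) * e1 G v) 0 := along (by simpa using ph_deriv hG0 (Dom_im hv))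
  have h5 := h4.mul (h3.sub h1)
  rw [(Xf_hd hG hv t).deriv]
  refine (h5.congr_deriv ?_).congr_of_eventuallyEq (Eventually.of_forall fun s => ?_)
  · simp only [qq_neg, e1_neg hG0 (Dom_im hv), ph_neg hG0 (Dom_im hv)]
    have := ph_ne (by linarith) hv
    simp
    field_simp
    ring
  · simp [Pf, Function.comp, add_comm]

end

open Real Filter MeasureTheory Set Topology

noncomputable def kp (u : ℂ) : ℂ := Complex.exp (Complex.I * u) / (1 - Complex.exp (Complex.I * u))

lemma kp_neg {u : ℂ} (h : Complex.exp (Complex.I * u) ≠ 1) : kp (-u) = -1 - kp u := by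
  unfold kp
  rw [mul_neg, Complex.exp_neg]
  have h0 := Complex.exp_ne_zero (Complex.I * u)
  have h1 : 1 - Complex.exp (Complex.I * u) ≠ 0 := sub_ne_zero.2 h.symm
  have h2 : Complex.exp (Complex.I * u) - 1 ≠ 0 := sub_ne_zero.2 h
  field_simp
  ring

lemma kp_per (u : ℂ) : kp (u + 2 * π) = kp u := by
  unfold kp
  rw [show Complex.I * (u + 2 * π) = Complex.I * u + 2 * π * Complex.I by ring, Complex.exp_periodic]

lemma EE_norm (u : ℂ) : ‖Complex.exp (Complex.I * u)‖ = Real.exp (-u.im) := by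
  rw [Complex.norm_exp]; simp

lemma EE_ne {u : ℂ} (h : u.im ≠ 0) : Complex.exp (Complex.I * u) ≠ 1 := by
  intro h'
  have := EE_norm u
  rw [h', norm_one, eq_comm, Real.exp_eq_one_iff] at this
  exact h (by linarith)

lemma EE_ne' {u : ℂ} (h : |u.re| < 2 * π) (h0 : u ≠ 0) : Complex.exp (Complex.I * u) ≠ 1 := by
  intro h'
  obtain ⟨n, hn⟩ := Complex.exp_eq_one_iff.1 h'
  have h1 : u = n * (2 * π) := by
    have : Complex.I * u = Complex.I * (n * (2 * π)) := by rw [hn]; ring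
    exact mul_left_cancel₀ Complex.I_ne_zero this
  have h2 : u.re = n * (2 * π) := by
    rw [h1]
    have : ((n : ℂ) * (2 * π)) = (((n:ℝ) * (2 * π) : ℝ) : ℂ) := by push_cast; ring
    rw [this, Complex.ofReal_re]
  have hp := Real.pi_pos
  rw [h2, abs_mul, abs_of_pos (by positivity : 0 < 2 * π)] at h
  have h3 : |(n:ℝ)| < 1 := by by_contra hc; push Not at hc; nlinarith
  have h4 : n = 0 := by
    have : |n| < 1 := by exact_mod_cast h3
    exact Int.abs_lt_one_iff.1 this
  exact h0 (by rw [h1, h4]; simp)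

lemma kp_top {z : ℂ} {σ : ℝ} (h : z.im < σ) : ∫ x in (-π)..π, kp ((x:ℂ) + σ * Complex.I - z) = 0 := by
  have him : ∀ x : ℝ, ((x:ℂ) + σ * Complex.I - z).im = σ - z.im := fun x => by simp
  have hs : ∀ x : ℝ, 1 - Complex.exp (Complex.I * ((x:ℂ) + σ * Complex.I - z)) ∈ Complex.slitPlane := by
    intro x
    left
    have h1 := EE_norm ((x:ℂ) + σ * Complex.I - z)
    have h2 := Complex.re_le_norm (Complex.exp (Complex.I * ((x:ℂ) + σ * Complex.I - z)))
    rw [h1, him] at h2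
    have : Real.exp (-(σ - z.im)) < 1 := Real.exp_lt_one_iff.2 (by linarith)
    simp only [Complex.sub_re, Complex.one_re]
    linarith
  have hE : ∀ x : ℝ, HasDerivAt (fun x : ℝ => Complex.exp (Complex.I * ((x:ℂ) + σ * Complex.I - z))) (Complex.exp (Complex.I * ((x:ℂ) + σ * Complex.I - z)) * Complex.I) x := by
    intro x
    have h1 : HasDerivAt (fun x : ℝ => Complex.I * ((x:ℂ) + σ * Complex.I - z)) Complex.I x := by
      simpa using (((hasDerivAt_id x).ofReal_comp.add_const (σ * Complex.I)).sub_const z).const_mul Complex.I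
    exact h1.cexp
  have hd : ∀ x : ℝ, HasDerivAt (fun x : ℝ => Complex.I * Complex.log (1 - Complex.exp (Complex.I * ((x:ℂ) + σ * Complex.I - z)))) (kp ((x:ℂ) + σ * Complex.I - z)) x := by
    intro x
    have := (((hE x).const_sub 1).clog_real (hs x)).const_mul Complex.I
    refine this.congr_deriv ?_
    have := Complex.slitPlane_ne_zero (hs x)
    unfold kp
    field_simp
    rw [Complex.I_sq]; ring
  rw [intervalIntegral.integral_eq_sub_of_hasDerivAt (fun x _ => hd x)]
  · have : Complex.I * ((π:ℂ) + σ * Complex.I - z) = Complex.I * (((-π : ℝ):ℂ) + σ * Complex.I - z) + 2 * π * Complex.I := by push_cast; ring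
    simp only [this]
    rw [Complex.exp_periodic, sub_self]
  · apply Continuous.intervalIntegrable
    have c1 : Continuous (fun x : ℝ => Complex.exp (Complex.I * ((x:ℂ) + σ * Complex.I - z))) := by fun_prop
    exact c1.div (continuous_const.sub c1) fun x => Complex.slitPlane_ne_zero (hs x)

lemma kp_contAt {u : ℂ} (h : Complex.exp (Complex.I * u) ≠ 1) : ContinuousAt kp u := by
  unfold kp
  exact ContinuousAt.div (by fun_prop) (by fun_prop) (sub_ne_zero.2 h.symm)

/-- kernel formula on a rectangle -/
lemma kernel {p : ℂ → ℂ} {U : Set ℂ} (hU : IsOpen U) (hp : DifferentiableOn ℂ p U) {σ : ℝ} {z : ℂ} (hσ : |z.im| < σ) (hz : |z.re| ≤ 1)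
    (hsub : (Icc (-π) π) ×ℂ (Icc (-σ) σ) ⊆ U) :
    2 * π * p z = (∫ x in (-π)..π, p (x:ℂ)) + (∫ x in (-π)..π, p ((x:ℂ) + σ * Complex.I) * kp ((x:ℂ) + σ * Complex.I - z))
      + (∫ x in (-π)..π, p ((x:ℂ) - σ * Complex.I) * kp (z - ((x:ℂ) - σ * Complex.I)))
      - Complex.I * (∫ y in (0)..σ, (p (π + y * Complex.I) - p (-π + y * Complex.I)) * kp (π + y * Complex.I - z))
      + Complex.I * (∫ y in (-σ)..0, (p (π + y * Complex.I) - p (-π + y * Complex.I)) * kp (z - (π + y * Complex.I))) := by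
  have hpi := Real.pi_gt_three
  obtain ⟨hs1, hs2⟩ := abs_lt.1 hσ
  obtain ⟨hz1, hz2⟩ := abs_le.1 hz
  have hσ0 : 0 < σ := by linarith
  have hR : ∀ x y : ℝ, x ∈ Icc (-π) π → y ∈ Icc (-σ) σ → (x:ℂ) + y * Complex.I ∈ U := fun x y hx hy =>
    hsub (by rw [Complex.mem_reProdIm]; simpa using ⟨hx, hy⟩)
  have hpc : ∀ w ∈ U, ContinuousAt p w := fun w hw => (hp.differentiableAt (hU.mem_nhds hw)).continuousAt
  have hzU : z ∈ U := by
    have := hR z.re z.im ⟨by linarith, by linarith⟩ ⟨by linarith, by linarith⟩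
    rwa [Complex.re_add_im] at this
  set g : ℂ → ℂ := fun w => Complex.exp (Complex.I * (w - z)) with hg
  have hgd : HasDerivAt g Complex.I z := by
    have h1 : HasDerivAt (fun w : ℂ => Complex.I * (w - z)) Complex.I z := by
      simpa using ((hasDerivAt_id z).sub_const z).const_mul Complex.I
    simpa using h1.cexp
  set V : Set ℂ := U ∩ {w | |w.re - z.re| < 2 * π} with hV
  have hVo : IsOpen V := hU.inter (isOpen_lt (by fun_prop) (by fun_prop))
  have hzV : z ∈ V := ⟨hzU, by simp; positivity⟩
  have hg0 : ∀ w ∈ V, dslope g z w ≠ 0 := by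
    intro w hw
    by_cases h : w = z
    · rw [h, dslope_same, hgd.deriv]; exact Complex.I_ne_zero
    · rw [dslope_of_ne _ h, slope_def_field]
      have : g w ≠ 1 := EE_ne' (by simpa using hw.2) (sub_ne_zero.2 h)
      exact div_ne_zero (by simpa [hg, sub_eq_zero] using this) (sub_ne_zero.2 h)
  set f : ℂ → ℂ := fun w => -(dslope p z w * g w / dslope g z w) with hf
  have hfd : DifferentiableOn ℂ f V := by
    refine (DifferentiableOn.div (DifferentiableOn.mul ?_ ?_) ?_ hg0).neg
    · exact (Complex.differentiableOn_dslope (hVo.mem_nhds hzV)).2 (hp.mono inter_subset_left)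
    · exact Differentiable.differentiableOn (by fun_prop)
    · exact (Complex.differentiableOn_dslope (hVo.mem_nhds hzV)).2 (Differentiable.differentiableOn (by fun_prop))
  have hfe : ∀ w, w ≠ z → f w = (p w - p z) * kp (w - z) := by
    intro w h
    have h2 := sub_ne_zero.2 h
    simp only [hf, dslope_of_ne _ h, slope_def_field]
    have : g z = 1 := by simp [hg]
    rw [this]
    unfold kp
    change _ = (p w - p z) * (g w / (1 - g w))
    rw [mul_div_assoc, div_div_eq_mul_div, ← neg_sub (g w) 1, div_neg, mul_neg, neg_inj]
    field_simp
  have hRV : Icc (-π) π ×ℂ Icc (-σ) σ ⊆ V := by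
    intro w hw
    refine ⟨hsub hw, ?_⟩
    rw [Complex.mem_reProdIm] at hw
    obtain ⟨⟨h1, h2⟩, _⟩ := hw
    rw [mem_ofPred_eq, abs_lt]; constructor <;> linarith
  have B1 := Complex.integral_boundary_rect_eq_zero_of_differentiableOn f (⟨-π, -σ⟩ : ℂ) (⟨π, σ⟩ : ℂ) (hfd.mono (by
    simp only
    rwa [uIcc_of_le (by linarith), uIcc_of_le (by linarith)]))
  have B2 := Complex.integral_boundary_rect_eq_zero_of_differentiableOn p (⟨-π, -σ⟩ : ℂ) (⟨π, 0⟩ : ℂ) (hp.mono (by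
    simp only
    rw [uIcc_of_le (by linarith), uIcc_of_le (by linarith)]
    intro w hw
    rw [Complex.mem_reProdIm] at hw
    exact hsub (by rw [Complex.mem_reProdIm]; exact ⟨hw.1, hw.2.1, hw.2.2.trans hσ0.le⟩)))
  simp only [smul_eq_mul] at B1 B2
  -- integrability
  have Ix : ∀ c : ℝ, c ∈ Icc (-σ) σ → ContinuousOn (fun x : ℝ => p ((x:ℂ) + c * Complex.I)) (uIcc (-π) π) := by
    intro c hc x hx
    rw [uIcc_of_le (by linarith)] at hx
    exact (ContinuousAt.comp (f := fun x : ℝ => (x:ℂ) + c * Complex.I) (hpc _ (hR x c hx hc)) (by fun_prop)).continuousWithinAt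
  have Iy : ∀ c : ℝ, c ∈ Icc (-π) π → ∀ a b : ℝ, a ∈ Icc (-σ) σ → b ∈ Icc (-σ) σ → ContinuousOn (fun y : ℝ => p ((c:ℂ) + y * Complex.I)) (uIcc a b) := by
    intro c hc a b ha hb y hy
    exact (ContinuousAt.comp (f := fun y : ℝ => (c:ℂ) + y * Complex.I) (hpc _ (hR c y hc (uIcc_subset_Icc ha hb hy))) (by fun_prop)).continuousWithinAt
  have kx : ∀ (c : ℝ) (s : ℂ), c - z.im ≠ 0 → (s = 1 ∨ s = -1) → Continuous (fun x : ℝ => kp (s * ((x:ℂ) + c * Complex.I - z))) := by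
    intro c s hc hs
    rw [continuous_iff_continuousAt]
    intro x
    refine ContinuousAt.comp (f := fun x : ℝ => s * ((x:ℂ) + c * Complex.I - z)) (kp_contAt (EE_ne ?_)) (by fun_prop)
    rcases hs with rfl | rfl <;> simp
    · exact hc
    · intro h; exact hc (by linarith)
  have ny : ∀ (y : ℝ), Complex.exp (Complex.I * ((π:ℂ) + y * Complex.I - z)) ≠ 1 := by
    intro y
    refine EE_ne' ?_ ?_
    · simp; rw [abs_lt]; constructor <;> linarith
    · intro h; have := congrArg Complex.re h; simp at this; linarith
  have ny' : ∀ (y : ℝ), Complex.exp (Complex.I * (z - ((π:ℂ) + y * Complex.I))) ≠ 1 := by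
    intro y
    refine EE_ne' ?_ ?_
    · simp; rw [abs_lt]; constructor <;> linarith
    · intro h; have := congrArg Complex.re h; simp at this; linarith
  have ky : Continuous (fun y : ℝ => kp ((π:ℂ) + y * Complex.I - z)) :=
    continuous_iff_continuousAt.2 fun y => ContinuousAt.comp (f := fun y : ℝ => (π:ℂ) + y * Complex.I - z) (kp_contAt (ny y)) (by fun_prop)
  have ky' : Continuous (fun y : ℝ => kp (z - ((π:ℂ) + y * Complex.I))) :=
    continuous_iff_continuousAt.2 fun y => ContinuousAt.comp (f := fun y : ℝ => z - ((π:ℂ) + y * Complex.I)) (kp_contAt (ny' y)) (by fun_prop)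
  have mσ : σ ∈ Icc (-σ) σ := ⟨by linarith, le_rfl⟩
  have mσ' : -σ ∈ Icc (-σ) σ := ⟨le_rfl, by linarith⟩
  have m0 : (0:ℝ) ∈ Icc (-σ) σ := ⟨by linarith, by linarith⟩
  have mp : π ∈ Icc (-π) π := ⟨by linarith, le_rfl⟩
  have mp' : -π ∈ Icc (-π) π := ⟨le_rfl, by linarith⟩
  have top : ∫ x in (-π)..π, f ((x:ℂ) + σ * Complex.I) = ∫ x in (-π)..π, p ((x:ℂ) + σ * Complex.I) * kp ((x:ℂ) + σ * Complex.I - z) := by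
    have hk : Continuous (fun x : ℝ => kp ((x:ℂ) + σ * Complex.I - z)) := by simpa using kx σ 1 (by linarith) (Or.inl rfl)
    have e : ∀ x : ℝ, f ((x:ℂ) + σ * Complex.I) = p ((x:ℂ) + σ * Complex.I) * kp ((x:ℂ) + σ * Complex.I - z) - p z * kp ((x:ℂ) + σ * Complex.I - z) := by
      intro x
      rw [hfe _ (by intro h; have := congrArg Complex.im h; simp at this; linarith)]; ring
    simp only [e]
    rw [intervalIntegral.integral_sub ((Ix σ mσ).fun_mul hk.continuousOn).intervalIntegrable (continuous_const.fun_mul hk).continuousOn.intervalIntegrable]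
    rw [intervalIntegral.integral_const_mul, kp_top hs2]; ring
  have bot : ∫ x in (-π)..π, f ((x:ℂ) + (-σ : ℝ) * Complex.I) = 2 * π * p z - (∫ x in (-π)..π, p ((x:ℂ) + (-σ : ℝ) * Complex.I)) - ∫ x in (-π)..π, p ((x:ℂ) + (-σ : ℝ) * Complex.I) * kp (z - ((x:ℂ) + (-σ : ℝ) * Complex.I)) := by
    have hk : Continuous (fun x : ℝ => kp (z - ((x:ℂ) + (-σ : ℝ) * Complex.I))) := by
      convert kx (-σ) (-1) (by intro h; linarith) (Or.inr rfl) using 3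
      ring
    have e : ∀ x : ℝ, f ((x:ℂ) + (-σ : ℝ) * Complex.I) = (p z - p ((x:ℂ) + (-σ : ℝ) * Complex.I)) - (p ((x:ℂ) + (-σ : ℝ) * Complex.I) * kp (z - ((x:ℂ) + (-σ : ℝ) * Complex.I)) - p z * kp (z - ((x:ℂ) + (-σ : ℝ) * Complex.I))) := by
      intro x
      rw [hfe _ (by intro h; have := congrArg Complex.im h; simp at this; linarith), ← neg_sub z, kp_neg (EE_ne (by simp; intro h; linarith))]; ring
    have h0 : ∫ x in (-π)..π, kp (z - ((x:ℂ) + (-σ : ℝ) * Complex.I)) = 0 := by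
      rw [← kp_top (z := -z) (σ := σ) (by simp; linarith), ← neg_neg π, ← intervalIntegral.integral_comp_neg]
      simp only [neg_neg]
      congr 1; ext x; congr 1; push_cast; ring
    simp only [e]
    have i1 := (Ix (-σ) mσ').intervalIntegrable (μ := volume)
    have i2 := ((Ix (-σ) mσ').fun_mul hk.continuousOn).intervalIntegrable (μ := volume)
    have i3 := ((continuous_const (y := p z)).fun_mul hk).continuousOn.intervalIntegrable (μ := volume) (a := -π) (b := π)
    rw [intervalIntegral.integral_sub (intervalIntegrable_const.sub i1) (i2.sub i3), intervalIntegral.integral_sub intervalIntegrable_const i1, intervalIntegral.integral_sub i2 i3,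
      intervalIntegral.integral_const_mul, h0, intervalIntegral.integral_const, Complex.real_smul]
    push_cast; ring
  have side : (∫ y in (-σ)..σ, f ((π:ℂ) + y * Complex.I)) - (∫ y in (-σ)..σ, f (((-π:ℝ):ℂ) + y * Complex.I)) =
      (∫ y in (0)..σ, (p (π + y * Complex.I) - p (-π + y * Complex.I)) * kp (π + y * Complex.I - z))
      - (∫ y in (-σ)..0, (p (π + y * Complex.I) - p (-π + y * Complex.I)))
      - (∫ y in (-σ)..0, (p (π + y * Complex.I) - p (-π + y * Complex.I)) * kp (z - (π + y * Complex.I))) := by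
    have e1 : ∀ y : ℝ, f ((π:ℂ) + y * Complex.I) = (p ((π:ℂ) + y * Complex.I) - p z) * kp (π + y * Complex.I - z) := by
      intro y
      rw [hfe _ (by intro h; have := congrArg Complex.re h; simp at this; linarith)]
    have e2 : ∀ y : ℝ, f (((-π:ℝ):ℂ) + y * Complex.I) = (p (((-π:ℝ):ℂ) + y * Complex.I) - p z) * kp (π + y * Complex.I - z) := by
      intro y
      rw [hfe _ (by intro h; have := congrArg Complex.re h; simp at this; linarith), ← kp_per]
      congr 2; push_cast; ring
    simp only [e1, e2]
    have j1 : ∀ a b : ℝ, a ∈ Icc (-σ) σ → b ∈ Icc (-σ) σ → ContinuousOn (fun y : ℝ => p ((π:ℂ) + y * Complex.I)) (uIcc a b) := fun a b ha hb => Iy π mp a b ha hb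
    have j2 : ∀ a b : ℝ, a ∈ Icc (-σ) σ → b ∈ Icc (-σ) σ → ContinuousOn (fun y : ℝ => p (((-π:ℝ):ℂ) + y * Complex.I)) (uIcc a b) := fun a b ha hb => Iy (-π) mp' a b ha hb
    rw [← intervalIntegral.integral_sub (((j1 _ _ mσ' mσ).fun_sub continuousOn_const).fun_mul ky.continuousOn).intervalIntegrable (((j2 _ _ mσ' mσ).fun_sub continuousOn_const).fun_mul ky.continuousOn).intervalIntegrable]
    have e3 : ∀ y : ℝ, (p ((π:ℂ) + y * Complex.I) - p z) * kp (π + y * Complex.I - z) - (p (((-π:ℝ):ℂ) + y * Complex.I) - p z) * kp (π + y * Complex.I - z) = (p (π + y * Complex.I) - p (-π + y * Complex.I)) * kp (π + y * Complex.I - z) := by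
      intro y; push_cast; ring
    simp only [e3]
    simp only [Complex.ofReal_neg] at j2
    have j3 := fun a b ha hb => ((j1 a b ha hb).fun_sub (j2 a b ha hb))
    have j4 := fun a b ha hb => ((j3 a b ha hb).fun_mul ky.continuousOn).intervalIntegrable (μ := volume)
    rw [← intervalIntegral.integral_add_adjacent_intervals (j4 _ _ mσ' m0) (j4 _ _ m0 mσ)]
    have e4 : ∀ y : ℝ, (p (π + y * Complex.I) - p (-π + y * Complex.I)) * kp (π + y * Complex.I - z) = -(p (π + y * Complex.I) - p (-π + y * Complex.I)) - (p (π + y * Complex.I) - p (-π + y * Complex.I)) * kp (z - (π + y * Complex.I)) := by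
      intro y
      rw [← neg_sub z, kp_neg (ny' y)]; ring
    rw [show (∫ y in (-σ)..0, (p (π + y * Complex.I) - p (-π + y * Complex.I)) * kp (π + y * Complex.I - z)) = ∫ y in (-σ)..0, (-(p (π + y * Complex.I) - p (-π + y * Complex.I)) - (p (π + y * Complex.I) - p (-π + y * Complex.I)) * kp (z - (π + y * Complex.I))) from by simp only [← e4],
      intervalIntegral.integral_sub (j3 _ _ mσ' m0).fun_neg.intervalIntegrable ((j3 _ _ mσ' m0).fun_mul ky'.continuousOn).intervalIntegrable, intervalIntegral.integral_neg]
    ring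
  have side2 : (∫ y in (-σ)..0, p ((π:ℂ) + y * Complex.I)) - (∫ y in (-σ)..0, p (((-π:ℝ):ℂ) + y * Complex.I)) = ∫ y in (-σ)..0, (p (π + y * Complex.I) - p (-π + y * Complex.I)) := by
    rw [← intervalIntegral.integral_sub (Iy π mp _ _ mσ' m0).intervalIntegrable (Iy (-π) mp' _ _ mσ' m0).intervalIntegrable]
    push_cast; rfl
  have e5 : ∀ x : ℝ, (x:ℂ) - σ * Complex.I = (x:ℂ) + ((-σ:ℝ):ℂ) * Complex.I := fun x => by push_cast; ring
  simp only [e5]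
  rw [top, bot] at B1
  simp only [Complex.ofReal_zero, zero_mul, add_zero] at B2
  linear_combination B1 - Complex.I * side + B2 - Complex.I * side2

open Real Filter MeasureTheory Set Topology

variable {G : ℝ} {v z : ℂ}

noncomputable def sg (G : ℝ) : ℝ := G ^ 3 / 3 - 2
/-- weighted bound -/
def Bd (G M : ℝ) : Prop := ∀ (v : ℂ) (t : ℝ), |v.re| < π + 1 / 2 → |v.im| < sg G + 1 → (π + 1 / 2 - |v.re|) * ‖Pf G v t‖ ≤ M * exp (|v.im| - sg G)

noncomputable def bt (G y : ℝ) : ℝ := 10 ^ 29 / √G ^ 5 / √(sg G + 3 / 2 - |y|)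

lemma Dom_of (h1 : |v.re| ≤ 4) (h2 : |v.im| < sg G + 1) : v ∈ Dom G := by
  constructor
  · linarith
  · unfold sg at h2; linarith

lemma exp_half : exp (1 / 2 : ℝ) ≤ 2 := by
  have h := Real.exp_one_lt_d9
  have h2 : exp (1 / 2 : ℝ) * exp (1 / 2) = exp 1 := by rw [← Real.exp_add]; norm_num
  nlinarith [Real.exp_pos (1 / 2 : ℝ)]

lemma dX_le (hG : 10 ^ 20 ≤ G) {M : ℝ} (hM : Bd G M) (h1 : |v.re| < π + 1 / 2) (h2 : |v.im| ≤ sg G) (t : ℝ) :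
    ‖deriv (fun w => Xf G w t) v‖ ≤ 32 * M * bt G v.im * exp (|v.im| - sg G) / (π + 1 / 2 - |v.re|) ^ 2 := by
  have hpi := Real.pi_lt_d2
  have hpi3 := Real.pi_gt_three
  have hG0 : 0 < G := by linarith
  set d := π + 1 / 2 - |v.re| with hd
  have hd0 : 0 < d := by simp only [hd]; linarith
  have hd4 : d ≤ 4 := by have := abs_nonneg v.re; simp only [hd]; linarith
  set r := min (d / 2) (1 / 2) with hr
  have hr0 : d / 8 ≤ r := le_min (by linarith) (by linarith)
  have hr1 : r ≤ d / 2 := min_le_left _ _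
  have hr2 : r ≤ 1 / 2 := min_le_right _ _
  have hrp : 0 < r := by linarith
  have pos : 0 < sg G + 3 / 2 - |v.im| := by linarith
  have key : ∀ w ∈ Metric.closedBall v r, w ∈ Dom G ∧ ‖Xf G w t‖ ≤ bt G v.im * (2 / d * (M * (2 * exp (|v.im| - sg G)))) := by
    intro w hw
    rw [mem_closedBall_iff_norm] at hw
    have a1 : |w.re| ≤ |v.re| + r := by
      have := (Complex.abs_re_le_norm (w - v)).trans hw
      rw [Complex.sub_re] at this
      have := abs_sub_abs_le_abs_sub w.re v.re; linarith
    have a2 : |w.im| ≤ |v.im| + r := by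
      have := (Complex.abs_im_le_norm (w - v)).trans hw
      rw [Complex.sub_im] at this
      have := abs_sub_abs_le_abs_sub w.im v.im; linarith
    have hw1 : |w.re| < π + 1 / 2 := by linarith
    have hw2 : |w.im| < sg G + 1 := by linarith
    have hwD : w ∈ Dom G := Dom_of (by linarith) hw2
    refine ⟨hwD, (Xf_le hG hwD t).trans ?_⟩
    have b1 := hM w t hw1 hw2
    have b2 : d / 2 ≤ π + 1 / 2 - |w.re| := by linarith
    have b3 : exp (|w.im| - sg G) ≤ 2 * exp (|v.im| - sg G) := by
      calc _ ≤ exp (1 / 2 + (|v.im| - sg G)) := Real.exp_le_exp.2 (by linarith)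
        _ ≤ _ := by rw [Real.exp_add]; gcongr; exact exp_half
    have hM0 : 0 ≤ M := by
      by_contra hc; push Not at hc
      have : M * exp (|w.im| - sg G) < 0 := mul_neg_of_neg_of_pos hc (exp_pos _)
      have : 0 ≤ (π + 1 / 2 - |w.re|) * ‖Pf G w t‖ := mul_nonneg (by linarith) (norm_nonneg _)
      linarith
    have b4 : ‖Pf G w t‖ ≤ 2 / d * (M * (2 * exp (|v.im| - sg G))) := by
      rw [div_mul_eq_mul_div, le_div_iff₀ hd0]
      have := mul_le_mul_of_nonneg_right b2 (norm_nonneg (Pf G w t))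
      have := mul_le_mul_of_nonneg_left b3 hM0
      nlinarith
    refine mul_le_mul ?_ b4 (norm_nonneg _) (by unfold bt; positivity)
    unfold bt
    rw [div_div]
    have : sg G + 3 / 2 - |v.im| ≤ y0 G w := by unfold y0; unfold sg at *; linarith
    gcongr
  have hb : ∀ w ∈ Metric.sphere v r, ‖Xf G w t‖ ≤ bt G v.im * (2 / d * (M * (2 * exp (|v.im| - sg G)))) := fun w hw => (key w (Metric.sphere_subset_closedBall hw)).2
  have hdc : DiffContOnCl ℂ (fun w => Xf G w t) (Metric.ball v r) := by
    refine DifferentiableOn.diffContOnCl ?_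
    rw [closure_ball _ hrp.ne']
    exact (Xf_hol hG t).mono fun w hw => (key w hw).1
  refine (Complex.norm_deriv_le_of_forall_mem_sphere_norm_le hrp hdc hb).trans ?_
  have hC : 0 ≤ bt G v.im * (2 / d * (M * (2 * exp (|v.im| - sg G)))) := (norm_nonneg _).trans (key v (Metric.mem_closedBall_self hrp.le)).2
  calc _ ≤ bt G v.im * (2 / d * (M * (2 * exp (|v.im| - sg G)))) / (d / 8) := by gcongr
    _ = _ := by field_simp; ring

/-- quasi-invariance along the diagonal -/
lemma shift_le (hG : 10 ^ 20 ≤ G) {M : ℝ} (hM : Bd G M) {η : ℝ} (h2 : |η| ≤ sg G) (t x : ℝ) (hx : |x| < π + 1 / 2) :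
    ‖Pf G (η * Complex.I + x) (t + x) - Pf G (η * Complex.I) t‖ ≤ 32 * M * bt G η * exp (|η| - sg G) / (π + 1 / 2 - |x|) := by
  have hpi := Real.pi_lt_d2
  have hpi3 := Real.pi_gt_three
  set c := 32 * M * bt G η * exp (|η| - sg G) with hc
  have hc0 : 0 ≤ c := by
    have := (norm_nonneg _).trans (dX_le hG hM (v := η * Complex.I) (by simp; linarith) (by simpa using h2) t)
    simp only [Complex.mul_im, Complex.ofReal_re, Complex.I_im, Complex.ofReal_im, Complex.I_re, mul_one, mul_zero, add_zero, Complex.mul_re, sub_zero, abs_zero] at this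
    by_contra hn; push Not at hn
    have : c / (π + 1 / 2) ^ 2 < 0 := div_neg_of_neg_of_pos hn (by positivity)
    linarith
  have gen : ∀ s : ℝ, (s = 1 ∨ s = -1) → ∀ w ∈ Icc 0 |x|, ‖Pf G (η * Complex.I + (s * w : ℝ)) (t + s * w) - Pf G (η * Complex.I) t‖ ≤ c / (π + 1 / 2 - w) - c / (π + 1 / 2) := by
    intro s hs
    have hs1 : |s| = 1 := by rcases hs with rfl | rfl <;> simp
    have hd : ∀ y ∈ Icc 0 |x|, HasDerivAt (fun y : ℝ => Pf G (η * Complex.I + (s * y : ℝ)) (t + s * y)) (s * -deriv (fun w => Xf G w (t + s * y)) (η * Complex.I + (s * y : ℝ))) y ∧ ‖(s:ℂ) * -deriv (fun w => Xf G w (t + s * y)) (η * Complex.I + (s * y : ℝ))‖ ≤ c / (π + 1 / 2 - y) ^ 2 := by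
      intro y hy
      have hsy : |s * y| = y := by rw [abs_mul, hs1, one_mul, abs_of_nonneg hy.1]
      have e1 : |(η * Complex.I + (s * y : ℝ)).re| = y := by simp [-abs_mul]; exact hsy
      have e2 : (η * Complex.I + (s * y : ℝ)).im = η := by simp
      have hl : y < π + 1 / 2 := lt_of_le_of_lt hy.2 hx
      constructor
      · have h := Pf_diag hG (Dom_of (v := η * Complex.I + (s * y : ℝ)) (by rw [e1]; linarith) (by rw [e2]; linarith)) (t + s * y)
        have h3 : HasDerivAt (fun u : ℝ => s * (u - y)) s y := by
          simpa using ((hasDerivAt_id y).sub_const y).const_mul s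
        have h4 := HasDerivAt.scomp y (g₁ := fun s' : ℝ => Pf G (η * Complex.I + (s * y : ℝ) + s') (t + s * y + s')) (h := fun u : ℝ => s * (u - y)) (by simp only [sub_self, mul_zero]; exact h) h3
        rw [Complex.real_smul] at h4
        refine h4.congr_of_eventuallyEq (Eventually.of_forall fun u => ?_)
        simp only [Function.comp]
        congr 1
        · push_cast; ring
        · ring
      · rw [norm_mul, norm_neg, Complex.norm_real, Real.norm_eq_abs, hs1, one_mul]
        have := dX_le hG hM (v := η * Complex.I + (s * y : ℝ)) (by rw [e1]; linarith) (by rw [e2]; exact h2) (t + s * y)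
        rwa [e1, e2] at this
    refine image_norm_le_of_norm_deriv_right_le_deriv_boundary' (f := fun y : ℝ => Pf G (η * Complex.I + (s * y : ℝ)) (t + s * y) - Pf G (η * Complex.I) t) (B := fun y => c / (π + 1 / 2 - y) - c / (π + 1 / 2)) (B' := fun y => c / (π + 1 / 2 - y) ^ 2) (fun y hy => ((hd y hy).1.sub_const _).continuousAt.continuousWithinAt)
      (fun y hy => ((hd y ⟨hy.1, hy.2.le⟩).1.sub_const _).hasDerivWithinAt) (by simp) ?_ ?_ (fun y hy => (hd y ⟨hy.1, hy.2.le⟩).2)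
    · refine ContinuousOn.sub (ContinuousOn.div continuousOn_const (by fun_prop) fun y hy => ?_) continuousOn_const
      have := hy.2; intro h; linarith
    · intro y hy
      have : π + 1 / 2 - y ≠ 0 := by have := hy.2; intro h; linarith
      have h1 := ((hasDerivAt_const y c).div ((hasDerivAt_id y).const_sub (π + 1 / 2)) this).sub_const (c / (π + 1 / 2))
      exact (h1.congr_deriv (by simp)).hasDerivWithinAt
  have hle : c / (π + 1 / 2 - |x|) - c / (π + 1 / 2) ≤ c / (π + 1 / 2 - |x|) := by
    have : 0 ≤ c / (π + 1 / 2) := by positivity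
    linarith
  rcases le_total 0 x with h | h
  · have := gen 1 (Or.inl rfl) |x| ⟨abs_nonneg _, le_rfl⟩
    rw [one_mul, abs_of_nonneg h] at this
    rw [abs_of_nonneg h] at hle ⊢; linarith
  · have := gen (-1) (Or.inr rfl) |x| ⟨abs_nonneg _, le_rfl⟩
    rw [abs_of_nonpos h] at this
    simp only [neg_mul, one_mul, neg_neg] at this
    rw [abs_of_nonpos h] at hle ⊢; linarith

open Real Filter MeasureTheory Set Topology

variable {G : ℝ} {v z : ℂ}

lemma bt_cont : ContinuousOn (bt G) (Icc (-sg G) (sg G)) := by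
  unfold bt
  refine ContinuousOn.div continuousOn_const (by fun_prop) fun y hy => ?_
  have := abs_le.2 hy
  exact (Real.sqrt_pos.2 (by linarith)).ne'

lemma bt_neg (y : ℝ) : bt G (-y) = bt G y := by simp [bt]

lemma bt_int (hG : 10 ^ 20 ≤ G) (hs : 0 ≤ sg G) : ∫ y in (0)..sg G, bt G y ≤ 2 * 10 ^ 29 / G := by
  have hG0 : 0 < G := by linarith
  have hd : ∀ y ∈ uIcc 0 (sg G), HasDerivAt (fun y => -(2 * (10 ^ 29 / √G ^ 5) * √(sg G + 3 / 2 - y))) (bt G y) y := by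
    intro y hy
    rw [uIcc_of_le hs] at hy
    have h1 : 0 < sg G + 3 / 2 - y := by have := hy.2; linarith
    have := ((((hasDerivAt_id y).const_sub (sg G + 3 / 2)).sqrt h1.ne').const_mul (2 * (10 ^ 29 / √G ^ 5))).neg
    refine this.congr_deriv ?_
    unfold bt
    have h2 := (Real.sqrt_pos.2 h1).ne'
    rw [abs_of_nonneg hy.1]
    simp only [id]
    field_simp
  rw [intervalIntegral.integral_eq_sub_of_hasDerivAt hd ((bt_cont.mono (by rw [uIcc_of_le hs]; exact Icc_subset_Icc (by linarith) le_rfl)).intervalIntegrable)]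
  have h3 : 0 ≤ 2 * (10 ^ 29 / √G ^ 5) * √(sg G + 3 / 2 - sg G) := by positivity
  have hq : √G ^ 2 = G := Real.sq_sqrt hG0.le
  have hq0 : 0 < √G := Real.sqrt_pos.2 hG0
  have h4 : √(sg G + 3 / 2 - 0) ≤ √G ^ 3 := by
    rw [Real.sqrt_le_left (by positivity)]
    unfold sg
    have : (√G ^ 3) ^ 2 = G ^ 3 := by rw [← pow_mul, mul_comm, pow_mul, hq]
    rw [this]
    have : 0 < G ^ 3 := by positivity
    linarith
  have h5 : 2 * (10 ^ 29 / √G ^ 5) * √(sg G + 3 / 2 - 0) ≤ 2 * 10 ^ 29 / G := by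
    calc _ ≤ 2 * (10 ^ 29 / √G ^ 5) * √G ^ 3 := by gcongr
      _ = 2 * 10 ^ 29 / √G ^ 2 := by field_simp
      _ = _ := by rw [hq]
  linarith

lemma kp_le (h : Real.cos z.re ≤ 0) : ‖kp z‖ ≤ exp (-z.im) := by
  unfold kp
  rw [norm_div, EE_norm]
  have h1 : 1 ≤ ‖1 - Complex.exp (Complex.I * z)‖ := by
    refine le_trans ?_ (Complex.re_le_norm _)
    rw [Complex.sub_re, Complex.one_re, Complex.exp_re]
    simp only [Complex.mul_re, Complex.I_re, zero_mul, Complex.I_im, one_mul, zero_sub, Complex.mul_im, zero_add]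
    nlinarith [Real.exp_pos (-z.im)]
  exact div_le_self (exp_pos _).le h1

lemma kp_le2 (h : 1 ≤ z.im) : ‖kp z‖ ≤ 2 * exp (-z.im) ∧ ‖kp z - Complex.exp (Complex.I * z)‖ ≤ 2 * exp (-z.im) ^ 2 := by
  have h0 : exp (-z.im) ≤ 1 / 2 := by
    have := Real.add_one_le_exp (z.im)
    rw [Real.exp_neg, one_div]
    gcongr; linarith
  have h1 : 1 / 2 ≤ ‖1 - Complex.exp (Complex.I * z)‖ := by
    have := norm_sub_norm_le (1:ℂ) (Complex.exp (Complex.I * z))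
    rw [EE_norm, norm_one] at this; linarith
  have hn : 1 - Complex.exp (Complex.I * z) ≠ 0 := by intro hc; rw [hc, norm_zero] at h1; linarith
  have e : kp z - Complex.exp (Complex.I * z) = Complex.exp (Complex.I * z) ^ 2 / (1 - Complex.exp (Complex.I * z)) := by
    unfold kp; field_simp; ring
  rw [e]
  unfold kp
  rw [norm_div, norm_div, norm_pow, EE_norm]
  have hp := Real.exp_pos (-z.im)
  constructor
  · rw [div_le_iff₀ (by linarith)]; nlinarith
  · rw [div_le_iff₀ (by linarith)]; nlinarith [sq_nonneg (exp (-z.im))]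

lemma Bd_nonneg (hs : 0 ≤ sg G) {M : ℝ} (hM : Bd G M) : 0 ≤ M := by
  have hpi := Real.pi_gt_three
  have := hM 0 0 (by simp; linarith) (by simp; linarith)
  have h2 : 0 ≤ (π + 1 / 2 - |(0:ℂ).re|) * ‖Pf G 0 0‖ := mul_nonneg (by simp; linarith) (norm_nonneg _)
  exact nonneg_of_mul_nonneg_left (h2.trans this) (exp_pos _)

noncomputable def SS (G : ℝ) (t : ℝ) (z : ℂ) : ℂ := 2 * π * Pf G z t - (∫ x in (-π)..π, Pf G ((x:ℂ) + sg G * Complex.I) t * kp ((x:ℂ) + sg G * Complex.I - z))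
      - (∫ x in (-π)..π, Pf G ((x:ℂ) - sg G * Complex.I) t * kp (z - ((x:ℂ) - sg G * Complex.I)))

lemma SS_le (hG : 10 ^ 20 ≤ G) {M : ℝ} (hM : Bd G M) (hz1 : |z.re| ≤ 1) (hz2 : |z.im| < sg G) (t : ℝ) :
    ‖SS G t z‖ ≤ 10 ^ 32 / G * M * exp (|z.im| - sg G) := by
  have hpi := Real.pi_lt_d2
  have hpi3 := Real.pi_gt_three
  have hG0 : 0 < G := by linarith
  have hs : 0 ≤ sg G := by linarith [abs_nonneg z.im]
  have hM0 := Bd_nonneg hs hM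
  obtain ⟨hzl, hzr⟩ := abs_le.1 hz1
  have hD : ∀ w : ℂ, |w.re| ≤ π → |w.im| ≤ sg G → w ∈ Dom G := fun w h1 h2 => Dom_of (by linarith) (by linarith)
  have hp : DifferentiableOn ℂ (fun v => Pf G v t) (Dom G) := Pf_hol hG t
  have hK := kernel Dom_open hp hz2 hz1 (fun w hw => by
    rw [Complex.mem_reProdIm] at hw
    exact hD w (abs_le.2 hw.1) (abs_le.2 hw.2))
  -- mean
  have hmean : ‖∫ x in (-π)..π, Pf G (x:ℂ) t‖ ≤ 64 * M * bt G 0 * exp (0 - sg G) * (2 * π) := by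
    have hcf : Continuous (fun s : ℝ => Pf G 0 s) := by
      rw [continuous_iff_continuousAt]; intro s
      have h0 : (0:ℂ) ∈ Dom G := hD 0 (by simp; linarith) (by simpa using hs)
      exact ContinuousAt.comp (f := fun s : ℝ => ((0:ℂ), s)) ((Pf_cont hG).continuousAt ((Dom_open.prod isOpen_univ).mem_nhds ⟨h0, mem_univ _⟩)) (by fun_prop)
    have hz : ∫ x in (-π)..π, Pf G 0 (t - x) = 0 := by
      rw [intervalIntegral.integral_comp_sub_left (fun s => Pf G 0 s)]
      have hper : Function.Periodic (fun s => Pf G 0 s) (2 * π) := fun s => Pf_per hG 0 s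
      have h1 := hper.intervalIntegral_add_eq (t - π) (-π)
      rw [show t - -π = t - π + 2 * π by ring, h1, show -π + 2 * π = π by ring]
      have h2 := intervalIntegral.integral_comp_neg (a := -π) (b := π) (fun s => Pf G 0 s)
      have h3 : ∀ s, Pf G 0 (-s) = -Pf G 0 s := fun s => by
        have := Pf_odd hG (hD 0 (by simp; linarith) (by simpa using hs)) s
        rwa [neg_zero] at this
      simp only [h3, intervalIntegral.integral_neg, neg_neg] at h2
      have h4 : (2:ℂ) * (∫ s in (-π)..π, Pf G 0 s) = 0 := by linear_combination -h2
      simpa using h4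
    have hci : IntervalIntegrable (fun x : ℝ => Pf G (x:ℂ) t) volume (-π) π := by
      apply ContinuousOn.intervalIntegrable
      intro x hx
      rw [uIcc_of_le (by linarith)] at hx
      exact (ContinuousAt.comp (f := fun x : ℝ => (x:ℂ)) (hp.differentiableAt (Dom_open.mem_nhds (hD x (by simpa using abs_le.2 hx) (by simpa using hs)))).continuousAt (by fun_prop)).continuousWithinAt
    have e : ∫ x in (-π)..π, Pf G (x:ℂ) t = ∫ x in (-π)..π, (Pf G (x:ℂ) t - Pf G 0 (t - x)) := by
      rw [intervalIntegral.integral_sub hci (show IntervalIntegrable (fun x : ℝ => Pf G 0 (t - x)) volume (-π) π from (hcf.comp (by fun_prop : Continuous fun x : ℝ => t - x)).intervalIntegrable _ _), hz, sub_zero]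
    rw [e]
    have := intervalIntegral.norm_integral_le_of_norm_le_const (a := -π) (b := π) (f := fun x : ℝ => (Pf G (x:ℂ) t - Pf G 0 (t - x))) (C := 64 * M * bt G 0 * exp (0 - sg G)) (by
      intro x hx
      rw [uIoc_of_le (by linarith)] at hx
      have hx1 : |x| ≤ π := abs_le.2 ⟨hx.1.le, hx.2⟩
      have := shift_le hG hM (η := 0) (by simpa using hs) (t - x) x (by linarith)
      simp only [Complex.ofReal_zero, zero_mul, zero_add, sub_add_cancel, abs_zero] at this
      refine this.trans ?_
      rw [div_le_iff₀ (by linarith)]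
      have : 0 ≤ 32 * M * bt G 0 * exp (0 - sg G) := by unfold bt; positivity
      nlinarith)
    rwa [show |π - -π| = 2 * π by rw [sub_neg_eq_add, ← two_mul, abs_of_pos (by positivity)]] at this
  -- sides
  have hE : ∀ y : ℝ, |y| ≤ sg G → ‖Pf G (π + y * Complex.I) t - Pf G (-π + y * Complex.I) t‖ ≤ 128 * M * bt G y * exp (|y| - sg G) := by
    intro y hy
    have h1 := shift_le hG hM hy (t - π) π (by rw [abs_of_pos pi_pos]; linarith)
    have h2 := shift_le hG hM hy (t + π) (-π) (by rw [abs_neg, abs_of_pos pi_pos]; linarith)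
    rw [abs_neg] at h2
    rw [abs_of_pos pi_pos, show π + 1 / 2 - π = 1 / 2 by ring] at h1 h2
    have h3 := Pf_per hG (y * Complex.I) (t - π)
    rw [show t - π + 2 * π = t + π by ring] at h3
    rw [h3, show t + π + -π = t by ring] at h2
    rw [show t - π + π = t by ring] at h1
    have h4 : Pf G (π + y * Complex.I) t - Pf G (-π + y * Complex.I) t = (Pf G (y * Complex.I + π) t - Pf G (y * Complex.I) (t - π)) - (Pf G (y * Complex.I + (-π : ℝ)) t - Pf G (y * Complex.I) (t - π)) := by
      rw [add_comm (π:ℂ), add_comm (-(π:ℂ))]; push_cast; ring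
    rw [h4]
    refine (norm_sub_le _ _).trans ((add_le_add h1 h2).trans (le_of_eq (by ring)))
  have hcos : ∀ y : ℝ, Real.cos (π + y * Complex.I - z).re ≤ 0 ∧ Real.cos (z - (π + y * Complex.I)).re ≤ 0 := by
    intro y
    have h : Real.cos (π - z.re) ≤ 0 := by
      apply Real.cos_nonpos_of_pi_div_two_le_of_le <;> linarith
    constructor
    · simpa using h
    · rw [← Real.cos_neg]; simpa using h
  have hI := bt_int hG hs
  have hbi : IntervalIntegrable (bt G) volume 0 (sg G) := (bt_cont.mono (by rw [uIcc_of_le hs]; exact Icc_subset_Icc (by linarith) le_rfl)).intervalIntegrable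
  have hbi' : IntervalIntegrable (bt G) volume (-sg G) 0 := (bt_cont.mono (by rw [uIcc_of_le (by linarith)]; exact Icc_subset_Icc le_rfl (by linarith))).intervalIntegrable
  have hI' : ∫ y in (-sg G)..0, bt G y ≤ 2 * 10 ^ 29 / G := by
    have := intervalIntegral.integral_comp_neg (a := 0) (b := sg G) (bt G)
    simp only [bt_neg, neg_zero] at this
    rwa [← this]
  have s1 : ‖∫ y in (0)..sg G, (Pf G (π + y * Complex.I) t - Pf G (-π + y * Complex.I) t) * kp (π + y * Complex.I - z)‖ ≤ 128 * M * exp (|z.im| - sg G) * (2 * 10 ^ 29 / G) := by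
    refine (intervalIntegral.norm_integral_le_of_norm_le hs (ae_of_all _ fun y hy => ?_) (hbi.const_mul (128 * M * exp (|z.im| - sg G)))).trans ?_
    · have ha : |y| = y := abs_of_pos hy.1
      rw [norm_mul]
      refine (mul_le_mul (hE y (by rw [ha]; exact hy.2)) (kp_le (hcos y).1) (norm_nonneg _) (by unfold bt; positivity)).trans ?_
      have : exp (|y| - sg G) * exp (-(π + y * Complex.I - z).im) ≤ exp (|z.im| - sg G) := by
        rw [← Real.exp_add]; apply Real.exp_le_exp.2
        have := le_abs_self z.im
        simp; linarith
      have h0 : 0 ≤ 128 * M * bt G y := by unfold bt; positivity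
      nlinarith
    · rw [intervalIntegral.integral_const_mul]; gcongr
  have s2 : ‖∫ y in (-sg G)..0, (Pf G (π + y * Complex.I) t - Pf G (-π + y * Complex.I) t) * kp (z - (π + y * Complex.I))‖ ≤ 128 * M * exp (|z.im| - sg G) * (2 * 10 ^ 29 / G) := by
    refine (intervalIntegral.norm_integral_le_of_norm_le (by linarith) (ae_of_all _ fun y hy => ?_) (hbi'.const_mul (128 * M * exp (|z.im| - sg G)))).trans ?_
    · have ha : |y| = -y := abs_of_nonpos hy.2
      rw [norm_mul]
      refine (mul_le_mul (hE y (by rw [ha]; linarith [hy.1])) (kp_le (hcos y).2) (norm_nonneg _) (by unfold bt; positivity)).trans ?_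
      have : exp (|y| - sg G) * exp (-(z - (π + y * Complex.I)).im) ≤ exp (|z.im| - sg G) := by
        rw [← Real.exp_add]; apply Real.exp_le_exp.2
        have := neg_abs_le z.im
        simp; linarith
      have h0 : 0 ≤ 128 * M * bt G y := by unfold bt; positivity
      nlinarith
    · rw [intervalIntegral.integral_const_mul]; gcongr
  have e : SS G t z = (∫ x in (-π)..π, Pf G (x:ℂ) t) - Complex.I * (∫ y in (0)..sg G, (Pf G (π + y * Complex.I) t - Pf G (-π + y * Complex.I) t) * kp (π + y * Complex.I - z))
      + Complex.I * (∫ y in (-sg G)..0, (Pf G (π + y * Complex.I) t - Pf G (-π + y * Complex.I) t) * kp (z - (π + y * Complex.I))) := by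
    unfold SS; rw [hK]; ring
  rw [e]
  have n1 := norm_add_le ((∫ x in (-π)..π, Pf G (x:ℂ) t) - Complex.I * (∫ y in (0)..sg G, (Pf G (π + y * Complex.I) t - Pf G (-π + y * Complex.I) t) * kp (π + y * Complex.I - z))) (Complex.I * (∫ y in (-sg G)..0, (Pf G (π + y * Complex.I) t - Pf G (-π + y * Complex.I) t) * kp (z - (π + y * Complex.I))))
  have n2 := norm_sub_le (∫ x in (-π)..π, Pf G (x:ℂ) t) (Complex.I * (∫ y in (0)..sg G, (Pf G (π + y * Complex.I) t - Pf G (-π + y * Complex.I) t) * kp (π + y * Complex.I - z)))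
  rw [norm_mul, Complex.norm_I, one_mul] at n1 n2
  have hb0 : bt G 0 ≤ 10 ^ 29 / G := by
    have hq : √G ^ 2 = G := Real.sq_sqrt hG0.le
    have hq1 : 1 ≤ √G := Real.one_le_sqrt.2 (by linarith)
    have h1 : 1 ≤ √(sg G + 3 / 2 - |0|) := Real.one_le_sqrt.2 (by rw [abs_zero]; linarith)
    have h5 : G ≤ √G ^ 5 := by
      calc G = √G ^ 2 := hq.symm
        _ ≤ √G ^ 5 := pow_le_pow_right₀ hq1 (by norm_num)
    calc bt G 0 ≤ 10 ^ 29 / √G ^ 5 := div_le_self (by positivity) h1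
      _ ≤ _ := by gcongr
  have m2 : 64 * M * bt G 0 * exp (0 - sg G) * (2 * π) ≤ 64 * M * (10 ^ 29 / G) * exp (|z.im| - sg G) * (2 * 3.15) := by
    have := abs_nonneg z.im
    have hb : 0 ≤ bt G 0 := by unfold bt; positivity
    gcongr
  have fin : 64 * M * (10 ^ 29 / G) * exp (|z.im| - sg G) * (2 * 3.15) + 128 * M * exp (|z.im| - sg G) * (2 * 10 ^ 29 / G) + 128 * M * exp (|z.im| - sg G) * (2 * 10 ^ 29 / G) ≤ 10 ^ 32 / G * M * exp (|z.im| - sg G) := by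
    have h0 : 0 ≤ M * exp (|z.im| - sg G) / G := by positivity
    have e1 : 64 * M * (10 ^ 29 / G) * exp (|z.im| - sg G) * (2 * 3.15) + 128 * M * exp (|z.im| - sg G) * (2 * 10 ^ 29 / G) + 128 * M * exp (|z.im| - sg G) * (2 * 10 ^ 29 / G) = (64 * 10 ^ 29 * 6.3 + 512 * 10 ^ 29) * (M * exp (|z.im| - sg G) / G) := by ring
    have e2 : 10 ^ 32 / G * M * exp (|z.im| - sg G) = 10 ^ 32 * (M * exp (|z.im| - sg G) / G) := by ring
    rw [e1, e2]; gcongr; norm_num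
  linarith

open Real Filter MeasureTheory Set Topology

variable {G : ℝ} {v z : ℂ}

noncomputable def TT0 (G : ℝ) : ℝ := 2 * 10 ^ 22 / √G ^ 3

lemma Pf_T (hG : 10 ^ 20 ≤ G) (hv : v ∈ Dom G) (t : ℝ) : ‖Pf G v t‖ ≤ TT0 G := by
  have hG0 : 0 < G := by linarith
  refine (Pf_le hG hv t).trans ?_
  unfold TT0
  have h1 : 1 ≤ √(y0 G v) := Real.one_le_sqrt.2 (Dom_y0 hv).le
  have h2 : 1 ≤ √(y0 G v) ^ 3 := one_le_pow₀ h1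
  have h3 : 0 < √G ^ 3 := by have := Real.sqrt_pos.2 hG0; positivity
  gcongr
  nlinarith

lemma sg_ge (hG : 10 ^ 20 ≤ G) : G ≤ sg G := by
  unfold sg
  have : G * 10 ^ 20 ≤ G * G := by gcongr
  have : (G * 10 ^ 20) * 10 ^ 20 ≤ G * G * G := by gcongr
  nlinarith

set_option maxHeartbeats 800000 in
lemma boot (hG : 10 ^ 40 ≤ G) {M : ℝ} (hM : Bd G M) : Bd G (16 * TT0 G + M / 2) := by
  have hG' : 10 ^ 20 ≤ G := by linarith
  have hpi := Real.pi_lt_d2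
  have hpi3 := Real.pi_gt_three
  have hG0 : 0 < G := by linarith
  have hsg := sg_ge hG'
  have hM0 := Bd_nonneg (by linarith) hM
  have hT : 0 ≤ TT0 G := by unfold TT0; positivity
  intro v t h1 h2
  have hvD : v ∈ Dom G := Dom_of (by linarith) h2
  set E := exp (|v.im| - sg G) with hE
  have hE0 : 0 < E := exp_pos _
  rcases le_or_gt (sg G - 1) |v.im| with h | h
  · have e1 : 1 / 4 ≤ E := by
      have h3 : exp (-1) ≤ E := Real.exp_le_exp.2 (by linarith)
      have h4 : (1:ℝ) / 4 ≤ exp (-1) := by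
        rw [Real.exp_neg, one_div]; gcongr
        linarith [Real.exp_one_lt_d9]
      linarith
    have := Pf_T hG' hvD t
    have ha := abs_nonneg v.re
    calc _ ≤ 4 * TT0 G := mul_le_mul (by linarith) this (norm_nonneg _) (by norm_num)
      _ ≤ (16 * TT0 G + M / 2) * (1 / 4) := by linarith
      _ ≤ _ := by gcongr
  · have hs := shift_le hG' hM (η := v.im) (by linarith) (t - v.re) v.re h1
    rw [sub_add_cancel, add_comm (_ * Complex.I), Complex.re_add_im, ← hE] at hs
    have hS := SS_le hG' hM (z := v.im * Complex.I) (by simp) (by simp; linarith) (t - v.re)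
    have eim : ((v.im : ℂ) * Complex.I).im = v.im := by simp
    rw [eim, ← hE] at hS
    obtain ⟨hl, hr⟩ := abs_lt.1 h
    have hi : ∀ s : ℝ, (s = 1 ∨ s = -1) → ‖∫ x in (-π)..π, Pf G ((x:ℂ) + s * sg G * Complex.I) (t - v.re) * kp (s * ((x:ℂ) + s * sg G * Complex.I - v.im * Complex.I))‖ ≤ 2 * TT0 G * E * |π - -π| := by
      intro s hs
      refine intervalIntegral.norm_integral_le_of_norm_le_const fun x hx => ?_
      rw [uIoc_of_le (by linarith)] at hx
      have hx1 : |x| ≤ π := abs_le.2 ⟨hx.1.le, hx.2⟩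
      have k1 := Pf_T hG' (v := (x:ℂ) + s * sg G * Complex.I) (Dom_of (by simp; linarith) (by rcases hs with rfl | rfl <;> simp [abs_of_pos (by linarith : 0 < sg G)])) (t - v.re)
      have him : (s * ((x:ℂ) + s * sg G * Complex.I - v.im * Complex.I)).im = sg G - s * v.im := by
        rcases hs with rfl | rfl <;> simp <;> ring
      have k2 := (kp_le2 (z := s * ((x:ℂ) + s * sg G * Complex.I - v.im * Complex.I)) (by rw [him]; rcases hs with rfl | rfl <;> linarith)).1
      have k3 : exp (-(sg G - s * v.im)) ≤ E := Real.exp_le_exp.2 (by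
        have := le_abs_self v.im; have := neg_abs_le v.im
        rcases hs with rfl | rfl <;> linarith)
      rw [him] at k2
      rw [norm_mul]
      calc _ ≤ TT0 G * (2 * E) := mul_le_mul k1 (by linarith) (norm_nonneg _) hT
        _ = _ := by ring
    have i1 := hi 1 (Or.inl rfl)
    have i2 := hi (-1) (Or.inr rfl)
    rw [show |π - -π| = 2 * π by rw [sub_neg_eq_add, ← two_mul, abs_of_pos (by positivity)]] at i1 i2
    have e1 : SS G (t - v.re) (v.im * Complex.I) = 2 * π * Pf G (v.im * Complex.I) (t - v.re) - (∫ x in (-π)..π, Pf G ((x:ℂ) + (1:ℝ) * sg G * Complex.I) (t - v.re) * kp ((1:ℝ) * ((x:ℂ) + (1:ℝ) * sg G * Complex.I - v.im * Complex.I))) - (∫ x in (-π)..π, Pf G ((x:ℂ) + (-1:ℝ) * sg G * Complex.I) (t - v.re) * kp ((-1:ℝ) * ((x:ℂ) + (-1:ℝ) * sg G * Complex.I - v.im * Complex.I))) := by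
      simp only [SS, Complex.ofReal_one, one_mul, Complex.ofReal_neg, neg_mul, ← sub_eq_add_neg, neg_sub]
    have n3 : 2 * π * ‖Pf G (v.im * Complex.I) (t - v.re)‖ ≤ ‖SS G (t - v.re) (v.im * Complex.I)‖ + 2 * TT0 G * E * (2 * π) + 2 * TT0 G * E * (2 * π) := by
      have : (2 * π * Pf G (v.im * Complex.I) (t - v.re)) = SS G (t - v.re) (v.im * Complex.I) + (∫ x in (-π)..π, Pf G ((x:ℂ) + (1:ℝ) * sg G * Complex.I) (t - v.re) * kp ((1:ℝ) * ((x:ℂ) + (1:ℝ) * sg G * Complex.I - v.im * Complex.I))) + (∫ x in (-π)..π, Pf G ((x:ℂ) + (-1:ℝ) * sg G * Complex.I) (t - v.re) * kp ((-1:ℝ) * ((x:ℂ) + (-1:ℝ) * sg G * Complex.I - v.im * Complex.I))) := by rw [e1]; ring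
      have e3 : 2 * π * ‖Pf G (v.im * Complex.I) (t - v.re)‖ = ‖(2 * π * Pf G (v.im * Complex.I) (t - v.re))‖ := by
        rw [norm_mul, norm_mul, Complex.norm_real, Real.norm_of_nonneg pi_pos.le]; simp
      rw [e3, this]
      refine (norm_add_le _ _).trans (add_le_add ((norm_add_le _ _).trans (add_le_add le_rfl i1)) i2)
    have hdel : 10 ^ 32 / G ≤ 1 / 10 ^ 8 := by rw [div_le_div_iff₀ hG0 (by norm_num)]; linarith
    have n4 : ‖Pf G (v.im * Complex.I) (t - v.re)‖ ≤ 4 * TT0 G * E + M * E / 10 ^ 8 := by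
      have : 10 ^ 32 / G * M * E ≤ 1 / 10 ^ 8 * (M * E) := by rw [mul_assoc]; gcongr
      have hME : 0 ≤ M * E := by positivity
      nlinarith
    have hb : bt G v.im ≤ 1 / 10 ^ 8 := by
      have hq : √G ^ 2 = G := Real.sq_sqrt hG0.le
      have hq1 : 10 ^ 20 ≤ √G := Real.le_sqrt_of_sq_le (by linarith)
      have hh : 1 ≤ √(sg G + 3 / 2 - |v.im|) := Real.one_le_sqrt.2 (by linarith)
      calc bt G v.im ≤ 10 ^ 29 / √G ^ 5 := div_le_self (by positivity) hh
        _ ≤ 10 ^ 29 / (10 ^ 20) ^ 5 := by gcongr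
        _ ≤ _ := by norm_num
    set d := π + 1 / 2 - |v.re| with hd
    have hd0 : 0 < d := by simp only [hd]; linarith
    have hd4 : d ≤ 4 := by have := abs_nonneg v.re; simp only [hd]; linarith
    rw [le_div_iff₀ hd0] at hs
    have n5 := norm_sub_norm_le (Pf G v t) (Pf G (v.im * Complex.I) (t - v.re))
    have hME : 0 ≤ M * E := by positivity
    have n6 : 32 * M * bt G v.im * E ≤ M * E / 100 := by
      calc 32 * M * bt G v.im * E = 32 * bt G v.im * (M * E) := by ring
        _ ≤ 32 * (1 / 10 ^ 8) * (M * E) := by gcongr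
        _ ≤ _ := by linarith
    have n7 : d * ‖Pf G (v.im * Complex.I) (t - v.re)‖ ≤ 4 * (4 * TT0 G * E + M * E / 10 ^ 8) := mul_le_mul hd4 n4 (norm_nonneg _) (by norm_num)
    have n8 := mul_le_mul_of_nonneg_left n5 hd0.le
    rw [mul_sub] at n8
    linarith

lemma Bd_32 (hG : 10 ^ 40 ≤ G) : Bd G (32 * TT0 G) := by
  have hG0 : 0 < G := by linarith
  have hG' : 10 ^ 20 ≤ G := by linarith
  have hpi := Real.pi_lt_d2
  have hT : 0 ≤ TT0 G := by unfold TT0; positivity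
  have ind : ∀ n : ℕ, Bd G (32 * TT0 G + (4 * TT0 G * exp (sg G)) / 2 ^ n) := by
    intro n
    induction n with
    | zero =>
      intro v t h1 h2
      have := Pf_T hG' (Dom_of (by linarith) h2) t
      have ha := abs_nonneg v.re
      have h3 : (π + 1 / 2 - |v.re|) * ‖Pf G v t‖ ≤ 4 * TT0 G := mul_le_mul (by linarith) this (norm_nonneg _) (by norm_num)
      have h4 : exp (sg G) * exp (|v.im| - sg G) = exp |v.im| := by rw [← Real.exp_add]; congr 1; ring
      have h5 : 1 ≤ exp |v.im| := Real.one_le_exp (abs_nonneg _)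
      have h6 : 0 ≤ 32 * TT0 G * exp (|v.im| - sg G) := by positivity
      calc _ ≤ 4 * TT0 G := h3
        _ ≤ 32 * TT0 G * exp (|v.im| - sg G) + 4 * TT0 G * exp |v.im| := by nlinarith
        _ = _ := by rw [← h4]; ring
    | succ n ih =>
      have := boot hG ih
      convert this using 1
      rw [pow_succ]; field_simp; ring
  intro v t h1 h2
  have lim : Tendsto (fun n : ℕ => (32 * TT0 G + (4 * TT0 G * exp (sg G)) / 2 ^ n) * exp (|v.im| - sg G)) atTop (𝓝 ((32 * TT0 G + 0) * exp (|v.im| - sg G))) := by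
    refine (tendsto_const_nhds.add ?_).mul_const _
    exact tendsto_const_nhds.div_atTop (tendsto_pow_atTop_atTop_of_one_lt (by norm_num))
  rw [add_zero] at lim
  exact ge_of_tendsto' lim fun n => ind n v t h1 h2

noncomputable def AA (G : ℝ) : ℂ := ∫ x in (-π)..π, Pf G ((x:ℂ) + sg G * Complex.I) 0 * Complex.exp (Complex.I * x)

set_option maxHeartbeats 800000 in
lemma Pf_dne (hG : 10 ^ 40 ≤ G) (ha : 90 * (10 ^ 32 / G) * TT0 G < ‖AA G‖) : deriv (fun v => Pf G v 0) 0 ≠ 0 := by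
  intro hd0
  have hG' : 10 ^ 20 ≤ G := by linarith
  have hpi := Real.pi_lt_d2
  have hpi3 := Real.pi_gt_three
  have hG0 : 0 < G := by linarith
  have hsg := sg_ge hG'
  have hT : 0 ≤ TT0 G := by unfold TT0; positivity
  set A := ∫ x in (-π)..π, Pf G ((x:ℂ) + sg G * Complex.I) 0 * Complex.exp (Complex.I * ((x:ℂ) + sg G * Complex.I)) with hA
  set B := ∫ x in (-π)..π, Pf G ((x:ℂ) - sg G * Complex.I) 0 * Complex.exp (Complex.I * -((x:ℂ) - sg G * Complex.I)) with hB
  have hAA : ‖A‖ = exp (-sg G) * ‖AA G‖ := by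
    have : A = exp (-sg G) * AA G := by
      rw [hA, AA, ← intervalIntegral.integral_const_mul]
      congr 1; ext x
      rw [mul_add, Complex.exp_add, show Complex.I * (sg G * Complex.I) = ((-sg G : ℝ) : ℂ) by push_cast; linear_combination (sg G : ℂ) * Complex.I_sq, Complex.ofReal_exp]
      ring
    rw [this, norm_mul, Complex.norm_real, Real.norm_of_nonneg (exp_pos _).le]
  set err : ℂ → ℂ := fun z => 2 * π * Pf G z 0 - A * Complex.exp (-Complex.I * z) - B * Complex.exp (Complex.I * z) with herr
  have hball : Metric.closedBall (0:ℂ) 1 ⊆ Dom G := by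
    intro w hw
    rw [mem_closedBall_zero_iff] at hw
    exact Dom_of (by linarith [Complex.abs_re_le_norm w]) (by linarith [Complex.abs_im_le_norm w])
  set ε := 90 * (10 ^ 32 / G) * TT0 G * exp (-sg G) with hε
  have hle : ∀ z ∈ Metric.closedBall (0:ℂ) 1, ‖err z‖ ≤ ε := by
    intro z hz
    rw [mem_closedBall_zero_iff] at hz
    have hz1 : |z.re| ≤ 1 := (Complex.abs_re_le_norm z).trans hz
    have hz2 : |z.im| ≤ 1 := (Complex.abs_im_le_norm z).trans hz
    obtain ⟨hl, hr⟩ := abs_le.1 hz2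
    have hS := SS_le hG' (Bd_32 hG) hz1 (by linarith) 0
    have hPc : ∀ s : ℝ, |s| = 1 → ContinuousOn (fun x : ℝ => Pf G ((x:ℂ) + s * sg G * Complex.I) 0) (uIcc (-π) π) := by
      intro s hs x hx
      rw [uIcc_of_le (by linarith)] at hx
      have hD : (x:ℂ) + s * sg G * Complex.I ∈ Dom G := Dom_of (by simp; linarith [abs_le.2 hx]) (by simp [hs, abs_of_pos (by linarith : 0 < sg G)])
      exact (ContinuousAt.comp (f := fun x : ℝ => (x:ℂ) + s * sg G * Complex.I) ((Pf_hol hG' 0).differentiableAt (Dom_open.mem_nhds hD)).continuousAt (by fun_prop)).continuousWithinAt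
    have him : ∀ s x : ℝ, (s = 1 ∨ s = -1) → (s * ((x:ℂ) + s * sg G * Complex.I - z)).im = sg G - s * z.im := by
      rintro s x (rfl | rfl) <;> simp <;> ring
    have hi : ∀ s : ℝ, (s = 1 ∨ s = -1) → ‖(∫ x in (-π)..π, Pf G ((x:ℂ) + s * sg G * Complex.I) 0 * kp (s * ((x:ℂ) + s * sg G * Complex.I - z))) - (∫ x in (-π)..π, Pf G ((x:ℂ) + s * sg G * Complex.I) 0 * Complex.exp (Complex.I * (s * ((x:ℂ) + s * sg G * Complex.I)))) * Complex.exp (-(Complex.I * (s * z)))‖ ≤ TT0 G * (2 * exp (-(sg G - 1)) ^ 2) * |π - -π| := by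
      intro s hs
      have hs1 : |s| = 1 := by rcases hs with rfl | rfl <;> simp
      rw [← intervalIntegral.integral_mul_const, ← intervalIntegral.integral_sub]
      · refine intervalIntegral.norm_integral_le_of_norm_le_const fun x hx => ?_
        rw [uIoc_of_le (by linarith)] at hx
        have hx1 : |x| ≤ π := abs_le.2 ⟨hx.1.le, hx.2⟩
        have k1 := Pf_T hG' (v := (x:ℂ) + s * sg G * Complex.I) (Dom_of (by simp; linarith) (by simp [hs1, abs_of_pos (by linarith : 0 < sg G)])) 0
        have k2 := (kp_le2 (z := s * ((x:ℂ) + s * sg G * Complex.I - z)) (by rw [him s x hs]; rcases hs with rfl | rfl <;> linarith)).2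
        rw [him s x hs] at k2
        have k3 : exp (-(sg G - s * z.im)) ≤ exp (-(sg G - 1)) := Real.exp_le_exp.2 (by rcases hs with rfl | rfl <;> linarith)
        have e : Pf G ((x:ℂ) + s * sg G * Complex.I) 0 * kp (s * ((x:ℂ) + s * sg G * Complex.I - z)) - Pf G ((x:ℂ) + s * sg G * Complex.I) 0 * Complex.exp (Complex.I * (s * ((x:ℂ) + s * sg G * Complex.I))) * Complex.exp (-(Complex.I * (s * z))) = Pf G ((x:ℂ) + s * sg G * Complex.I) 0 * (kp (s * ((x:ℂ) + s * sg G * Complex.I - z)) - Complex.exp (Complex.I * (s * ((x:ℂ) + s * sg G * Complex.I - z)))) := by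
          have ee : Complex.exp (Complex.I * (s * ((x:ℂ) + s * sg G * Complex.I - z))) = Complex.exp (Complex.I * (s * ((x:ℂ) + s * sg G * Complex.I))) * Complex.exp (-(Complex.I * (s * z))) := by
            rw [← Complex.exp_add]; congr 1; ring
          rw [ee]; ring
        rw [e, norm_mul]
        refine mul_le_mul k1 (k2.trans ?_) (norm_nonneg _) hT
        gcongr
      · refine ((hPc s hs1).mul ?_).intervalIntegrable
        intro x _
        refine (ContinuousAt.comp (f := fun x : ℝ => s * ((x:ℂ) + s * sg G * Complex.I - z)) (kp_contAt (EE_ne ?_)) (by fun_prop)).continuousWithinAt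
        rw [him s x hs]; rcases hs with rfl | rfl <;> intro h <;> linarith
      · exact (((hPc s hs1).mul (by fun_prop)).mul continuousOn_const).intervalIntegrable
    have i1 := hi 1 (Or.inl rfl)
    have i2 := hi (-1) (Or.inr rfl)
    rw [show |π - -π| = 2 * π by rw [sub_neg_eq_add, ← two_mul, abs_of_pos (by positivity)]] at i1 i2
    simp only [Complex.ofReal_one, one_mul] at i1
    simp only [Complex.ofReal_neg, Complex.ofReal_one, neg_mul, one_mul, ← sub_eq_add_neg, neg_sub, mul_neg, neg_neg] at i2
    have e : err z = SS G 0 z + ((∫ x in (-π)..π, Pf G ((x:ℂ) + sg G * Complex.I) 0 * kp ((x:ℂ) + sg G * Complex.I - z)) - A * Complex.exp (-(Complex.I * z))) + ((∫ x in (-π)..π, Pf G ((x:ℂ) - sg G * Complex.I) 0 * kp (z - ((x:ℂ) - sg G * Complex.I))) - B * Complex.exp (Complex.I * z)) := by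
      simp only [herr, SS, neg_mul]; ring
    rw [e]
    have hBe : B = ∫ x in (-π)..π, Pf G ((x:ℂ) - sg G * Complex.I) 0 * Complex.exp (Complex.I * (sg G * Complex.I - (x:ℂ))) := by
      simp only [hB, neg_sub]
    rw [← hA] at i1
    rw [← hBe] at i2
    refine (norm_add₃_le).trans ((add_le_add (add_le_add hS i1) i2).trans ?_)
    have x1 : exp (|z.im| - sg G) ≤ 2.72 * exp (-sg G) := by
      calc _ ≤ exp (1 + -sg G) := Real.exp_le_exp.2 (by linarith)
        _ ≤ _ := by rw [Real.exp_add]; gcongr; linarith [Real.exp_one_lt_d9]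
    have x2 : exp (-(sg G - 1)) ^ 2 ≤ 9 * (1 / G) * exp (-sg G) := by
      have hx : exp (-sg G) ≤ 1 / G := by
        rw [Real.exp_neg, one_div]; gcongr
        linarith [Real.add_one_le_exp (sg G)]
      have hy : exp (-(sg G - 1)) = exp 1 * exp (-sg G) := by rw [← Real.exp_add]; congr 1; ring
      have h9 : exp 1 ^ 2 ≤ 9 := by have := Real.exp_one_lt_d9; nlinarith [Real.exp_pos 1]
      rw [hy, mul_pow]
      calc exp 1 ^ 2 * exp (-sg G) ^ 2 ≤ 9 * (exp (-sg G) * exp (-sg G)) := by rw [sq (exp (-sg G))]; gcongr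
        _ ≤ 9 * (1 / G * exp (-sg G)) := by gcongr
        _ = _ := by ring
    set w := TT0 G * exp (-sg G) / G with hw
    have hw0 : 0 ≤ w := by positivity
    have y1 : 10 ^ 32 / G * (32 * TT0 G) * exp (|z.im| - sg G) ≤ 10 ^ 32 * 32 * 2.72 * w := by
      calc _ ≤ 10 ^ 32 / G * (32 * TT0 G) * (2.72 * exp (-sg G)) := by gcongr
        _ = _ := by rw [hw]; ring
    have y2 : TT0 G * (2 * exp (-(sg G - 1)) ^ 2) * (2 * π) ≤ 200 * w := by
      calc _ ≤ TT0 G * (2 * (9 * (1 / G) * exp (-sg G))) * (2 * 3.15) := by gcongr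
        _ = 113.4 * w := by rw [hw]; ring
        _ ≤ _ := by linarith
    have y3 : ε = 90 * 10 ^ 32 * w := by rw [hε, hw]; ring
    rw [y3, ← neg_sub (sg G) 1]; linarith
  have hPd : HasDerivAt (fun v => Pf G v 0) 0 0 := by
    have := ((Pf_hol hG' 0).differentiableAt (Dom_open.mem_nhds (hball (by simp : (0:ℂ) ∈ _)))).hasDerivAt
    rwa [hd0] at this
  have hed : HasDerivAt err (Complex.I * A - Complex.I * B) 0 := by
    have h1 : HasDerivAt (fun z => Complex.exp (-Complex.I * z)) (-Complex.I) 0 := by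
      simpa using ((hasDerivAt_id (0:ℂ)).const_mul (-Complex.I)).cexp
    have h2 : HasDerivAt (fun z => Complex.exp (Complex.I * z)) (Complex.I) 0 := by
      simpa using ((hasDerivAt_id (0:ℂ)).const_mul (Complex.I)).cexp
    exact (((hPd.const_mul (2 * π : ℂ)).sub (h1.const_mul A)).sub (h2.const_mul B)).congr_deriv (by ring)
  have hdc : DiffContOnCl ℂ err (Metric.ball 0 1) := by
    refine DifferentiableOn.diffContOnCl ?_
    rw [closure_ball _ one_ne_zero]
    refine ((((Pf_hol hG' 0).mono hball).const_mul _).sub ?_).sub ?_ <;> exact Differentiable.differentiableOn (by fun_prop)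
  have c1 := Complex.norm_deriv_le_of_forall_mem_sphere_norm_le one_pos hdc fun z hz => hle z (Metric.sphere_subset_closedBall hz)
  rw [hed.deriv, div_one, ← mul_sub, norm_mul, Complex.norm_I, one_mul] at c1
  have hP0 : Pf G 0 0 = 0 := by
    have := Pf_odd hG' (v := 0) (hball (by simp)) 0
    rw [neg_zero, neg_zero] at this
    have h4 : (2:ℂ) * Pf G 0 0 = 0 := by linear_combination this
    simpa using h4
  have c2 := hle 0 (by simp)
  have : err 0 = -(A + B) := by simp [herr, hP0]; ring
  rw [this, norm_neg] at c2
  have c3 : ‖A‖ ≤ ε := by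
    have h5 : (2:ℂ) * A = (A - B) + (A + B) := by ring
    have h6 := norm_add_le (A - B) (A + B)
    rw [← h5, norm_mul] at h6
    simp at h6; linarith
  rw [hAA, hε, mul_comm] at c3
  have := le_of_mul_le_mul_right c3 (exp_pos _)
  linarith

open Real Filter MeasureTheory Set Topology

lemma japi {C r : ℝ} (hr : 1 < r) : Integrable fun u : ℝ => C * (1 + |u|) ^ (-r) :=
  (integrable_one_add_norm (E := ℝ) (μ := volume) (r := r) (by simpa)).const_mul C

lemma two_slit (u : ℝ) : (2 + u * Complex.I : ℂ) ∈ Complex.slitPlane := by left; simp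
lemma wcont : Continuous fun u : ℝ => (2 + u * Complex.I : ℂ) ^ (-(3/2) : ℂ) :=
  continuous_iff_continuousAt.2 fun u => ContinuousAt.cpow (by fun_prop) continuousAt_const (two_slit u)

lemma wcpow_int : Integrable fun u : ℝ => (2 + u * Complex.I : ℂ) ^ (-(3/2) : ℂ) := by
  refine (japi (C := 3 ^ (3/2:ℝ)) (r := 3/2) (by norm_num)).mono' wcont.aestronglyMeasurable (ae_of_all _ fun u => ?_)
  have h2 : (-(3/2) : ℂ) = ((-(3/2) : ℝ) : ℂ) := by push_cast; rfl
  have h0 : (2 + u * Complex.I : ℂ) ≠ 0 := Complex.slitPlane_ne_zero (two_slit u)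
  rw [h2, Complex.norm_cpow_of_ne_zero h0]; simp
  have h3 : (1 + |u|) / 3 ≤ ‖(2 + u * Complex.I : ℂ)‖ := by
    have a := Complex.abs_re_le_norm (2 + u * Complex.I : ℂ)
    have b := Complex.abs_im_le_norm (2 + u * Complex.I : ℂ)
    simp at a b; linarith
  calc _ ≤ ((1 + |u|) / 3) ^ (-(3/2):ℝ) := Real.rpow_le_rpow_of_nonpos (by positivity) h3 (by norm_num)
    _ = _ := by rw [Real.div_rpow (by positivity) (by norm_num), Real.rpow_neg (by norm_num : (0:ℝ) ≤ 3)]; field_simp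

lemma gam {r : ℂ} (hr : 1 < r.re) : ∫ t : ℝ in Ioi 0, (t:ℂ) ^ ((3/2:ℂ) - 1) * Complex.exp (-(r * t)) = r ^ (-(3/2) : ℂ) * Complex.Gamma (3/2) := by
  have hU : IsOpen {r : ℂ | 1 < r.re} := isOpen_lt continuous_const Complex.continuous_re
  have hB := integrableOn_rpow_mul_exp_neg_mul_rpow (p := 1) (s := 1/2) (b := 1) (by norm_num) one_pos (by norm_num)
  have h1 : DifferentiableOn ℂ (fun r : ℂ => ∫ t : ℝ in Ioi 0, (t:ℂ) ^ ((3/2:ℂ) - 1) * Complex.exp (-(r * t))) {r | 1 < r.re} := by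
    refine holo_integral hU (ae_of_all _ fun a => Differentiable.differentiableOn (by fun_prop)) (fun v hv => ?_) hB ?_
    · refine ContinuousOn.aestronglyMeasurable (fun x hx => ContinuousAt.continuousWithinAt ?_) measurableSet_Ioi
      exact ContinuousAt.mul (ContinuousAt.cpow (by fun_prop) continuousAt_const (by simpa using hx)) (by fun_prop)
    · filter_upwards [ae_restrict_mem measurableSet_Ioi] with t ht w hw
      have ht : 0 < t := ht
      have hw : 1 < w.re := hw
      rw [norm_mul, Complex.norm_cpow_eq_rpow_re_of_pos ht, Complex.norm_exp]
      simp; norm_num; gcongr; nlinarith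
  have h2 : DifferentiableOn ℂ (fun r : ℂ => r ^ (-(3/2) : ℂ) * Complex.Gamma (3/2)) {r | 1 < r.re} := fun w hw =>
    ((differentiableAt_id.cpow_const (Or.inl (by simp; linarith [show 1 < w.re from hw]))).mul_const _).differentiableWithinAt
  refine (h1.analyticOnNhd hU).eqOn_of_preconnected_of_frequently_eq (h2.analyticOnNhd hU) (convex_halfSpace_re_gt 1).isPreconnected (z₀ := 2) (by simp) ?_ hr
  have h3 : ∃ᶠ x : ℝ in 𝓝[>] 2, True := frequently_true_iff_neBot _ |>.2 inferInstance
  have h4 : Tendsto (fun x : ℝ => (x:ℂ)) (𝓝[>] 2) (𝓝[≠] 2) := by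
    refine tendsto_nhdsWithin_of_tendsto_nhds_of_eventually_within _ ?_ ?_
    · exact (Complex.continuous_ofReal.tendsto' 2 2 (by simp)).mono_left nhdsWithin_le_nhds
    · filter_upwards [self_mem_nhdsWithin] with x hx h
      have : x = 2 := by exact_mod_cast (show (x:ℂ) = 2 from h)
      exact absurd hx (by simp [this])
  refine h4.frequently ((h3.and_eventually self_mem_nhdsWithin).mono ?_)
  rintro x ⟨-, hx⟩
  have hx : 0 < x := two_pos.trans hx
  rw [Complex.integral_cpow_mul_exp_neg_mul_Ioi (by norm_num) hx, one_div, Complex.inv_cpow _ _ (by simp [Complex.arg_ofReal_of_nonneg hx.le, pi_ne_zero.symm]), Complex.cpow_neg]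

lemma four_ne : ∫ u : ℝ, (2 + u * Complex.I : ℂ) ^ (-(3/2) : ℂ) * Complex.exp (Complex.I * u) ≠ 0 := by
  let f : ℝ → ℂ := (Ioi 0).indicator fun x => (x:ℂ) ^ ((3/2:ℂ) - 1) * Complex.exp (-2 * x)
  have hf : Integrable f := by
    rw [integrable_indicator_iff measurableSet_Ioi]
    have := integrableOn_rpow_mul_exp_neg_mul_rpow (p := 1) (s := 1/2) (b := 2) (by norm_num) one_pos (by norm_num)
    refine IntegrableOn.congr_fun (f := fun x : ℝ => ((x ^ (1/2:ℝ) * rexp (-2 * x ^ (1:ℝ)) : ℝ) : ℂ)) this.ofReal (fun x hx => ?_) measurableSet_Ioi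
    simp [Complex.ofReal_cpow (le_of_lt hx)]; norm_num
  have hF : ∀ w, FourierTransform.fourier f w = Complex.Gamma (3/2) * (2 + (2 * π * w : ℝ) * Complex.I : ℂ) ^ (-(3/2) : ℂ) := by
    intro w
    rw [Real.fourier_real_eq_integral_exp_smul, mul_comm (Complex.Gamma _), ← gam (by simp), ← integral_indicator measurableSet_Ioi]
    congr 1; ext x
    by_cases hx : x ∈ Ioi (0:ℝ)
    · simp only [f, indicator_of_mem hx, smul_eq_mul]
      rw [mul_left_comm, ← Complex.exp_add]; congr 2; push_cast; ring
    · simp [f, indicator_of_notMem hx]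
  have hFi : Integrable (FourierTransform.fourier f) := by
    rw [funext hF]; refine Integrable.const_mul ?_ _
    exact wcpow_int.comp_mul_left' (R := 2 * π) (by positivity)
  have hc : ContinuousAt f 1 := by
    have : f =ᶠ[𝓝 1] fun x : ℝ => (x:ℂ) ^ ((3/2:ℂ) - 1) * Complex.exp (-2 * x) := by
      filter_upwards [Ioi_mem_nhds (show (0:ℝ) < 1 by norm_num)] with x hx
      simp only [f, indicator_of_mem hx]
    rw [continuousAt_congr this]
    refine ContinuousAt.mul (ContinuousAt.cpow (by fun_prop) continuousAt_const (by simp)) (by fun_prop)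
  have h := hf.fourierInv_fourier_eq hFi hc
  rw [Real.fourierInv_eq', funext hF] at h
  have h1 : f 1 ≠ 0 := by simp [f]
  intro h0
  apply h1
  rw [← h]
  have := Measure.integral_comp_mul_left (fun u : ℝ => (2 + u * Complex.I : ℂ) ^ (-(3/2) : ℂ) * Complex.exp (Complex.I * u)) (2 * π)
  rw [h0, smul_zero] at this
  calc _ = Complex.Gamma (3/2) * ∫ x : ℝ, (2 + (2 * π * x : ℝ) * Complex.I : ℂ) ^ (-(3/2) : ℂ) * Complex.exp (Complex.I * (2 * π * x : ℝ)) := by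
        rw [← integral_const_mul]; congr 1; ext x; simp; rw [show (2 * (π:ℂ) * x * Complex.I) = Complex.I * (2 * π * x) by ring]; ring
    _ = 0 := by rw [this, mul_zero]

open Real Filter MeasureTheory Set Topology
noncomputable def zs (G u : ℝ) : ℂ := u + sg G * Complex.I
noncomputable def Hh (G u : ℝ) : ℂ := e1 G (zs G u) / rh G (zs G u) ^ 4
section
variable {G : ℝ}
lemma zs_im (hG : 10 ^ 20 ≤ G) (u : ℝ) : |(zs G u).im| < G ^ 3 / 3 := by
  have := sg_ge hG
  simp only [zs, Complex.add_im, Complex.ofReal_im, Complex.mul_im, Complex.ofReal_re, Complex.I_im, Complex.I_re]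
  norm_num; rw [abs_of_pos (by linarith)]; unfold sg; linarith
lemma zs_neg (u : ℝ) : zs G (-u) = -(starRingEnd ℂ (zs G u)) := by simp [zs]; ring
lemma rh_zneg (hG : 10 ^ 20 ≤ G) (u : ℝ) : rh G (zs G (-u)) = starRingEnd ℂ (rh G (zs G u)) := by
  rw [zs_neg, rh_neg (by linarith) (by simpa using zs_im hG u), rh_conj (by linarith) (zs_im hG u)]
lemma e1_zneg (hG : 10 ^ 20 ≤ G) (u : ℝ) : e1 G (zs G (-u)) = -starRingEnd ℂ (e1 G (zs G u)) := by
  rw [zs_neg, e1_neg (by linarith) (by simpa using zs_im hG u), e1_conj (by linarith) (zs_im hG u)]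
lemma zs_dom (hG : 10 ^ 20 ≤ G) {u : ℝ} (hu : |u| ≤ 4) : zs G u ∈ Dom G := by
  have := sg_ge hG
  refine Dom_of (by simpa [zs]) ?_
  simp only [zs, Complex.add_im, Complex.ofReal_im, Complex.mul_im, Complex.ofReal_re, Complex.I_im, Complex.I_re]
  norm_num; rw [abs_of_pos (by linarith)]; linarith

lemma nrm (hG : 10 ^ 20 ≤ G) (u : ℝ) : G * (1 + |u|) / 40 ≤ ‖rh G (zs G u)‖ ^ 2 ∧ ‖e1 G (zs G u)‖ ≤ 300 * √G := by
  have key : ∀ u : ℝ, 0 ≤ u → G * (1 + |u|) / 40 ≤ ‖rh G (zs G u)‖ ^ 2 ∧ ‖e1 G (zs G u)‖ ≤ 300 * √G := by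
    intro u hu
    have hd := zs_dom hG (u := 0) (by simp)
    have hy := Dom_y0 hd
    have h1 := K1 (by linarith) hd hu
    have h2 := K3 (by linarith) hd hu
    have e : zs G 0 + u = zs G u := by simp [zs, add_comm]
    rw [e] at h1 h2
    rw [abs_of_nonneg hu]
    have h3 : 1 ≤ √(y0 G (zs G 0)) := Real.one_le_sqrt.2 hy.le
    constructor
    · refine le_trans ?_ h1; gcongr
    · nlinarith [norm_nonneg (e1 G (zs G u))]
  rcases le_total 0 u with h | h
  · exact key u h
  · have := key (-u) (by linarith)
    rwa [rh_zneg hG, e1_zneg hG, norm_neg, RCLike.norm_conj, RCLike.norm_conj, abs_neg] at this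

lemma zs_hd (u : ℝ) : HasDerivAt (zs G) 1 u := by
  exact ((Complex.ofRealCLM.hasDerivAt (x := u)).add_const (sg G * Complex.I)).congr_deriv (by simp)
lemma rz_hd (hG : 10 ^ 20 ≤ G) (u : ℝ) : HasDerivAt (fun u => rh G (zs G u)) (e1 G (zs G u)) u := by
  exact ((rh_deriv (by linarith) (zs_im hG u)).comp u (zs_hd u)).congr_deriv (mul_one _)
lemma rz_ne (hG : 10 ^ 20 ≤ G) (u : ℝ) : rh G (zs G u) ≠ 0 := rh_ne (by linarith) (zs_im hG u)
lemma rz_cont (hG : 10 ^ 20 ≤ G) : Continuous fun u => rh G (zs G u) :=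
  continuous_iff_continuousAt.2 fun u => (rz_hd hG u).continuousAt
lemma Hh_cont (hG : 10 ^ 20 ≤ G) : Continuous (Hh G) := by
  refine Continuous.div ?_ ((rz_cont hG).pow 4) fun u => pow_ne_zero _ (rz_ne hG u)
  exact continuous_iff_continuousAt.2 fun u => (e1_deriv (by linarith) (zs_im hG u)).continuousAt.comp (zs_hd u).continuousAt
lemma Hh_int (hG : 10 ^ 20 ≤ G) : Integrable (Hh G) := by
  refine (japi (C := 300 * √G * 1600 / G ^ 2) (r := 2) (by norm_num)).mono' (Hh_cont hG).aestronglyMeasurable (ae_of_all _ fun u => ?_)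
  obtain ⟨h1, h2⟩ := nrm hG u
  have hG0 : 0 < G := by linarith
  have h0 : 0 < 1 + |u| := by positivity
  rw [Hh, norm_div, norm_pow, show ‖rh G (zs G u)‖ ^ 4 = (‖rh G (zs G u)‖ ^ 2) ^ 2 by ring, Real.rpow_neg h0.le, Real.rpow_two]
  calc _ ≤ 300 * √G / (G * (1 + |u|) / 40) ^ 2 := by gcongr
    _ = _ := by field_simp; norm_num
lemma r3_le (hG : 10 ^ 20 ≤ G) (u : ℝ) : ‖(√(2 * G) ^ 3 : ℝ) * (rh G (zs G u))⁻¹ ^ 3‖ ≤ 80 ^ (3/2:ℝ) * (1 + |u|) ^ (-(3/2):ℝ) := by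
  obtain ⟨h1, -⟩ := nrm hG u
  have hG0 : 0 < G := by linarith
  have h0 : 0 < 1 + |u| := by positivity
  have h3 : 0 < √(1 + |u|) := Real.sqrt_pos.2 h0
  have hr : 0 < ‖rh G (zs G u)‖ := norm_pos_iff.2 (rz_ne hG u)
  have e : ∀ x : ℝ, 0 ≤ x → x ^ (3/2:ℝ) = √x ^ 3 := fun x hx => by
    rw [Real.sqrt_eq_rpow, ← Real.rpow_natCast, ← Real.rpow_mul hx]; norm_num
  have h2 : √(2 * G) * √(1 + |u|) ≤ √80 * ‖rh G (zs G u)‖ := by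
    refine (sq_le_sq₀ (by positivity) (by positivity)).1 ?_
    rw [mul_pow, mul_pow, Real.sq_sqrt, Real.sq_sqrt, Real.sq_sqrt] <;> first | positivity | linarith
  rw [Real.rpow_neg h0.le, e _ h0.le, e _ (by norm_num), norm_mul, norm_pow, norm_inv, Complex.norm_real, Real.norm_of_nonneg (by positivity),
    ← inv_pow, ← mul_pow, ← mul_pow]
  refine pow_le_pow_left₀ (by positivity) ?_ 3
  rw [← div_eq_mul_inv, ← div_eq_mul_inv, div_le_div_iff₀ hr h3]; exact h2

lemma Jeq (hG : 10 ^ 20 ≤ G) : ∫ u, Hh G u * Complex.exp (Complex.I * u) = Complex.I / 3 * ∫ u : ℝ, (rh G (zs G u))⁻¹ ^ 3 * Complex.exp (Complex.I * u) := by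
  have en : ∀ u : ℝ, ‖Complex.exp (Complex.I * u)‖ = 1 := fun u => by rw [mul_comm]; exact Complex.norm_exp_ofReal_mul_I u
  have ec : Continuous fun u : ℝ => Complex.exp (Complex.I * u) := by fun_prop
  have hk : (√(2 * G) ^ 3 : ℝ) ≠ 0 := by have : 0 < G := by linarith
                                         positivity
  have rc : Continuous fun u : ℝ => (rh G (zs G u))⁻¹ ^ 3 := ((rz_cont hG).inv₀ (rz_ne hG)).pow 3
  have ri : Integrable fun u : ℝ => (rh G (zs G u))⁻¹ ^ 3 := by
    have : Integrable fun u : ℝ => (√(2 * G) ^ 3 : ℝ) * (rh G (zs G u))⁻¹ ^ 3 := (japi (by norm_num)).mono' (rc.const_mul _).aestronglyMeasurable (ae_of_all _ (r3_le hG))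
    rwa [integrable_const_mul_iff (IsUnit.mk0 _ (by exact_mod_cast hk))] at this
  have bi : ∀ {f : ℝ → ℂ}, Integrable f → Integrable fun u => f u * Complex.exp (Complex.I * u) := fun hf =>
    hf.mul_bdd (c := 1) ec.aestronglyMeasurable (ae_of_all _ fun u => (en u).le)
  have hd : ∀ u : ℝ, HasDerivAt (fun u => (rh G (zs G u))⁻¹ ^ 3) (-3 * Hh G u) u := fun u => by
    refine (((rz_hd hG u).fun_inv (rz_ne hG u)).pow 3).congr_deriv ?_
    have := rz_ne hG u
    rw [Hh]; simp; field_simp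
  have hd2 : ∀ u : ℝ, HasDerivAt (fun u : ℝ => Complex.exp (Complex.I * u)) (Complex.exp (Complex.I * u) * Complex.I) u := fun u => by
    simpa using ((Complex.ofRealCLM.hasDerivAt (x := u)).const_mul Complex.I).cexp
  have h := integral_mul_deriv_eq_deriv_mul_of_integrable (fun x _ => hd x) (fun x _ => hd2 x)
    (by simpa [mul_assoc, Pi.mul_def] using! (bi ri).mul_const Complex.I) (by simpa [mul_assoc, Pi.mul_def] using! bi ((Hh_int hG).const_mul (-3))) (bi ri)
  simp only [← mul_assoc] at h
  rw [integral_mul_const] at h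
  have h2 : ∫ u : ℝ, -3 * Hh G u * Complex.exp (Complex.I * u) = -3 * ∫ u : ℝ, Hh G u * Complex.exp (Complex.I * u) := by
    rw [← integral_const_mul]; simp only [mul_assoc]
  rw [h2] at h
  linear_combination (1/3) * (-h)
end

open Real Filter MeasureTheory Set Topology
section
variable {G : ℝ}
noncomputable def cq : ℂ := ∫ y in (-π)..π, (qq y : ℂ) * Complex.exp (Complex.I * y)
lemma qqc : Continuous fun x : ℝ => (qq x : ℂ) := Complex.continuous_ofReal.comp qq_cont
lemma cq_ne : cq ≠ 0 := by
  intro h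
  have h1 : cq.re = ∫ y in (-π)..π, qq y * cos y := by
    have := Complex.reCLM.intervalIntegral_comp_comm (μ := volume) (a := -π) (b := π) (f := fun y : ℝ => (qq y : ℂ) * Complex.exp (Complex.I * y)) (by have := qqc; exact Continuous.intervalIntegrable (by fun_prop) _ _)
    rw [cq, ← Complex.reCLM_apply, ← this]
    refine intervalIntegral.integral_congr fun y _ => ?_
    rw [mul_comm Complex.I]
    simp [Complex.exp_ofReal_mul_I_re]
  have := qq_coef_neg
  rw [← h1, h] at this; simp at this

lemma en1 (u : ℝ) : ‖Complex.exp (Complex.I * u)‖ = 1 := by rw [mul_comm]; exact Complex.norm_exp_ofReal_mul_I u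
lemma qn1 (u : ℝ) : ‖(qq u : ℂ)‖ ≤ 1 := by
  rw [Complex.norm_real, Real.norm_of_nonneg (qq_nonneg u)]; exact qq_le_one u

lemma Pf_app (hG : 10 ^ 20 ≤ G) {x : ℝ} (hx : |x| ≤ 4) : ‖Pf G (zs G x) 0 + 3/2 * ∫ u, (qq (u - x) : ℂ) * Hh G u‖ ≤ 2 * 10 ^ 12 / √G ^ 5 := by
  have hd := zs_dom hG hx
  have hG0 : 0 < G := by linarith
  have hi : Integrable fun s : ℝ => (qq s : ℂ) * Hh G (x + s) := by
    refine ((Hh_int hG).comp_add_left x).bdd_mul (c := 1) qqc.aestronglyMeasurable (ae_of_all _ qn1)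
  have e0 : ∫ u, (qq (u - x) : ℂ) * Hh G u = ∫ s, (qq s : ℂ) * Hh G (x + s) := by
    rw [← integral_add_left_eq_self _ x]; simp
  have e1' : ∫ y : ℝ in Ioi 0, e1 G (zs G x + y) * (3 / 2 * qq (0 + y) / rh G (zs G x + y) ^ 4) = 3/2 * ∫ s in Ioi 0, (qq s : ℂ) * Hh G (x + s) := by
    rw [← integral_const_mul]; congr 1; ext s
    rw [Hh, zero_add, show zs G (x + s) = zs G x + s by simp [zs]; ring]; ring
  have e2 : ∫ y : ℝ in Ioi 0, e1 G (-zs G x + y) * (3 / 2 * qq (-0 + y) / rh G (-zs G x + y) ^ 4) = -(3/2 * ∫ s in Iic 0, (qq s : ℂ) * Hh G (x + s)) := by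
    have := integral_comp_neg_Ioi 0 fun s => (qq s : ℂ) * Hh G (x + s)
    rw [neg_zero] at this
    rw [← this, ← integral_const_mul, ← integral_neg]; congr 1; ext s
    rw [Hh, qq_neg, neg_zero, zero_add, show -zs G x + s = -zs G (x + -s) by simp [zs]; ring, rh_neg hG0 (zs_im hG _), e1_neg hG0 (zs_im hG _)]; ring
  have h1 := (xph_le hG hd 0).2.1
  have h2 := (xph_le hG (Dom_neg hd) (-0)).2.1
  rw [e1'] at h1; rw [e2] at h2
  rw [Pf_eq hG hd, e0, ← intervalIntegral.integral_Iic_add_Ioi hi.integrableOn hi.integrableOn]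
  refine le_trans (le_of_eq ?_) ((norm_sub_le _ _).trans ((add_le_add h2 h1).trans (le_of_eq (by ring))))
  congr 1; ring

lemma fub (hG : 10 ^ 20 ≤ G) : ∫ x in (-π)..π, (∫ u, (qq (u - x) : ℂ) * Hh G u) * Complex.exp (Complex.I * x) = cq * ∫ u, Hh G u * Complex.exp (Complex.I * u) := by
  have h1 : ∀ x : ℝ, (∫ u, (qq (u - x) : ℂ) * Hh G u) * Complex.exp (Complex.I * x) = ∫ u, (qq (u - x) : ℂ) * Hh G u * Complex.exp (Complex.I * x) := fun x => (integral_mul_const _ _).symm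
  simp_rw [h1]
  have hc := qqc
  have hH := Hh_cont hG
  rw [intervalIntegral_integral_swap, ← integral_const_mul]
  · congr 1; ext u
    have e : ∀ x : ℝ, (qq (u - x) : ℂ) * Hh G u * Complex.exp (Complex.I * x) = Hh G u * Complex.exp (Complex.I * u) * ((qq (x - u) : ℂ) * Complex.exp (Complex.I * (x - u : ℝ))) := fun x => by
      rw [← qq_neg (x - u), neg_sub, show Complex.exp (Complex.I * x) = Complex.exp (Complex.I * u) * Complex.exp (Complex.I * (x - u : ℝ)) by rw [← Complex.exp_add]; congr 1; push_cast; ring]; ring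
    simp_rw [e]
    rw [intervalIntegral.integral_const_mul, intervalIntegral.integral_comp_sub_right (fun y : ℝ => (qq y : ℂ) * Complex.exp (Complex.I * y)), mul_comm]
    congr 1
    have hp : Function.Periodic (fun y : ℝ => (qq y : ℂ) * Complex.exp (Complex.I * y)) (2 * π) := fun y => by
      simp only [qq_periodic y]
      rw [show Complex.I * ((y + 2 * π : ℝ):ℂ) = Complex.I * y + 2 * π * Complex.I by push_cast; ring, Complex.exp_periodic]
    have := hp.intervalIntegral_add_eq (-π - u) (-π)
    rw [cq]; convert this using 2 <;> ring
  · have : IsFiniteMeasure (volume.restrict (uIoc (-π) π)) := by rw [uIoc_of_le (by linarith [pi_pos])]; infer_instance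
    have : Integrable (fun z : ℝ × ℝ => (1:ℂ) * Hh G z.2) ((volume.restrict (uIoc (-π) π)).prod volume) :=
      Integrable.mul_prod (integrable_const _) (Hh_int hG)
    refine this.mono (Continuous.aestronglyMeasurable ?_) (ae_of_all _ fun z => ?_)
    · exact ((hc.comp (by fun_prop : Continuous fun z : ℝ × ℝ => z.2 - z.1)).mul (hH.comp continuous_snd)).mul (by fun_prop)
    · simp only [Function.uncurry, norm_mul, en1, mul_one, norm_one]
      gcongr; exact qn1 _

lemma AA_est (hG : 10 ^ 20 ≤ G) : ‖AA G + 3/2 * (cq * ∫ u, Hh G u * Complex.exp (Complex.I * u))‖ ≤ 10 ^ 14 / √G ^ 5 := by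
  have hπ := pi_lt_d2
  have hπ0 := pi_pos
  have hin : ∀ x ∈ uIcc (-π) π, |x| ≤ 4 := fun x hx => by
    rw [uIcc_of_le (by linarith)] at hx; rw [abs_le]; constructor <;> linarith [hx.1, hx.2]
  have c1 : ContinuousOn (fun x : ℝ => Pf G (zs G x) 0 * Complex.exp (Complex.I * x)) (uIcc (-π) π) := by
    refine ContinuousOn.mul (fun x hx => ?_) (by fun_prop)
    have := (Pf_hd hG (zs_dom hG (hin x hx)) 0).continuousAt
    exact (this.comp (f := zs G) (zs_hd x).continuousAt).continuousWithinAt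
  have c2 : Continuous fun x : ℝ => ∫ u, (qq (u - x) : ℂ) * Hh G u := by
    refine continuous_of_dominated (bound := fun u => ‖Hh G u‖) (fun x => ?_) (fun x => ae_of_all _ fun u => ?_) (Hh_int hG).norm (ae_of_all _ fun u => ?_)
    · exact ((qqc.comp (by fun_prop : Continuous fun u : ℝ => u - x)).mul (Hh_cont hG)).aestronglyMeasurable
    · rw [norm_mul]; nlinarith [qn1 (u - x), norm_nonneg (Hh G u)]
    · exact (qqc.comp (by fun_prop : Continuous fun x : ℝ => u - x)).mul continuous_const
  have c3 : Continuous fun x : ℝ => 3/2 * ((∫ u, (qq (u - x) : ℂ) * Hh G u) * Complex.exp (Complex.I * x)) := by fun_prop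
  rw [← fub hG, ← intervalIntegral.integral_const_mul]
  change ‖(∫ x in (-π)..π, Pf G (zs G x) 0 * Complex.exp (Complex.I * x)) + _‖ ≤ _
  rw [← intervalIntegral.integral_add c1.intervalIntegrable (c3.intervalIntegrable _ _)]
  refine (intervalIntegral.norm_integral_le_of_norm_le_const (C := 2 * 10 ^ 12 / √G ^ 5) fun x hx => ?_).trans ?_
  · have := Pf_app hG (hin x (uIoc_subset_uIcc hx))
    rw [← mul_assoc, ← add_mul, norm_mul, en1, mul_one]; exact this
  · rw [abs_of_pos (by linarith), div_mul_eq_mul_div]; gcongr; linarith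

lemma R_lim (u : ℝ) : Tendsto (fun G : ℝ => (√(2 * G) ^ 3 : ℝ) * (rh G (zs G u))⁻¹ ^ 3) atTop (𝓝 ((2 + u * Complex.I : ℂ) ^ (-(3/2) : ℂ))) := by
  have hs := two_slit u
  have ev : ∀ᶠ G : ℝ in atTop, 10 ^ 20 ≤ G := eventually_ge_atTop _
  have cub : ∀ᶠ G : ℝ in atTop, (Tt G (zs G u) - Complex.I) ^ 2 * (Tt G (zs G u) + 2 * Complex.I) = 6 * (u - 2 * Complex.I) / (G:ℂ) ^ 3 := by
    filter_upwards [ev] with G hG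
    have hc := tau_cubic (zim (by linarith : 0 < G) (zs_im hG u))
    have hg : (G:ℂ) ≠ 0 := by have : G ≠ 0 := by linarith
                              exact_mod_cast this
    have hz : 2 * (3 * zs G u / (G:ℂ) ^ 3) = 6 * (u - 2 * Complex.I) / (G:ℂ) ^ 3 + 2 * Complex.I := by
      simp only [zs, sg]; push_cast; field_simp; ring
    rw [hz] at hc
    simp only [Tt]
    linear_combination hc + (-3 * tau (3 * zs G u / (G:ℂ) ^ 3) + 2 * Complex.I) * Complex.I_sq
  have hT : Tendsto (fun G : ℝ => Tt G (zs G u)) atTop (𝓝 Complex.I) := by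
    rw [tendsto_iff_norm_sub_tendsto_zero]
    have l0 : Tendsto (fun G : ℝ => 6 * ‖(u - 2 * Complex.I : ℂ)‖ / G ^ 3) atTop (𝓝 0) :=
      Tendsto.const_div_atTop (tendsto_pow_atTop (by norm_num)) _
    have l1 := l0.sqrt
    rw [Real.sqrt_zero] at l1
    refine squeeze_zero' (Eventually.of_forall fun _ => norm_nonneg _) ?_ l1
    filter_upwards [ev, cub] with G hG hc
    refine Real.le_sqrt_of_sq_le ?_
    have hi := abs_lt.1 (Tt_im (by linarith : 0 < G) (zs_im hG u))
    have h1 : 1 ≤ ‖Tt G (zs G u) + 2 * Complex.I‖ := by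
      have := Complex.abs_im_le_norm (Tt G (zs G u) + 2 * Complex.I)
      simp at this; linarith [le_abs_self ((Tt G (zs G u)).im + 2), hi.1]
    have h2 := congrArg norm hc
    rw [norm_mul, norm_pow, norm_div, norm_mul, norm_pow, Complex.norm_real, Real.norm_of_nonneg (by linarith)] at h2
    norm_num at h2
    rw [← h2]; nlinarith [sq_nonneg ‖Tt G (zs G u) - Complex.I‖]
  have hR2 : Tendsto (fun G : ℝ => (rh G (zs G u) / (√(2 * G) : ℝ)) ^ 2) atTop (𝓝 (2 + u * Complex.I)) := by
    have h3 : Tendsto (fun G : ℝ => 3 / 4 * (u - 2 * Complex.I) * (Tt G (zs G u) + Complex.I) ^ 2 / (Tt G (zs G u) + 2 * Complex.I)) atTop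
       (𝓝 (3 / 4 * (u - 2 * Complex.I) * (Complex.I + Complex.I) ^ 2 / (Complex.I + 2 * Complex.I))) :=
      (((hT.add_const _).pow 2).const_mul _).div (hT.add_const _) (by ring_nf; simp)
    rw [show 3 / 4 * (u - 2 * Complex.I) * (Complex.I + Complex.I) ^ 2 / (Complex.I + 2 * Complex.I) = (2 + u * Complex.I) by
      rw [div_eq_iff (by ring_nf; simp)]; ring_nf; simp] at h3
    refine h3.congr' ?_
    filter_upwards [ev, cub] with G hG hc
    have hG0 : 0 < G := by linarith
    have hg : (G:ℂ) ≠ 0 := by exact_mod_cast hG0.ne'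
    have hne : Tt G (zs G u) + 2 * Complex.I ≠ 0 := fun h => by
      have hi := abs_lt.1 (Tt_im hG0 (zs_im hG u))
      have := congrArg Complex.im h
      simp at this; linarith [hi.1]
    rw [div_pow, ← Complex.ofReal_pow, Real.sq_sqrt (by positivity), rh]
    set T := Tt G (zs G u)
    rw [eq_div_iff (by positivity)] at hc
    have : (1 + T ^ 2) = (T - Complex.I) * (T + Complex.I) := by linear_combination Complex.I_sq
    rw [this, div_eq_div_iff hne (by exact_mod_cast (mul_pos two_pos hG0).ne')]
    push_cast
    linear_combination (-(1:ℂ)/4) * G * (T + Complex.I) ^ 2 * hc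
  have hR : Tendsto (fun G : ℝ => rh G (zs G u) / (√(2 * G) : ℝ)) atTop (𝓝 ((2 + u * Complex.I : ℂ) ^ (2⁻¹:ℂ))) := by
    refine ((continuousAt_id.cpow continuousAt_const hs).tendsto.comp hR2).congr' ?_
    filter_upwards [ev] with G hG
    have hG0 : 0 < G := by linarith
    refine Complex.sq_cpow_two_inv ?_
    rw [Complex.div_ofReal_re]
    refine div_pos ?_ (Real.sqrt_pos.2 (by linarith))
    have hi := abs_lt.1 (Tt_im hG0 (zs_im hG u))
    have : (rh G (zs G u)).re = G ^ 2 * (1 + (Tt G (zs G u)).re ^ 2 - (Tt G (zs G u)).im ^ 2) / 2 := by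
      rw [rh, ← Complex.ofReal_pow, mul_div_assoc, Complex.re_ofReal_mul]; simp [pow_two]; ring
    rw [this]
    have : 0 < 1 + (Tt G (zs G u)).re ^ 2 - (Tt G (zs G u)).im ^ 2 := by nlinarith [sq_nonneg (Tt G (zs G u)).re]
    positivity
  have h0 := Complex.slitPlane_ne_zero hs
  have := (hR.inv₀ (by rw [Complex.cpow_def_of_ne_zero h0]; exact Complex.exp_ne_zero _)).pow 3
  rw [show (2 + u * Complex.I : ℂ) ^ (-(3/2) : ℂ) = ((2 + u * Complex.I : ℂ) ^ (2⁻¹:ℂ))⁻¹ ^ 3 by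
    rw [Complex.cpow_neg, inv_pow, ← Complex.cpow_mul_nat]; congr 2; norm_num]
  refine this.congr fun G => ?_
  rw [inv_div, div_eq_mul_inv, mul_pow]; push_cast; rfl

lemma P7 : ∀ᶠ G : ℝ in atTop, deriv (fun v => Pf G v 0) 0 ≠ 0 := by
  have ev : ∀ᶠ G : ℝ in atTop, 10 ^ 20 ≤ G := eventually_ge_atTop _
  have hl : Tendsto (fun G : ℝ => ∫ u : ℝ, (√(2 * G) ^ 3 : ℝ) * (rh G (zs G u))⁻¹ ^ 3 * Complex.exp (Complex.I * u)) atTop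
      (𝓝 (∫ u : ℝ, (2 + u * Complex.I : ℂ) ^ (-(3/2) : ℂ) * Complex.exp (Complex.I * u))) := by
    refine tendsto_integral_filter_of_dominated_convergence (fun u => 80 ^ (3/2:ℝ) * (1 + |u|) ^ (-(3/2):ℝ)) ?_ ?_ (japi (by norm_num)) (ae_of_all _ fun u => (R_lim u).mul_const _)
    · filter_upwards [ev] with G hG
      exact ((((rz_cont hG).inv₀ (rz_ne hG)).pow 3).const_mul _ |>.mul (by fun_prop : Continuous fun u : ℝ => Complex.exp (Complex.I * u))).aestronglyMeasurable
    · filter_upwards [ev] with G hG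
      exact ae_of_all _ fun u => by rw [norm_mul, en1, mul_one]; exact r3_le hG u
  set L := ∫ u : ℝ, (2 + u * Complex.I : ℂ) ^ (-(3/2) : ℂ) * Complex.exp (Complex.I * u)
  have hL : 0 < ‖L‖ := norm_pos_iff.2 four_ne
  have hcq : 0 < ‖cq‖ := norm_pos_iff.2 cq_ne
  filter_upwards [hl.norm.eventually_const_lt (half_lt_self hL), eventually_ge_atTop (10 ^ 40), eventually_gt_atTop (10 ^ 60 / (‖cq‖ * ‖L‖))] with G h1 h2 h3
  have hG : 10 ^ 20 ≤ G := by linarith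
  have hG0 : 0 < G := by linarith
  apply Pf_dne h2
  have h4 := AA_est hG
  rw [Jeq hG] at h4
  simp only [mul_assoc] at h1
  rw [integral_const_mul, norm_mul, Complex.norm_real, Real.norm_of_nonneg (by positivity)] at h1
  set I := ∫ u : ℝ, (rh G (zs G u))⁻¹ ^ 3 * Complex.exp (Complex.I * u)
  set k := √(2 * G) ^ 3
  have h5 := norm_sub_norm_le (3/2 * (cq * (Complex.I / 3 * I))) (AA G + 3/2 * (cq * (Complex.I / 3 * I)))
  rw [← norm_neg (_ - _)] at h5
  simp only [neg_sub, add_sub_cancel_right, norm_mul, norm_div, Complex.norm_I] at h5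
  norm_num at h5
  have hs : 0 < √G := Real.sqrt_pos.2 hG0
  have hk : k ≤ 3 * √G ^ 3 := by
    have : √2 ≤ 1.42 := by rw [Real.sqrt_le_left (by norm_num)]; norm_num
    simp only [k]; rw [Real.sqrt_mul (by norm_num), mul_pow]; gcongr
    calc _ ≤ (1.42:ℝ) ^ 3 := by gcongr
      _ ≤ _ := by norm_num
  have h6 : 3 / 2 * (‖cq‖ * (1 / 3 * ‖I‖)) * √G ^ 3 > ‖cq‖ * ‖L‖ / 12 := by
    have : ‖L‖ / 2 < 3 * √G ^ 3 * ‖I‖ := h1.trans_le (by gcongr)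
    nlinarith
  rw [div_lt_iff₀ (by positivity)] at h3
  have e5 : √G ^ 5 = G * √G ^ 3 := by
    calc √G ^ 5 = √G ^ 2 * √G ^ 3 := by ring
      _ = _ := by rw [Real.sq_sqrt hG0.le]
  rw [e5] at h4
  have h7 : 10 ^ 14 / (G * √G ^ 3) + 90 * (10 ^ 32 / G) * TT0 G ≤ 10 ^ 57 / (G * √G ^ 3) := by
    rw [TT0, show (90:ℝ) * (10 ^ 32 / G) * (2 * 10 ^ 22 / √G ^ 3) = 180 * 10 ^ 54 / (G * √G ^ 3) by field_simp; norm_num, ← add_div]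
    gcongr; norm_num
  have h8 : 10 ^ 57 / (G * √G ^ 3) < 3 / 2 * (‖cq‖ * (1 / 3 * ‖I‖)) := by
    rw [div_lt_iff₀ (by positivity)]
    nlinarith
  linarith
end

open Real Filter MeasureTheory Set Topology

noncomputable def ff (G t r : ℝ) : ℝ := G ^ 2 / r ^ 3 - r * (r ^ 2 + qq t) ^ (-(3 : ℝ) / 2)
def Sol (F : ℝ → ℝ → ℝ) (x y : ℝ → ℝ) (s : Set ℝ) : Prop := ∀ t ∈ s, HasDerivAt x (y t) t ∧ HasDerivAt y (F t (x t)) t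

section
variable {G : ℝ}

lemma FF_re {r : ℝ} (hr : 0 < r) (t : ℝ) : FF G (qq t) r = ff G t r := by
  have hq := qq_nonneg t
  have e : (r ^ 2 + qq t : ℝ) = r ^ 2 * (1 + qq t / r ^ 2) := by field_simp
  have e2 : (r ^ 2) ^ (-(3 : ℝ) / 2) = 1 / r ^ 3 := by
    rw [← Real.rpow_natCast r 2, ← Real.rpow_mul hr.le, one_div, ← Real.rpow_natCast r 3, ← Real.rpow_neg hr.le]; norm_num
  unfold FF ff pw
  rw [e, Real.mul_rpow (by positivity) (by positivity), e2, show (1 + (qq t:ℂ) / (r:ℂ) ^ 2) = ((1 + qq t / r ^ 2 : ℝ) : ℂ) by push_cast; ring,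
    ← Complex.ofReal_cpow (by positivity)]
  have : (r:ℂ) ≠ 0 := by exact_mod_cast hr.ne'
  push_cast; rw [neg_div]; field_simp

lemma zero_Dom (hG : 10 ^ 20 ≤ G) : (0:ℂ) ∈ Dom G := by
  constructor
  · simp
  · have : (10 ^ 20:ℝ) ^ 3 ≤ G ^ 3 := by gcongr
    simp; linarith

/-- real Kepler parabola -/
lemma rh_real (hG : 0 < G) (s : ℝ) : ∃ T : ℝ, T ^ 3 + 3 * T = 6 * s / G ^ 3 ∧ rh G s = (G ^ 2 * (1 + T ^ 2) / 2 : ℝ) := by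
  have hu : |(s:ℂ).im| < G ^ 3 / 3 := by simp; positivity
  have hc : starRingEnd ℂ (Tt G s) = Tt G s := by rw [← Tt_conj hG hu, Complex.conj_ofReal]
  obtain ⟨T, hT⟩ := Complex.conj_eq_iff_real.1 hc
  have := Tt_cub hG hu
  refine ⟨T, ?_, by unfold rh; rw [hT]; push_cast; ring⟩
  rw [hT] at this
  have h2 : ((T ^ 3 + 3 * T : ℝ):ℂ) = ((2 * (3 * s / G ^ 3) : ℝ) : ℂ) := by push_cast; exact this
  rw [Complex.ofReal_inj.1 h2]; ring

lemma x_sol (hG : 10 ^ 20 ≤ G) (τ : ℝ) : ∃ x y : ℝ → ℝ, Sol (fun s => ff G (τ + s)) x y (Ici 0) ∧ y 0 = 0 ∧ x 0 = (Ph G 0 τ).re ∧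
    ∀ s ≥ 0, 4 ≤ x s ∧ ∃ T : ℝ, T ^ 3 + 3 * T = 6 * s / G ^ 3 ∧ |x s - G ^ 2 * (1 + T ^ 2) / 2| ≤ G ^ 2 * (1 + T ^ 2) / 4 := by
  have hG0 : 0 < G := by linarith
  have h0 := zero_Dom hG
  obtain ⟨R, R', r1, r2, r3, r4, -⟩ := R_ode hG h0 τ
  have e0 : e1 G 0 = 0 := by have := e1_neg (u := 0) hG0 (by simp; positivity); simp only [neg_zero] at this; exact self_eq_neg.1 this
  have hx : ∀ s ≥ 0, (R s).im = 0 ∧ 4 ≤ (R s).re ∧ ∃ T : ℝ, T ^ 3 + 3 * T = 6 * s / G ^ 3 ∧ |(R s).re - G ^ 2 * (1 + T ^ 2) / 2| ≤ G ^ 2 * (1 + T ^ 2) / 4 := by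
    intro s hs
    obtain ⟨T, hT, hr⟩ := rh_real hG0 s
    have hc := (xi_good hG).conj 0 h0 s hs τ
    rw [map_zero] at hc
    obtain ⟨a, ha⟩ := Complex.conj_eq_iff_real.1 hc.symm
    have b := (xi_good hG).bd 0 h0 s hs τ
    obtain ⟨c1, c2, -⟩ := NN_all hG h0 hs (k0_le hG).2.1 τ b b
    have := r1 s hs
    rw [zero_add] at this c1 c2
    rw [ha, hr, Complex.norm_real, Complex.norm_real, Real.norm_eq_abs, Real.norm_of_nonneg (by positivity)] at c1
    rw [hr, Complex.norm_real, Real.norm_of_nonneg (by positivity)] at c2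
    rw [ha, hr, ← Complex.ofReal_add] at this
    have := abs_le.1 c1
    rw [‹R s = _›, Complex.ofReal_re, Complex.ofReal_im]
    exact ⟨rfl, by linarith, T, hT, by rw [add_sub_cancel_left]; linarith⟩
  refine ⟨fun s => (R s).re, fun s => (R' s).re, fun s hs => ⟨?_, ?_⟩, by simp [r4, e0], ?_, fun s hs => (hx s hs).2⟩
  · exact Complex.reCLM.hasFDerivAt.comp_hasDerivAt s (r2 s)
  · obtain ⟨h1, h2, -⟩ := hx s hs
    have := Complex.reCLM.hasFDerivAt.comp_hasDerivAt s (r3 s hs)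
    rw [show R s = ((R s).re : ℂ) from Complex.ext rfl (by simpa using h1), FF_re (by linarith)] at this
    simpa using! this
  · simp [r1 0 le_rfl, Ph]

lemma Rs_deriv (hG : 10 ^ 30 ≤ G) (h7 : deriv (fun v => Pf G v 0) 0 ≠ 0) : ∃ c : ℝ, c ≠ 0 ∧ HasDerivAt (fun t : ℝ => (Ph G 0 t).re) c 0 := by
  have hG' : 10 ^ 20 ≤ G := by linarith
  have hG0 : 0 < G := by linarith
  have h0 := zero_Dom hG'
  have e0 : e1 G 0 = 0 := by have := e1_neg (u := 0) hG0 (by simp; positivity); simp only [neg_zero] at this; exact self_eq_neg.1 this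
  have hp := ph_ne (by linarith) h0
  have hv : deriv (fun w => Ph G w 0) 0 ≠ 0 := by
    intro h; apply h7
    rw [(Pf_hd hG' h0 0).deriv, e0]; simp [h]
  have hF : FF G (qq 0) (Ph G 0 0) ≠ 0 := by
    intro h
    have b := (xi_good hG').bd 0 h0 0 le_rfl 0
    rw [add_zero] at b
    have := bX hG' h0 0 b (xph_le hG' h0 0).2.2
    rw [show rh G 0 + xi G 0 0 0 = Ph G 0 0 from rfl, h, zero_sub, norm_neg] at this
    have h1 : 10 ^ 29 / (√G ^ 5 * √(y0 G 0)) < 1 := by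
      rw [div_lt_one (by have := Dom_y0 h0; positivity)]
      have h2 : 1 ≤ √(y0 G 0) := Real.one_le_sqrt.2 (Dom_y0 h0).le
      have h3 : 10 ^ 15 ≤ √G := Real.le_sqrt_of_sq_le (by linarith)
      have : (10 ^ 15:ℝ) ^ 5 ≤ √G ^ 5 := by gcongr
      nlinarith
    have := norm_pos_iff.2 hp
    nlinarith
  have d1 := Ph_diag hG' h0 0
  have d2 := (diag0 Dom_open (Ph_cont hG') (Ph_hol hG') h0 (t := 0) (w₁ := fun h : ℝ => 0 + (h:ℂ)) (w₂ := fun _ => 0) (d₁ := 1) (d₂ := 0) (s := univ)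
    (by simp) rfl (((hasDerivAt_id (0:ℝ)).ofReal_comp.const_add 0).hasDerivWithinAt) (hasDerivWithinAt_const _ _ _) (mem_univ _)).hasDerivAt univ_mem
  have d3 := (d1.sub d2).congr_deriv (g' := -(deriv (fun w => Ph G w 0) 0 * FF G (qq 0) (Ph G 0 0) / ph G 0)) (by rw [e0]; ring)
  have d4 : HasDerivAt (fun t : ℝ => Ph G 0 t) (-(deriv (fun w => Ph G w 0) 0 * FF G (qq 0) (Ph G 0 0) / ph G 0)) 0 :=
    d3.congr_of_eventuallyEq (.of_forall fun s => by simp)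
  have dre := Complex.reCLM.hasFDerivAt.comp_hasDerivAt (0:ℝ) d4
  have dim := Complex.imCLM.hasFDerivAt.comp_hasDerivAt (0:ℝ) d4
  refine ⟨_, fun hz => ?_, dre⟩
  have hi : ∀ t, (Ph G 0 t).im = 0 := fun t => by
    obtain ⟨T, -, hr⟩ := rh_real hG0 0
    have hc := (xi_good hG').conj 0 h0 0 le_rfl t
    rw [map_zero] at hc
    have := Complex.conj_eq_iff_im.1 hc.symm
    unfold Ph; rw [Complex.add_im, this, ← Complex.ofReal_zero, hr, Complex.ofReal_im, add_zero]
  have hz2 := dim.unique ((hasDerivAt_const (0:ℝ) (0:ℝ)).congr_of_eventuallyEq (.of_forall fun t => hi t))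
  have : -(deriv (fun w => Ph G w 0) 0 * FF G (qq 0) (Ph G 0 0) / ph G 0) = 0 := Complex.ext hz hz2
  simp [hv, hF, hp] at this
end

open Real Filter MeasureTheory Set Topology

noncomputable def fr (G t r : ℝ) : ℝ := -3 * G ^ 2 / r ^ 4 - 1 / √(r ^ 2 + qq t) ^ 3 + 3 * r ^ 2 / √(r ^ 2 + qq t) ^ 5

section
variable {G t r : ℝ}

lemma ff_eq (hr : 0 < r) : ff G t r = G ^ 2 / r ^ 3 - r / √(r ^ 2 + qq t) ^ 3 := by
  have h : 0 < r ^ 2 + qq t := by have := qq_nonneg t; positivity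
  unfold ff
  rw [Real.sqrt_eq_rpow, ← Real.rpow_natCast (_ ^ (1 / 2 : ℝ)), ← Real.rpow_mul h.le, div_eq_mul_inv r, ← Real.rpow_neg h.le]; norm_num

lemma ss (hr : 0 < r) : 0 < √(r ^ 2 + qq t) ∧ √(r ^ 2 + qq t) ^ 2 = r ^ 2 + qq t ∧ r ≤ √(r ^ 2 + qq t) := by
  have := qq_nonneg t
  exact ⟨by positivity, Real.sq_sqrt (by positivity), Real.le_sqrt_of_sq_le (by linarith)⟩

lemma ff_deriv (hr : 0 < r) : HasDerivAt (ff G t) (fr G t r) r := by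
  obtain ⟨h1, h2, h3⟩ := ss (t := t) hr
  have e : ff G t =ᶠ[𝓝 r] fun r => G ^ 2 / r ^ 3 - r / √(r ^ 2 + qq t) ^ 3 := by
    filter_upwards [lt_mem_nhds hr] with x hx using ff_eq hx
  have d1 := ((((hasDerivAt_id r).pow 2).add_const (qq t)).sqrt (by simpa using (h2 ▸ pow_pos h1 2 : 0 < r ^ 2 + qq t).ne')).pow 3
  have d2 := ((hasDerivAt_const r (G ^ 2)).div ((hasDerivAt_id r).pow 3) (by simpa using hr.ne')).sub ((hasDerivAt_id r).div d1 (by simpa using (pow_pos h1 3).ne'))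
  refine (d2.congr_of_eventuallyEq e).congr_deriv ?_
  unfold fr
  simp only [id, Pi.pow_apply]
  field_simp
  ring

lemma ff_cont (hr : 0 < r) : ContinuousAt (fun p : ℝ × ℝ => ff G p.1 p.2) (t, r) ∧ ContinuousAt (fun p : ℝ × ℝ => fr G p.1 p.2) (t, r) := by
  have h := ss (t := t) hr
  have hq := qq_cont
  have h5 := (pow_pos h.1 5).ne'
  have h3 := (pow_pos h.1 3).ne'
  have h4 : r ^ 2 + qq t ≠ 0 := by have := qq_nonneg t; positivity
  unfold ff fr
  constructor
  · refine ContinuousAt.sub (ContinuousAt.div (by fun_prop) (by fun_prop) (by simp; positivity)) (ContinuousAt.mul (by fun_prop) (ContinuousAt.rpow_const (by fun_prop) (Or.inl h4)))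
  · refine ContinuousAt.add (ContinuousAt.sub (ContinuousAt.div (by fun_prop) (by fun_prop) (by simp; positivity)) (ContinuousAt.div (by fun_prop) (by fun_prop) h3)) (ContinuousAt.div (by fun_prop) (by fun_prop) h5)

lemma ff_le (hr : 1 ≤ r) : |ff G t r| ≤ G ^ 2 + 1 ∧ |fr G t r| ≤ 3 * G ^ 2 + 4 := by
  obtain ⟨h1, h2, h3⟩ := ss (t := t) (by linarith : 0 < r)
  rw [ff_eq (by linarith), fr]
  set s := √(r ^ 2 + qq t)
  have hs : 1 ≤ s := hr.trans h3
  have i3 : 1 / s ^ 3 ≤ 1 := div_le_one_of_le₀ (one_le_pow₀ hs) (by positivity)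
  have a1 : G ^ 2 / r ^ 3 ≤ G ^ 2 := div_le_self (by positivity) (one_le_pow₀ hr)
  have a2 : r / s ^ 3 ≤ 1 := div_le_one_of_le₀ (h3.trans (le_self_pow₀ hs (by norm_num))) (by positivity)
  have a3 : 3 * G ^ 2 / r ^ 4 ≤ 3 * G ^ 2 := div_le_self (by positivity) (one_le_pow₀ hr)
  have a4 : 3 * r ^ 2 / s ^ 5 ≤ 3 := by
    rw [div_le_iff₀ (by positivity)]
    have : r ^ 2 ≤ s ^ 5 := (pow_le_pow_left₀ (by linarith) h3 2).trans (pow_le_pow_right₀ hs (by norm_num))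
    linarith
  have p1 : 0 ≤ G ^ 2 / r ^ 3 := by positivity
  have p2 : 0 ≤ r / s ^ 3 := by positivity
  have p3 : 0 ≤ 3 * G ^ 2 / r ^ 4 := by positivity
  have p4 : 0 ≤ 3 * r ^ 2 / s ^ 5 := by positivity
  have p5 : 0 ≤ 1 / s ^ 3 := by positivity
  rw [neg_mul, neg_div]
  constructor <;> rw [abs_le] <;> constructor <;> linarith

lemma ff_ge (hr : 0 < r) : (G ^ 2 - r) / r ^ 3 ≤ ff G t r := by
  obtain ⟨h1, h2, h3⟩ := ss (t := t) hr
  rw [ff_eq hr, sub_div]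
  gcongr

lemma ff_far (hG : 1 ≤ G) (hr : 10 * G ^ 2 ≤ r) : ff G t r < 0 ∧ 0 ≤ fr G t r := by
  have hG2 : 1 ≤ G ^ 2 := one_le_pow₀ hG
  have hr0 : 0 < r := by linarith
  obtain ⟨h1, h2, h3⟩ := ss (t := t) hr0
  rw [ff_eq hr0, fr]
  have q1 := qq_le_one t
  have q0 := qq_nonneg t
  set s := √(r ^ 2 + qq t)
  have hs : s ≤ 11 / 10 * r := abs_le_of_sq_le_sq' (by nlinarith) (by linarith) |>.2
  have s3 : s ^ 3 ≤ (11 / 10 * r) ^ 3 := by gcongr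
  have s5 : s ^ 5 ≤ (11 / 10 * r) ^ 5 := by gcongr
  constructor
  · have : G ^ 2 / r ^ 3 < 1 / (11 / 10) ^ 3 / r ^ 2 := by
      rw [div_lt_div_iff₀ (by positivity) (by positivity)]
      have : r ^ 2 * G ^ 2 ≤ r ^ 2 * (r / 10) := by gcongr; linarith
      nlinarith [pow_pos hr0 3]
    have h2 : 1 / (11 / 10) ^ 3 / r ^ 2 ≤ r / s ^ 3 := by
      calc _ = r / (11 / 10 * r) ^ 3 := by field_simp
        _ ≤ _ := by gcongr
    linarith
  · have e : -3 * G ^ 2 / r ^ 4 - 1 / s ^ 3 + 3 * r ^ 2 / s ^ 5 = (3 * r ^ 2 - s ^ 2) / s ^ 5 - 3 * G ^ 2 / r ^ 4 := by field_simp; ring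
    have a : 3 * G ^ 2 / r ^ 4 ≤ 19 / 10 * r ^ 2 / (11 / 10 * r) ^ 5 := by
      rw [div_le_div_iff₀ (by positivity) (by positivity)]
      have : r ^ 5 * G ^ 2 ≤ r ^ 5 * (r / 10) := by gcongr; linarith
      nlinarith [pow_pos hr0 6]
    have b : 19 / 10 * r ^ 2 / (11 / 10 * r) ^ 5 ≤ (3 * r ^ 2 - s ^ 2) / s ^ 5 := by gcongr ?_ / ?_ <;> nlinarith
    rw [e]; linarith
end

open Real Filter MeasureTheory Set Topology

section
variable {G : ℝ}

lemma mvt {f f' : ℝ → ℝ} {a b : ℝ} (hab : a < b) (h : ∀ t ∈ Icc a b, HasDerivAt f (f' t) t) : ∃ c ∈ Ioo a b, f b - f a = f' c * (b - a) := by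
  obtain ⟨c, hc, e⟩ := exists_hasDerivAt_eq_slope f f' hab (fun t ht => (h t ht).continuousAt.continuousWithinAt) (fun t ht => h t (Ioo_subset_Icc_self ht))
  exact ⟨c, hc, by rw [e]; field_simp [(sub_pos.2 hab).ne']⟩

lemma cub_mono {a b : ℝ} (h : a ^ 3 + 3 * a ≤ b ^ 3 + 3 * b) : a ≤ b := by
  by_contra! hc
  nlinarith [sq_nonneg (a + b), sq_nonneg (a - b), mul_pos (sub_pos.2 hc) (by positivity : (0:ℝ) < 3 + a ^ 2 + b ^ 2 + (a + b) ^ 2)]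

lemma y_pos (hG : 10 ^ 30 ≤ G) {x y : ℝ → ℝ} (hs : Sol (ff G) x y (Ici 0)) (hy : y 0 = 0) (hR : |x 0 - G ^ 2 / 2| ≤ 10 ^ 26 / G ^ 2)
    (hx : ∀ s ≥ 0, 4 ≤ x s ∧ ∃ T : ℝ, T ^ 3 + 3 * T = 6 * s / G ^ 3 ∧ |x s - G ^ 2 * (1 + T ^ 2) / 2| ≤ G ^ 2 * (1 + T ^ 2) / 4) :
    ∀ t > 0, 0 < y t := by
  intro t ht
  by_contra! hc
  have hG0 : 0 < G := by linarith
  have G2 : (10 ^ 30) ^ 2 ≤ G ^ 2 := by gcongr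
  have small : 10 ^ 26 / G ^ 2 ≤ 1 := by rw [div_le_one (by positivity)]; linarith
  have hR' := abs_le.1 (hR.trans small)
  have cy : ∀ {a b}, 0 ≤ a → ContinuousOn y (Icc a b) := fun ha t ht => (hs t (ha.trans ht.1)).2.continuousAt.continuousWithinAt
  have hpos : ∀ {u}, 0 < u → (∀ s ∈ Icc 0 u, x s < G ^ 2) → 0 < y u := fun {u} hu h => by
    obtain ⟨c, hc, e⟩ := mvt hu (fun t ht => (hs t ht.1).2)
    have h1 := ff_ge (G := G) (t := c) (r := x c) (by linarith [(hx c hc.1.le).1])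
    have h2 : 0 < (G ^ 2 - x c) / x c ^ 3 := by
      have := h c ⟨hc.1.le, hc.2.le⟩
      have := (hx c hc.1.le).1
      exact div_pos (by linarith) (by positivity)
    have : 0 < ff G c (x c) * (u - 0) := mul_pos (by linarith) (by linarith)
    linarith
  obtain ⟨d, hd, hd2⟩ : ∃ d > 0, ∀ u ∈ Ioc 0 d, 0 < y u := by
    have : ∀ᶠ u in 𝓝 0, x u < G ^ 2 := (hs 0 (mem_Ici.2 le_rfl)).1.continuousAt.eventually_lt_const (by linarith)
    obtain ⟨d, hd, h⟩ := Metric.eventually_nhds_iff.1 this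
    exact ⟨d / 2, by linarith, fun u hu => hpos hu.1 fun s hs => h (by rw [Real.dist_0_eq_abs, abs_of_nonneg hs.1]; linarith [hs.2, hu.2])⟩
  have hdt : d < t := by by_contra! h; linarith [hd2 t ⟨ht, h⟩]
  have iv : ∀ u, d ≤ u → y u ≤ 0 → ∃ z ∈ Icc d u, y z = 0 := fun u hu h =>
    intermediate_value_Icc' hu (cy hd.le) ⟨h, (hd2 d ⟨hd, le_rfl⟩).le⟩
  have hK : IsCompact (Icc d t ∩ y ⁻¹' {0}) :=
    isCompact_Icc.of_isClosed_subset ((cy hd.le).preimage_isClosed_of_isClosed isClosed_Icc isClosed_singleton) inter_subset_left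
  obtain ⟨z, hz, hz0⟩ := iv t hdt.le hc
  obtain ⟨t1, ⟨⟨h1d, h1t⟩, h10⟩, hl⟩ := hK.exists_isLeast ⟨z, hz, hz0⟩
  have h1 : 0 < t1 := by linarith
  have h10 : y t1 = 0 := h10
  have yp : ∀ u ∈ Ioo 0 t1, 0 < y u := fun u hu => by
    by_contra! h
    rcases le_total u d with h' | h'
    · linarith [hd2 u ⟨hu.1, h'⟩]
    · obtain ⟨z, hz, hz0⟩ := iv u h' h
      linarith [hl ⟨⟨hz.1, by linarith [hz.2, hu.2]⟩, hz0⟩, hz.2, hu.2]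
  have xm : ∀ u ∈ Icc 0 t1, x u ≤ x t1 := fun u hu => by
    rcases hu.2.eq_or_lt with h | h
    · rw [h]
    · obtain ⟨c, hc, e⟩ := mvt h (fun t ht => (hs t (hu.1.trans ht.1)).1)
      have := mul_pos (yp c ⟨by linarith [hc.1, hu.1], hc.2⟩) (sub_pos.2 h)
      linarith
  have x1 : G ^ 2 ≤ x t1 := by
    by_contra! h
    linarith [hpos h1 fun s hs => (xm s hs).trans_lt h]
  have hE : (G ^ 2 - 2 * x 0) / (2 * x 0 ^ 2) ≤ (G ^ 2 - 2 * x t1) / (2 * x t1 ^ 2) := by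
    obtain ⟨c, hc, e⟩ := mvt (f := fun t => y t ^ 2 / 2 + (G ^ 2 - 2 * x t) / (2 * x t ^ 2)) (f' := fun t => y t * (ff G t (x t) - (G ^ 2 - x t) / x t ^ 3)) h1 fun t ht => by
      have hp := (hx t ht.1).1
      have := (((hs t ht.1).2.pow 2).div_const 2).add ((((hs t ht.1).1.const_mul 2).const_sub (G ^ 2)).div (((hs t ht.1).1.pow 2).const_mul 2) (by simp; positivity))
      refine this.congr_deriv ?_
      simp only [Pi.pow_apply]; field_simp; ring
    have h3 := ff_ge (G := G) (t := c) (r := x c) (by linarith [(hx c hc.1.le).1])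
    have := mul_nonneg (mul_nonneg (yp c hc).le (sub_nonneg.2 h3)) (sub_pos.2 h1).le
    simp only [hy, h10] at e
    linarith
  have x2 : 30 * G ^ 2 ≤ x t1 := by
    by_contra! h
    have e1 : (G ^ 2 - 2 * x t1) / (2 * x t1 ^ 2) ≤ - (1 / (60 * G ^ 2)) := by
      have hp : 0 < x t1 := by linarith
      rw [div_le_iff₀ (by positivity), neg_mul, ← mul_div_right_comm, le_neg, neg_sub, div_le_iff₀ (by positivity)]
      nlinarith
    have e2 : - (1 / (60 * G ^ 2)) < (G ^ 2 - 2 * x 0) / (2 * x 0 ^ 2) := by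
      have hp : 1 / 3 * G ^ 2 ≤ x 0 := by linarith
      have : (1 / 3 * G ^ 2) * (1 / 3 * G ^ 2) ≤ x 0 ^ 2 := by rw [pow_two (x 0)]; exact mul_le_mul hp hp (by positivity) (by linarith)
      rw [lt_div_iff₀ (by nlinarith), neg_mul, ← mul_div_right_comm, neg_lt, neg_sub, lt_div_iff₀ (by positivity)]
      nlinarith
    linarith
  obtain ⟨-, T1, hT1, hb1⟩ := hx t1 h1.le
  have hT0 : 0 ≤ T1 := cub_mono (by rw [hT1]; norm_num; positivity)
  have far : ∀ s ≥ t1, 10 * G ^ 2 ≤ x s := fun s hs' => by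
    obtain ⟨-, T, hT, hb⟩ := hx s (h1.le.trans hs')
    have : T1 ≤ T := cub_mono (by rw [hT, hT1]; gcongr)
    have : G ^ 2 * (1 + T1 ^ 2) ≤ G ^ 2 * (1 + T ^ 2) := by gcongr
    linarith [abs_le.1 hb, abs_le.1 hb1]
  have yn : ∀ s > t1, y s ≤ 0 := fun s hs' => by
    obtain ⟨c, hc, e⟩ := mvt hs' (fun t ht => (hs t (h1.le.trans ht.1)).2)
    have : ff G c (x c) * (s - t1) < 0 := mul_neg_of_neg_of_pos ((ff_far (t := c) (by linarith : 1 ≤ G) (far c hc.1.le)).1) (sub_pos.2 hs')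
    linarith
  set s := G ^ 3 * (x t1 ^ 3 + 3 * x t1) / 6 + t1 + 1
  have hst : t1 < s := by
    have : 0 ≤ G ^ 3 * (x t1 ^ 3 + 3 * x t1) / 6 := by have := (hx t1 h1.le).1; positivity
    simp only [s]; linarith
  obtain ⟨-, T, hT, hb⟩ := hx s (h1.le.trans hst.le)
  have : x t1 ≤ T := cub_mono (by
    rw [hT, le_div_iff₀ (by positivity)]
    simp only [s]
    linarith)
  obtain ⟨c, hc, e⟩ := mvt hst (fun t ht => (hs t (h1.le.trans ht.1)).1)
  have := mul_nonpos_of_nonpos_of_nonneg (yn c hc.1) (sub_pos.2 hst).le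
  nlinarith [abs_le.1 hb, (hx t1 h1.le).1]
end

open Real Filter MeasureTheory Set Topology

def So (F : ℝ → ℝ → ℝ) (u : ℝ → ℝ × ℝ) (s : Set ℝ) : Prop := ∀ t ∈ s, HasDerivAt (fun t => (u t).1) (u t).2 t ∧ HasDerivAt (fun t => (u t).2) (F t (u t).1) t

structure Out (G c f : ℝ) (U : ℝ → ℝ → ℝ × ℝ) : Prop where
  G1 : 10 ≤ G
  hc : c ≠ 0
  hf : 0 < f
  sol : ∀ τ ≤ 0, So (ff G) (U τ) (Ici 0)
  four : ∀ τ ≤ 0, ∀ t ≥ 0, 4 ≤ (U τ t).1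
  far : ∃ S > 7, ∀ τ ≤ 0, ∀ t ≥ S, 10 * G ^ 2 + 1 ≤ (U τ t).1
  sub : ∀ τ ≤ 0, ∀ ε > 0, ∃ S, ∀ t ≥ S, (U τ t).1 ≤ ε * t
  y0 : (U 0 0).2 = 0
  yp : ∀ t > 0, 0 < (U 0 t).2
  f0 : ff G 0 (U 0 0).1 = f
  low : (U 0 0).1 < G ^ 2
  tx : Tendsto (fun τ => ((U τ 0).1 - (U 0 0).1) / τ) (𝓝[<] 0) (𝓝 c)
  ty : Tendsto (fun τ => (U τ 0).2 / τ) (𝓝[<] 0) (𝓝 (-f))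

section
variable {G : ℝ}

lemma outA (hG : 10 ^ 30 ≤ G) (h7 : deriv (fun v => Pf G v 0) 0 ≠ 0) : ∃ c f U, Out G c f U := by
  have hG0 : 0 < G := by linarith
  have G2 : (10 ^ 30) ^ 2 ≤ G ^ 2 := by gcongr
  obtain ⟨c, hc, hd⟩ := Rs_deriv hG h7
  choose x y hs hy hx0 hx using x_sol (G := G) (by linarith)
  have hR : |x 0 0 - G ^ 2 / 2| ≤ 10 ^ 26 / G ^ 2 := by
    obtain ⟨T, hT, hr⟩ := rh_real hG0 0
    have T0 : T = 0 := by
      have : T * (T ^ 2 + 3) = 0 := by simp at hT; linarith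
      rcases mul_eq_zero.1 this with h | h
      · exact h
      · nlinarith
    have h3 := (xph_le (by linarith) (zero_Dom (G := G) (by linarith)) 0).2.2
    rw [T0, Complex.ofReal_zero] at hr
    rw [hx0, Ph, Complex.add_re, hr]
    rw [show √G ^ 4 = (√G ^ 2) ^ 2 by ring, sq_sqrt hG0.le] at h3
    refine le_trans ?_ ((Complex.abs_re_le_norm _).trans h3)
    apply le_of_eq; congr 1; rw [Complex.ofReal_re]; ring
  have small : 10 ^ 26 / G ^ 2 ≤ 1 := by rw [div_le_one (by positivity)]; linarith
  have hR' := abs_le.1 (hR.trans small)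
  have hs0 : Sol (ff G) (x 0) (y 0) (Ici 0) := fun t ht => by simpa using hs 0 t ht
  have hf0 := ff_ge (G := G) (t := 0) (r := x 0 0) (by linarith)
  have hf1 : 0 < (G ^ 2 - x 0 0) / x 0 0 ^ 3 := div_pos (by linarith) (pow_pos (by linarith) 3)
  set B := G ^ 2 + 1
  have hB : ∀ τ s, s ≥ 0 → |ff G (τ + s) (x τ s)| ≤ B := fun τ s h => (ff_le (by linarith [(hx τ s h).1])).1
  have yb : ∀ τ s, 0 < s → |y τ s| ≤ B * s := fun τ s h => by
    obtain ⟨d, hd, e⟩ := mvt h (fun t ht => (hs τ t ht.1).2)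
    rw [hy, sub_zero, sub_zero] at e
    rw [e, abs_mul, abs_of_pos h]
    gcongr; exact hB τ d hd.1.le
  have xb : ∀ τ s, 0 < s → |x τ s - x τ 0| ≤ B * s * s := fun τ s h => by
    obtain ⟨d, hd, e⟩ := mvt h (fun t ht => (hs τ t ht.1).1)
    rw [e, sub_zero, abs_mul, abs_of_pos h]
    gcongr
    exact (yb τ d hd.1).trans (by gcongr; exact hd.2.le)
  have key : ∀ τ ≤ (0:ℝ), ∀ t, 0 ≤ t → 0 ≤ t - τ := fun τ h t ht => by linarith
  have tau : Tendsto (fun τ : ℝ => τ) (𝓝[<] 0) (𝓝 0) := tendsto_id.mono_left nhdsWithin_le_nhds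
  refine ⟨c, ff G 0 (x 0 0), fun τ t => (x τ (t - τ), y τ (t - τ)), by linarith, hc, by linarith, ?_, fun τ h t ht => (hx τ _ (key τ h t ht)).1, ?_, ?_, by simp [hy], by simpa using y_pos hG hs0 (hy 0) hR (hx 0), by simp, by simp; linarith, ?_, ?_⟩
  · intro τ h t ht
    obtain ⟨h1, h2⟩ := hs τ _ (key τ h t ht)
    exact ⟨h1.comp_sub_const t τ, by simpa using h2.comp_sub_const t τ⟩
  · refine ⟨G ^ 3 * 1000 + 7, by linarith [pow_pos hG0 3], fun τ h t ht => ?_⟩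
    have hG3 := pow_pos hG0 3
    obtain ⟨-, T, hT, hb⟩ := hx τ (t - τ) (by linarith)
    have : 10 ≤ T := cub_mono (by rw [hT, le_div_iff₀ hG3]; linarith)
    have := (abs_le.1 hb).1
    simp only
    nlinarith [mul_self_le_mul_self (by norm_num : (0:ℝ) ≤ 10) ‹10 ≤ T›]
  · intro τ h ε hε
    set k := 24 * G ^ 2 / ε with hk
    have hk0 : 0 < k := by positivity
    have hG3 : 1 ≤ G ^ 3 := one_le_pow₀ (by linarith)
    refine ⟨max (-τ) (2 * G ^ 2 * (1 + k ^ 2) / ε), fun t ht => ?_⟩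
    have ht1 := (le_max_left _ _).trans ht
    have ht2 := (le_max_right _ _).trans ht
    rw [div_le_iff₀ hε] at ht2
    obtain ⟨-, T, hT, hb⟩ := hx τ (t - τ) (by linarith)
    have hT0 : 0 ≤ T := cub_mono (by rw [hT]; norm_num; exact div_nonneg (by linarith) (by positivity))
    have h1 : T ^ 3 ≤ 12 * t := by
      have : 6 * (t - τ) / G ^ 3 ≤ 6 * (t - τ) := div_le_self (by linarith) hG3
      linarith
    have h2 : T ^ 2 ≤ k ^ 2 + T ^ 3 / k := by
      rcases le_total T k with h | h
      · have : 0 ≤ T ^ 3 / k := by positivity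
        have : T ^ 2 ≤ k ^ 2 := by gcongr
        linarith
      · have : T ^ 2 ≤ T ^ 3 / k := by rw [le_div_iff₀ hk0, pow_succ T 2]; gcongr
        nlinarith
    have h3 : T ^ 3 / k ≤ ε * t / (2 * G ^ 2) := by
      rw [div_le_div_iff₀ hk0 (by positivity), hk]; field_simp; linarith
    have h4 : G ^ 2 * T ^ 2 ≤ G ^ 2 * (k ^ 2 + ε * t / (2 * G ^ 2)) := by gcongr; linarith
    have h5 : G ^ 2 * (ε * t / (2 * G ^ 2)) = ε * t / 2 := by field_simp
    have : 0 ≤ G ^ 2 * T ^ 2 := by positivity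
    linarith [(abs_le.1 hb).2]
  · have h0 : Tendsto (fun τ => ((Ph G 0 τ).re - (Ph G 0 0).re) / τ) (𝓝[<] 0) (𝓝 c) := by
      refine ((hasDerivAt_iff_tendsto_slope.1 hd).mono_left (nhdsWithin_mono _ fun t (ht : t < 0) => ht.ne)).congr fun t => ?_
      simp [slope_def_field]
    have h1 : Tendsto (fun τ => (x τ (-τ) - x τ 0) / τ) (𝓝[<] 0) (𝓝 0) := by
      refine squeeze_zero_norm' ?_ (by simpa using tau.neg.const_mul B)
      filter_upwards [self_mem_nhdsWithin] with τ hτ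
      have hτ : τ < 0 := hτ
      rw [norm_div, Real.norm_eq_abs, Real.norm_eq_abs, abs_of_neg hτ, div_le_iff₀ (by linarith)]
      simpa using xb τ _ (neg_pos.2 hτ)
    simpa [hx0, ← add_div] using! h1.add h0
  · have hm : ∀ τ < 0, ∃ d ∈ Ioo 0 (-τ), y τ (-τ) = ff G (τ + d) (x τ d) * (-τ) := fun τ h => by
      simpa [hy] using mvt (by linarith : 0 < -τ) (fun t ht => (hs τ t ht.1).2)
    choose! d hd1 hd2 using hm
    have mem : ∀ᶠ τ : ℝ in 𝓝[<] 0, τ < 0 := self_mem_nhdsWithin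
    have td : Tendsto d (𝓝[<] 0) (𝓝 0) := squeeze_zero_norm' (a := fun τ => -τ) (mem.mono fun τ h => by
      rw [Real.norm_eq_abs, abs_of_pos (hd1 τ h).1]; exact (hd1 τ h).2.le) (by simpa using tau.neg)
    have t1 : Tendsto (fun τ => x τ (d τ) - x τ 0) (𝓝[<] 0) (𝓝 0) := squeeze_zero_norm' (mem.mono fun τ h => xb τ _ (hd1 τ h).1) (by simpa using (td.const_mul B).mul td)
    have t2 : Tendsto (fun τ => x τ 0) (𝓝[<] 0) (𝓝 (x 0 0)) := by
      simp only [hx0]; exact hd.continuousAt.tendsto.comp tau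
    have t3 : Tendsto (fun τ => (τ + d τ, x τ (d τ))) (𝓝[<] 0) (𝓝 (0, x 0 0)) := by
      refine Tendsto.prodMk_nhds (by simpa using tau.add td) (by simpa using t1.add t2)
    refine (((ff_cont (G := G) (by linarith)).1.tendsto.comp t3).neg.congr' (mem.mono fun τ h => ?_)).trans (by simp)
    simp only [Function.comp, zero_sub]
    rw [hd2 τ h]; field_simp [h.ne]
end

open Real Filter MeasureTheory Set Topology

noncomputable def gg (G c t r : ℝ) : ℝ := ff G t (max r c)
noncomputable def KK (G : ℝ) : ℝ := 3 * G ^ 2 + 4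
def sgm (z : ℝ × ℝ) : ℝ × ℝ := (z.1, -z.2)

section
variable {G c a b t s m : ℝ} {u v : ℝ → ℝ × ℝ} {A : Set ℝ}

lemma So.mono {F} {B : Set ℝ} (h : So F u A) (hB : B ⊆ A) : So F u B := fun t ht => h t (hB ht)

lemma So.tog (h : So (ff G) u A) (hc : ∀ t ∈ A, c ≤ (u t).1) : So (gg G c) u A := fun t ht => by
  rw [gg, max_eq_left (hc t ht)]; exact h t ht

lemma So.tof (h : So (gg G c) u A) (hc : ∀ t ∈ A, c ≤ (u t).1) : So (ff G) u A := fun t ht => by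
  have := h t ht
  rwa [gg, max_eq_left (hc t ht)] at this

lemma gg_lip (hc : 1 ≤ c) (x y : ℝ) : |gg G c t x - gg G c t y| ≤ KK G * |x - y| := by
  have h := (convex_Ici (1:ℝ)).norm_image_sub_le_of_norm_hasDerivWithin_le (f := ff G t) (f' := fr G t) (C := KK G) (fun r (hr : 1 ≤ r) => (ff_deriv (by linarith)).hasDerivWithinAt) (fun r hr => (ff_le hr).2) (mem_Ici.2 (hc.trans (le_max_right y c))) (mem_Ici.2 (hc.trans (le_max_right x c)))
  refine h.trans ?_
  gcongr
  · unfold KK; positivity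
  · exact abs_max_sub_max_le_abs x y c

lemma gg_cont (hc : 1 ≤ c) : Continuous fun p : ℝ × ℝ => gg G c p.1 p.2 := continuous_iff_continuousAt.2 fun p =>
  ContinuousAt.comp (g := fun p : ℝ × ℝ => ff G p.1 p.2) (f := fun p : ℝ × ℝ => (p.1, max p.2 c)) (ff_cont (by linarith [le_max_right p.2 c])).1 (by fun_prop)

lemma ff_per (N : ℤ) : ff G (2 * π * N - t) s = ff G t s := by
  have h : Function.Periodic qq (2 * π) := fun t => qq_per t
  rw [ff, ff, ← qq_neg, neg_sub, show t - 2 * π * N = t - N * (2 * π) by ring, h.sub_int_mul_eq]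

lemma So.refl {F} (N : ℤ) (h : So F u A) (hF : ∀ t r, F (2 * π * N - t) r = F t r) : So F (fun t => sgm (u (2 * π * N - t))) {t | 2 * π * N - t ∈ A} := fun t ht => by
  obtain ⟨h1, h2⟩ := h _ ht
  rw [hF] at h2
  exact ⟨h1.comp_const_sub (2 * π * N) t, (h2.comp_const_sub (2 * π * N) t).fun_neg.congr_deriv (neg_neg _)⟩

lemma sgm_norm (z w : ℝ × ℝ) : ‖sgm z - sgm w‖ = ‖z - w‖ := by
  simp only [sgm, Prod.norm_def, Prod.fst_sub, Prod.snd_sub, neg_sub_neg, norm_sub_rev w.2]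

lemma So.cont {F} (h : So F u A) : ContinuousOn u A := fun t ht =>
  ((h t ht).1.continuousAt.prodMk (h t ht).2.continuousAt).continuousWithinAt

lemma gron' (hc : 1 ≤ c) (hst : s ≤ t) (hu : So (gg G c) u (Icc s t)) (hv : So (gg G c) v (Icc s t)) : ‖u t - v t‖ ≤ exp (KK G * (t - s)) * ‖u s - v s‖ := by
  have h := norm_le_gronwallBound_of_norm_deriv_right_le (f := fun r => u r - v r) (f' := fun r => ((u r).2 - (v r).2, gg G c r (u r).1 - gg G c r (v r).1)) (a := s) (b := t) (K := KK G) (ε := 0) (hu.cont.sub hv.cont) (fun r hr => by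
    have hr := Ico_subset_Icc_self hr
    exact (((hu r hr).1.sub (hv r hr).1).prodMk ((hu r hr).2.sub (hv r hr).2)).hasDerivWithinAt) le_rfl (fun r hr => by
    have hK : 1 ≤ KK G := by unfold KK; nlinarith [sq_nonneg G]
    rw [add_zero, Prod.norm_def]
    refine max_le ((norm_snd_le (u r - v r)).trans (le_mul_of_one_le_left (norm_nonneg _) hK)) ((gg_lip hc _ _).trans ?_)
    gcongr
    exact norm_fst_le (u r - v r)) t (right_mem_Icc.2 hst)
  rwa [gronwallBound_ε0, mul_comm] at h

lemma gron (hc : 1 ≤ c) (hu : So (gg G c) u (uIcc s t)) (hv : So (gg G c) v (uIcc s t)) : ‖u t - v t‖ ≤ exp (KK G * |t - s|) * ‖u s - v s‖ := by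
  rcases le_total s t with h | h
  · rw [uIcc_of_le h] at hu hv
    rw [abs_of_nonneg (sub_nonneg.2 h)]; exact gron' hc h hu hv
  · rw [uIcc_of_ge h] at hu hv
    have hm : Icc (-s) (-t) ⊆ {r | 2 * π * (0:ℤ) - r ∈ Icc t s} := fun r hr => by simp; constructor <;> linarith [hr.1, hr.2]
    have hF : ∀ t r, gg G c (2 * π * (0:ℤ) - t) r = gg G c t r := fun t r => ff_per 0
    have := gron' hc (neg_le_neg h) ((hu.refl 0 hF).mono hm) ((hv.refl 0 hF).mono hm)
    simpa [sgm_norm, abs_of_nonpos (sub_nonpos.2 h), add_comm, ← sub_eq_add_neg] using this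

lemma fl0 (hc : 1 ≤ c) (t0 : ℝ) (Z : ℝ × ℝ) (T : ℝ) (hT : 0 < T) : ∃ u, So (gg G c) u (Ioo (t0 - T) (t0 + T)) ∧ u t0 = Z := by
  set B := G ^ 2 + 1
  set w := 2 * T * Z.2
  have nn : ∀ q : ℝ, 0 ≤ q → ∃ k : NNReal, (k:ℝ) = q := fun q h => ⟨⟨q, h⟩, rfl⟩
  obtain ⟨r, hr⟩ := nn (|w| + 2 * B * T ^ 2) (by positivity)
  obtain ⟨l, hl⟩ := nn (r / T) (by positivity)
  obtain ⟨k, hk⟩ := nn (max (1 / (2 * T)) (KK G * (2 * T))) (by positivity)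
  have hP : IsPicardLindelof (fun t (z : ℝ × ℝ) => (z.2 / (2 * T), gg G c t z.1 * (2 * T))) (tmin := t0 - T) (tmax := t0 + T) ⟨t0, by constructor <;> linarith⟩ (Z.1, w) r 0 l k := by
    refine ⟨fun t _ => LipschitzWith.lipschitzOnWith (LipschitzWith.of_dist_le_mul fun p q => ?_), fun z _ => ?_, fun t _ z hz => ?_, ?_⟩
    · rw [hk, Prod.dist_eq (x := (_, _))]
      refine max_le ?_ ?_
      · rw [Real.dist_eq, ← sub_div, abs_div, abs_of_pos (by positivity : 0 < 2 * T), div_eq_mul_one_div, mul_comm]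
        gcongr
        · exact le_max_left _ _
        · exact norm_snd_le (p - q)
      · rw [Real.dist_eq, ← sub_mul, abs_mul, abs_of_pos (by positivity : 0 < 2 * T)]
        calc _ ≤ KK G * |p.1 - q.1| * (2 * T) := by gcongr; exact gg_lip hc _ _
          _ = (KK G * (2 * T)) * |p.1 - q.1| := by ring
          _ ≤ _ := by
            gcongr
            · exact le_max_right _ _
            · exact norm_fst_le (p - q)
    · have : Continuous fun t => gg G c t z.1 := (gg_cont hc).comp (by fun_prop : Continuous fun t : ℝ => (t, z.1))
      fun_prop
    · have hz2 : |z.2 - w| ≤ r := by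
        have := (mem_closedBall_iff_norm.1 hz)
        exact (norm_snd_le (z - (Z.1, w))).trans this
      have hz3 : |z.2| ≤ |w| + r := by linarith [abs_sub_abs_le_abs_sub z.2 w]
      rw [hl, Prod.norm_def]
      refine max_le ?_ ?_
      · rw [norm_div, Real.norm_eq_abs, Real.norm_eq_abs, abs_of_pos (by positivity : 0 < 2 * T), div_le_div_iff₀ (by positivity) hT]
        have : 0 ≤ 2 * B * T ^ 2 := by positivity
        nlinarith
      · have := (ff_le (G := G) (t := t) (hc.trans (le_max_right z.1 c))).1
        rw [norm_mul, Real.norm_eq_abs, Real.norm_eq_abs, abs_of_pos (by positivity : 0 < 2 * T), le_div_iff₀ hT, hr]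
        have : |gg G c t z.1| * (2 * T) * T ≤ B * (2 * T) * T := by gcongr; exact this
        linarith [abs_nonneg w]
    · simp [hl]; rw [div_mul_cancel₀ _ hT.ne']
  obtain ⟨α, h0, hα⟩ := hP.exists_eq_forall_mem_Icc_hasDerivWithinAt₀
  refine ⟨fun t => ((α t).1, (α t).2 / (2 * T)), fun t ht => ?_, by simp at h0; simp [h0, w]; field_simp⟩
  have h := (hα t (Ioo_subset_Icc_self ht)).hasDerivAt (Icc_mem_nhds ht.1 ht.2)
  refine ⟨h.hasFDerivAt.fst.hasDerivAt.congr_deriv (by simp), (h.hasFDerivAt.snd.hasDerivAt.div_const (2 * T)).congr_deriv (by simp; field_simp)⟩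

lemma fl (hc : 1 ≤ c) (t0 : ℝ) (Z : ℝ × ℝ) : ∃ u, So (gg G c) u univ ∧ u t0 = Z := by
  choose! u hu h0 using fl0 (G := G) hc t0 Z
  have ag : ∀ T T' t, |t - t0| < T → T ≤ T' → u T t = u T' t := fun T T' t ht hT => by
    have hT0 : 0 < T := (abs_nonneg _).trans_lt ht
    have ht := abs_lt.1 ht
    have hs : uIcc t0 t ⊆ Ioo (t0 - T) (t0 + T) := ordConnected_Ioo.uIcc_subset (by constructor <;> linarith) (by constructor <;> linarith)
    have := gron hc ((hu T hT0).mono hs) ((hu T' (by linarith)).mono (hs.trans (Ioo_subset_Ioo (by linarith) (by linarith))))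
    rw [h0 T hT0, h0 T' (by linarith)] at this
    simpa [sub_eq_zero] using this
  refine ⟨fun t => u (|t - t0| + 1) t, fun t _ => ?_, h0 _ (by positivity)⟩
  set T := |t - t0| + 3
  have ev : (fun t => u (|t - t0| + 1) t) =ᶠ[𝓝 t] u T := by
    filter_upwards [Metric.ball_mem_nhds t one_pos] with r hr
    refine ag _ _ r (by linarith) ?_
    have := abs_sub_abs_le_abs_sub (r - t0) (t - t0)
    rw [sub_sub_sub_cancel_right] at this
    have hr : |r - t| < 1 := hr
    simp only [T]; linarith
  have h := hu T (by positivity) t (by have := abs_lt.1 (by simp only [T]; linarith : |t - t0| < T); constructor <;> linarith)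
  rw [← ev.eq_of_nhds] at h
  exact ⟨h.1.congr_of_eventuallyEq (ev.fun_comp Prod.fst), h.2.congr_of_eventuallyEq (ev.fun_comp Prod.snd)⟩
end

open Real Filter MeasureTheory Set Topology

section
variable {G a b t s p L M : ℝ} {u v : ℝ → ℝ × ℝ}

lemma gm (hG : 1 ≤ G) (x y : ℝ) : gg G (10 * G ^ 2) t x < 0 ∧ 0 ≤ (x - y) * (gg G (10 * G ^ 2) t x - gg G (10 * G ^ 2) t y) := by
  have h0 : 0 < 10 * G ^ 2 := by positivity
  refine ⟨(ff_far hG (le_max_right _ _)).1, ?_⟩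
  have mono : MonotoneOn (ff G t) (Ici (10 * G ^ 2)) := fun a (ha : 10 * G ^ 2 ≤ a) b hb hab => by
    rcases hab.eq_or_lt with h | h
    · rw [h]
    obtain ⟨c, hc, e⟩ := mvt h fun r hr => ff_deriv (G := G) (t := t) (by linarith [hr.1] : 0 < r)
    have := mul_nonneg (ff_far (t := t) hG (ha.trans hc.1.le)).2 (sub_pos.2 h).le
    linarith
  have key : ∀ x y : ℝ, x ≤ y → gg G (10 * G ^ 2) t x ≤ gg G (10 * G ^ 2) t y := fun x y h =>
    mono (mem_Ici.2 (le_max_right _ _)) (mem_Ici.2 (le_max_right _ _)) (max_le_max_right _ h)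
  rcases le_total x y with h | h
  · exact mul_nonneg_of_nonpos_of_nonpos (by linarith) (by linarith [key x y h])
  · exact mul_nonneg (by linarith) (by linarith [key y x h])

lemma cv (hG : 1 ≤ G) (hu : So (gg G (10 * G ^ 2)) u (Icc a b)) (hv : So (gg G (10 * G ^ 2)) v (Icc a b)) : ConvexOn ℝ (Icc a b) fun t => |(u t).1 - (v t).1| := by
  have hi : ∀ ι > 0, ConvexOn ℝ (Icc a b) fun t => √(((u t).1 - (v t).1) ^ 2 + ι ^ 2) := fun ι hι => by
    have d1 : ∀ t ∈ Icc a b, HasDerivAt (fun t => √(((u t).1 - (v t).1) ^ 2 + ι ^ 2)) (((u t).1 - (v t).1) * ((u t).2 - (v t).2) / √(((u t).1 - (v t).1) ^ 2 + ι ^ 2)) t := fun t ht =>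
      (((((hu t ht).1.fun_sub (hv t ht).1).fun_pow 2).add_const (ι ^ 2)).sqrt (by positivity)).congr_deriv (by simp; ring)
    have d2 := fun t ht => (((hu t ht).1.fun_sub (hv t ht).1).fun_mul ((hu t ht).2.fun_sub (hv t ht).2)).fun_div (d1 t ht) (by positivity)
    refine convexOn_of_hasDerivWithinAt2_nonneg (convex_Icc a b) (fun t ht => (d1 t ht).continuousAt.continuousWithinAt) (fun t ht => (d1 t (interior_subset ht)).hasDerivWithinAt) (fun t ht => (d2 t (interior_subset ht)).hasDerivWithinAt) fun t ht => ?_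
    have h := (gm (t := t) hG (u t).1 (v t).1).2
    set D := (u t).1 - (v t).1
    set D1 := (u t).2 - (v t).2
    have hq : 0 < √(D ^ 2 + ι ^ 2) := by positivity
    refine div_nonneg ?_ (by positivity)
    rw [mul_div_assoc', sub_nonneg, div_le_iff₀ hq, mul_assoc _ (√_), mul_self_sqrt (by positivity)]
    nlinarith [mul_nonneg h (by positivity : 0 ≤ D ^ 2 + ι ^ 2), sq_nonneg (D1 * ι)]
  refine ⟨convex_Icc a b, fun x hx y hy α β hα hβ h1 => le_of_forall_pos_le_add fun ι hι => ?_⟩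
  have h2 := (hi ι hι).2 hx hy hα hβ h1
  have lo : ∀ d : ℝ, |d| ≤ √(d ^ 2 + ι ^ 2) := fun d => abs_le_sqrt (by nlinarith)
  have up : ∀ d : ℝ, √(d ^ 2 + ι ^ 2) ≤ |d| + ι := fun d => by
    rw [sqrt_le_left (by positivity)]; nlinarith [sq_abs d, abs_nonneg d]
  simp only [smul_eq_mul] at h2 ⊢
  refine (lo _).trans (h2.trans ?_)
  nlinarith [mul_le_mul_of_nonneg_left (up ((u x).1 - (v x).1)) hα, mul_le_mul_of_nonneg_left (up ((u y).1 - (v y).1)) hβ]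

lemma chord {q : ℝ → ℝ} (h : ConvexOn ℝ (Icc a b) q) (ht : t ∈ Icc a b) : (b - a) * q t ≤ (b - t) * q a + (t - a) * q b := by
  rcases (ht.1.trans ht.2).eq_or_lt with e | hab
  · have h1 : t = a := le_antisymm (by linarith [ht.2]) ht.1
    subst h1; subst e; simp
  have hb : 0 < b - a := by linarith
  have := h.2 (left_mem_Icc.2 hab.le) (right_mem_Icc.2 hab.le) (div_nonneg (by linarith [ht.2]) hb.le : 0 ≤ (b - t) / (b - a)) (div_nonneg (by linarith [ht.1]) hb.le : 0 ≤ (t - a) / (b - a)) (by field_simp; ring)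
  simp only [smul_eq_mul] at this
  rw [show (b - t) / (b - a) * a + (t - a) / (b - a) * b = t by field_simp; ring] at this
  calc _ ≤ (b - a) * ((b - t) / (b - a) * q a + (t - a) / (b - a) * q b) := by gcongr
    _ = _ := by field_simp

lemma slp {f : ℝ → ℝ} {d C : ℝ} (h : HasDerivAt f d 0) (hL : 0 < L) (H : ∀ t ∈ Ioo 0 L, f t ≤ f 0 + t * C) : d ≤ C := by
  refine le_of_tendsto ((hasDerivAt_iff_tendsto_slope.1 h).mono_left (nhdsWithin_mono _ fun t (ht : t ∈ Ioi 0) => ht.ne')) ?_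
  filter_upwards [Ioo_mem_nhdsGT hL] with t ht
  rw [slope_def_field, div_le_iff₀ (by linarith [ht.1])]
  linarith [H t ht]

lemma der (hG : 1 ≤ G) (hL : 0 < L) (hu : So (gg G (10 * G ^ 2)) u (Icc (p - L) (p + L))) (hv : So (gg G (10 * G ^ 2)) v (Icc (p - L) (p + L))) (h1 : |(u (p - L)).1 - (v (p - L)).1| ≤ M) (h2 : |(u (p + L)).1 - (v (p + L)).1| ≤ M) : |(u p).2 - (v p).2| ≤ M / L := by
  wlog h : (v p).1 ≤ (u p).1 generalizing u v
  · rw [abs_sub_comm]; exact this hv hu (by rwa [abs_sub_comm]) (by rwa [abs_sub_comm]) (le_of_not_ge h)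
  have hp : p ∈ Icc (p - L) (p + L) := by constructor <;> linarith
  have hd := (hu p hp).1.fun_sub (hv p hp).1
  have e0 : |(u p).1 - (v p).1| = (u p).1 - (v p).1 := abs_of_nonneg (by linarith)
  rw [abs_le']
  constructor
  · refine slp (f := fun t => (u (p + t)).1 - (v (p + t)).1) (HasDerivAt.comp_const_add p 0 (by simpa using! hd)) hL fun t ht => ?_
    have := chord (cv (a := p) (b := p + L) hG (hu.mono (Icc_subset_Icc (by linarith) le_rfl)) (hv.mono (Icc_subset_Icc (by linarith) le_rfl))) (t := p + t) (by constructor <;> linarith [ht.1, ht.2])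
    have hM := mul_le_mul_of_nonneg_left h2 ht.1.le
    have := mul_le_mul_of_nonneg_left (le_abs_self ((u (p + t)).1 - (v (p + t)).1)) hL.le
    have : 0 ≤ t * ((u p).1 - (v p).1) := mul_nonneg ht.1.le (by linarith)
    simp only [add_zero]
    rw [mul_div_assoc', ← sub_le_iff_le_add', le_div_iff₀ hL]
    simp only [e0] at *
    nlinarith
  · refine slp (f := fun t => (u (p - t)).1 - (v (p - t)).1) (HasDerivAt.comp_const_sub p 0 (by simpa using! hd)) hL fun t ht => ?_
    have := chord (cv (a := p - L) (b := p) hG (hu.mono (Icc_subset_Icc le_rfl (by linarith))) (hv.mono (Icc_subset_Icc le_rfl (by linarith)))) (t := p - t) (by constructor <;> linarith [ht.1, ht.2])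
    have hM := mul_le_mul_of_nonneg_left h1 ht.1.le
    have := mul_le_mul_of_nonneg_left (le_abs_self ((u (p - t)).1 - (v (p - t)).1)) hL.le
    have : 0 ≤ t * ((u p).1 - (v p).1) := mul_nonneg ht.1.le (by linarith)
    simp only [sub_zero]
    rw [mul_div_assoc', ← sub_le_iff_le_add', le_div_iff₀ hL]
    simp only [e0] at *
    nlinarith

lemma expn (hG : 1 ≤ G) (hab : a < b) (hu : So (gg G (10 * G ^ 2)) u (Icc a b)) (hv : So (gg G (10 * G ^ 2)) v (Icc a b)) (h : (u a).1 = (v a).1) : |(u a).2 - (v a).2| ≤ |(u b).1 - (v b).1| / (b - a) := by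
  have hd := ((hu a (left_mem_Icc.2 hab.le)).1.fun_sub (hv a (left_mem_Icc.2 hab.le)).1)
  have hb : 0 < b - a := by linarith
  have ch : ∀ t ∈ Ioo 0 (b - a), |(u (a + t)).1 - (v (a + t)).1| ≤ t * (|(u b).1 - (v b).1| / (b - a)) := fun t ht => by
    have := chord (cv hG hu hv) (t := a + t) (by constructor <;> linarith [ht.1, ht.2])
    rw [mul_div_assoc', le_div_iff₀ hb]
    simp only [h, sub_self, abs_zero, mul_zero] at this
    linarith
  rw [abs_le']
  constructor
  · refine slp (f := fun t => (u (a + t)).1 - (v (a + t)).1) (HasDerivAt.comp_const_add a 0 (by simpa using! hd)) hb fun t ht => ?_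
    simp only [add_zero, h, sub_self, zero_add]
    exact (le_abs_self _).trans (ch t ht)
  · refine slp (f := fun t => -((u (a + t)).1 - (v (a + t)).1)) (HasDerivAt.comp_const_add a 0 (by simpa using! hd)).fun_neg hb fun t ht => ?_
    simp only [add_zero, h, sub_self, zero_add, neg_zero]
    exact (neg_le_abs _).trans (ch t ht)

lemma cave (hG : 1 ≤ G) (hu : So (gg G (10 * G ^ 2)) u (Icc a b)) (ha : M ≤ (u a).1) (hb : M ≤ (u b).1) (ht : t ∈ Icc a b) : M ≤ (u t).1 := by
  have h : ConvexOn ℝ (Icc a b) fun t => -(u t).1 := convexOn_of_hasDerivWithinAt2_nonneg (convex_Icc a b) (fun t ht => (hu t ht).1.fun_neg.continuousAt.continuousWithinAt) (fun t ht => (hu t (interior_subset ht)).1.fun_neg.hasDerivWithinAt) (fun t ht => (hu t (interior_subset ht)).2.fun_neg.hasDerivWithinAt) fun t ht => (neg_pos.2 (gm hG _ 0).1).le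
  have := h.le_max_of_mem_Icc (left_mem_Icc.2 (ht.1.trans ht.2)) (right_mem_Icc.2 (ht.1.trans ht.2)) ht
  rcases le_max_iff.1 this with h | h <;> linarith

lemma bvp (hG : 1 ≤ G) (hab : a < b) (α β : ℝ) : ∃ u, So (gg G (10 * G ^ 2)) u univ ∧ (u a).1 = α ∧ (u b).1 = β := by
  have hc : 1 ≤ 10 * G ^ 2 := by nlinarith
  choose φ hφ h0 using fun w : ℝ => fl (G := G) hc a (α, w)
  have hb : 0 < b - a := by linarith
  have ct : Continuous fun w => (φ w b).1 := (LipschitzWith.of_dist_le' (K := exp (KK G * |b - a|)) fun x y => by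
    refine (norm_fst_le (φ x b - φ y b)).trans ((gron (s := a) hc ((hφ x).mono (subset_univ _)) ((hφ y).mono (subset_univ _))).trans ?_)
    rw [h0, h0]; simp [Real.dist_eq, Prod.norm_def]).continuous
  have bd : ∀ w, |(φ w b).1 - α - w * (b - a)| ≤ (G ^ 2 + 1) * (b - a) * (b - a) := fun w => by
    obtain ⟨d, hd, e⟩ := mvt hab fun t _ => (hφ w t trivial).1
    obtain ⟨d', hd', e'⟩ := mvt hd.1 fun t _ => (hφ w t trivial).2
    simp only [h0] at e e'
    rw [e, ← sub_mul, e', abs_mul, abs_mul, abs_of_pos hb, abs_of_pos (sub_pos.2 hd.1)]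
    gcongr
    · exact sub_nonneg.2 hd.1.le
    · exact (ff_le (hc.trans (le_max_right _ _))).1
    · exact hd.2.le
  obtain ⟨w, hw⟩ := mem_range_of_exists_le_of_exists_ge (c := β) ct ⟨(β - α) / (b - a) - (G ^ 2 + 1) * (b - a), by
    have := (abs_le.1 (bd ((β - α) / (b - a) - (G ^ 2 + 1) * (b - a)))).2
    rw [sub_mul _ _ (b - a), div_mul_cancel₀ _ hb.ne'] at this; linarith⟩ ⟨(β - α) / (b - a) + (G ^ 2 + 1) * (b - a), by
    have := (abs_le.1 (bd ((β - α) / (b - a) + (G ^ 2 + 1) * (b - a)))).1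
    rw [add_mul ((β - α) / (b - a)), div_mul_cancel₀ _ hb.ne'] at this; linarith⟩
  exact ⟨φ w, hφ w, by rw [h0], hw⟩
end

open Real Filter MeasureTheory Set Topology

noncomputable def flw (G : ℝ) (Z : ℝ × ℝ) : ℝ → ℝ × ℝ := (fl (G := G) le_rfl 0 Z).choose
noncomputable def ztt (G a b α β : ℝ) : ℝ → ℝ × ℝ := Classical.epsilon fun u => So (gg G (10 * G ^ 2)) u univ ∧ (u a).1 = α ∧ (u b).1 = β
noncomputable def Qp (G S e : ℝ) (Z Z' : ℝ × ℝ) : ℝ := (flw G Z S).2 - (ztt G S e (flw G Z S).1 (flw G (sgm Z') S).1 S).2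
def Wr (a b c d : ℝ × ℝ) : ℝ := (a.2 - b.2) * (c.1 - d.1) - (a.1 - b.1) * (c.2 - d.2)

section
variable {G c f t S T ε B : ℝ} {U : ℝ → ℝ → ℝ × ℝ} {Z Z' W W' : ℝ × ℝ} {u v : ℝ → ℝ × ℝ}

lemma flw_sol : So (gg G 1) (flw G Z) univ := (fl (G := G) le_rfl 0 Z).choose_spec.1
lemma flw_zero : flw G Z 0 = Z := (fl (G := G) le_rfl 0 Z).choose_spec.2
lemma ztt_spec (hG : 1 ≤ G) {a b : ℝ} (hab : a < b) (α β : ℝ) : So (gg G (10 * G ^ 2)) (ztt G a b α β) univ ∧ (ztt G a b α β a).1 = α ∧ (ztt G a b α β b).1 = β :=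
  Classical.epsilon_spec (bvp hG hab α β)

lemma gr0 (hu : So (gg G 1) u (Icc 0 S)) (hv : So (gg G 1) v (Icc 0 S)) (ht : t ∈ Icc 0 S) : ‖u t - v t‖ ≤ exp (KK G * S) * ‖u 0 - v 0‖ := by
  have hs : uIcc 0 t ⊆ Icc 0 S := by rw [uIcc_of_le ht.1]; exact Icc_subset_Icc le_rfl ht.2
  refine (gron le_rfl (hu.mono hs) (hv.mono hs)).trans ?_
  have : 0 ≤ KK G := by unfold KK; positivity
  rw [sub_zero, abs_of_nonneg ht.1]
  gcongr
  exact ht.2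

lemma mvf {a b : ℝ} (ha : 0 < a) (hb : 0 < b) : ∃ ξ ∈ uIcc a b, ff G t a - ff G t b = fr G t ξ * (a - b) := by
  rcases lt_trichotomy a b with h | h | h
  · obtain ⟨ξ, h1, h2⟩ := mvt h fun r hr => ff_deriv (G := G) (t := t) (ha.trans_le hr.1)
    exact ⟨ξ, by rw [uIcc_of_le h.le]; exact Ioo_subset_Icc_self h1, by linarith⟩
  · exact ⟨a, left_mem_uIcc, by simp [h]⟩
  · obtain ⟨ξ, h1, h2⟩ := mvt h fun r hr => ff_deriv (G := G) (t := t) (hb.trans_le hr.1)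
    exact ⟨ξ, by rw [uIcc_of_ge h.le]; exact Ioo_subset_Icc_self h1, by linarith⟩

lemma wr0 (G T B : ℝ) (hε : 0 < ε) : ∃ η > 0, η ≤ 1 ∧ ∀ t ∈ Icc 0 T, ∀ z a b c d : ℝ, 4 ≤ z → z ≤ B → |a - z| ≤ η → |b - z| ≤ η → |c - z| ≤ η → |d - z| ≤ η →
    |(ff G t a - ff G t b) * (c - d) - (a - b) * (ff G t c - ff G t d)| ≤ ε * |a - b| * |c - d| := by
  have hu : UniformContinuousOn (fun p : ℝ × ℝ => fr G p.1 p.2) (Icc 0 T ×ˢ Icc 1 (B + 1)) := (isCompact_Icc.prod isCompact_Icc).uniformContinuousOn_of_continuous fun p hp =>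
    (ff_cont (G := G) (t := p.1) (by linarith [hp.2.1])).2.continuousWithinAt
  obtain ⟨η, hη, h⟩ := Metric.uniformContinuousOn_iff.1 hu ε hε
  refine ⟨min 1 (η / 3), by positivity, min_le_left _ _, fun t ht z a b c d h4 hB ha hb hc hd => ?_⟩
  have m1 := min_le_left 1 (η / 3)
  have m2 := min_le_right 1 (η / 3)
  have mm : ∀ {x y ξ : ℝ}, |x - z| ≤ min 1 (η / 3) → |y - z| ≤ min 1 (η / 3) → ξ ∈ uIcc x y → |ξ - z| ≤ min 1 (η / 3) := fun hx hy hξ => by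
    have := ordConnected_Icc.uIcc_subset (by constructor <;> linarith [abs_le.1 hx]) (by constructor <;> linarith [abs_le.1 hy]) hξ (s := Icc (z - min 1 (η / 3)) (z + min 1 (η / 3)))
    exact abs_le.2 ⟨by linarith [this.1], by linarith [this.2]⟩
  have pos : ∀ {x : ℝ}, |x - z| ≤ min 1 (η / 3) → x ∈ Icc 1 (B + 1) := fun hx => by constructor <;> linarith [abs_le.1 hx]
  obtain ⟨ξ, h1, e1⟩ := mvf (G := G) (t := t) (by linarith [(pos ha).1] : 0 < a) (by linarith [(pos hb).1] : 0 < b)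
  obtain ⟨ζ, h2, e2⟩ := mvf (G := G) (t := t) (by linarith [(pos hc).1] : 0 < c) (by linarith [(pos hd).1] : 0 < d)
  have h1 := mm ha hb h1
  have h2 := mm hc hd h2
  have := h (t, ξ) ⟨ht, pos h1⟩ (t, ζ) ⟨ht, pos h2⟩ (by
    rw [Prod.dist_eq, dist_self, Real.dist_eq, max_eq_right (abs_nonneg _), abs_lt]; constructor <;> linarith [abs_le.1 h1, abs_le.1 h2])
  rw [Real.dist_eq] at this
  rw [e1, e2, show fr G t ξ * (a - b) * (c - d) - (a - b) * (fr G t ζ * (c - d)) = (fr G t ξ - fr G t ζ) * (a - b) * (c - d) by ring, abs_mul, abs_mul]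
  gcongr

lemma wrI {p q η MD ME : ℝ} (h0 : 0 ≤ p) (hpq : p < q) (hq : q ≤ T) (hM : 0 ≤ MD) (hε : 0 < ε)
    (hη : ∀ t ∈ Icc 0 T, ∀ z a b c d : ℝ, 4 ≤ z → z ≤ B → |a - z| ≤ η → |b - z| ≤ η → |c - z| ≤ η → |d - z| ≤ η →
    |(ff G t a - ff G t b) * (c - d) - (a - b) * (ff G t c - ff G t d)| ≤ ε * |a - b| * |c - d|)
    {a b c d z : ℝ → ℝ × ℝ} (ha : So (ff G) a (Icc p q)) (hb : So (ff G) b (Icc p q)) (hc : So (ff G) c (Icc p q)) (hd : So (ff G) d (Icc p q))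
    (h : ∀ t ∈ Icc p q, (4 ≤ (z t).1 ∧ (z t).1 ≤ B) ∧ (|(a t).1 - (z t).1| ≤ η ∧ |(b t).1 - (z t).1| ≤ η ∧ |(c t).1 - (z t).1| ≤ η ∧ |(d t).1 - (z t).1| ≤ η) ∧ |(a t).1 - (b t).1| ≤ MD ∧ |(c t).1 - (d t).1| ≤ ME) :
    |Wr (a q) (b q) (c q) (d q) - Wr (a p) (b p) (c p) (d p)| ≤ ε * MD * ME * (q - p) := by
  obtain ⟨s, hs, e⟩ := mvt (f := fun t => Wr (a t) (b t) (c t) (d t)) (f' := fun t => (ff G t (a t).1 - ff G t (b t).1) * ((c t).1 - (d t).1) - ((a t).1 - (b t).1) * (ff G t (c t).1 - ff G t (d t).1)) hpq fun t ht =>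
    ((((ha t ht).2.fun_sub (hb t ht).2).fun_mul ((hc t ht).1.fun_sub (hd t ht).1)).fun_sub (((ha t ht).1.fun_sub (hb t ht).1).fun_mul ((hc t ht).2.fun_sub (hd t ht).2))).congr_deriv (by ring)
  have hs := Ioo_subset_Icc_self hs
  obtain ⟨⟨h1, h2⟩, ⟨h3, h4, h5, h6⟩, h7, h8⟩ := h s hs
  rw [e, abs_mul, abs_of_pos (sub_pos.2 hpq)]
  have := hη s ⟨h0.trans hs.1, hs.2.trans hq⟩ _ _ _ _ _ h1 h2 h3 h4 h5 h6
  refine mul_le_mul_of_nonneg_right (this.trans ?_) (sub_pos.2 hpq).le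
  gcongr

lemma sublin (o : Out G c f U) (hS : ∀ τ ≤ 0, ∀ t ≥ S, 10 * G ^ 2 + 1 ≤ (U τ t).1) (h0 : 0 < S) {τ : ℝ} (hτ : τ ≤ 0) (ht : S ≤ t) : |(U τ t).1 - (U 0 t).1| ≤ |(U τ S).1 - (U 0 S).1| := by
  have hG : 1 ≤ G := by linarith [o.G1]
  have so : ∀ τ ≤ 0, So (gg G (10 * G ^ 2)) (U τ) (Ici S) := fun τ h => ((o.sol τ h).mono (Ici_subset_Ici.2 h0.le)).tog fun t ht => by linarith [hS τ h t ht]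
  refine le_of_forall_pos_le_add fun g hg => ?_
  have hk : 0 < t - S + 1 := by linarith
  obtain ⟨e1, h1⟩ := o.sub τ hτ (g / (2 * (t - S + 1))) (by positivity)
  obtain ⟨e2, h2⟩ := o.sub 0 le_rfl (g / (2 * (t - S + 1))) (by positivity)
  set e := max (max e1 e2) (max t (2 * S + 1))
  have he1 : e1 ≤ e := (le_max_left _ _).trans (le_max_left _ _)
  have he2 : e2 ≤ e := (le_max_right _ _).trans (le_max_left _ _)
  have he3 : t ≤ e := (le_max_left _ _).trans (le_max_right _ _)
  have he4 : 2 * S + 1 ≤ e := (le_max_right _ _).trans (le_max_right _ _)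
  have ch := chord (cv hG ((so τ hτ).mono Icc_subset_Ici_self) ((so 0 le_rfl).mono Icc_subset_Ici_self)) (⟨ht, he3⟩ : t ∈ Icc S e)
  have h1 := h1 e he1
  have h2 := h2 e he2
  have hE : |(U τ e).1 - (U 0 e).1| ≤ g / (2 * (t - S + 1)) * e := abs_le.2 ⟨by linarith [hS τ hτ e (by linarith), sq_nonneg G], by linarith [hS 0 le_rfl e (by linarith), sq_nonneg G]⟩
  have h3 : (t - S) * |(U τ e).1 - (U 0 e).1| ≤ g * (e / 2) := by
    calc _ ≤ (t - S + 1) * (g / (2 * (t - S + 1)) * e) := by gcongr; linarith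
      _ = _ := by field_simp
  have h4 : (e - t) * |(U τ S).1 - (U 0 S).1| ≤ (e - S) * |(U τ S).1 - (U 0 S).1| := by gcongr
  have h5 : g * (e / 2) ≤ g * (e - S) := by gcongr; linarith
  have : 0 < e - S := by linarith
  refine le_of_mul_le_mul_left ?_ this
  linarith
end

open Real Filter MeasureTheory Set Topology

section
variable {G c f t S e δ ε : ℝ} {U : ℝ → ℝ → ℝ × ℝ} {Z Z' W W' : ℝ × ℝ}

lemma Out.sgm (o : Out G c f U) : ‖sgm Z - U 0 0‖ = ‖Z - U 0 0‖ := by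
  rw [← sgm_norm Z, show _root_.sgm (U 0 0) = U 0 0 by ext <;> simp [_root_.sgm, o.y0]]

lemma Out.sg1 (o : Out G c f U) {τ : ℝ} (hτ : τ ≤ 0) : So (gg G 1) (U τ) (Ici 0) := (o.sol τ hτ).tog fun t ht => by linarith [o.four τ hτ t ht]

lemma near (o : Out G c f U) (h0 : 0 < S) (hS : ∀ τ ≤ 0, ∀ t ≥ S, 10 * G ^ 2 + 1 ≤ (U τ t).1) (hδ : exp (KK G * S) * δ ≤ 1 / 2) (hZ : ‖Z - U 0 0‖ ≤ δ) :
    (∀ t ∈ Icc 0 S, ‖flw G Z t - U 0 t‖ ≤ exp (KK G * S) * δ ∧ 1 < (flw G Z t).1) ∧ So (ff G) (flw G Z) (Icc 0 S) ∧ 10 * G ^ 2 ≤ (flw G Z S).1 ∧ (flw G Z S).1 ≤ (U 0 S).1 + 1 := by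
  have n1 : ∀ t ∈ Icc 0 S, ‖flw G Z t - U 0 t‖ ≤ exp (KK G * S) * δ := fun t ht => by
    refine (gr0 (flw_sol.mono (subset_univ _)) ((o.sg1 le_rfl).mono Icc_subset_Ici_self) ht).trans ?_
    rw [flw_zero]; gcongr
  have n2 : ∀ t ∈ Icc 0 S, |(flw G Z t).1 - (U 0 t).1| ≤ 1 / 2 := fun t ht => ((norm_fst_le (flw G Z t - U 0 t)).trans (n1 t ht)).trans hδ
  have n3 : ∀ t ∈ Icc 0 S, 1 < (flw G Z t).1 := fun t ht => by linarith [abs_le.1 (n2 t ht), o.four 0 le_rfl t ht.1]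
  have := abs_le.1 (n2 S ⟨h0.le, le_rfl⟩)
  exact ⟨fun t ht => ⟨n1 t ht, n3 t ht⟩, (flw_sol.mono (subset_univ _)).tof fun t ht => (n3 t ht).le, by linarith [hS 0 le_rfl S le_rfl], by linarith⟩

lemma near2 (o : Out G c f U) (h0 : 0 < S) (hS : ∀ τ ≤ 0, ∀ t ≥ S, 10 * G ^ 2 + 1 ≤ (U τ t).1) (hδ : exp (KK G * S) * δ ≤ 1 / 2) (hZ : ‖Z - U 0 0‖ ≤ δ) (hZ' : ‖Z' - U 0 0‖ ≤ δ) (he : S < e) :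
    ∀ t ∈ Icc S e, 10 * G ^ 2 ≤ (ztt G S e (flw G Z S).1 (flw G (sgm Z') S).1 t).1 := fun t ht => by
  have hG : 1 ≤ G := by linarith [o.G1]
  obtain ⟨h1, h2, h3⟩ := ztt_spec hG he (flw G Z S).1 (flw G (sgm Z') S).1
  exact cave hG (h1.mono (subset_univ _)) (by rw [h2]; exact (near o h0 hS hδ hZ).2.2.1) (by rw [h3]; exact (near o h0 hS hδ (o.sgm.trans_le hZ')).2.2.1) ht

lemma ke2 (o : Out G c f U) (h0 : 0 < S) (hS : ∀ τ ≤ 0, ∀ t ≥ S, 10 * G ^ 2 + 1 ≤ (U τ t).1) (hε : 0 < ε) : ∃ E, ∀ e ≥ E, |Qp G S e (U 0 0) (U 0 0)| ≤ ε := by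
  have hG : 1 ≤ G := by linarith [o.G1]
  obtain ⟨E, hE⟩ := o.sub 0 le_rfl (ε / 4) (by positivity)
  refine ⟨max E (max (2 * S) (4 * (U 0 S).1 / ε)), fun e he => ?_⟩
  have he1 := hE e ((le_max_left _ _).trans he)
  have he2 := (le_max_left _ _).trans ((le_max_right _ _).trans he)
  have he3 := (le_max_right _ _).trans ((le_max_right _ _).trans he)
  rw [div_le_iff₀ hε] at he3
  have eq : flw G (U 0 0) S = U 0 S := by
    have := gr0 (G := G) (u := flw G (U 0 0)) (flw_sol.mono (subset_univ _)) ((o.sg1 le_rfl).mono Icc_subset_Ici_self) (right_mem_Icc.2 h0.le)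
    simpa [flw_zero, sub_eq_zero] using this
  have eq2 : sgm (U 0 0) = U 0 0 := by ext <;> simp [sgm, o.y0]
  obtain ⟨h1, h2, h3⟩ := ztt_spec hG (by linarith : S < e) (U 0 S).1 (U 0 S).1
  have s0 : So (gg G (10 * G ^ 2)) (U 0) (Icc S e) := ((o.sol 0 le_rfl).mono fun t ht => h0.le.trans ht.1).tog fun t ht => by linarith [hS 0 le_rfl t ht.1]
  rw [Qp, eq2, eq]
  refine (expn hG (by linarith) s0 (h1.mono (subset_univ _)) h2.symm).trans ?_
  rw [h3, div_le_iff₀ (by linarith)]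
  have := hS 0 le_rfl S le_rfl
  have := hS 0 le_rfl e (by linarith)
  exact abs_le.2 ⟨by nlinarith, by nlinarith⟩

lemma ke (o : Out G c f U) (h0 : 0 < S) (hS : ∀ τ ≤ 0, ∀ t ≥ S, 10 * G ^ 2 + 1 ≤ (U τ t).1) (hε : 0 < ε) : ∃ k : ℝ, ∃ δ > 0, ∃ E, ∀ e ≥ E, ∀ Z Z' W W' : ℝ × ℝ,
    ‖Z - U 0 0‖ ≤ δ → ‖Z' - U 0 0‖ ≤ δ → ‖W - U 0 0‖ ≤ δ → ‖W' - U 0 0‖ ≤ δ →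
    |k * (Qp G S e Z Z' - Qp G S e W W') - (f * (Z.1 - W.1) + c * (Z.2 - W.2))| ≤ ε * max ‖Z - W‖ ‖Z' - W'‖ := by
  have hG : 1 ≤ G := by linarith [o.G1]
  have hf := o.hf
  set Q := exp (KK G * S)
  have hQ : 0 < Q := exp_pos _
  set cE := |c| + f + 1
  have hcE : 0 < cE := by positivity
  set A := Q * Q * cE
  have hA : 0 < A := by positivity
  obtain ⟨L, hL, hAL⟩ : ∃ L > 0, A * 8 ≤ ε * L := ⟨A * 8 / ε, by positivity, by field_simp; rfl⟩
  obtain ⟨ε1, hε1, hA1⟩ : ∃ x > 0, x * A * (S + L) ≤ ε / 4 := ⟨ε / (4 * A * (S + L)), by positivity, by field_simp; rfl⟩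
  obtain ⟨B, hB⟩ : ∃ B, ∀ t ∈ Icc 0 (S + L), (U 0 t).1 ≤ B := by
    obtain ⟨B, hB⟩ := isCompact_Icc.bddAbove_image (f := fun t => (U 0 t).1) (K := Icc 0 (S + L)) fun t ht => (o.sol 0 le_rfl t ht.1).1.continuousAt.continuousWithinAt
    exact ⟨B, fun t ht => hB ⟨t, ht, rfl⟩⟩
  obtain ⟨η, hη, hη1, hw⟩ := wr0 G (S + L) B hε1
  obtain ⟨τ, hτ, hτx, hτy, hτ3⟩ : ∃ τ < 0, |((U τ 0).1 - (U 0 0).1) / τ - c| < min 1 (ε / 8) ∧ |(U τ 0).2 / τ - -f| < min 1 (ε / 8) ∧ |exp (KK G * (S + L)) * (cE * τ)| < η := by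
    have m : 0 < min 1 (ε / 8) := by positivity
    have t3 : Tendsto (fun τ : ℝ => exp (KK G * (S + L)) * (cE * τ)) (𝓝[<] 0) (𝓝 0) := by
      have : Continuous fun τ : ℝ => exp (KK G * (S + L)) * (cE * τ) := by fun_prop
      simpa using (this.tendsto 0).mono_left nhdsWithin_le_nhds
    have h1 := Metric.tendsto_nhds.1 o.tx _ m
    have h2 := Metric.tendsto_nhds.1 o.ty _ m
    have h3 := Metric.tendsto_nhds.1 t3 η hη
    obtain ⟨τ, ⟨⟨h1, h2⟩, h3⟩, h4⟩ := (((h1.and h2).and h3).and self_mem_nhdsWithin).exists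
    exact ⟨τ, h4, h1, h2, by simpa [Real.dist_eq] using h3⟩
  have hτ' : 0 < |τ| := abs_pos.2 hτ.ne
  have dx : |(U τ 0).1 - (U 0 0).1 - τ * c| ≤ |τ| * min 1 (ε / 8) := by
    rw [show (U τ 0).1 - (U 0 0).1 - τ * c = τ * (((U τ 0).1 - (U 0 0).1) / τ - c) by field_simp [hτ.ne], abs_mul]; gcongr
  have dy : |(U τ 0).2 + τ * f| ≤ |τ| * min 1 (ε / 8) := by
    rw [show (U τ 0).2 + τ * f = τ * ((U τ 0).2 / τ - -f) by field_simp [hτ.ne]; ring, abs_mul]; gcongr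
  have m1 : |τ| * min 1 (ε / 8) ≤ |τ| * 1 := by gcongr; exact min_le_left _ _
  have m2 : |τ| * min 1 (ε / 8) ≤ |τ| * (ε / 8) := by gcongr; exact min_le_right _ _
  have E0 : ‖U τ 0 - U 0 0‖ ≤ cE * |τ| := by
    rw [Prod.norm_def]
    refine max_le ?_ ?_ <;> simp only [Prod.fst_sub, Prod.snd_sub, o.y0, Real.norm_eq_abs, cE, sub_zero]
    · have := abs_sub_abs_le_abs_sub ((U τ 0).1 - (U 0 0).1) (τ * c)
      rw [abs_mul] at this; nlinarith
    · have := abs_sub_abs_le_abs_sub (U τ 0).2 (-(τ * f))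
      rw [abs_neg, abs_mul, abs_of_pos hf, sub_neg_eq_add] at this; nlinarith [abs_nonneg c]
  have Eη : ∀ t ∈ Icc 0 (S + L), |(U τ t).1 - (U 0 t).1| ≤ η := fun t ht => by
    refine (norm_fst_le (U τ t - U 0 t)).trans ((gr0 ((o.sg1 hτ.le).mono Icc_subset_Ici_self) ((o.sg1 le_rfl).mono Icc_subset_Ici_self) ht).trans ?_)
    rw [abs_mul, abs_of_pos (exp_pos _), abs_mul, abs_of_pos hcE] at hτ3
    exact le_trans (by gcongr) hτ3.le
  have EQ : ∀ t ∈ Icc 0 S, |(U τ t).1 - (U 0 t).1| ≤ Q * (cE * |τ|) := fun t ht => by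
    refine (norm_fst_le (U τ t - U 0 t)).trans ((gr0 ((o.sg1 hτ.le).mono Icc_subset_Ici_self) ((o.sg1 le_rfl).mono Icc_subset_Ici_self) ht).trans ?_)
    gcongr
  have EQ' : ∀ t ≥ S, |(U τ t).1 - (U 0 t).1| ≤ Q * (cE * |τ|) := fun t ht => (sublin o hS h0 hτ.le ht).trans (EQ S ⟨h0.le, le_rfl⟩)
  obtain ⟨E, hE⟩ := o.sub 0 le_rfl (η / (8 * L)) (by positivity)
  refine ⟨((U τ S).1 - (U 0 S).1) / τ, η / 2 / Q, by positivity, max (max E (S + L + L)) (max (2 * S) (8 * L * ((U 0 S).1 + 1) / η)), fun e he Z Z' W W' hZ hZ' hW hW' => ?_⟩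
  have hδ : Q * (η / 2 / Q) = η / 2 := by field_simp
  have he1 := hE e ((le_max_left _ _).trans ((le_max_left _ _).trans he))
  have he2 := (le_max_right _ _).trans ((le_max_left _ _).trans he)
  have he3 := (le_max_left _ _).trans ((le_max_right _ _).trans he)
  have he4 := (le_max_right _ _).trans ((le_max_right _ _).trans he)
  rw [div_le_iff₀ hη] at he4
  have hSe : S < e := by linarith
  have se : ∀ τ ≤ 0, So (gg G (10 * G ^ 2)) (U τ) (Ici S) := fun τ h => ((o.sol τ h).mono (Ici_subset_Ici.2 h0.le)).tog fun t ht => by linarith [hS τ h t ht]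
  have h12 : Q * (η / 2 / Q) ≤ 1 / 2 := by rw [hδ]; linarith
  have zη : ∀ Z Z' : ℝ × ℝ, ‖Z - U 0 0‖ ≤ η / 2 / Q → ‖Z' - U 0 0‖ ≤ η / 2 / Q → ∀ t ∈ Icc S (S + L), |(ztt G S e (flw G Z S).1 (flw G (sgm Z') S).1 t).1 - (U 0 t).1| ≤ η := fun Z Z' hZ hZ' t ht => by
    obtain ⟨s1, s2, s3⟩ := ztt_spec hG hSe (flw G Z S).1 (flw G (sgm Z') S).1
    have ch := chord (cv hG (s1.mono (subset_univ _)) ((se 0 le_rfl).mono Icc_subset_Ici_self)) (⟨ht.1, by linarith [ht.2]⟩ : t ∈ Icc S e)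
    simp only [s2, s3] at ch
    have nz := near o h0 hS h12 hZ
    have nz' := near o h0 hS h12 (o.sgm.trans_le hZ')
    have a1 : |(flw G Z S).1 - (U 0 S).1| ≤ η / 2 := ((norm_fst_le (flw G Z S - U 0 S)).trans (nz.1 S ⟨h0.le, le_rfl⟩).1).trans hδ.le
    have G2 := sq_nonneg G
    have a2 : |(flw G (sgm Z') S).1 - (U 0 e).1| ≤ (U 0 S).1 + 1 + η / (8 * L) * e := by
      have := hS 0 le_rfl e hSe.le
      have := hS 0 le_rfl S le_rfl
      have : 0 ≤ η / (8 * L) * e := mul_nonneg (by positivity) (by linarith)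
      exact abs_le.2 ⟨by linarith [nz'.2.2.1], by linarith [nz'.2.2.2]⟩
    have b1 : (e - t) * |(flw G Z S).1 - (U 0 S).1| ≤ (e - S) * (η / 2) := mul_le_mul (by linarith [ht.1]) a1 (abs_nonneg _) (by linarith)
    have b2 : (t - S) * |(flw G (sgm Z') S).1 - (U 0 e).1| ≤ L * ((U 0 S).1 + 1 + η / (8 * L) * e) := mul_le_mul (by linarith [ht.2]) a2 (abs_nonneg _) hL.le
    have b3 : L * (η / (8 * L) * e) = η * e / 8 := by field_simp
    have b4 : η * (2 * S) ≤ η * e := by gcongr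
    refine le_of_mul_le_mul_left ?_ (by linarith : 0 < e - S)
    linarith
  set m := max ‖Z - W‖ ‖Z' - W'‖
  have hm : 0 ≤ m := (norm_nonneg _).trans (le_max_left _ _)
  have fz : ∀ {Z W : ℝ × ℝ}, ‖Z - W‖ ≤ m → ∀ t ∈ Icc 0 S, |(flw G Z t).1 - (flw G W t).1| ≤ Q * m := fun {Z W} h t ht => by
    refine (norm_fst_le (flw G Z t - flw G W t)).trans ((gr0 (flw_sol.mono (subset_univ _)) (flw_sol.mono (subset_univ _)) ht).trans ?_)
    rw [flw_zero, flw_zero]; gcongr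
  obtain ⟨s1, s2, s3⟩ := ztt_spec hG hSe (flw G Z S).1 (flw G (sgm Z') S).1
  obtain ⟨r1, r2, r3⟩ := ztt_spec hG hSe (flw G W S).1 (flw G (sgm W') S).1
  have yz := near2 o h0 hS h12 hZ hZ' hSe
  have yw := near2 o h0 hS h12 hW hW' hSe
  have xz := zη Z Z' hZ hZ'
  have xw := zη W W' hW hW'
  simp only [Qp]
  set ζ := ztt G S e (flw G Z S).1 (flw G (sgm Z') S).1
  set χ := ztt G S e (flw G W S).1 (flw G (sgm W') S).1
  have zb : ∀ t ∈ Icc S e, |(ζ t).1 - (χ t).1| ≤ Q * m := fun t ht => by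
    refine ((cv hG (s1.mono (subset_univ _)) (r1.mono (subset_univ _))).le_max_of_mem_Icc (left_mem_Icc.2 hSe.le) (right_mem_Icc.2 hSe.le) ht).trans (max_le ?_ ?_)
    · rw [s2, r2]; exact fz (le_max_left _ _) S ⟨h0.le, le_rfl⟩
    · rw [s3, r3]; exact fz (by rw [sgm_norm]; exact le_max_right _ _) S ⟨h0.le, le_rfl⟩
  have nz := near o h0 hS h12 hZ
  have nw := near o h0 hS h12 hW
  have I1 := wrI (a := flw G Z) (b := flw G W) (c := U τ) (d := U 0) (z := U 0) (p := 0) (q := S) (MD := Q * m) (ME := Q * (cE * |τ|)) le_rfl h0 (by linarith) (by positivity) hε1 hw nz.2.1 nw.2.1 ((o.sol τ hτ.le).mono Icc_subset_Ici_self) ((o.sol 0 le_rfl).mono Icc_subset_Ici_self) fun t ht => by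
    have ht' : t ∈ Icc 0 (S + L) := ⟨ht.1, by linarith [ht.2]⟩
    exact ⟨⟨o.four 0 le_rfl t ht.1, hB t ht'⟩, ⟨((norm_fst_le (flw G Z t - U 0 t)).trans (nz.1 t ht).1).trans (by linarith), ((norm_fst_le (flw G W t - U 0 t)).trans (nw.1 t ht).1).trans (by linarith), Eη t ht', by simpa using hη.le⟩, fz (le_max_left _ _) t ht, EQ t ht⟩
  have sub : Icc S (S + L) ⊆ Icc S e := Icc_subset_Icc le_rfl (by linarith)
  have sub0 : Icc S (S + L) ⊆ Ici 0 := fun t ht => h0.le.trans ht.1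
  have I2 := wrI (a := ζ) (b := χ) (c := U τ) (d := U 0) (z := U 0) (p := S) (q := S + L) (MD := Q * m) (ME := Q * (cE * |τ|)) h0.le (by linarith) le_rfl (by positivity) hε1 hw ((s1.mono (subset_univ _)).tof fun t ht => yz t (sub ht)) ((r1.mono (subset_univ _)).tof fun t ht => yw t (sub ht)) ((o.sol τ hτ.le).mono sub0) ((o.sol 0 le_rfl).mono sub0) fun t ht => by
    have ht' : t ∈ Icc 0 (S + L) := ⟨sub0 ht, ht.2⟩
    exact ⟨⟨o.four 0 le_rfl t ht'.1, hB t ht'⟩, ⟨xz t ht, xw t ht, Eη t ht', by simpa using hη.le⟩, zb t (sub ht), EQ' t ht.1⟩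
  have D1 : |(ζ (S + L)).2 - (χ (S + L)).2| ≤ Q * m / L := der hG hL (s1.mono (subset_univ _)) (r1.mono (subset_univ _)) (zb _ ⟨by linarith, by linarith⟩) (zb _ ⟨by linarith, by linarith⟩)
  have D2 : |(U τ (S + L)).2 - (U 0 (S + L)).2| ≤ Q * (cE * |τ|) / L := by
    have sb : Icc (S + L - L) (S + L + L) ⊆ Ici S := fun t ht => by have := ht.1; simp at this; exact this
    exact der hG hL ((se τ hτ.le).mono sb) ((se 0 le_rfl).mono sb) (EQ' _ (by linarith)) (EQ' _ (by linarith))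
  have I3 : |Wr (ζ (S + L)) (χ (S + L)) (U τ (S + L)) (U 0 (S + L))| ≤ |τ| * m * (ε / 4) := by
    refine (abs_sub _ _).trans ?_
    rw [abs_mul, abs_mul]
    have := mul_le_mul D1 (EQ' (S + L) (by linarith)) (abs_nonneg _) (by positivity)
    have := mul_le_mul (zb (S + L) ⟨by linarith, by linarith⟩) D2 (abs_nonneg _) (by positivity)
    have : Q * m / L * (Q * (cE * |τ|)) + Q * m * (Q * (cE * |τ|) / L) = |τ| * m * (A * 2 / L) := by simp only [A]; field_simp; ring
    have : |τ| * m * (A * 2 / L) ≤ |τ| * m * (ε / 4) := mul_le_mul_of_nonneg_left (by rw [div_le_div_iff₀ hL (by norm_num)]; linarith) (by positivity)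
    linarith
  have I0 : |Wr (flw G Z 0) (flw G W 0) (U τ 0) (U 0 0) - τ * (f * (Z.1 - W.1) + c * (Z.2 - W.2))| ≤ |τ| * m * (ε / 4) := by
    rw [flw_zero, flw_zero, show Wr Z W (U τ 0) (U 0 0) - τ * (f * (Z.1 - W.1) + c * (Z.2 - W.2)) = (Z.2 - W.2) * ((U τ 0).1 - (U 0 0).1 - τ * c) - (Z.1 - W.1) * ((U τ 0).2 + τ * f) by simp only [Wr, o.y0]; ring]
    refine (abs_sub _ _).trans ?_
    rw [abs_mul, abs_mul]
    have := mul_le_mul ((norm_snd_le (Z - W)).trans (le_max_left _ ‖Z' - W'‖)) (dx.trans m2) (abs_nonneg _) hm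
    have := mul_le_mul ((norm_fst_le (Z - W)).trans (le_max_left _ ‖Z' - W'‖)) (dy.trans m2) (abs_nonneg _) hm
    simp only [Prod.fst_sub, Prod.snd_sub, Real.norm_eq_abs] at *
    linarith
  have IS : Wr (flw G Z S) (flw G W S) (U τ S) (U 0 S) - Wr (ζ S) (χ S) (U τ S) (U 0 S) = ((U τ S).1 - (U 0 S).1) * ((flw G Z S).2 - (ζ S).2 - ((flw G W S).2 - (χ S).2)) := by
    simp only [Wr, s2, r2]; ring
  have IA : |τ| * m * (ε1 * A * (S + L)) ≤ |τ| * m * (ε / 4) := by gcongr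
  refine le_of_mul_le_mul_left ?_ hτ'
  rw [← abs_mul, show τ * (((U τ S).1 - (U 0 S).1) / τ * ((flw G Z S).2 - (ζ S).2 - ((flw G W S).2 - (χ S).2)) - (f * (Z.1 - W.1) + c * (Z.2 - W.2))) = ((U τ S).1 - (U 0 S).1) * ((flw G Z S).2 - (ζ S).2 - ((flw G W S).2 - (χ S).2)) - τ * (f * (Z.1 - W.1) + c * (Z.2 - W.2)) by field_simp [hτ.ne], ← IS]
  rw [abs_le] at *
  simp only [A] at IA
  constructor <;> linarith
end

open Real Filter MeasureTheory Set Topology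

def sh (a : ℤ → ℕ) : ℤ → ℕ := fun n => a (n - 1)
def hs (a : ℤ → ℕ) : ℤ → ℕ := fun n => a (n + 1)
lemma hs_sh (a) : hs (sh a) = a := by ext n; simp [hs, sh]
lemma sh_hs (a) : sh (hs a) = a := by ext n; simp [hs, sh]

lemma ctr {B : Type} [MetricSpace B] [CompleteSpace B] [Nonempty B] {C : ℝ} (hC : ∀ x y : B, dist x y ≤ C) (H : ℕ × ℕ → B × B × B → B)
    (hH : ∀ n x y, dist (H n x) (H n y) ≤ (1 / 2 : NNReal) * dist x y) : ∃ Z : (ℤ → ℕ) → B, Continuous Z ∧ ∀ a, Z a = H (a 0, a 1) (Z a, Z (sh a), Z (hs a)) := by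
  have c1 : Continuous fun p : (ℕ × ℕ) × (B × B × B) => H p.1 p.2 := continuous_prod_of_discrete_left.2 fun n => (LipschitzWith.of_dist_le_mul (hH n)).continuous
  have csh : Continuous sh := continuous_pi fun n => continuous_apply _
  have chs : Continuous hs := continuous_pi fun n => continuous_apply _
  let T : BoundedContinuousFunction (ℤ → ℕ) B → BoundedContinuousFunction (ℤ → ℕ) B := fun Z =>
    BoundedContinuousFunction.mkOfBound ⟨fun a => H (a 0, a 1) (Z a, Z (sh a), Z (hs a)), c1.comp ((by fun_prop : Continuous fun a : ℤ → ℕ => (a 0, a 1)).prodMk (Z.continuous.prodMk ((Z.continuous.comp csh).prodMk (Z.continuous.comp chs))))⟩ C fun _ _ => hC _ _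
  have hT : ContractingWith (1 / 2) T := by
    refine ⟨by norm_num, LipschitzWith.of_dist_le_mul fun Z W => ?_⟩
    rw [BoundedContinuousFunction.dist_le (by positivity)]
    intro a
    refine (hH _ _ _).trans ?_
    gcongr
    exact max_le (Z.dist_coe_le_dist _) (max_le (Z.dist_coe_le_dist _) (Z.dist_coe_le_dist _))
  have : Nonempty (BoundedContinuousFunction (ℤ → ℕ) B) := ⟨BoundedContinuousFunction.const _ (Classical.arbitrary B)⟩
  let Y : BoundedContinuousFunction (ℤ → ℕ) B := hT.fixedPoint T
  have hY : T Y = Y := hT.fixedPoint_isFixedPt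
  exact ⟨Y, Y.continuous, fun a => congrArg (fun W : BoundedContinuousFunction (ℤ → ℕ) B => W a) hY.symm⟩

section
variable {G c f S : ℝ} {U : ℝ → ℝ → ℝ × ℝ}

lemma fixp (o : Out G c f U) (h0 : 0 < S) (hS : ∀ τ ≤ 0, ∀ t ≥ S, 10 * G ^ 2 + 1 ≤ (U τ t).1) : ∃ δ0 > 0, ∀ δ > 0, δ ≤ δ0 → ∃ N1 : ℕ, ∀ N0 ≥ N1, ∃ Z : (ℤ → ℕ) → ℝ × ℝ, Continuous Z ∧ (∀ a, ‖Z a - U 0 0‖ ≤ δ) ∧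
    ∀ a, Qp G S (2 * π * (N0 + a 0 : ℕ) - S) (Z a) (Z (sh a)) = 0 ∧ Qp G S (2 * π * (N0 + a 0 : ℕ) - S) (sgm (Z (sh a))) (sgm (Z a)) = 0 := by
  have hf := o.hf
  have hc := abs_pos.2 o.hc
  obtain ⟨k, δ0, hδ0, E, hE⟩ := ke o h0 hS (ε := min f |c| / 2) (by positivity)
  have e1 : min f |c| / 2 ≤ f / 2 := by gcongr; exact min_le_left _ _
  have e2 : min f |c| / 2 ≤ |c| / 2 := by gcongr; exact min_le_right _ _
  set ε := min f |c| / 2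
  have hk : k ≠ 0 := by
    rintro rfl
    have := hE E le_rfl (U 0 0 + (δ0, 0)) (U 0 0) (U 0 0) (U 0 0) (by simp [Prod.norm_def, hδ0.le, abs_of_pos hδ0]) (by simp [hδ0.le]) (by simp [hδ0.le]) (by simp [hδ0.le])
    simp [Prod.norm_def, abs_of_pos hδ0, hδ0.le, abs_of_pos hf] at this
    nlinarith
  refine ⟨δ0, hδ0, fun δ hδ hδ1 => ?_⟩
  obtain ⟨E', hE'⟩ := ke2 o h0 hS (ε := ε * δ / |k|) (by positivity)
  obtain ⟨N1, hN1⟩ := exists_nat_ge (max E E' + S)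
  refine ⟨N1, fun N0 hN0 => ?_⟩
  set e : ℕ → ℝ := fun n => 2 * π * (N0 + n : ℕ) - S with he
  have hen : ∀ n, max E E' ≤ e n := fun n => by
    have : (N1 : ℝ) ≤ (N0 + n : ℕ) := by exact_mod_cast hN0.trans (Nat.le_add_right _ _)
    have := pi_gt_three
    simp only [e]; nlinarith
  let C := U 0 0
  let p : ℕ → ℝ × ℝ → ℝ × ℝ → ℝ := fun n Z Z' => k * Qp G S (e n) Z Z'
  let H : ℕ × ℕ → (ℝ × ℝ) × (ℝ × ℝ) × (ℝ × ℝ) → ℝ × ℝ := fun n x => (x.1.1 - (p n.1 x.1 x.2.1 + p n.2 (sgm x.1) (sgm x.2.2)) / (2 * f), x.1.2 - (p n.1 x.1 x.2.1 - p n.2 (sgm x.1) (sgm x.2.2)) / (2 * c))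
  have key : ∀ n x y, ‖x.1 - C‖ ≤ δ → ‖x.2.1 - C‖ ≤ δ → ‖x.2.2 - C‖ ≤ δ → ‖y.1 - C‖ ≤ δ → ‖y.2.1 - C‖ ≤ δ → ‖y.2.2 - C‖ ≤ δ → ‖H n x - H n y‖ ≤ 1 / 2 * ‖x - y‖ := by
    intro n x y h1 h2 h3 h4 h5 h6
    have k1 := hE (e n.1) ((le_max_left _ _).trans (hen _)) x.1 x.2.1 y.1 y.2.1 (h1.trans hδ1) (h2.trans hδ1) (h4.trans hδ1) (h5.trans hδ1)
    have k2 := hE (e n.2) ((le_max_left _ _).trans (hen _)) (sgm x.1) (sgm x.2.2) (sgm y.1) (sgm y.2.2) (o.sgm.trans_le (h1.trans hδ1)) (o.sgm.trans_le (h3.trans hδ1)) (o.sgm.trans_le (h4.trans hδ1)) (o.sgm.trans_le (h6.trans hδ1))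
    have m0 := norm_fst_le (x - y)
    have m1 := norm_snd_le (x - y)
    have m2 := (norm_fst_le (x - y).2).trans m1
    have m3 := (norm_snd_le (x - y).2).trans m1
    have hε : 0 ≤ ε := by positivity
    replace k1 := k1.trans (mul_le_mul_of_nonneg_left (max_le m0 m2) hε)
    rw [sgm_norm, sgm_norm] at k2
    replace k2 := k2.trans (mul_le_mul_of_nonneg_left (max_le m0 m3) hε)
    set m := ‖x - y‖
    have hm : 0 ≤ m := norm_nonneg _
    have a1 : ε * m ≤ f / 2 * m := by gcongr
    have a2 : ε * m ≤ |c| / 2 * m := by gcongr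
    rw [Prod.norm_def]
    refine max_le ?_ ?_ <;> simp only [H, Prod.fst_sub, Prod.snd_sub, Real.norm_eq_abs]
    · rw [← mul_le_mul_iff_right₀ (show 0 < 2 * f by positivity)]
      nth_rw 1 [← abs_of_pos (show 0 < 2 * f by positivity)]
      rw [← abs_mul]
      rw [show 2 * f * (x.1.1 - (p n.1 x.1 x.2.1 + p n.2 (sgm x.1) (sgm x.2.2)) / (2 * f) - (y.1.1 - (p n.1 y.1 y.2.1 + p n.2 (sgm y.1) (sgm y.2.2)) / (2 * f))) = 2 * f * (x.1.1 - y.1.1) - (p n.1 x.1 x.2.1 - p n.1 y.1 y.2.1 + (p n.2 (sgm x.1) (sgm x.2.2) - p n.2 (sgm y.1) (sgm y.2.2))) by field_simp; ring]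
      simp only [p, _root_.sgm] at *
      rw [abs_le] at *
      constructor <;> linarith
    · rw [← mul_le_mul_iff_right₀ (show 0 < |2 * c| by rw [abs_mul]; positivity)]
      rw [← abs_mul]
      have hc' := o.hc
      rw [show 2 * c * (x.1.2 - (p n.1 x.1 x.2.1 - p n.2 (sgm x.1) (sgm x.2.2)) / (2 * c) - (y.1.2 - (p n.1 y.1 y.2.1 - p n.2 (sgm y.1) (sgm y.2.2)) / (2 * c))) = 2 * c * (x.1.2 - y.1.2) - (p n.1 x.1 x.2.1 - p n.1 y.1 y.2.1 - (p n.2 (sgm x.1) (sgm x.2.2) - p n.2 (sgm y.1) (sgm y.2.2))) by field_simp; ring]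
      rw [abs_mul 2 c, abs_two]
      simp only [p, _root_.sgm] at *
      rw [abs_le] at k1 k2 ⊢
      constructor <;> linarith
  have sC : sgm C = C := by ext <;> simp [sgm, C, o.y0]
  have base : ∀ n, ‖H n (C, C, C) - C‖ ≤ δ / 2 := fun n => by
    have hq : ∀ n, |p n C C| ≤ ε * δ := fun n => by
      simp only [p, abs_mul]
      refine (mul_le_mul_of_nonneg_left (hE' _ ((le_max_right _ _).trans (hen _))) (abs_nonneg _)).trans_eq ?_
      have := abs_pos.2 hk
      field_simp
    have a1 : ε * δ ≤ f / 2 * δ := by gcongr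
    have a2 : ε * δ ≤ |c| / 2 * δ := by gcongr
    have q1 := hq n.1
    have q2 := hq n.2
    rw [Prod.norm_def]
    refine max_le ?_ ?_ <;> simp only [H, Prod.fst_sub, Prod.snd_sub, Real.norm_eq_abs, sC, sub_sub_cancel_left, abs_neg, abs_div, abs_mul (2 : ℝ), abs_two]
    · rw [div_le_iff₀ (by positivity), abs_of_pos hf]
      exact (abs_add_le _ _).trans (by linarith)
    · rw [div_le_iff₀ (by positivity)]
      exact (abs_sub _ _).trans (by linarith)
  let B := Metric.closedBall C δ
  have mB : ∀ {x}, x ∈ B ↔ ‖x - C‖ ≤ δ := by intro x; rw [Metric.mem_closedBall, dist_eq_norm]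
  have hCB : C ∈ B := by simp [mB, hδ.le]
  have : CompleteSpace B := Metric.isClosed_closedBall.completeSpace_coe
  have : Nonempty B := ⟨⟨C, hCB⟩⟩
  have k' : ∀ n (x y : B × B × B), ‖H n (x.1, x.2.1, x.2.2) - H n (y.1, y.2.1, y.2.2)‖ ≤ 1 / 2 * dist x y := fun n x y => by
    refine (key n _ _ (mB.1 x.1.2) (mB.1 x.2.1.2) (mB.1 x.2.2.2) (mB.1 y.1.2) (mB.1 y.2.1.2) (mB.1 y.2.2.2)).trans_eq ?_
    rw [← dist_eq_norm]; rfl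
  have inB : ∀ n (x : B × B × B), H n (x.1, x.2.1, x.2.2) ∈ B := fun n x => mB.2 <| by
    have h1 := k' n x (⟨C, hCB⟩, ⟨C, hCB⟩, ⟨C, hCB⟩)
    have h2 : dist x (⟨C, hCB⟩, ⟨C, hCB⟩, ⟨C, hCB⟩) ≤ δ := max_le x.1.2 (max_le x.2.1.2 x.2.2.2)
    have h3 := norm_add_le (H n (x.1, x.2.1, x.2.2) - H n (C, C, C)) (H n (C, C, C) - C)
    rw [sub_add_sub_cancel] at h3
    linarith [base n]
  obtain ⟨Z, hZ, hfix⟩ := ctr (B := B) (C := δ + δ) (fun x y => (dist_triangle_right (x : ℝ × ℝ) y C).trans (add_le_add x.2 y.2)) (fun n x => ⟨H n (x.1, x.2.1, x.2.2), inB n x⟩) fun n x y => by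
    change dist (H n _) (H n _) ≤ _
    rw [dist_eq_norm]; simpa using k' n x y
  have hq : ∀ a, p (a 0) (Z a) (Z (sh a)) = 0 ∧ p (a 1) (sgm (Z a)) (sgm (Z (hs a))) = 0 := fun a => by
    have h := congrArg Subtype.val (hfix a)
    have h1 := congrArg Prod.fst h
    have h2 := congrArg Prod.snd h
    simp only [H] at h1 h2
    rw [eq_comm, sub_eq_self, div_eq_zero_iff, or_iff_left (by simp [hf.ne', o.hc])] at h1 h2
    constructor <;> linarith
  refine ⟨fun a => Z a, continuous_subtype_val.comp hZ, fun a => mB.1 (Z a).2, fun a => ⟨?_, ?_⟩⟩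
  · exact (mul_eq_zero_iff_left hk).1 (hq a).1
  · have := (hq (sh a)).2
    rw [hs_sh, show sh a 1 = a 0 from rfl] at this
    exact (mul_eq_zero_iff_left hk).1 this
end

open Real Filter MeasureTheory Set Topology

section
variable {G c f S δ e t s : ℝ} {U : ℝ → ℝ → ℝ × ℝ} {Z Z' : ℝ × ℝ} {u v : ℝ → ℝ × ℝ}

lemma uq (hc : 1 ≤ c) (hu : So (gg G c) u (uIcc s t)) (hv : So (gg G c) v (uIcc s t)) (h : u s = v s) : u t = v t := by
  have := gron hc hu hv
  rw [h, sub_self, norm_zero, mul_zero] at this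
  exact sub_eq_zero.1 (norm_le_zero_iff.1 this)

lemma So.rf {c} (N : ℕ) (h : So (gg G c) u univ) : So (gg G c) (fun t => sgm (u (2 * π * N - t))) univ := by
  have := So.refl (N : ℤ) h fun t r => ff_per N
  simpa using this

lemma sgm2 : sgm (sgm Z) = Z := by simp [sgm]

lemma link (o : Out G c f U) (h0 : 0 < S) (hS : ∀ τ ≤ 0, ∀ t ≥ S, 10 * G ^ 2 + 1 ≤ (U τ t).1) (hδ : exp (KK G * S) * δ ≤ 1 / 2) (hZ : ‖Z - U 0 0‖ ≤ δ) (hZ' : ‖Z' - U 0 0‖ ≤ δ)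
    {N : ℕ} (hN : S < 2 * π * N - S) (q1 : Qp G S (2 * π * N - S) Z Z' = 0) (q2 : Qp G S (2 * π * N - S) (sgm Z') (sgm Z) = 0) :
    (∀ t, flw G Z t = sgm (flw G (sgm Z') (2 * π * N - t))) ∧ ∀ t ∈ Icc S (2 * π * N - S), 10 * G ^ 2 ≤ (flw G Z t).1 := by
  have hG : 1 ≤ G := by linarith [o.G1]
  have h10 : 1 ≤ 10 * G ^ 2 := by nlinarith
  have y := near2 o h0 hS hδ hZ hZ' hN
  obtain ⟨s1, s2, s3⟩ := ztt_spec hG hN (flw G Z S).1 (flw G (sgm Z') S).1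
  obtain ⟨r1, r2, r3⟩ := ztt_spec hG hN (flw G (sgm Z') S).1 (flw G Z S).1
  simp only [Qp, sgm2] at q1 q2
  set e := 2 * π * N - S with he
  have he' : 2 * π * N - e = S := by rw [he]; ring
  set ζ := ztt G S e (flw G Z S).1 (flw G (sgm Z') S).1
  set ξ := ztt G S e (flw G (sgm Z') S).1 (flw G Z S).1
  have i1 : flw G Z S = ζ S := Prod.ext s2.symm (sub_eq_zero.1 q1)
  have i2 : flw G (sgm Z') S = ξ S := Prod.ext r2.symm (sub_eq_zero.1 q2)
  have B : ∀ t ∈ Icc S e, flw G Z t = ζ t := fun t ht => by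
    have sb : uIcc S t ⊆ Icc S e := by rw [uIcc_of_le ht.1]; exact Icc_subset_Icc_right ht.2
    exact uq le_rfl (flw_sol.mono (subset_univ _)) (((s1.mono (subset_univ _)).tof fun t ht => y t (sb ht)).tog fun t ht => h10.trans (y t (sb ht))) i1
  have i3 : sgm (ξ e) = ζ S := by
    have := expn hG hN ((r1.rf N).mono (subset_univ _)) (s1.mono (subset_univ _)) (by simp only [← he]; simp [sgm, s2, r3])
    simp only [← he, he'] at this
    rw [show (sgm (ξ S)).1 = (ζ e).1 by simp [sgm, s3, r2], sub_self, abs_zero, zero_div] at this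
    exact Prod.ext (by simp [sgm, s2, r3]) (sub_eq_zero.1 (abs_nonpos_iff.1 this))
  have i4 : sgm (ξ S) = ζ e := by
    have := uq (s := S) (t := e) h10 ((r1.rf N).mono (subset_univ _)) (s1.mono (subset_univ _)) (by simpa only [← he] using i3)
    simpa only [he'] using this
  refine ⟨fun t => uq (s := e) le_rfl (flw_sol.mono (subset_univ _)) (((flw_sol (Z := sgm Z')).rf N).mono (subset_univ _)) ?_, fun t ht => (B t ht).symm ▸ y t ht⟩
  simp only [he', i2, i4]; exact B e ⟨hN.le, le_rfl⟩
end

open Real Filter MeasureTheory Set Topology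

structure Gd (G S m d κ : ℝ) (z : ℝ × ℝ) : Prop where
  lm : z.1 < m
  mm : ∀ t ∈ Icc (2 * π) S, m < (flw G z t).1
  one : ∀ t ∈ Icc 0 S, 1 < (flw G z t).1
  yp : ∀ t ∈ Icc d S, 0 < (flw G z t).2
  kp : ∀ t ∈ Icc (-d) d, κ ≤ gg G 1 t (flw G z t).1

section
variable {G c f S δ e t s : ℝ} {U : ℝ → ℝ → ℝ × ℝ} {z Z Z' : ℝ × ℝ} {u v : ℝ → ℝ × ℝ}

lemma good (o : Out G c f U) (h7 : 7 < S) (hS : ∀ τ ≤ 0, ∀ t ≥ S, 10 * G ^ 2 + 1 ≤ (U τ t).1) : ∃ m < 10 * G ^ 2, ∃ d > 0, d < 1 ∧ ∃ κ > 0, ∃ δ > 0, exp (KK G * S) * δ ≤ 1 / 2 ∧ ∀ z, ‖z - U 0 0‖ ≤ δ → Gd G S m d κ z := by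
  have h0 : 0 < S := by linarith
  have hK : 0 ≤ KK G := by unfold KK; positivity
  set Q := exp (KK G * S)
  have mono : ∀ a b, 0 ≤ a → a < b → (U 0 a).1 < (U 0 b).1 := fun a b ha hab => by
    obtain ⟨x, hx, h⟩ := mvt hab fun t ht => (o.sol 0 le_rfl t (ha.trans ht.1)).1
    have := mul_pos (o.yp x (by linarith [hx.1])) (sub_pos.2 hab)
    linarith
  have h6 := pi_gt_three
  obtain ⟨m, hm1, hm2⟩ := exists_between (lt_min (mono 0 (2 * π) le_rfl (by linarith)) o.low)
  rw [lt_min_iff] at hm2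
  have R4 := o.four 0 le_rfl 0 le_rfl
  obtain ⟨η, hη, hk⟩ := Metric.eventually_nhds_iff.1 (((gg_cont (G := G) le_rfl).tendsto (0, (U 0 0).1)).eventually (lt_mem_nhds (show f / 2 < gg G 1 0 (U 0 0).1 by unfold gg; rw [max_eq_left (by linarith), o.f0]; linarith [o.hf])))
  obtain ⟨d', hd', hc⟩ := Metric.eventually_nhds_iff.1 (((flw_sol (G := G) (Z := U 0 0)) 0 trivial).1.continuousAt.tendsto.eventually (Metric.ball_mem_nhds _ (half_pos hη)))
  obtain ⟨d, hd, hdd⟩ := exists_between (lt_min (lt_min hd' hη) one_pos)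
  rw [lt_min_iff, lt_min_iff] at hdd
  obtain ⟨x, hx, hmin⟩ := isCompact_Icc.exists_isMinOn (nonempty_Icc.2 (by linarith : d ≤ S)) (f := fun t => (U 0 t).2) fun t ht => (o.sol 0 le_rfl t (hd.le.trans ht.1)).2.continuousAt.continuousWithinAt
  have hy := o.yp x (hd.trans_le hx.1)
  obtain ⟨q, hq, hqq⟩ := exists_between (lt_min (lt_min (sub_pos.2 hm1) (sub_pos.2 hm2.1)) (lt_min hy (lt_min (half_pos hη) one_half_pos)))
  simp only [lt_min_iff] at hqq
  obtain ⟨⟨q1, q2⟩, q3, q4, q5⟩ := hqq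
  have hQ : 0 < Q := exp_pos _
  have hQq : Q * (q / Q) = q := by field_simp
  refine ⟨m, by nlinarith [sq_nonneg G], d, hd, hdd.2, f / 2, half_pos o.hf, q / Q, by positivity, by linarith, fun z hz => ?_⟩
  have nr := near o h0 hS (by linarith) hz
  rw [show exp (KK G * S) = Q from rfl, hQq] at nr
  have nx := fun t ht => abs_le.1 ((norm_fst_le _).trans (nr.1 t ht).1)
  have ny := fun t ht => abs_le.1 ((norm_snd_le _).trans (nr.1 t ht).1)
  simp only [Prod.fst_sub, Prod.snd_sub] at nx ny
  refine ⟨?_, fun t ht => ?_, fun t ht => (nr.1 t ht).2, fun t ht => ?_, fun t ht => ?_⟩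
  · have := nx 0 ⟨le_rfl, h0.le⟩
    rw [flw_zero] at this; linarith
  · have := nx t ⟨by linarith [ht.1], ht.2⟩
    rcases ht.1.eq_or_lt with h | h
    · rw [← h] at this ⊢; linarith
    · linarith [mono _ _ (by positivity) h]
  · have := ny t ⟨hd.le.trans ht.1, ht.2⟩
    have := hmin ht
    simp at this; linarith
  · have ht' := abs_le.2 ht
    have a1 := gron (s := 0) (t := t) le_rfl ((flw_sol (G := G) (Z := z)).mono (subset_univ _)) ((flw_sol (G := G) (Z := U 0 0)).mono (subset_univ _))
    rw [flw_zero, flw_zero, sub_zero] at a1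
    have a2 : exp (KK G * |t|) * ‖z - U 0 0‖ ≤ Q * (q / Q) := mul_le_mul (exp_le_exp.2 (mul_le_mul_of_nonneg_left (by linarith) hK)) hz (norm_nonneg _) (by positivity)
    have a3 := hc (y := t) (by simpa using! ht'.trans_lt hdd.1.1)
    rw [flw_zero] at a3
    have a4 := (norm_fst_le _).trans (a1.trans a2)
    refine (hk (y := (t, (flw G z t).1)) ?_).le
    refine max_lt (by simpa using! ht'.trans_lt hdd.1.2) ?_
    simp only [Real.dist_eq, Prod.fst_sub, Real.norm_eq_abs] at *
    have := abs_sub_le (flw G z t).1 (flw G (U 0 0) t).1 (U 0 0).1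
    linarith
end

open Real Filter MeasureTheory Set Topology

section
variable {G S m d κ t s : ℝ} {z w Z Z' : ℝ × ℝ}

lemma rf0 (z) (t : ℝ) : flw G z t = sgm (flw G (sgm z) (-t)) := by
  have := uq (s := 0) (t := t) le_rfl ((flw_sol (G := G) (Z := z)).mono (subset_univ _)) (((flw_sol (G := G) (Z := sgm z)).rf 0).mono (subset_univ _)) (by simp [flw_zero, sgm2])
  simpa using this

lemma gp (N : ℕ) {c} : gg G c (2 * π * N - t) s = gg G c t s := by unfold gg; simpa using ff_per (G := G) (t := t) (s := max s c) (N : ℤ)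

lemma flw_cont (t : ℝ) : Continuous fun z => flw G z t := by
  obtain ⟨k, hk⟩ : ∃ k : NNReal, (k : ℝ) = exp (KK G * |t - 0|) := ⟨⟨_, (exp_pos _).le⟩, rfl⟩
  refine (LipschitzWith.of_dist_le_mul (K := k) fun z w => ?_).continuous
  have := gron (s := 0) (t := t) le_rfl ((flw_sol (G := G) (Z := z)).mono (subset_univ _)) ((flw_sol (G := G) (Z := w)).mono (subset_univ _))
  rwa [flw_zero, flw_zero, ← hk, ← dist_eq_norm, ← dist_eq_norm] at this

def Dc (G m : ℝ) (z : ℝ × ℝ) (n : ℕ) : Prop := 0 < n ∧ (flw G z (2 * π * n)).1 < m ∧ ∀ j ∈ Finset.Ioo 0 n, m < (flw G z (2 * π * j)).1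

lemma dec {ι : Type} {l : Filter ι} {z : ι → ℝ × ℝ} {n : ι → ℕ} {z0 n0} (hz : Tendsto z l (𝓝 z0)) (hP : ∀ b, Dc G m (z b) (n b)) (h0 : Dc G m z0 n0) :
    (∀ᶠ b in l, n b = n0) ∧ Tendsto (fun b => flw G (z b) (2 * π * n b)) l (𝓝 (flw G z0 (2 * π * n0))) := by
  have T : ∀ t, Tendsto (fun b => flw G (z b) t) l (𝓝 (flw G z0 t)) := fun t => ((flw_cont t).tendsto z0).comp hz
  have e : ∀ᶠ b in l, n b = n0 := by
    have e1 := (continuous_fst.continuousAt.tendsto.comp (T (2 * π * n0))).eventually (gt_mem_nhds h0.2.1)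
    have e2 : ∀ᶠ b in l, ∀ j ∈ Finset.Ioo 0 n0, m < (flw G (z b) (2 * π * j)).1 := (Finset.eventually_all _).2 fun j hj => (continuous_fst.continuousAt.tendsto.comp (T (2 * π * j))).eventually (lt_mem_nhds (h0.2.2 j hj))
    filter_upwards [e1, e2] with b e1 e2
    obtain ⟨p1, p2, p3⟩ := hP b
    rcases lt_trichotomy (n b) n0 with h | h | h
    · exact absurd (e2 _ (Finset.mem_Ioo.2 ⟨p1, h⟩)) p2.not_gt
    · exact h
    · exact absurd (p3 _ (Finset.mem_Ioo.2 ⟨h0.1, h⟩)) (not_lt.2 (le_of_lt e1))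
  refine ⟨e, (T _).congr' ?_⟩
  filter_upwards [e] with b hb
  rw [hb]

structure Sy (G S m d κ : ℝ) (N0 : ℕ) (Z : (ℤ → ℕ) → ℝ × ℝ) : Prop where
  G1 : 10 ≤ G
  h7 : 7 < S
  hm : m < 10 * G ^ 2
  hd : 0 < d
  hd1 : d < 1
  hκ : 0 < κ
  hN : S < 2 * π * N0 - S
  ct : Continuous Z
  gd : ∀ a, Gd G S m d κ (Z a)
  gs : ∀ a, Gd G S m d κ (sgm (Z a))
  lk : ∀ a t, flw G (Z a) t = sgm (flw G (sgm (Z (sh a))) (2 * π * (N0 + a 0 : ℕ) - t))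
  fr : ∀ a, ∀ t ∈ Icc S (2 * π * (N0 + a 0 : ℕ) - S), 10 * G ^ 2 ≤ (flw G (Z a) t).1

variable {N0 : ℕ} {Z : (ℤ → ℕ) → ℝ × ℝ}

lemma Sy.lk' (y : Sy G S m d κ N0 Z) (a t) : flw G (sgm (Z (sh a))) t = sgm (flw G (Z a) (2 * π * (N0 + a 0 : ℕ) - t)) := by
  rw [y.lk, sgm2, sub_sub_cancel]

lemma Sy.mid (y : Sy G S m d κ N0 Z) (a t) (ht : t ∈ Icc (2 * π) (2 * π * (N0 + a 0 : ℕ) - 2 * π)) : m < (flw G (Z a) t).1 := by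
  rcases le_total t S with h | h
  · exact (y.gd a).mm t ⟨ht.1, h⟩
  rcases le_total t (2 * π * (N0 + a 0 : ℕ) - S) with h' | h'
  · exact y.hm.trans_le (y.fr a t ⟨h, h'⟩)
  · rw [y.lk]
    exact (y.gs _).mm _ ⟨by linarith [ht.2], by linarith⟩

lemma Sy.d1 (y : Sy G S m d κ N0 Z) (a) : Dc G m (Z a) (N0 + a 0) ∧ Dc G m (sgm (Z (sh a))) (N0 + a 0) := by
  have hN : 0 < N0 := by
    rcases Nat.eq_zero_or_pos N0 with h | h
    · have := y.hN; rw [h] at this; push_cast at this; linarith [y.h7]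
    · exact h
  have hj : ∀ j ∈ Finset.Ioo 0 (N0 + a 0), 2 * π * j ∈ Icc (2 * π) (2 * π * (N0 + a 0 : ℕ) - 2 * π) := fun j hj => by
    rw [Finset.mem_Ioo] at hj
    have h1 : (1 : ℝ) ≤ j := by exact_mod_cast hj.1
    have h2 : (j : ℝ) + 1 ≤ (N0 + a 0 : ℕ) := by exact_mod_cast hj.2
    have := pi_pos
    constructor <;> nlinarith
  refine ⟨⟨by omega, ?_, fun j h => y.mid a _ (hj j h)⟩, by omega, ?_, fun j h => ?_⟩
  · rw [y.lk, sub_self, flw_zero]; exact (y.gd (sh a)).lm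
  · rw [y.lk', sub_self, flw_zero]; exact (y.gd a).lm
  · rw [y.lk']
    have := hj j h
    exact y.mid a _ ⟨by linarith [this.2], by linarith [this.1]⟩

lemma Sy.stp (y : Sy G S m d κ N0 Z) {l : Filter (ℤ → ℕ)} {φ : (ℤ → ℕ) → (ℤ → ℕ)} {a} (h : Tendsto (fun b => Z (φ b)) l (𝓝 (Z a))) :
    ((∀ᶠ b in l, φ b 0 = a 0) ∧ Tendsto (fun b => Z (sh (φ b))) l (𝓝 (Z (sh a)))) ∧ (∀ᶠ b in l, φ b 1 = a 1) ∧ Tendsto (fun b => Z (hs (φ b))) l (𝓝 (Z (hs a))) := by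
  have cs : Continuous sgm := by unfold sgm; fun_prop
  constructor
  · have := dec h (fun b => (y.d1 (φ b)).1) (y.d1 a).1
    refine ⟨this.1.mono fun b hb => by omega, ?_⟩
    have := this.2
    simp only [y.lk, sub_self, flw_zero, sgm2] at this
    exact this
  · have h1 := fun b => (y.d1 (hs b)).2
    simp only [sh_hs] at h1
    have := dec ((cs.tendsto _).comp h) (fun b => h1 (φ b)) (h1 a)
    have e : ∀ b : ℤ → ℕ, hs b 0 = b 1 := fun b => rfl
    refine ⟨this.1.mono fun b hb => by have := e a; have := e (φ b); omega, ?_⟩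
    have k : ∀ b, flw G (sgm (Z b)) (2 * π * (N0 + hs b 0 : ℕ)) = sgm (Z (hs b)) := fun b => by
      have := y.lk' (hs b) (2 * π * (N0 + hs b 0 : ℕ))
      rwa [sh_hs, sub_self, flw_zero] at this
    have := (cs.tendsto _).comp this.2
    simp only [Function.comp_def, k, sgm2] at this
    exact this

lemma Sy.emb (y : Sy G S m d κ N0 Z) : IsEmbedding Z := by
  refine IsInducing.isEmbedding (isInducing_iff_nhds.2 fun a => le_antisymm (y.ct.tendsto a).le_comap ?_)
  set l := comap Z (𝓝 (Z a))
  have h1 : ∀ k : ℕ, Tendsto (fun b => Z (sh^[k] b)) l (𝓝 (Z (sh^[k] a))) := fun k => by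
    induction k with
    | zero => exact tendsto_comap
    | succ k ih => simp only [Function.iterate_succ_apply']; exact (y.stp ih).1.2
  have h2 : ∀ k : ℕ, Tendsto (fun b => Z (hs^[k] b)) l (𝓝 (Z (hs^[k] a))) := fun k => by
    induction k with
    | zero => exact tendsto_comap
    | succ k ih => simp only [Function.iterate_succ_apply']; exact (y.stp ih).2.2
  have s1 : ∀ (k : ℕ) (b : ℤ → ℕ) n, sh^[k] b n = b (n - k) := fun k => by
    induction k with
    | zero => simp
    | succ k ih => intro b n; rw [Function.iterate_succ_apply', sh, ih]; push_cast; ring_nf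
  have s2 : ∀ (k : ℕ) (b : ℤ → ℕ) n, hs^[k] b n = b (n + k) := fun k => by
    induction k with
    | zero => simp
    | succ k ih => intro b n; rw [Function.iterate_succ_apply', hs, ih]; push_cast; ring_nf
  refine tendsto_id'.1 (tendsto_pi_nhds.2 fun n => ?_)
  rw [nhds_discrete, tendsto_pure]
  obtain ⟨k, rfl | rfl⟩ := n.eq_nat_or_neg
  · simpa [s2] using (y.stp (h2 k)).1.1
  · simpa [s1] using (y.stp (h1 k)).1.1
end

open Real Filter MeasureTheory Set Topology

noncomputable def tp (G d : ℝ) (z : ℝ × ℝ) : ℝ := Classical.epsilon fun t => t ∈ Ioo (-d) d ∧ (flw G z t).2 = 0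
noncomputable def emm (G d : ℝ) (z : ℝ × ℝ) : ℝ × AddCircle (2 * Real.pi) := ((flw G z (tp G d z)).1, (tp G d z : AddCircle (2 * Real.pi)))

section
variable {G S m d κ t s a b : ℝ} {z w : ℝ × ℝ}

lemma Gd.mo (g : Gd G S m d κ z) (ha : -d ≤ a) (hab : a ≤ b) (hb : b ≤ d) : κ * (b - a) ≤ (flw G z b).2 - (flw G z a).2 := by
  rcases hab.eq_or_lt with rfl | h
  · simp
  obtain ⟨x, hx, e⟩ := mvt h fun t _ => ((flw_sol (G := G) (Z := z)) t trivial).2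
  rw [e]
  have := g.kp x ⟨by linarith [hx.1], by linarith [hx.2]⟩
  have := sub_pos.2 h
  gcongr

lemma tp_spec (hd : 0 < d) (hS : d ≤ S) (g : Gd G S m d κ z) (g' : Gd G S m d κ (sgm z)) : tp G d z ∈ Ioo (-d) d ∧ (flw G z (tp G d z)).2 = 0 := by
  refine Classical.epsilon_spec (p := fun t => t ∈ Ioo (-d) d ∧ (flw G z t).2 = 0) ?_
  have h1 := g.yp d ⟨le_rfl, hS⟩
  have h2 : (flw G z (-d)).2 < 0 := by
    have := g'.yp d ⟨le_rfl, hS⟩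
    rw [rf0, neg_neg]; simp only [sgm] at *; linarith
  obtain ⟨t, ht, h⟩ := intermediate_value_Ioo (show -d ≤ d by linarith) (f := fun t => (flw G z t).2) (fun t _ => ((flw_sol (G := G) (Z := z)) t trivial).2.continuousAt.continuousWithinAt) ⟨h2, h1⟩
  exact ⟨t, ht, h⟩

lemma tp_uq (hκ : 0 < κ) (hd : 0 < d) (hS : d ≤ S) (g : Gd G S m d κ z) (g' : Gd G S m d κ (sgm z)) (ht : t ∈ Ioo (-d) d) (h : (flw G z t).2 = 0) : t = tp G d z := by
  obtain ⟨p1, p2⟩ := tp_spec hd hS g g'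
  rcases le_total t (tp G d z) with k | k
  · have := g.mo ht.1.le k p1.2.le
    nlinarith
  · have := g.mo p1.1.le k ht.2.le
    nlinarith

lemma tp_sgm (hκ : 0 < κ) (hd : 0 < d) (hS : d ≤ S) (g : Gd G S m d κ z) (g' : Gd G S m d κ (sgm z)) : tp G d (sgm z) = -tp G d z := by
  obtain ⟨p1, p2⟩ := tp_spec hd hS g g'
  refine (tp_uq hκ hd hS g' (by rwa [sgm2]) ⟨by linarith [p1.2], by linarith [p1.1]⟩ ?_).symm
  rw [rf0, sgm2, neg_neg, sgm, p2, neg_zero]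

lemma ypos (hκ : 0 < κ) (hd : 0 < d) (hS : d ≤ S) (g : Gd G S m d κ z) (g' : Gd G S m d κ (sgm z)) (h1 : tp G d z < t) (h2 : t ≤ S) : 0 < (flw G z t).2 := by
  obtain ⟨p1, p2⟩ := tp_spec hd hS g g'
  rcases le_total t d with h | h
  · have := g.mo p1.1.le h1.le h
    nlinarith
  · exact g.yp t ⟨h, h2⟩

lemma tp_cont (hκ : 0 < κ) (hd : 0 < d) (hS : d ≤ S) {K : Set (ℝ × ℝ)} (hK : ∀ z ∈ K, Gd G S m d κ z ∧ Gd G S m d κ (sgm z)) : ContinuousOn (tp G d) K := by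
  have k0 : 0 ≤ KK G := by unfold KK; positivity
  obtain ⟨k, hk⟩ : ∃ k : NNReal, (k : ℝ) = exp (KK G * d) / κ := ⟨⟨_, by positivity⟩, rfl⟩
  refine (LipschitzOnWith.of_dist_le_mul (K := k) fun z hz w hw => ?_).continuousOn
  obtain ⟨p1, p2⟩ := tp_spec hd hS (hK z hz).1 (hK z hz).2
  obtain ⟨q1, q2⟩ := tp_spec hd hS (hK w hw).1 (hK w hw).2
  have h := gron (s := 0) (t := tp G d z) le_rfl ((flw_sol (G := G) (Z := z)).mono (subset_univ _)) ((flw_sol (G := G) (Z := w)).mono (subset_univ _))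
  rw [flw_zero, flw_zero, sub_zero] at h
  have h1 := abs_le.1 ((norm_snd_le _).trans h)
  have h2 : exp (KK G * |tp G d z|) * ‖z - w‖ ≤ exp (KK G * d) * ‖z - w‖ := by
    have := abs_le.2 ⟨p1.1.le, p1.2.le⟩
    gcongr
  simp only [Prod.snd_sub, p2] at h1
  rw [hk, Real.dist_eq, dist_eq_norm, div_mul_eq_mul_div, le_div_iff₀ hκ, mul_comm]
  rcases le_total (tp G d z) (tp G d w) with e | e
  · have := (hK w hw).1.mo p1.1.le e q1.2.le
    rw [abs_sub_comm, abs_of_nonneg (sub_nonneg.2 e)]; linarith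
  · have := (hK w hw).1.mo q1.1.le e p1.2.le
    rw [abs_of_nonneg (sub_nonneg.2 e)]; linarith

lemma em_emb (hκ : 0 < κ) (hd : 0 < d) (hd1 : d < 1) (hS : d ≤ S) {K : Set (ℝ × ℝ)} (hc : IsCompact K) (hK : ∀ z ∈ K, Gd G S m d κ z ∧ Gd G S m d κ (sgm z)) : IsEmbedding fun z : K => emm G d z := by
  have : CompactSpace K := isCompact_iff_compactSpace.1 hc
  have k0 : 0 ≤ KK G := by unfold KK; positivity
  obtain ⟨k, hk⟩ : ∃ k : NNReal, (k : ℝ) = exp (KK G * 1) := ⟨⟨_, (exp_pos _).le⟩, rfl⟩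
  have J := continuousOn_prod_of_continuousOn_lipschitzOnWith (s := (univ : Set (ℝ × ℝ))) (t := Icc (-1 : ℝ) 1) (fun p : (ℝ × ℝ) × ℝ => flw G p.1 p.2) k (fun z _ => (flw_sol.cont).mono (subset_univ _)) fun t ht => LipschitzOnWith.of_dist_le_mul fun z _ w _ => by
    have h := gron (s := 0) (t := t) le_rfl ((flw_sol (G := G) (Z := z)).mono (subset_univ _)) ((flw_sol (G := G) (Z := w)).mono (subset_univ _))
    rw [flw_zero, flw_zero, sub_zero] at h
    rw [dist_eq_norm, dist_eq_norm, hk]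
    refine h.trans ?_
    have := abs_le.2 ht
    gcongr
  have ct : Continuous fun z : K => tp G d z := (tp_cont hκ hd hS hK).restrict
  have sp : ∀ z : K, (-1 ≤ tp G d z ∧ tp G d z < 1) ∧ (flw G z (tp G d z)).2 = 0 := fun z => by
    have := tp_spec hd hS (hK z z.2).1 (hK z z.2).2
    exact ⟨⟨by linarith [this.1.1], by linarith [this.1.2]⟩, this.2⟩
  have cf : Continuous fun z : K => flw G z (tp G d z) := J.comp_continuous (continuous_subtype_val.prodMk ct) fun z => ⟨trivial, (sp z).1.1, (sp z).1.2.le⟩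
  refine (Continuous.isClosedEmbedding ((continuous_fst.comp cf).prodMk ((AddCircle.continuous_mk' _).comp ct)) fun z w h => ?_).isEmbedding
  have h1 := congrArg Prod.fst h
  have h2 := congrArg Prod.snd h
  simp only [Function.comp_apply] at h1 h2
  have : Fact (0 < 2 * π) := ⟨by positivity⟩
  have := pi_gt_three
  have e := (AddCircle.coe_eq_coe_iff_of_mem_Ico (p := 2 * π) (a := -1) ⟨(sp z).1.1, by linarith [(sp z).1.2]⟩ ⟨(sp w).1.1, by linarith [(sp w).1.2]⟩).1 h2
  rw [← e] at h1
  have q := (sp w).2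
  rw [← e] at q
  have := uq (t := 0) le_rfl ((flw_sol (G := G) (Z := z)).mono (subset_univ _)) ((flw_sol (G := G) (Z := w)).mono (subset_univ _)) (Prod.ext h1 ((sp z).2.trans q.symm))
  rw [flw_zero, flw_zero] at this
  exact Subtype.ext this

variable {N0 : ℕ} {Z : (ℤ → ℕ) → ℝ × ℝ}

lemma one' (g : Gd G S m d κ z) (g' : Gd G S m d κ (sgm z)) (ht : t ∈ Icc (-S) S) : 1 < (flw G z t).1 := by
  rcases le_total 0 t with h | h
  · exact g.one t ⟨h, ht.2⟩
  · rw [rf0]; exact g'.one _ ⟨by linarith, by linarith [ht.1]⟩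

lemma Sy.one (y : Sy G S m d κ N0 Z) (a) (ht : t ∈ Icc (-S) (2 * π * (N0 + a 0 : ℕ) + S)) : 1 < (flw G (Z a) t).1 := by
  rcases le_total t S with h | h
  · exact one' (y.gd a) (y.gs a) ⟨ht.1, h⟩
  rcases le_total t (2 * π * (N0 + a 0 : ℕ) - S) with h' | h'
  · have := y.fr a t ⟨h, h'⟩
    nlinarith [y.G1]
  · rw [y.lk]
    exact one' (y.gs _) (by rw [sgm2]; exact y.gd _) ⟨by linarith [ht.2], by linarith⟩

lemma gg1 (h : 1 < s) : gg G 1 t s = G ^ 2 / s ^ 3 - s * (s ^ 2 + primRho t ^ 2 / 4) ^ (-(3 : ℝ) / 2) := by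
  unfold gg ff qq; rw [max_eq_left h.le]

lemma dd (z : ℝ × ℝ) : (deriv fun t => (flw G z t).1) = fun t => (flw G z t).2 := funext fun t => (flw_sol t trivial).1.deriv
lemma dd2 (z : ℝ × ℝ) : (deriv fun t => (flw G z t).2) = fun t => gg G 1 t (flw G z t).1 := funext fun t => (flw_sol t trivial).2.deriv

lemma Sy.sec (y : Sy G S m d κ N0 Z) (a) : emm G d (Z a) ∈ SectionPlus G := by
  have hS : d ≤ S := by linarith [y.hd1, y.h7]
  obtain ⟨p1, p2⟩ := tp_spec y.hd hS (y.gd a) (y.gs a)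
  have h1 := one' (y.gd a) (y.gs a) (t := tp G d (Z a)) ⟨by linarith [p1.1], by linarith [p1.2]⟩
  refine ⟨by simp only [emm]; linarith, fun t ht => ?_⟩
  simp only [emm] at *
  rw [← gg1 h1]
  obtain ⟨n, hn⟩ := AddSubgroup.mem_zmultiples_iff.1 (QuotientAddGroup.eq.1 ht)
  have e : gg G 1 t (flw G (Z a) (tp G d (Z a))).1 = gg G 1 (tp G d (Z a)) (flw G (Z a) (tp G d (Z a))).1 := by
    rw [zsmul_eq_mul] at hn
    rw [show t = 2 * π * ((-n : ℤ) : ℝ) - (2 * π * ((0 : ℤ) : ℝ) - tp G d (Z a)) by push_cast; linarith]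
    exact (ff_per _).trans (ff_per _)
  rw [e]
  exact y.hκ.trans_le ((y.gd a).kp _ ⟨p1.1.le, p1.2.le⟩)

lemma Sy.ret (y : Sy G S m d κ N0 Z) (a) : PoincareReturn G (emm G d (Z a)) (emm G d (Z (sh a))) := by
  have hS : d ≤ S := by linarith [y.hd1, y.h7]
  obtain ⟨p1, p2⟩ := tp_spec y.hd hS (y.gd a) (y.gs a)
  obtain ⟨q1, q2⟩ := tp_spec y.hd hS (y.gd (sh a)) (y.gs (sh a))
  have hN : S < 2 * π * (N0 + a 0 : ℕ) - S := by
    have := y.hN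
    push_cast
    nlinarith [pi_pos, (a 0).cast_nonneg (α := ℝ)]
  have h7 := y.h7
  have hd1 := y.hd1
  have fl1 : flw G (Z a) (2 * π * (N0 + a 0 : ℕ) + tp G d (Z (sh a))) = flw G (Z (sh a)) (tp G d (Z (sh a))) := by
    rw [y.lk, rf0 (Z (sh a))]; congr 2; ring
  refine ⟨tp G d (Z a), 2 * π * (N0 + a 0 : ℕ) + tp G d (Z (sh a)), fun t => (flw G (Z a) t).1, rfl, by linarith [p1.2, q1.1], ⟨-S, 2 * π * (N0 + a 0 : ℕ) + S, by linarith [p1.1], by linarith [q1.2], fun t ht => ?_⟩, rfl, ?_, ?_, ?_, fun t ht => ?_, ?_⟩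
  · have h1 := y.one a ⟨ht.1.le, ht.2.le⟩
    refine ⟨by linarith, ContDiff.contDiffAt ?_, ?_⟩
    · rw [show (2 : WithTop ℕ∞) = 1 + 1 by norm_num, contDiff_succ_iff_deriv, dd, contDiff_one_iff_deriv, dd2]
      have c1 : Continuous (flw G (Z a)) := continuousOn_univ.1 flw_sol.cont
      exact ⟨fun t => (flw_sol t trivial).1.differentiableAt, by simp, fun t => (flw_sol t trivial).2.differentiableAt, (gg_cont le_rfl).comp (continuous_id.prodMk (continuous_fst.comp c1))⟩
    · rw [dd, dd2]; exact gg1 h1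
  · rw [dd]; exact p2
  · rw [dd]; dsimp only; rw [fl1]; exact q2
  · rw [dd, dd2]; dsimp only; rw [fl1, show 2 * π * (N0 + a 0 : ℕ) + tp G d (Z (sh a)) = 2 * π * (N0 + a 0 : ℕ) - (2 * π * (0 : ℕ) - tp G d (Z (sh a))) by push_cast; ring, gp, gp]
    exact y.hκ.trans_le ((y.gd (sh a)).kp _ ⟨q1.1.le, q1.2.le⟩)
  · rw [dd, dd2]
    rintro ⟨e1, e2⟩
    rcases le_total t S with h | h
    · linarith [ypos y.hκ y.hd hS (y.gd a) (y.gs a) ht.1 h]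
    rcases le_total t (2 * π * (N0 + a 0 : ℕ) - S) with h' | h'
    · have := y.fr a t ⟨h, h'⟩
      have h3 := (ff_far (G := G) (t := t) (by linarith [y.G1]) this).1
      simp only [gg] at e2
      rw [max_eq_left (by nlinarith [y.G1])] at e2
      linarith
    · dsimp only at e1
      rw [y.lk] at e1
      have := ypos (t := 2 * π * (N0 + a 0 : ℕ) - t) y.hκ y.hd hS (y.gs (sh a)) (by rw [sgm2]; exact y.gd _) (by rw [tp_sgm y.hκ y.hd hS (y.gd _) (y.gs _)]; linarith [ht.2]) (by linarith)
      simp only [sgm] at e1 this; linarith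
  · simp only [emm, fl1, Prod.mk.injEq, true_and]
    exact QuotientAddGroup.eq.2 (AddSubgroup.mem_zmultiples_iff.2 ⟨(N0 + a 0 : ℕ), by rw [zsmul_eq_mul]; push_cast; ring⟩)
end

open Real Filter MeasureTheory Set Topology

theorem rei3bp_smale_horseshoe :
    ∃ Gstar : ℝ, 0 < Gstar ∧ ∀ G : ℝ, Gstar < G →
      ∃ S : Set (ℝ × AddCircle (2 * Real.pi)), S ⊆ SectionPlus G ∧
        ∃ χ : (ℤ → ℕ) ≃ₜ S,
          ∀ a : ℤ → ℕ,
            PoincareReturn G (χ a).val (χ (fun n => a (n - 1))).val := by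
  obtain ⟨A, hA⟩ := eventually_atTop.1 P7
  refine ⟨max A (10 ^ 30), by positivity, fun G hG => ?_⟩
  obtain ⟨hG1, hG2⟩ := max_lt_iff.1 hG
  obtain ⟨c, f, U, o⟩ := outA hG2.le (hA G hG1.le)
  obtain ⟨S, h7, hS⟩ := o.far
  have h0 : 0 < S := by linarith
  obtain ⟨m, hm, d, hd, hd1, κ, hκ, δ1, hδ1, hQ, hgd⟩ := good o h7 hS
  obtain ⟨δ2, hδ2, hfix⟩ := fixp o h0 hS
  have hδ : 0 < min δ1 δ2 := by positivity
  have hg : ∀ z, ‖z - U 0 0‖ ≤ min δ1 δ2 → Gd G S m d κ z ∧ Gd G S m d κ (sgm z) := fun z hz => ⟨hgd z (hz.trans (min_le_left _ _)), hgd _ (o.sgm.trans_le (hz.trans (min_le_left _ _)))⟩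
  obtain ⟨N1, hN1⟩ := hfix _ hδ (min_le_right _ _)
  obtain ⟨M, hM⟩ := exists_nat_gt (2 * S)
  obtain ⟨Z, hZc, hZ, hq⟩ := hN1 (max N1 M) (le_max_left _ _)
  have hN : S < 2 * π * (max N1 M : ℕ) - S := by
    have : (M : ℝ) ≤ (max N1 M : ℕ) := by exact_mod_cast le_max_right _ _
    nlinarith [pi_gt_three]
  have hN' : ∀ n : ℕ, S < 2 * π * (max N1 M + n : ℕ) - S := fun n => by
    rw [Nat.cast_add]
    nlinarith [pi_pos, n.cast_nonneg (α := ℝ)]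
  have hQ' : exp (KK G * S) * min δ1 δ2 ≤ 1 / 2 := le_trans (by gcongr; exact min_le_left _ _) hQ
  have L := fun a => link o h0 hS hQ' (hZ a) (hZ (sh a)) (hN' (a 0)) (hq a).1 (hq a).2
  have y : Sy G S m d κ (max N1 M) Z := ⟨o.G1, h7, hm, hd, hd1, hκ, hN, hZc, fun a => (hg _ (hZ a)).1, fun a => (hg _ (hZ a)).2, fun a => (L a).1, fun a => (L a).2⟩
  have mB : ∀ z, z ∈ Metric.closedBall (U 0 0) (min δ1 δ2) ↔ ‖z - U 0 0‖ ≤ min δ1 δ2 := fun z => by rw [Metric.mem_closedBall, dist_eq_norm]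
  have E : IsEmbedding fun a => emm G d (Z a) := (em_emb hκ hd hd1 (by linarith) (isCompact_closedBall (U 0 0) (min δ1 δ2)) fun z hz => hg z ((mB z).1 hz)).comp (y.emb.codRestrict _ fun a => (mB _).2 (hZ a))
  refine ⟨range fun a => emm G d (Z a), ?_, E.toHomeomorph, fun a => y.ret a⟩
  rintro _ ⟨a, rfl⟩
  exact y.sec a
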